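/- (L^p–L^q local smoothing for the wave equation in ℝ².) Let j ≥ 0 and suppose p ≤ q, 1/p + 1/q ≤ 1, and 1/p + 3/q ≥ 1. Then for every ε > 0 there is a constant C (independent of j, f) such that ‖ e^{it√(−Δ)} 𝒫_j f ‖_{L^q(ℝ²×[1,2], dx dt)} ≤ C · 2^{(3/2)(1/p − 1/q)j + εj} ‖f‖_{L^p(ℝ²)}. -/

import Mathlib

open MeasureTheory Real Set
open scoped ENNReal

noncomputable section

/-- Euclidean norm on `ℝ²` (the product norm on `ℝ × ℝ` is the sup norm, so we
spell out the Euclidean one). -/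
def enorm2 (ξ : ℝ × ℝ) : ℝ := Real.sqrt (ξ.1 ^ 2 + ξ.2 ^ 2)

/-- Fourier transform on `ℝ²` (nonunitary convention). -/
def ft2 (g : ℝ × ℝ → ℂ) (ξ : ℝ × ℝ) : ℂ :=
  ∫ y : ℝ × ℝ, Complex.exp (-(Complex.I) * ((y.1 * ξ.1 + y.2 * ξ.2 : ℝ) : ℂ)) * g y

/-- Fourier transform of the arclength measure `dσ` on the unit circle in `ℝ²`. -/
def sigmaHat (ξ : ℝ × ℝ) : ℂ :=
  ∫ θ in Set.Ioc (0:ℝ) (2 * π),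
    Complex.exp (-(Complex.I) * ((ξ.1 * Real.cos θ + ξ.2 * Real.sin θ : ℝ) : ℂ))

/-- The operator `𝒜_t g(r,x₃) = (2π)⁻² ∫ e^{i(((r²+t²)/2)ξ₁+x₃ξ₂)} \widehat{dσ}(trξ) ĝ(ξ) dξ`. -/
def Aop (g : ℝ × ℝ → ℂ) (t r x₃ : ℝ) : ℂ :=
  (((2 * π) ^ (-2 : ℤ) : ℝ) : ℂ) *
    ∫ ξ : ℝ × ℝ,
      Complex.exp (Complex.I * ((((r ^ 2 + t ^ 2) / 2) * ξ.1 + x₃ * ξ.2 : ℝ) : ℂ)) *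
        sigmaHat (t * r * ξ.1, t * r * ξ.2) * ft2 g ξ

/-- A Littlewood–Paley bump: nonnegative, smooth, supported in `[1−10⁻³, 2+10⁻³]`,
with `∑_{j∈ℤ} φ(2^{−j}s) = 1` for all `s > 0`. -/
def IsLPBump (φ : ℝ → ℝ) : Prop :=
  ContDiff ℝ (⊤ : ℕ∞) φ ∧ (∀ s, 0 ≤ φ s) ∧
    Function.support φ ⊆ Set.Icc (1 - 1/1000) (2 + 1/1000) ∧
    ∀ s : ℝ, 0 < s → HasSum (fun j : ℤ => φ ((2:ℝ) ^ (-j) * s)) 1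

/-- The Littlewood–Paley projection `𝒫_j`, defined via its multiplier `φ(2^{−j}|ξ|)`. -/
def proj (φ : ℝ → ℝ) (j : ℤ) (g : ℝ × ℝ → ℂ) (x : ℝ × ℝ) : ℂ :=
  (((2 * π) ^ (-2 : ℤ) : ℝ) : ℂ) *
    ∫ ξ : ℝ × ℝ,
      Complex.exp (Complex.I * ((x.1 * ξ.1 + x.2 * ξ.2 : ℝ) : ℂ)) *
        ((φ ((2:ℝ) ^ (-j) * enorm2 ξ) : ℝ) : ℂ) * ft2 g ξ

/-- `φ_{<ℓ}(s) = ∑_{j<ℓ} φ(2^{−j} s)`. -/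
def philt (φ : ℝ → ℝ) (l : ℤ) (s : ℝ) : ℝ :=
  ∑' j : ℤ, if j < l then φ ((2:ℝ) ^ (-j) * s) else 0

/-- The projection `𝒫_{<ℓ}`, with multiplier `φ_{<ℓ}(|ξ|)`. -/
def projLt (φ : ℝ → ℝ) (l : ℤ) (g : ℝ × ℝ → ℂ) (x : ℝ × ℝ) : ℂ :=
  (((2 * π) ^ (-2 : ℤ) : ℝ) : ℂ) *
    ∫ ξ : ℝ × ℝ,
      Complex.exp (Complex.I * ((x.1 * ξ.1 + x.2 * ξ.2 : ℝ) : ℂ)) *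
        ((philt φ l (enorm2 ξ) : ℝ) : ℂ) * ft2 g ξ

/-- The wave propagator `e^{it√(−Δ)} f(x) = (2π)^{−2} ∫ e^{i(x·ξ+t|ξ|)} f̂(ξ) dξ` on `ℝ²`. -/
def waveProp (f : ℝ × ℝ → ℂ) (t : ℝ) (x : ℝ × ℝ) : ℂ :=
  (((2 * π) ^ (-2 : ℤ) : ℝ) : ℂ) *
    ∫ ξ : ℝ × ℝ,
      Complex.exp (Complex.I * ((x.1 * ξ.1 + x.2 * ξ.2 + t * enorm2 ξ : ℝ) : ℂ)) * ft2 f ξ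

namespace WaveEnv

open SchwartzMap FourierTransform
open scoped ComplexConjugate
set_option linter.unusedSectionVars false

section Schwartz

variable {V : Type*} [NormedAddCommGroup V] [InnerProductSpace ℝ V] [FiniteDimensional ℝ V]
  [MeasurableSpace V] [BorelSpace V]

/-- The Schwartz function `F * conj G`. -/
def mulConj (F G : 𝓢(V, ℂ)) : 𝓢(V, ℂ) :=
  pairing (ContinuousLinearMap.mul ℝ ℂ) F
    (postcompCLM (Complex.conjCLE : ℂ →L[ℝ] ℂ) G)

@[simp] theorem mulConj_apply (F G : 𝓢(V, ℂ)) (x : V) : mulConj F G x = F x * conj (G x) := rfl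

theorem lintegral_fourier_sq (h : 𝓢(V, ℂ)) :
    ∫⁻ ξ, ‖𝓕 h ξ‖ₑ ^ 2 = ∫⁻ x, ‖h x‖ₑ ^ 2 := by
  have key : ∀ g : 𝓢(V, ℂ), ∫⁻ ξ, ‖g ξ‖ₑ ^ 2 = ENNReal.ofReal (∫ ξ, ‖g ξ‖ ^ 2) := by
    intro g
    rw [ofReal_integral_eq_lintegral_ofReal]
    · refine lintegral_congr fun x => ?_
      rw [ENNReal.ofReal_pow (norm_nonneg _), ofReal_norm]
    · have := (g.memLp 2).integrable_norm_pow (by norm_num)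
      simpa using this
    · exact Filter.Eventually.of_forall fun x => by positivity
  rw [key h, ← integral_norm_sq_fourier h, ← key (𝓕 h)]

theorem fourier_conj (G : 𝓢(V, ℂ)) (ξ : V) :
    𝓕⁻ (postcompCLM (Complex.conjCLE : ℂ →L[ℝ] ℂ) G) ξ = conj (𝓕 G ξ) := by
  rw [fourierInv_coe, fourier_coe, Real.fourierInv_eq, Real.fourier_eq, ← integral_conj]
  refine integral_congr_ae (Filter.Eventually.of_forall fun x => ?_)
  simp [Circle.smul_def, Real.fourierChar_apply, ← Complex.exp_conj, Complex.conj_ofNat]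

theorem fourier_mulConj_ne_zero {F G : 𝓢(V, ℂ)} {ζ : V} (h : 𝓕 (mulConj F G) ζ ≠ 0) :
    ∃ ξ, 𝓕 F ξ ≠ 0 ∧ 𝓕 G (ξ - ζ) ≠ 0 := by
  set u : 𝓢(V, ℂ) := 𝓕⁻ F
  set v : 𝓢(V, ℂ) := 𝓕⁻ (postcompCLM (Complex.conjCLE : ℂ →L[ℝ] ℂ) G)
  have h1 : 𝓕⁻ (mulConj F G) (-ζ) = 𝓕 (mulConj F G) ζ := by
    rw [fourierInv_coe, fourier_coe, Real.fourierInv_eq_fourier_neg, neg_neg]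
  have h2 : 𝓕⁻ (mulConj F G) = convolution (ContinuousLinearMap.mul ℂ ℂ) u v := by
    rw [← fourierInv_fourier_eq (F := 𝓢(V, ℂ)) (convolution (ContinuousLinearMap.mul ℂ ℂ) u v),
      fourier_convolution]
    congr 1
    ext x
    simp [u, v]
  rw [← h1, h2, convolution_apply, MeasureTheory.convolution_def] at h
  by_contra! hcon
  apply h
  rw [← integral_zero V ℂ]
  congr 1
  ext t
  have hu : u t = 𝓕 F (-t) := by
    simp only [u]
    rw [fourierInv_coe, fourier_coe, Real.fourierInv_eq_fourier_neg]
  rw [hu]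
  by_cases h0 : 𝓕 F (-t) = 0
  · simp [h0]
  · have := hcon _ h0
    simp only [v]
    rw [fourier_conj, show -ζ - t = -t - ζ by abel, this]
    simp

theorem integral_mul_conj_fourier (f g : 𝓢(V, ℂ)) :
    ∫ ξ, 𝓕 f ξ * conj (𝓕 g ξ) = ∫ x, f x * conj (g x) := by
  have := integral_inner_fourier_fourier g f
  simpa [mul_comm] using this

end Schwartz

section Geometry

variable {V : Type*} [NormedAddCommGroup V] [InnerProductSpace ℝ V]

/-- Three linear coordinates in which the light cone is `p₁ p₃ = p₂²`. -/
@[ext] structure Coords (V : Type*) [NormedAddCommGroup V] [InnerProductSpace ℝ V] where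
  p1 : V →L[ℝ] ℝ
  p2 : V →L[ℝ] ℝ
  p3 : V →L[ℝ] ℝ

/-- `ξ` lies in the `i`-th plank of the `4⁻ⁿ`-neighbourhood of the cone. -/
def Near (P : Coords V) (κ : ℝ) (n i : ℕ) (ξ : V) : Prop :=
  ∃ ω δ : ℝ, 1 ≤ P.p1 ξ ∧ P.p1 ξ ≤ 1 + κ ∧ P.p2 ξ = P.p1 ξ * ω ∧
    P.p3 ξ = P.p1 ξ * ω ^ 2 + δ ∧ |ω - i / 2 ^ n| ≤ 2 / 2 ^ n ∧ |δ| ≤ 1 / 4 ^ n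

/-- A box of size `4⁻ʳ` in the coordinates `P`. -/
def Box (P : Coords V) (r : ℕ) : Set V :=
  {ζ | 4 ^ r * |P.p1 ζ| ≤ 32 ∧ 4 ^ r * |P.p2 ζ| ≤ 32 ∧ 4 ^ r * |P.p3 ζ| ≤ 32}

theorem measurableSet_Box [MeasurableSpace V] [BorelSpace V] (P : Coords V) (r : ℕ) :
    MeasurableSet (Box P r) := by
  refine IsClosed.measurableSet ?_
  unfold Box
  have key : ∀ p : V →L[ℝ] ℝ, IsClosed {ζ : V | 4 ^ r * |p ζ| ≤ 32} := fun p =>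
    isClosed_le (by fun_prop) continuous_const
  exact (key P.p1).inter ((key P.p2).inter (key P.p3))

/-- Lorentz rescaling adapted to the dyadic interval `[j 2⁻ᵏ, (j+1) 2⁻ᵏ]`. -/
def Coords.rescale (P : Coords V) (k j : ℕ) : Coords V where
  p1 := P.p1
  p2 := (2 ^ k : ℝ) • (P.p2 - ((j : ℝ) / 2 ^ k) • P.p1)
  p3 := (4 ^ k : ℝ) • (P.p3 - (2 * ((j : ℝ) / 2 ^ k)) • P.p2 + (((j : ℝ) / 2 ^ k) ^ 2) • P.p1)

theorem four_pow_eq (k : ℕ) : (4 : ℝ) ^ k = 2 ^ k * 2 ^ k := by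
  rw [← mul_pow]; norm_num

theorem rescale_rescale (P : Coords V) (k j k' j' : ℕ) :
    (P.rescale k j).rescale k' j' = P.rescale (k + k') (j * 2 ^ k' + j') := by
  have h2 : (2 : ℝ) ^ k ≠ 0 := by positivity
  have h2' : (2 : ℝ) ^ k' ≠ 0 := by positivity
  ext x
  · rfl
  · simp [Coords.rescale, pow_add]
    field_simp
    ring
  · simp [Coords.rescale, pow_add, four_pow_eq]
    field_simp
    ring

theorem rescale_zero (P : Coords V) : P.rescale 0 0 = P := by
  ext x <;> simp [Coords.rescale]

theorem Near.rescale {P : Coords V} {κ : ℝ} {k j n i : ℕ} {ξ : V}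
    (h : Near P κ (k + n) (j * 2 ^ n + i) ξ) : Near (P.rescale k j) κ n i ξ := by
  obtain ⟨ω, δ, h1, h2, h3, h4, h5, h6⟩ := h
  have k2 : (0 : ℝ) < 2 ^ k := by positivity
  have n2 : (0 : ℝ) < 2 ^ n := by positivity
  refine ⟨2 ^ k * (ω - j / 2 ^ k), 4 ^ k * δ, h1, h2, ?_, ?_, ?_, ?_⟩
  · simp [Coords.rescale, h3]; ring
  · simp [Coords.rescale, h3, h4, four_pow_eq]
    ring
  · have : 2 ^ k * (ω - j / 2 ^ k) - (i : ℝ) / 2 ^ n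
        = 2 ^ k * (ω - ((j * 2 ^ n + i : ℕ) : ℝ) / 2 ^ (k + n)) := by
      push_cast
      rw [pow_add]
      field_simp
      ring
    rw [this, abs_mul, abs_of_pos k2]
    calc _ ≤ (2 : ℝ) ^ k * (2 / 2 ^ (k + n)) := by gcongr
      _ = 2 / 2 ^ n := by rw [pow_add]; field_simp
  · rw [abs_mul, abs_of_pos (by positivity : (0 : ℝ) < 4 ^ k)]
    calc _ ≤ 4 ^ k * (1 / 4 ^ (k + n) : ℝ) := by gcongr
      _ = _ := by rw [pow_add]; field_simp

theorem Near.coarse {P : Coords V} {κ : ℝ} {m d τ i : ℕ} {ξ : V} (hi : i < 2 ^ d)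
    (h : Near P κ (m + d) (τ * 2 ^ d + i) ξ) : Near P κ m τ ξ := by
  obtain ⟨ω, δ, h1, h2, h3, h4, h5, h6⟩ := h
  have k2 : (0 : ℝ) < 2 ^ m := by positivity
  have n2 : (0 : ℝ) < 2 ^ d := by positivity
  refine ⟨ω, δ, h1, h2, h3, h4, ?_, h6.trans ?_⟩
  · have hi' : (i : ℝ) + 1 ≤ 2 ^ d := by exact_mod_cast hi
    rcases Nat.eq_zero_or_pos d with rfl | hd
    · have : i = 0 := by simpa using hi
      simpa [this] using h5
    have hd2 : (2 : ℝ) ≤ 2 ^ d := by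
      calc (2 : ℝ) = 2 ^ 1 := by norm_num
        _ ≤ 2 ^ d := by gcongr; norm_num; exact hd
    have e : ω - τ / 2 ^ m = (ω - ((τ * 2 ^ d + i : ℕ) : ℝ) / 2 ^ (m + d))
        + i / (2 ^ m * 2 ^ d) := by
      push_cast
      rw [pow_add]
      field_simp
      ring
    rw [e]
    refine (abs_add_le _ _).trans ?_
    have : |(i : ℝ) / (2 ^ m * 2 ^ d)| = i / (2 ^ m * 2 ^ d) := abs_of_nonneg (by positivity)
    rw [this]
    have : (2 : ℝ) / 2 ^ (m + d) + i / (2 ^ m * 2 ^ d) ≤ 2 / 2 ^ m := by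
      rw [pow_add, ← add_div, div_le_div_iff₀ (by positivity) (by positivity)]
      nlinarith
    linarith
  · gcongr
    · norm_num
    · omega

/-- The dual quadratic form `p₃ - 2ωp₂ + ω²p₁`. -/
def dualQ (P : Coords V) (ζ : V) (ω : ℝ) : ℝ := P.p3 ζ - 2 * ω * P.p2 ζ + ω ^ 2 * P.p1 ζ

theorem Near.sub_bounds {P : Coords V} {κ : ℝ} (hκ : κ ≤ 1) {n i : ℕ} {ξ ξ' : V}
    (h : Near P κ n i ξ) (h' : Near P κ n i ξ') :
    |P.p1 (ξ - ξ')| ≤ 1 ∧ |P.p2 (ξ - ξ') - i / 2 ^ n * P.p1 (ξ - ξ')| ≤ 8 / 2 ^ n ∧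
      |dualQ P (ξ - ξ') (i / 2 ^ n)| ≤ 10 / 4 ^ n := by
  obtain ⟨ω, δ, h1, h2, h3, h4, h5, h6⟩ := h
  obtain ⟨ω', δ', h1', h2', h3', h4', h5', h6'⟩ := h'
  set a := P.p1 ξ
  set a' := P.p1 ξ'
  set c : ℝ := i / 2 ^ n
  obtain ⟨s, rfl⟩ : ∃ s, ω = c + s := ⟨ω - c, by ring⟩
  obtain ⟨s', rfl⟩ : ∃ s, ω' = c + s := ⟨ω' - c, by ring⟩
  simp only [add_sub_cancel_left] at h5 h5'
  set e : ℝ := 1 / 2 ^ n with he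
  have e0 : 0 < e := by positivity
  have e4 : (1 : ℝ) / 4 ^ n = e ^ 2 := by rw [four_pow_eq, he]; field_simp
  have r2 : (2 : ℝ) / 2 ^ n = 2 * e := by rw [he]; ring
  have r8 : (8 : ℝ) / 2 ^ n = 8 * e := by rw [he]; ring
  have r10 : (10 : ℝ) / 4 ^ n = 10 * e ^ 2 := by rw [← e4]; ring
  rw [r8, r10]
  rw [r2] at h5 h5'
  rw [e4] at h6 h6'
  have b1 : |a * s| ≤ 4 * e := by
    rw [abs_mul, abs_of_nonneg (by linarith)]
    nlinarith [abs_nonneg s]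
  have b1' : |a' * s'| ≤ 4 * e := by
    rw [abs_mul, abs_of_nonneg (by linarith)]
    nlinarith [abs_nonneg s']
  have b2 : |s| ^ 2 ≤ (2 * e) ^ 2 := by gcongr
  have b2' : |s'| ^ 2 ≤ (2 * e) ^ 2 := by gcongr
  rw [sq_abs] at b2 b2'
  have q : 0 ≤ a * s ^ 2 ∧ a * s ^ 2 ≤ 8 * e ^ 2 := ⟨by positivity, by nlinarith [sq_nonneg s]⟩
  have q' : 0 ≤ a' * s' ^ 2 ∧ a' * s' ^ 2 ≤ 8 * e ^ 2 :=
    ⟨by positivity, by nlinarith [sq_nonneg s']⟩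
  simp only [dualQ, map_sub]
  rw [h3, h3', h4, h4']
  refine ⟨?_, ?_, ?_⟩
  · rw [abs_le]; constructor <;> linarith
  · have : P.p1 ξ * (c + s) - P.p1 ξ' * (c + s') - c * (P.p1 ξ - P.p1 ξ') = a * s - a' * s' := by
      simp only [a, a']; ring
    rw [this]
    rw [abs_le] at *; constructor <;> linarith
  · have : P.p1 ξ * (c + s) ^ 2 + δ - (P.p1 ξ' * (c + s') ^ 2 + δ')
        - 2 * c * (P.p1 ξ * (c + s) - P.p1 ξ' * (c + s')) + c ^ 2 * (P.p1 ξ - P.p1 ξ')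
        = (a * s ^ 2 - a' * s' ^ 2) + (δ - δ') := by
      simp only [a, a']; ring
    rw [this]
    rw [abs_le] at *; constructor <;> linarith

theorem omega_le {n i : ℕ} (hi : i < 2 ^ n) {ω : ℝ}
    (h5 : |ω - i / 2 ^ n| ≤ 2 / 2 ^ n) : |ω| ≤ 3 := by
  have hi' : (i : ℝ) ≤ 2 ^ n := by exact_mod_cast hi.le
  have h1 : (i : ℝ) / 2 ^ n ≤ 1 := by rw [div_le_one (by positivity)]; exact hi'
  have h0 : 0 ≤ (i : ℝ) / 2 ^ n := by positivity
  have h2 : (2 : ℝ) / 2 ^ n ≤ 2 := by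
    rw [div_le_iff₀ (by positivity)]
    have : (1 : ℝ) ≤ 2 ^ n := one_le_pow₀ (by norm_num)
    linarith
  rw [abs_le] at *; constructor <;> linarith

/-- Closeness of indices. -/
def Close (D : ℕ) (i i' : ℕ) : Prop := i ≤ i' + D ∧ i' ≤ i + D

theorem close_of_abs {n i i' : ℕ} {ω ω' L : ℝ} {D : ℕ} (h : |ω - i / 2 ^ n| ≤ 2 / 2 ^ n)
    (h' : |ω' - i' / 2 ^ n| ≤ 2 / 2 ^ n) (hL : |ω - ω'| ≤ L / 2 ^ n) (hD : L + 4 ≤ D) :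
    Close D i i' := by
  have n2 : (0 : ℝ) < 2 ^ n := by positivity
  have key : |(i : ℝ) / 2 ^ n - i' / 2 ^ n| ≤ (L + 4) / 2 ^ n := by
    have : (L + 4) / 2 ^ n = L / 2 ^ n + 2 / 2 ^ n + (2 : ℝ) / 2 ^ n := by ring
    rw [this]
    rw [abs_le] at *; constructor <;> linarith
  rw [← sub_div, abs_div, abs_of_pos n2, div_le_div_iff_of_pos_right n2] at key
  have := key.trans hD
  rw [abs_le] at this
  constructor
  · have : (i : ℝ) ≤ i' + D := by linarith
    exact_mod_cast this
  · have : (i' : ℝ) ≤ i + D := by linarith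
    exact_mod_cast this

theorem Near.close_of_mem_Box {P : Coords V} {κ : ℝ} {m n i i' : ℕ} {ξ ξ' : V}
    (hn : n ≤ 2 * m) (hi' : i' < 2 ^ n) (h : Near P κ n i ξ) (h' : Near P κ n i' ξ')
    (hB : ξ - ξ' ∈ Box P m) : Close 132 i i' := by
  obtain ⟨ω, δ, h1, h2, h3, h4, h5, h6⟩ := h
  obtain ⟨ω', δ', h1', h2', h3', h4', h5', h6'⟩ := h'
  have hω := omega_le hi' h5'
  obtain ⟨b1, b2, -⟩ := hB
  simp only [map_sub] at b1 b2
  rw [h3, h3'] at b2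
  refine close_of_abs (L := 128) h5 h5' ?_ (by norm_num)
  have e : (2 : ℝ) ^ n ≤ 4 ^ m := by
    calc (2 : ℝ) ^ n ≤ 2 ^ (2 * m) := by gcongr; norm_num
      _ = 4 ^ m := by rw [pow_mul]; norm_num
  have m4 : (0 : ℝ) < 4 ^ m := by positivity
  have id : P.p1 ξ * (ω - ω') = (P.p1 ξ * ω - P.p1 ξ' * ω') - ω' * (P.p1 ξ - P.p1 ξ') := by ring
  have : 4 ^ m * |ω - ω'| ≤ 128 := by
    calc 4 ^ m * |ω - ω'| ≤ 4 ^ m * (P.p1 ξ * |ω - ω'|) := by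
          gcongr; nlinarith [abs_nonneg (ω - ω')]
      _ = 4 ^ m * |P.p1 ξ * (ω - ω')| := by rw [abs_mul, abs_of_nonneg (by linarith : 0 ≤ P.p1 ξ)]
      _ ≤ 4 ^ m * (|P.p1 ξ * ω - P.p1 ξ' * ω'| + |ω'| * |P.p1 ξ - P.p1 ξ'|) := by
          rw [id, ← abs_mul]; gcongr; exact abs_sub _ _
      _ ≤ 32 + 3 * 32 := by
          rw [mul_add]
          have := mul_le_mul hω b1 (by positivity) (by norm_num)
          linarith
      _ = 128 := by norm_num
  rw [le_div_iff₀ (by positivity)]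
  nlinarith [abs_nonneg (ω - ω')]

set_option maxHeartbeats 1000000 in
/-- Córdoba–Fefferman type biorthogonality. -/
theorem Near.quadruple {P : Coords V} {κ : ℝ} {n i₁ i₂ i₃ i₄ : ℕ} {ξ₁ ξ₂ ξ₃ ξ₄ : V}
    (hκ : κ ≤ 1 / 4 ^ n) (hi₁ : i₁ < 2 ^ n) (hi₂ : i₂ < 2 ^ n) (hi₃ : i₃ < 2 ^ n)
    (hi₄ : i₄ < 2 ^ n)
    (h₁ : Near P κ n i₁ ξ₁) (h₂ : Near P κ n i₂ ξ₂) (h₃ : Near P κ n i₃ ξ₃)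
    (h₄ : Near P κ n i₄ ξ₄) (hsum : ξ₁ - ξ₃ = ξ₄ - ξ₂) :
    (Close 32 i₁ i₃ ∧ Close 32 i₂ i₄) ∨ (Close 32 i₁ i₄ ∧ Close 32 i₂ i₃) := by
  obtain ⟨w1, d1, a1, b1, c1, e1, f1, g1⟩ := h₁
  obtain ⟨w2, d2, a2, b2, c2, e2, f2, g2⟩ := h₂
  obtain ⟨w3, d3, a3, b3, c3, e3, f3, g3⟩ := h₃
  obtain ⟨w4, d4, a4, b4, c4, e4, f4, g4⟩ := h₄
  have o1 := omega_le hi₁ f1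
  have o2 := omega_le hi₂ f2
  have o3 := omega_le hi₃ f3
  have o4 := omega_le hi₄ f4
  have s2 : P.p2 ξ₁ - P.p2 ξ₃ = P.p2 ξ₄ - P.p2 ξ₂ := by rw [← map_sub, ← map_sub, hsum]
  have s3 : P.p3 ξ₁ - P.p3 ξ₃ = P.p3 ξ₄ - P.p3 ξ₂ := by rw [← map_sub, ← map_sub, hsum]
  rw [c1, c2, c3, c4] at s2
  rw [e1, e2, e3, e4] at s3
  set e : ℝ := 1 / 2 ^ n with he
  have e0 : 0 < e := by positivity
  have eq4 : (1 : ℝ) / 4 ^ n = e ^ 2 := by rw [four_pow_eq, he]; field_simp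
  have ele : e ≤ 1 := by
    rw [he, div_le_one (by positivity)]; exact one_le_pow₀ (by norm_num)
  rw [eq4] at hκ g1 g2 g3 g4
  have lin : ∀ {x w : ℝ}, 1 ≤ x → x ≤ 1 + κ → |w| ≤ 3 → |(x - 1) * w| ≤ 3 * e ^ 2 := by
    intro x w hx hx' hw
    rw [abs_mul, abs_of_nonneg (by linarith)]
    have := mul_le_mul (by linarith : x - 1 ≤ e ^ 2) hw (abs_nonneg _) (by positivity)
    linarith
  have quad : ∀ {x w : ℝ}, 1 ≤ x → x ≤ 1 + κ → |w| ≤ 3 → |(x - 1) * w ^ 2| ≤ 9 * e ^ 2 := by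
    intro x w hx hx' hw
    rw [abs_mul, abs_of_nonneg (by linarith), abs_pow]
    have h9 : |w| ^ 2 ≤ 9 := by nlinarith [abs_nonneg w]
    have := mul_le_mul (by linarith : x - 1 ≤ e ^ 2) h9 (by positivity) (by positivity)
    linarith
  have l1 := lin a1 b1 o1
  have l2 := lin a2 b2 o2
  have l3 := lin a3 b3 o3
  have l4 := lin a4 b4 o4
  have q1 := quad a1 b1 o1
  have q2 := quad a2 b2 o2
  have q3 := quad a3 b3 o3
  have q4 := quad a4 b4 o4
  have E1 : |w1 + w2 - w3 - w4| ≤ 12 * e ^ 2 := by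
    rw [abs_le] at *; constructor <;> linarith
  have E2 : |w1 ^ 2 + w2 ^ 2 - w3 ^ 2 - w4 ^ 2| ≤ 40 * e ^ 2 := by
    rw [abs_le] at *; constructor <;> linarith
  have E3 : |(w3 + w4 - w1) + w2| ≤ 12 := by
    rw [abs_le] at *; constructor <;> linarith
  have E4 : |(w1 - w3) * (w1 - w4)| ≤ 92 * e ^ 2 := by
    have id : (w1 - w3) * (w1 - w4) = ((w1 ^ 2 + w2 ^ 2 - w3 ^ 2 - w4 ^ 2)
      - (w1 + w2 - w3 - w4) * ((w3 + w4 - w1) + w2)) / 2 := by ring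
    have := mul_le_mul E1 E3 (abs_nonneg _) (by positivity)
    rw [← abs_mul] at this
    rw [id]
    rw [abs_le] at *; constructor <;> linarith
  have ee : e ^ 2 ≤ e := by nlinarith
  have r2 : (10 : ℝ) / 2 ^ n = 10 * e := by rw [he]; ring
  have r3 : (22 : ℝ) / 2 ^ n = 22 * e := by rw [he]; ring
  have key : |w1 - w3| ≤ 10 * e ∨ |w1 - w4| ≤ 10 * e := by
    by_contra! hh
    have := mul_lt_mul'' hh.1 hh.2 (by positivity) (by positivity)
    rw [← abs_mul, show 10 * e * (10 * e) = 100 * e ^ 2 by ring] at this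
    have := pow_pos e0 2
    linarith
  rcases key with hk | hk
  · left
    refine ⟨close_of_abs (L := 10) f1 f3 (by rw [r2]; exact hk) (by norm_num),
      close_of_abs (L := 22) f2 f4 (by rw [r3]; rw [abs_le] at *; constructor <;> linarith)
        (by norm_num)⟩
  · right
    refine ⟨close_of_abs (L := 10) f1 f4 (by rw [r2]; exact hk) (by norm_num),
      close_of_abs (L := 22) f2 f3 (by rw [r3]; rw [abs_le] at *; constructor <;> linarith)
        (by norm_num)⟩

end Geometry

theorem sum_range_mul {M : Type*} [AddCommMonoid M] (f : ℕ → M) (a b : ℕ) :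
    ∑ i ∈ Finset.range (a * b), f i
      = ∑ j ∈ Finset.range a, ∑ i ∈ Finset.range b, f (j * b + i) := by
  induction a with
  | zero => simp
  | succ a ih => rw [Nat.succ_mul, Finset.sum_range_add, ih, Finset.sum_range_succ]

theorem sum_range_two_pow {M : Type*} [AddCommMonoid M] (f : ℕ → M) (a b : ℕ) :
    ∑ i ∈ Finset.range (2 ^ (a + b)), f i
      = ∑ j ∈ Finset.range (2 ^ a), ∑ i ∈ Finset.range (2 ^ b), f (j * 2 ^ b + i) := by
  rw [pow_add, sum_range_mul]

theorem index_lt {a b j i : ℕ} (hj : j < 2 ^ a) (hi : i < 2 ^ b) :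
    j * 2 ^ b + i < 2 ^ (a + b) := by
  rw [pow_add]
  calc j * 2 ^ b + i < j * 2 ^ b + 2 ^ b := by omega
    _ = (j + 1) * 2 ^ b := by ring
    _ ≤ 2 ^ a * 2 ^ b := by gcongr; omega

instance (D i i' : ℕ) : Decidable (Close D i i') := by unfold Close; infer_instance

theorem Close.symm {D i i' : ℕ} (h : Close D i i') : Close D i' i := ⟨h.2, h.1⟩

theorem card_close_le (D N i : ℕ) :
    ((Finset.range N).filter fun i' => Close D i i').card ≤ 2 * D + 1 := by
  have : ((Finset.range N).filter fun i' => Close D i i') ⊆ Finset.Icc (i - D) (i + D) := by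
    intro x hx
    obtain ⟨-, h1, h2⟩ := Finset.mem_filter.1 hx
    simp only [Finset.mem_Icc]
    omega
  refine (Finset.card_le_card this).trans ?_
  rw [Nat.card_Icc]
  omega

/-- The near-diagonal double sum is dominated by the diagonal one. -/
theorem sum_close_le (D N : ℕ) (a : ℕ → ℝ) :
    ∑ i ∈ Finset.range N, ∑ i' ∈ Finset.range N, (if Close D i i' then a i * a i' else 0)
      ≤ (2 * D + 1) * ∑ i ∈ Finset.range N, a i ^ 2 := by
  have h1 : ∀ i i' : ℕ, (if Close D i i' then a i * a i' else 0)
      ≤ (if Close D i i' then a i ^ 2 / 2 else 0) + (if Close D i i' then a i' ^ 2 / 2 else 0) := by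
    intro i i'
    split_ifs
    · nlinarith [sq_nonneg (a i - a i')]
    · simp
  have h2 : ∑ i ∈ Finset.range N, ∑ i' ∈ Finset.range N, (if Close D i i' then a i ^ 2 / 2 else 0)
      ≤ ∑ i ∈ Finset.range N, (2 * D + 1) * (a i ^ 2 / 2) := by
    refine Finset.sum_le_sum fun i _ => ?_
    rw [← Finset.sum_filter, Finset.sum_const, nsmul_eq_mul]
    gcongr
    exact_mod_cast card_close_le D N i
  have h3 : ∑ i ∈ Finset.range N, ∑ i' ∈ Finset.range N, (if Close D i i' then a i' ^ 2 / 2 else 0)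
      = ∑ i ∈ Finset.range N, ∑ i' ∈ Finset.range N,
        (if Close D i i' then a i ^ 2 / 2 else 0) := by
    rw [Finset.sum_comm]
    refine Finset.sum_congr rfl fun i _ => Finset.sum_congr rfl fun i' _ => ?_
    congr 1
    exact propext ⟨Close.symm, Close.symm⟩
  calc _ ≤ ∑ i ∈ Finset.range N, ∑ i' ∈ Finset.range N,
        ((if Close D i i' then a i ^ 2 / 2 else 0)
          + (if Close D i i' then a i' ^ 2 / 2 else 0)) :=
        Finset.sum_le_sum fun i _ => Finset.sum_le_sum fun i' _ => h1 i i'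
    _ ≤ ∑ i ∈ Finset.range N, (2 * D + 1) * (a i ^ 2 / 2)
        + ∑ i ∈ Finset.range N, (2 * D + 1) * (a i ^ 2 / 2) := by
        simp only [Finset.sum_add_distrib]
        rw [h3]
        linarith
    _ = _ := by
        rw [← Finset.sum_add_distrib, Finset.mul_sum]
        exact Finset.sum_congr rfl fun i _ => by ring

/-- Quadruple sums over the two near-diagonal configurations. -/
theorem sum_quadruple_le (D N : ℕ) (a : ℕ → ℝ) (ha : ∀ i, 0 ≤ a i) :
    ∑ i₁ ∈ Finset.range N, ∑ i₃ ∈ Finset.range N, ∑ i₄ ∈ Finset.range N, ∑ i₂ ∈ Finset.range N,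
      (if (Close D i₁ i₃ ∧ Close D i₂ i₄) ∨ (Close D i₁ i₄ ∧ Close D i₂ i₃)
        then a i₁ * a i₃ * (a i₄ * a i₂) else 0)
      ≤ 2 * ((2 * D + 1) * ∑ i ∈ Finset.range N, a i ^ 2) ^ 2 := by
  set c : ℕ → ℕ → ℝ := fun i i' => if Close D i i' then a i * a i' else 0 with hc
  have c0 : ∀ i i', 0 ≤ c i i' := fun i i' => by
    simp only [hc]; split_ifs
    · exact mul_nonneg (ha _) (ha _)
    · exact le_rfl
  have csymm : ∀ i i', c i i' = c i' i := fun i i' => by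
    simp only [hc]
    by_cases h : Close D i i'
    · rw [if_pos h, if_pos h.symm, mul_comm]
    · rw [if_neg h, if_neg fun h' => h h'.symm]
  have h1 : ∀ i₁ i₃ i₄ i₂ : ℕ,
      (if (Close D i₁ i₃ ∧ Close D i₂ i₄) ∨ (Close D i₁ i₄ ∧ Close D i₂ i₃)
        then a i₁ * a i₃ * (a i₄ * a i₂) else 0) ≤ c i₁ i₃ * c i₄ i₂ + c i₁ i₄ * c i₃ i₂ := by
    intro i₁ i₃ i₄ i₂
    split_ifs with h
    · rcases h with h | h
      · have : c i₁ i₃ * c i₄ i₂ = a i₁ * a i₃ * (a i₄ * a i₂) := by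
          simp only [hc]; rw [if_pos h.1, if_pos h.2.symm]
        have := mul_nonneg (c0 i₁ i₄) (c0 i₃ i₂)
        linarith
      · have : c i₁ i₄ * c i₃ i₂ = a i₁ * a i₃ * (a i₄ * a i₂) := by
          simp only [hc]; rw [if_pos h.1, if_pos h.2.symm]; ring
        have := mul_nonneg (c0 i₁ i₃) (c0 i₄ i₂)
        linarith
    · exact add_nonneg (mul_nonneg (c0 _ _) (c0 _ _)) (mul_nonneg (c0 _ _) (c0 _ _))
  have hG := sum_close_le D N a
  set G : ℝ := ∑ i ∈ Finset.range N, ∑ i' ∈ Finset.range N, c i i' with hGdef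
  have G0 : 0 ≤ G := Finset.sum_nonneg fun i _ => Finset.sum_nonneg fun i' _ => c0 i i'
  have e1 : ∑ i₁ ∈ Finset.range N, ∑ i₃ ∈ Finset.range N, ∑ i₄ ∈ Finset.range N,
      ∑ i₂ ∈ Finset.range N, c i₁ i₃ * c i₄ i₂ = G ^ 2 := by
    rw [sq, hGdef, Finset.sum_mul]
    refine Finset.sum_congr rfl fun i _ => ?_
    rw [Finset.sum_mul]
    refine Finset.sum_congr rfl fun i' _ => ?_
    rw [Finset.mul_sum]
    refine Finset.sum_congr rfl fun _ _ => ?_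
    rw [Finset.mul_sum]
  have e2 : ∑ i₁ ∈ Finset.range N, ∑ i₃ ∈ Finset.range N, ∑ i₄ ∈ Finset.range N,
      ∑ i₂ ∈ Finset.range N, c i₁ i₄ * c i₃ i₂ = G ^ 2 := by
    rw [← e1]
    refine Finset.sum_congr rfl fun i _ => ?_
    rw [Finset.sum_comm]
  calc _ ≤ ∑ i₁ ∈ Finset.range N, ∑ i₃ ∈ Finset.range N, ∑ i₄ ∈ Finset.range N,
      ∑ i₂ ∈ Finset.range N, (c i₁ i₃ * c i₄ i₂ + c i₁ i₄ * c i₃ i₂) :=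
        Finset.sum_le_sum fun _ _ => Finset.sum_le_sum fun _ _ => Finset.sum_le_sum fun _ _ =>
          Finset.sum_le_sum fun _ _ => h1 _ _ _ _
    _ = 2 * G ^ 2 := by
        simp only [Finset.sum_add_distrib]
        rw [e1, e2]; ring
    _ ≤ _ := by gcongr

section Families

variable {V : Type*} [NormedAddCommGroup V] [InnerProductSpace ℝ V] [FiniteDimensional ℝ V]
  [MeasurableSpace V] [BorelSpace V]

/-- Sum of the `2ᵈ` consecutive functions below the `τ`-th node. -/
def coarse (F : ℕ → 𝓢(V, ℂ)) (d : ℕ) : ℕ → 𝓢(V, ℂ) :=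
  fun τ => ∑ i ∈ Finset.range (2 ^ d), F (τ * 2 ^ d + i)

/-- The squared square function `∑_{i < 2ᴺ} |F_i|²`. -/
def sqn (F : ℕ → 𝓢(V, ℂ)) (N : ℕ) : 𝓢(V, ℂ) :=
  ∑ i ∈ Finset.range (2 ^ N), mulConj (F i) (F i)

/-- The `L²` mass of `𝓕 h` on a box. -/
def env (P : Coords V) (r : ℕ) (h : 𝓢(V, ℂ)) : ℝ≥0∞ := ∫⁻ ζ in Box P r, ‖𝓕 h ζ‖ₑ ^ 2

/-- The wave envelope sum. -/
def waveEnv (P : Coords V) (n : ℕ) (F : ℕ → 𝓢(V, ℂ)) : ℝ≥0∞ :=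
  ∑ k ∈ Finset.range (n + 1), ∑ j ∈ Finset.range (2 ^ k),
    env (P.rescale k j) (n - k) (sqn (fun i => F (j * 2 ^ (n - k) + i)) (n - k))

/-- The Fourier supports of the `F i` lie in the planks. -/
def Supp (P : Coords V) (κ : ℝ) (n : ℕ) (F : ℕ → 𝓢(V, ℂ)) : Prop :=
  ∀ i < 2 ^ n, ∀ ξ, 𝓕 (F i) ξ ≠ 0 → Near P κ n i ξ

theorem coarse_coarse (F : ℕ → 𝓢(V, ℂ)) (d₁ d₂ : ℕ) :
    coarse (coarse F d₁) d₂ = coarse F (d₂ + d₁) := by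
  ext1 τ
  simp only [coarse]
  rw [sum_range_two_pow]
  refine Finset.sum_congr rfl fun i _ => Finset.sum_congr rfl fun i' _ => ?_
  congr 1
  ring

theorem sum_schwartz_apply {ι : Type*} (s : Finset ι) (f : ι → 𝓢(V, ℂ)) (x : V) :
    (∑ i ∈ s, f i) x = ∑ i ∈ s, f i x := by
  rw [SchwartzMap.sum_apply]

theorem fourier_sum_apply {ι : Type*} (s : Finset ι) (f : ι → 𝓢(V, ℂ)) (x : V) :
    𝓕 (∑ i ∈ s, f i) x = ∑ i ∈ s, 𝓕 (f i) x := by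
  rw [FourierTransform.fourier_sum, sum_schwartz_apply]

theorem sqn_apply (F : ℕ → 𝓢(V, ℂ)) (N : ℕ) (x : V) :
    sqn F N x = ((∑ i ∈ Finset.range (2 ^ N), ‖F i x‖ ^ 2 : ℝ) : ℂ) := by
  simp only [sqn, sum_schwartz_apply, mulConj_apply]
  push_cast
  exact Finset.sum_congr rfl fun i _ => by rw [Complex.mul_conj']

theorem enorm_sqn (F : ℕ → 𝓢(V, ℂ)) (N : ℕ) (x : V) :
    ‖sqn F N x‖ₑ = ENNReal.ofReal (∑ i ∈ Finset.range (2 ^ N), ‖F i x‖ ^ 2) := by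
  rw [sqn_apply, ← ofReal_norm, Complex.norm_real, Real.norm_of_nonneg]
  exact Finset.sum_nonneg fun i _ => by positivity

theorem Supp.coarse {P : Coords V} {κ : ℝ} {m d : ℕ} {F : ℕ → 𝓢(V, ℂ)}
    (h : Supp P κ (m + d) F) : Supp P κ m (coarse F d) := by
  intro τ hτ ξ hξ
  rw [WaveEnv.coarse, fourier_sum_apply] at hξ
  obtain ⟨i, hi, hne⟩ := Finset.exists_ne_zero_of_sum_ne_zero hξ
  rw [Finset.mem_range] at hi
  exact (h _ (index_lt hτ hi) ξ hne).coarse hi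

theorem Supp.rescale {P : Coords V} {κ : ℝ} {k n j : ℕ} {F : ℕ → 𝓢(V, ℂ)}
    (h : Supp P κ (k + n) F) (hj : j < 2 ^ k) :
    Supp (P.rescale k j) κ n (fun i => F (j * 2 ^ n + i)) := by
  intro i hi ξ hξ
  exact (h _ (index_lt hj hi) ξ hξ).rescale

/-- Expansion of the square function at scale `m` into pairs at scale `m + d`. -/
theorem sqn_coarse (F : ℕ → 𝓢(V, ℂ)) (m d : ℕ) :
    sqn (coarse F d) m = ∑ i ∈ Finset.range (2 ^ (m + d)), ∑ i' ∈ Finset.range (2 ^ (m + d)),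
      if i / 2 ^ d = i' / 2 ^ d then mulConj (F i) (F i') else 0 := by
  have hd : 0 < 2 ^ d := by positivity
  rw [sum_range_two_pow]
  simp only [sqn]
  refine Finset.sum_congr rfl fun τ hτ => ?_
  have inner : ∀ i ∈ Finset.range (2 ^ d),
      (∑ i' ∈ Finset.range (2 ^ (m + d)), if (τ * 2 ^ d + i) / 2 ^ d = i' / 2 ^ d
        then mulConj (F (τ * 2 ^ d + i)) (F i') else 0)
      = ∑ i' ∈ Finset.range (2 ^ d), mulConj (F (τ * 2 ^ d + i)) (F (τ * 2 ^ d + i')) := by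
    intro i hi
    rw [sum_range_two_pow]
    have hdiv : ∀ t u : ℕ, u ∈ Finset.range (2 ^ d) → (t * 2 ^ d + u) / 2 ^ d = t := by
      intro t u hu
      rw [Nat.mul_comm, Nat.mul_add_div hd, Nat.div_eq_of_lt (Finset.mem_range.1 hu), add_zero]
    rw [hdiv τ i hi]
    rw [Finset.sum_eq_single τ]
    · exact Finset.sum_congr rfl fun i' hi' => by rw [hdiv τ i' hi', if_pos rfl]
    · intro τ' _ hne
      exact Finset.sum_eq_zero fun i' hi' => by rw [hdiv τ' i' hi', if_neg (Ne.symm hne)]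
    · intro h; exact absurd hτ h
  rw [Finset.sum_congr rfl inner]
  ext x
  simp only [coarse, sum_schwartz_apply, mulConj_apply, map_sum]
  rw [Finset.sum_mul_sum]

end Families

section Orthogonality

variable {V : Type*} [NormedAddCommGroup V] [InnerProductSpace ℝ V] [FiniteDimensional ℝ V]
  [MeasurableSpace V] [BorelSpace V]

theorem fourier_ite_apply (c : Prop) [Decidable c] (f : 𝓢(V, ℂ)) (ζ : V) :
    𝓕 (if c then f else 0) ζ = if c then 𝓕 f ζ else 0 := by
  split_ifs
  · rfl
  · rw [FourierTransform.fourier_zero]; rfl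

theorem schwartz_ite_apply (c : Prop) [Decidable c] (f : 𝓢(V, ℂ)) (ζ : V) :
    (if c then f else 0) ζ = if c then f ζ else 0 := by
  split_ifs <;> rfl

theorem env_sqn_coarse_le {P : Coords V} {κ : ℝ} {m d : ℕ} {F : ℕ → 𝓢(V, ℂ)}
    (h : Supp P κ (m + d) F) (hd : m + d ≤ 2 * m) :
    env P m (sqn (coarse F d) m) ≤ 265 ^ 2 * ∫⁻ ζ, ‖𝓕 (sqn F (m + d)) ζ‖ₑ ^ 2 := by
  classical
  set N := 2 ^ (m + d) with hN
  set H : 𝓢(V, ℂ) := ∑ i ∈ Finset.range N, ∑ i' ∈ Finset.range N,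
    if i / 2 ^ d = i' / 2 ^ d ∧ Close 132 i i' then mulConj (F i) (F i') else 0 with hH
  have h1 : ∀ ζ ∈ Box P m, 𝓕 (sqn (coarse F d) m) ζ = 𝓕 H ζ := by
    intro ζ hζ
    rw [sqn_coarse, hH]
    simp only [fourier_sum_apply, fourier_ite_apply]
    refine Finset.sum_congr rfl fun i hi => Finset.sum_congr rfl fun i' hi' => ?_
    by_cases hc : i / 2 ^ d = i' / 2 ^ d
    · by_cases hcl : Close 132 i i'
      · rw [if_pos hc, if_pos ⟨hc, hcl⟩]
      · rw [if_pos hc, if_neg fun hh => hcl hh.2]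
        by_contra hne
        obtain ⟨ξ, hξ, hξ'⟩ := fourier_mulConj_ne_zero hne
        rw [Finset.mem_range] at hi hi'
        exact hcl (Near.close_of_mem_Box hd hi' (h _ hi _ hξ) (h _ hi' _ hξ') (by simpa using hζ))
    · rw [if_neg hc, if_neg fun hh => hc hh.1]
  have h2 : ∀ x, ‖H x‖ ≤ 265 * ∑ i ∈ Finset.range N, ‖F i x‖ ^ 2 := by
    intro x
    have := sum_close_le 132 N fun i => ‖F i x‖
    norm_num at this
    refine le_trans ?_ this
    rw [hH]
    simp only [sum_schwartz_apply, schwartz_ite_apply]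
    refine (norm_sum_le _ _).trans (Finset.sum_le_sum fun i _ => ?_)
    refine (norm_sum_le _ _).trans (Finset.sum_le_sum fun i' _ => ?_)
    split_ifs with ha hb hb
    · simp
    · exact absurd ha.2 hb
    · simp; positivity
    · simp
  calc env P m (sqn (coarse F d) m) = ∫⁻ ζ in Box P m, ‖𝓕 H ζ‖ₑ ^ 2 :=
        setLIntegral_congr_fun (measurableSet_Box P m) fun ζ hζ => by simp only [h1 ζ hζ]
    _ ≤ ∫⁻ ζ, ‖𝓕 H ζ‖ₑ ^ 2 := setLIntegral_le_lintegral _ _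
    _ = ∫⁻ x, ‖H x‖ₑ ^ 2 := lintegral_fourier_sq H
    _ ≤ ∫⁻ x, 265 ^ 2 * ‖sqn F (m + d) x‖ₑ ^ 2 := by
        refine lintegral_mono fun x => ?_
        rw [← mul_pow]
        gcongr
        rw [enorm_sqn, ← ofReal_norm, show (265 : ℝ≥0∞) = ENNReal.ofReal 265 by norm_num,
          ← ENNReal.ofReal_mul (by norm_num)]
        exact ENNReal.ofReal_le_ofReal (h2 x)
    _ = 265 ^ 2 * ∫⁻ x, ‖sqn F (m + d) x‖ₑ ^ 2 := lintegral_const_mul' _ _ (by norm_num)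
    _ = _ := by rw [lintegral_fourier_sq]

theorem lintegral_sq_eq_enorm_integral (A : 𝓢(V, ℂ)) :
    ∫⁻ x, ‖A x‖ₑ ^ 2 = ‖∫ x, mulConj A A x‖ₑ := by
  have e : ∀ x, mulConj A A x = ((‖A x‖ ^ 2 : ℝ) : ℂ) := fun x => by
    rw [mulConj_apply, Complex.mul_conj']; push_cast; rfl
  simp_rw [e]
  rw [integral_complex_ofReal, ← ofReal_norm, Complex.norm_real,
    Real.norm_of_nonneg (integral_nonneg fun x => by positivity),
    ofReal_integral_eq_lintegral_ofReal]
  · refine lintegral_congr fun x => ?_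
    rw [ENNReal.ofReal_pow (norm_nonneg _), ofReal_norm]
  · simpa using (A.memLp 2).integrable_norm_pow (by norm_num)
  · exact Filter.Eventually.of_forall fun x => by positivity

theorem integral_mulConj_mulConj_eq_zero {P : Coords V} {κ : ℝ} {n : ℕ} {F : ℕ → 𝓢(V, ℂ)}
    (hκ : κ ≤ 1 / 4 ^ n) (h : Supp P κ n F) {i₁ i₂ i₃ i₄ : ℕ}
    (hi₁ : i₁ < 2 ^ n) (hi₂ : i₂ < 2 ^ n) (hi₃ : i₃ < 2 ^ n) (hi₄ : i₄ < 2 ^ n)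
    (hc : ¬((Close 32 i₁ i₃ ∧ Close 32 i₂ i₄) ∨ (Close 32 i₁ i₄ ∧ Close 32 i₂ i₃))) :
    ∫ x, mulConj (mulConj (F i₁) (F i₃)) (mulConj (F i₄) (F i₂)) x = 0 := by
  simp only [mulConj_apply (mulConj _ _)]
  rw [← integral_mul_conj_fourier, ← integral_zero V ℂ]
  congr 1
  ext ζ
  by_contra hne
  obtain ⟨h1, h2⟩ := mul_ne_zero_iff.1 hne
  obtain ⟨ξ₁, a1, a3⟩ := fourier_mulConj_ne_zero h1
  obtain ⟨ξ₄, a4, a2⟩ := fourier_mulConj_ne_zero ((map_ne_zero _).1 h2)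
  exact hc (Near.quadruple hκ hi₁ hi₂ hi₃ hi₄ (h _ hi₁ _ a1) (h _ hi₂ _ a2) (h _ hi₃ _ a3)
    (h _ hi₄ _ a4) (by abel))

theorem lintegral_sqn_coarse_le {P : Coords V} {κ : ℝ} {m d : ℕ} {F : ℕ → 𝓢(V, ℂ)}
    (hκ : κ ≤ 1 / 4 ^ (m + d)) (h : Supp P κ (m + d) F) :
    ∫⁻ x, ‖sqn (coarse F d) m x‖ₑ ^ 2 ≤ 8450 * ∫⁻ x, ‖sqn F (m + d) x‖ₑ ^ 2 := by
  classical
  set N := 2 ^ (m + d) with hN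
  set M : ℕ → ℕ → 𝓢(V, ℂ) := fun i i' =>
    if i / 2 ^ d = i' / 2 ^ d then mulConj (F i) (F i') else 0 with hM
  have hA : sqn (coarse F d) m = ∑ i ∈ Finset.range N, ∑ i' ∈ Finset.range N, M i i' :=
    sqn_coarse F m d
  rw [lintegral_sq_eq_enorm_integral]
  have e1 : ∫ x, mulConj (sqn (coarse F d) m) (sqn (coarse F d) m) x
      = ∑ i₁ ∈ Finset.range N, ∑ i₃ ∈ Finset.range N, ∑ i₄ ∈ Finset.range N,
        ∑ i₂ ∈ Finset.range N, ∫ x, mulConj (M i₁ i₃) (M i₄ i₂) x := by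
    have : ∀ x, mulConj (sqn (coarse F d) m) (sqn (coarse F d) m) x
        = ∑ i₁ ∈ Finset.range N, ∑ i₃ ∈ Finset.range N, ∑ i₄ ∈ Finset.range N,
          ∑ i₂ ∈ Finset.range N, mulConj (M i₁ i₃) (M i₄ i₂) x := by
      intro x
      rw [hA]
      simp only [mulConj_apply, sum_schwartz_apply, map_sum, Finset.sum_mul]
      refine Finset.sum_congr rfl fun _ _ => Finset.sum_congr rfl fun _ _ => ?_
      rw [Finset.mul_sum]
      exact Finset.sum_congr rfl fun _ _ => by rw [Finset.mul_sum]
    simp_rw [this]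
    have int : ∀ i₁ i₃ i₄ i₂, Integrable fun x => mulConj (M i₁ i₃) (M i₄ i₂) x :=
      fun _ _ _ _ => SchwartzMap.integrable _
    rw [integral_finsetSum _ fun _ _ => integrable_finsetSum _ fun _ _ =>
      integrable_finsetSum _ fun _ _ => integrable_finsetSum _ fun _ _ => int _ _ _ _]
    refine Finset.sum_congr rfl fun _ _ => ?_
    rw [integral_finsetSum _ fun _ _ =>
      integrable_finsetSum _ fun _ _ => integrable_finsetSum _ fun _ _ => int _ _ _ _]
    refine Finset.sum_congr rfl fun _ _ => ?_
    rw [integral_finsetSum _ fun _ _ => integrable_finsetSum _ fun _ _ => int _ _ _ _]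
    refine Finset.sum_congr rfl fun _ _ => ?_
    rw [integral_finsetSum _ fun _ _ => int _ _ _ _]
  set Q : ℕ → ℕ → ℕ → ℕ → V → ℝ := fun i₁ i₃ i₄ i₂ x =>
    if (Close 32 i₁ i₃ ∧ Close 32 i₂ i₄) ∨ (Close 32 i₁ i₄ ∧ Close 32 i₂ i₃)
      then ‖F i₁ x‖ * ‖F i₃ x‖ * (‖F i₄ x‖ * ‖F i₂ x‖) else 0 with hQ
  have Q0 : ∀ i₁ i₃ i₄ i₂ x, 0 ≤ Q i₁ i₃ i₄ i₂ x := by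
    intro i₁ i₃ i₄ i₂ x
    simp only [hQ]
    split_ifs <;> positivity
  have Qm : ∀ i₁ i₃ i₄ i₂, Measurable fun x => ENNReal.ofReal (Q i₁ i₃ i₄ i₂ x) := by
    intro i₁ i₃ i₄ i₂
    have mF : ∀ i, Measurable fun x => ‖F i x‖ := fun i => (F i).continuous.norm.measurable
    simp only [hQ]
    split_ifs
    · exact (((mF _).mul (mF _)).mul ((mF _).mul (mF _))).ennreal_ofReal
    · exact measurable_const
  have e2 : ∀ i₁ ∈ Finset.range N, ∀ i₃ ∈ Finset.range N, ∀ i₄ ∈ Finset.range N,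
      ∀ i₂ ∈ Finset.range N, ‖∫ x, mulConj (M i₁ i₃) (M i₄ i₂) x‖ₑ
        ≤ ∫⁻ x, ENNReal.ofReal (Q i₁ i₃ i₄ i₂ x) := by
    intro i₁ h₁ i₃ h₃ i₄ h₄ i₂ h₂
    rw [Finset.mem_range] at h₁ h₂ h₃ h₄
    by_cases hc : (Close 32 i₁ i₃ ∧ Close 32 i₂ i₄) ∨ (Close 32 i₁ i₄ ∧ Close 32 i₂ i₃)
    · refine (enorm_integral_le_lintegral_enorm _).trans (lintegral_mono fun x => ?_)
      have bM : ∀ i i', ‖M i i' x‖ ≤ ‖F i x‖ * ‖F i' x‖ := by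
        intro i i'
        simp only [hM, schwartz_ite_apply]
        split_ifs
        · simp
        · simp; positivity
      rw [← ofReal_norm]
      apply ENNReal.ofReal_le_ofReal
      simp only [hQ, if_pos hc, mulConj_apply, norm_mul, RCLike.norm_conj]
      exact mul_le_mul (bM _ _) (bM _ _) (norm_nonneg _) (by positivity)
    · have : ∫ x, mulConj (M i₁ i₃) (M i₄ i₂) x = 0 := by
        by_cases ha : i₁ / 2 ^ d = i₃ / 2 ^ d
        · by_cases hb : i₄ / 2 ^ d = i₂ / 2 ^ d
          · simp only [hM, if_pos ha, if_pos hb]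
            exact integral_mulConj_mulConj_eq_zero hκ h h₁ h₂ h₃ h₄ hc
          · simp [hM, if_neg hb, mulConj_apply]
        · simp [hM, if_neg ha, mulConj_apply]
      rw [this]
      simp
  rw [e1]
  calc _ ≤ ∑ i₁ ∈ Finset.range N, ∑ i₃ ∈ Finset.range N, ∑ i₄ ∈ Finset.range N,
        ∑ i₂ ∈ Finset.range N, ∫⁻ x, ENNReal.ofReal (Q i₁ i₃ i₄ i₂ x) := by
        refine (enorm_sum_le _ _).trans (Finset.sum_le_sum fun _ h1 => ?_)
        refine (enorm_sum_le _ _).trans (Finset.sum_le_sum fun _ h3 => ?_)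
        refine (enorm_sum_le _ _).trans (Finset.sum_le_sum fun _ h4 => ?_)
        exact (enorm_sum_le _ _).trans (Finset.sum_le_sum fun _ h2 => e2 _ h1 _ h3 _ h4 _ h2)
    _ = ∫⁻ x, ∑ i₁ ∈ Finset.range N, ∑ i₃ ∈ Finset.range N, ∑ i₄ ∈ Finset.range N,
        ∑ i₂ ∈ Finset.range N, ENNReal.ofReal (Q i₁ i₃ i₄ i₂ x) := by
        rw [lintegral_finsetSum _ fun _ _ => by fun_prop]
        refine Finset.sum_congr rfl fun _ _ => ?_
        rw [lintegral_finsetSum _ fun _ _ => by fun_prop]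
        refine Finset.sum_congr rfl fun _ _ => ?_
        rw [lintegral_finsetSum _ fun _ _ => by fun_prop]
        refine Finset.sum_congr rfl fun _ _ => ?_
        rw [lintegral_finsetSum _ fun _ _ => by fun_prop]
    _ ≤ ∫⁻ x, 8450 * ‖sqn F (m + d) x‖ₑ ^ 2 := by
        refine lintegral_mono fun x => ?_
        have key := sum_quadruple_le 32 N (fun i => ‖F i x‖) fun i => norm_nonneg _
        have : ∑ i₁ ∈ Finset.range N, ∑ i₃ ∈ Finset.range N, ∑ i₄ ∈ Finset.range N,
            ∑ i₂ ∈ Finset.range N, ENNReal.ofReal (Q i₁ i₃ i₄ i₂ x)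
            = ENNReal.ofReal (∑ i₁ ∈ Finset.range N, ∑ i₃ ∈ Finset.range N,
              ∑ i₄ ∈ Finset.range N, ∑ i₂ ∈ Finset.range N, Q i₁ i₃ i₄ i₂ x) := by
          rw [ENNReal.ofReal_sum_of_nonneg fun _ _ => Finset.sum_nonneg fun _ _ =>
            Finset.sum_nonneg fun _ _ => Finset.sum_nonneg fun _ _ => Q0 _ _ _ _ _]
          refine Finset.sum_congr rfl fun _ _ => ?_
          rw [ENNReal.ofReal_sum_of_nonneg fun _ _ =>
            Finset.sum_nonneg fun _ _ => Finset.sum_nonneg fun _ _ => Q0 _ _ _ _ _]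
          refine Finset.sum_congr rfl fun _ _ => ?_
          rw [ENNReal.ofReal_sum_of_nonneg fun _ _ => Finset.sum_nonneg fun _ _ => Q0 _ _ _ _ _]
          refine Finset.sum_congr rfl fun _ _ => ?_
          rw [ENNReal.ofReal_sum_of_nonneg fun _ _ => Q0 _ _ _ _ _]
        rw [this, enorm_sqn, ← ENNReal.ofReal_pow (Finset.sum_nonneg fun _ _ => by positivity),
          show (8450 : ℝ≥0∞) = ENNReal.ofReal 8450 by norm_num,
          ← ENNReal.ofReal_mul (by norm_num)]
        apply ENNReal.ofReal_le_ofReal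
        refine key.trans (le_of_eq ?_)
        push_cast
        ring
    _ = _ := lintegral_const_mul' _ _ (by norm_num)

end Orthogonality

section Count

theorem card_le_of_close {S : Finset ℕ} {L : ℕ} (h : ∀ x ∈ S, ∀ y ∈ S, x ≤ y + L) :
    S.card ≤ L + 1 := by
  rcases S.eq_empty_or_nonempty with rfl | hS
  · simp
  · have : S ⊆ Finset.Icc (S.min' hS) (S.min' hS + L) := by
      intro x hx
      rw [Finset.mem_Icc]
      exact ⟨S.min'_le x hx, h x hx _ (S.min'_mem hS)⟩
    refine (Finset.card_le_card this).trans ?_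
    rw [Nat.card_Icc]; omega

theorem sibling_close {X Y Z g u v c c' ω ω' ωp ωp' : ℝ} (hg : 0 < g) (hgu : g * u = 1)
    (hv : 0 < v) (hX : |X| ≤ g ^ 2 * v)
    (h2 : |Y - ω * X| ≤ 8 * (g * v)) (h2' : |Y - ω' * X| ≤ 8 * (g * v))
    (hp : ¬(|X| ≤ g ^ 2 / 4 * v ∧ |Y - ωp * X| ≤ 4 * (g * v)))
    (hp' : ¬(|X| ≤ g ^ 2 / 4 * v ∧ |Y - ωp' * X| ≤ 4 * (g * v)))
    (hω : 0 ≤ ω - ωp ∧ ω - ωp ≤ u) (hω' : 0 ≤ ω' - ωp' ∧ ω' - ωp' ≤ u)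
    (hc : 0 ≤ c - ω ∧ c - ω ≤ u) (hc' : 0 ≤ c' - ω' ∧ c' - ω' ≤ u)
    (hQ : |Z - 2 * c * Y + c ^ 2 * X| ≤ 10 * v) (hQ' : |Z - 2 * c' * Y + c' ^ 2 * X| ≤ 10 * v)
    (hs : 0 ≤ c * X - Y ↔ 0 ≤ c' * X - Y) : g * (ω - ω') ≤ 64 := by
  have hu : 0 < u := by
    by_contra hu
    nlinarith
  have gv : 0 < g * v := by positivity
  by_cases hX4 : |X| ≤ g ^ 2 / 4 * v
  · have k1 : 4 * (g * v) < |Y - ωp * X| := by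
      by_contra hh; exact hp ⟨hX4, not_lt.1 hh⟩
    have k2 : 4 * (g * v) < |Y - ωp' * X| := by
      by_contra hh; exact hp' ⟨hX4, not_lt.1 hh⟩
    have small : ∀ s : ℝ, 0 ≤ s → s ≤ 2 * u → |s * X| ≤ g * v / 2 := by
      intro s hs0 hs2
      rw [abs_mul, abs_of_nonneg hs0]
      calc s * |X| ≤ 2 * u * (g ^ 2 / 4 * v) := by gcongr
        _ = (g * u) * (g * v) / 2 := by ring
        _ = _ := by rw [hgu, one_mul]
    have s1 := small (c - ωp) (by linarith) (by linarith)
    have s2 := small (c' - ωp') (by linarith) (by linarith)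
    have w1 : 7 / 2 * (g * v) ≤ |c * X - Y| := by
      have : Y - ωp * X = (c - ωp) * X - (c * X - Y) := by ring
      rw [this] at k1
      have := abs_sub ((c - ωp) * X) (c * X - Y)
      linarith
    have w2 : 7 / 2 * (g * v) ≤ |c' * X - Y| := by
      have : Y - ωp' * X = (c' - ωp') * X - (c' * X - Y) := by ring
      rw [this] at k2
      have := abs_sub ((c' - ωp') * X) (c' * X - Y)
      linarith
    have w3 : 7 * (g * v) ≤ |(c * X - Y) + (c' * X - Y)| := by
      by_cases hp0 : 0 ≤ c * X - Y
      · have := hs.1 hp0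
        rw [abs_of_nonneg hp0] at w1
        rw [abs_of_nonneg this] at w2
        rw [abs_of_nonneg (by linarith)]
        linarith
      · have h0 : ¬ 0 ≤ c' * X - Y := fun hh => hp0 (hs.2 hh)
        push Not at hp0 h0
        rw [abs_of_neg hp0] at w1
        rw [abs_of_neg h0] at w2
        rw [abs_of_neg (by linarith)]
        linarith
    have id : (c - c') * ((c * X - Y) + (c' * X - Y))
        = (Z - 2 * c * Y + c ^ 2 * X) - (Z - 2 * c' * Y + c' ^ 2 * X) := by ring
    have w4 : |c - c'| * (7 * (g * v)) ≤ 20 * v := by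
      calc |c - c'| * (7 * (g * v)) ≤ |c - c'| * |(c * X - Y) + (c' * X - Y)| := by gcongr
        _ ≤ 20 * v := by
          rw [← abs_mul, id]
          have := abs_sub (Z - 2 * c * Y + c ^ 2 * X) (Z - 2 * c' * Y + c' ^ 2 * X)
          linarith
    have w5 : g * |c - c'| * 7 ≤ 20 := by
      have : (g * |c - c'| * 7) * v ≤ 20 * v := by linarith
      exact le_of_mul_le_mul_right this hv
    have w6 : g * (ω - ω') ≤ g * (|c - c'| + u) := by
      gcongr
      have := le_abs_self (c - c')
      linarith
    rw [mul_add, hgu] at w6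
    linarith
  · push Not at hX4
    by_contra! hcon
    have t1 : (ω - ω') * X = (Y - ω' * X) - (Y - ω * X) := by ring
    have t2 : |(ω - ω') * X| ≤ 16 * (g * v) := by
      rw [t1]
      have := abs_sub (Y - ω' * X) (Y - ω * X)
      linarith
    have t0 : 0 < ω - ω' := by
      by_contra hh
      nlinarith
    rw [abs_mul, abs_of_pos t0] at t2
    have t3 : (ω - ω') * (g ^ 2 / 4 * v) ≤ 16 * (g * v) :=
      (mul_le_mul_of_nonneg_left hX4.le t0.le).trans t2
    have t4 : (g * (ω - ω')) * (g * v) ≤ 64 * (g * v) := by nlinarith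
    have := le_of_mul_le_mul_right t4 gv
    linarith

variable {V : Type*} [NormedAddCommGroup V] [InnerProductSpace ℝ V]

/-- The dyadic interval `(k, j)` is adapted to `ζ`. -/
def Adapted (P : Coords V) (n : ℕ) (ζ : V) (k j : ℕ) : Prop :=
  |P.p1 ζ| ≤ 4 ^ k / 4 ^ n ∧ |P.p2 ζ - j / 2 ^ k * P.p1 ζ| ≤ 8 * 2 ^ k / 4 ^ n

/-- Maximal adapted dyadic intervals. -/
def MaxAdapted (P : Coords V) (n : ℕ) (ζ : V) (k j : ℕ) : Prop :=
  Adapted P n ζ k j ∧ ∀ k' < k, ¬ Adapted P n ζ k' (j / 2 ^ (k - k'))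

theorem Adapted.mem_Box {P : Coords V} {n k j : ℕ} {ζ : V} (h : Adapted P n ζ k j) (hk : k ≤ n)
    {c : ℝ} (hc : 0 ≤ c - j / 2 ^ k ∧ c - j / 2 ^ k ≤ 1 / 2 ^ k)
    (hQ : |dualQ P ζ c| ≤ 10 / 4 ^ n) : ζ ∈ Box (P.rescale k j) (n - k) := by
  obtain ⟨h1, h2⟩ := h
  set ω : ℝ := j / 2 ^ k with hω
  set X := P.p1 ζ
  set Y := P.p2 ζ
  set g : ℝ := 2 ^ k with hg
  have g0 : 0 < g := by positivity
  set v : ℝ := 1 / 4 ^ n with hv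
  have v0 : 0 < v := by positivity
  have n4 : (4 : ℝ) ^ n = 4 ^ (n - k) * g ^ 2 := by
    rw [hg, sq, ← four_pow_eq, ← pow_add]; congr 1; omega
  have e1 : (4 : ℝ) ^ k / 4 ^ n = g ^ 2 * v := by rw [hv, four_pow_eq, hg]; ring
  have e2 : 8 * g / 4 ^ n = 8 * g * v := by rw [hv]; ring
  have e3 : (10 : ℝ) / 4 ^ n = 10 * v := by rw [hv]; ring
  have e4 : (4 : ℝ) ^ (n - k) * (g ^ 2 * v) = 1 := by
    rw [hv, ← mul_assoc, ← n4]; field_simp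
  rw [e1] at h1
  rw [e2] at h2
  rw [e3] at hQ
  have m0 : (0 : ℝ) < 4 ^ (n - k) := by positivity
  refine ⟨?_, ?_, ?_⟩
  · change (4 : ℝ) ^ (n - k) * |X| ≤ 32
    nlinarith
  · change (4 : ℝ) ^ (n - k) * |g * (Y - ω * X)| ≤ 32
    rw [abs_mul, abs_of_pos g0]
    have : (4 : ℝ) ^ (n - k) * (g * |Y - ω * X|) ≤ 4 ^ (n - k) * (g * (8 * g * v)) := by gcongr
    nlinarith
  · change (4 : ℝ) ^ (n - k) * |4 ^ k * (P.p3 ζ - 2 * ω * Y + ω ^ 2 * X)| ≤ 32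
    have hd : P.p3 ζ - 2 * ω * Y + ω ^ 2 * X
        = dualQ P ζ c + (c - ω) * (2 * (Y - ω * X) - (c - ω) * X) := by
      simp only [dualQ, X, Y]; ring
    have hgc : g * (c - ω) ≤ 1 := by
      have := mul_le_mul_of_nonneg_left hc.2 g0.le
      rwa [mul_one_div_cancel g0.ne'] at this
    have b1 : |(c - ω) * X| ≤ g * v := by
      rw [abs_mul, abs_of_nonneg hc.1]
      calc (c - ω) * |X| ≤ (c - ω) * (g ^ 2 * v) := by gcongr; exact hc.1
        _ = (g * (c - ω)) * (g * v) := by ring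
        _ ≤ 1 * (g * v) := by gcongr
        _ = _ := one_mul _
    have b2 : |(c - ω) * (2 * (Y - ω * X) - (c - ω) * X)| ≤ 17 * v := by
      rw [abs_mul, abs_of_nonneg hc.1]
      have b3 : |2 * (Y - ω * X) - (c - ω) * X| ≤ 17 * (g * v) := by
        refine (abs_sub _ _).trans ?_
        rw [abs_mul, abs_of_pos (by norm_num : (0 : ℝ) < 2)]
        linarith
      calc (c - ω) * |2 * (Y - ω * X) - (c - ω) * X| ≤ (c - ω) * (17 * (g * v)) := by
            gcongr; exact hc.1
        _ = (g * (c - ω)) * (17 * v) := by ring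
        _ ≤ 1 * (17 * v) := by gcongr
        _ = _ := one_mul _
    have b4 : |P.p3 ζ - 2 * ω * Y + ω ^ 2 * X| ≤ 27 * v := by
      rw [hd]
      refine (abs_add_le _ _).trans ?_
      linarith
    have k4 : (4 : ℝ) ^ k = g ^ 2 := by rw [four_pow_eq, sq]
    rw [k4, abs_mul, abs_of_nonneg (by positivity : 0 ≤ g ^ 2)]
    have : (4 : ℝ) ^ (n - k) * (g ^ 2 * |P.p3 ζ - 2 * ω * Y + ω ^ 2 * X|)
      ≤ 4 ^ (n - k) * (g ^ 2 * (27 * v)) := by gcongr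
    nlinarith

/-- At each level there are boundedly many maximal adapted intervals meeting the level set. -/
theorem card_maxAdapted_le (P : Coords V) (n k : ℕ) (ζ : V) (c : ℕ → ℝ) (S : Finset ℕ)
    (hS : ∀ j ∈ S, j < 2 ^ k ∧ MaxAdapted P n ζ k j ∧
      (0 ≤ c j - j / 2 ^ k ∧ c j - j / 2 ^ k ≤ 1 / 2 ^ k) ∧ |dualQ P ζ (c j)| ≤ 10 / 4 ^ n) :
    S.card ≤ 130 := by
  classical
  rcases Nat.eq_zero_or_pos k with rfl | hk
  · have : S ⊆ Finset.range 1 := fun j hj => by simpa using (hS j hj).1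
    exact (Finset.card_le_card this).trans (by simp)
  obtain ⟨l, rfl⟩ : ∃ l, k = l + 1 := ⟨k - 1, by omega⟩
  have g0 : (0 : ℝ) < 2 ^ (l + 1) := by positivity
  have par : ∀ j ∈ S, ¬(|P.p1 ζ| ≤ ((2 : ℝ) ^ (l + 1)) ^ 2 / 4 * (1 / 4 ^ n) ∧
      |P.p2 ζ - ((j / 2 : ℕ) : ℝ) / 2 ^ l * P.p1 ζ| ≤ 4 * (2 ^ (l + 1) * (1 / 4 ^ n))) := by
    intro j hj hh
    have := (hS j hj).2.1.2 l (Nat.lt_succ_self l)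
    rw [Nat.add_sub_cancel_left, pow_one] at this
    refine this ⟨hh.1.trans (le_of_eq ?_), hh.2.trans (le_of_eq ?_)⟩
    · rw [four_pow_eq l, pow_succ]; ring
    · rw [pow_succ]; ring
  have parω : ∀ j : ℕ, 0 ≤ (j : ℝ) / 2 ^ (l + 1) - ((j / 2 : ℕ) : ℝ) / 2 ^ l ∧
      (j : ℝ) / 2 ^ (l + 1) - ((j / 2 : ℕ) : ℝ) / 2 ^ l ≤ 1 / 2 ^ (l + 1) := by
    intro j
    have h2 : (j : ℝ) = 2 * ((j / 2 : ℕ) : ℝ) + ((j % 2 : ℕ) : ℝ) := by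
      exact_mod_cast (Nat.div_add_mod j 2).symm
    have h3 : ((j % 2 : ℕ) : ℝ) ≤ 1 := by exact_mod_cast (by omega : j % 2 ≤ 1)
    have h4 : (j : ℝ) / 2 ^ (l + 1) - ((j / 2 : ℕ) : ℝ) / 2 ^ l
        = ((j % 2 : ℕ) : ℝ) / 2 ^ (l + 1) := by
      rw [h2, pow_succ]
      generalize ((j / 2 : ℕ) : ℝ) = a
      generalize ((j % 2 : ℕ) : ℝ) = b
      field_simp
      ring
    rw [h4]
    exact ⟨by positivity, by gcongr⟩
  have sib : ∀ j ∈ S, ∀ j' ∈ S, (0 ≤ c j * P.p1 ζ - P.p2 ζ ↔ 0 ≤ c j' * P.p1 ζ - P.p2 ζ) →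
      j ≤ j' + 64 := by
    intro j hj j' hj' hs
    obtain ⟨-, ⟨⟨A1, A2⟩, -⟩, C, Q⟩ := hS j hj
    obtain ⟨-, ⟨⟨A1', A2'⟩, -⟩, C', Q'⟩ := hS j' hj'
    have := sibling_close (X := P.p1 ζ) (Y := P.p2 ζ) (Z := P.p3 ζ) (g := 2 ^ (l + 1))
      (u := 1 / 2 ^ (l + 1)) (v := 1 / 4 ^ n) (c := c j) (c' := c j')
      (ω := j / 2 ^ (l + 1)) (ω' := j' / 2 ^ (l + 1)) g0 (by field_simp) (by positivity)
      (A1.trans (le_of_eq (by rw [four_pow_eq]; ring)))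
      (A2.trans (le_of_eq (by ring))) (A2'.trans (le_of_eq (by ring)))
      (par j hj) (par j' hj') (parω j) (parω j') C C'
      (by simpa [dualQ, div_eq_mul_inv] using Q) (by simpa [dualQ, div_eq_mul_inv] using Q') hs
    rw [mul_sub, mul_div_cancel₀ _ g0.ne', mul_div_cancel₀ _ g0.ne'] at this
    have : (j : ℝ) ≤ j' + 64 := by linarith
    exact_mod_cast this
  rw [← Finset.card_filter_add_card_filter_not (s := S) (fun j => 0 ≤ c j * P.p1 ζ - P.p2 ζ)]
  have c1 := card_le_of_close (S := S.filter fun j => 0 ≤ c j * P.p1 ζ - P.p2 ζ) (L := 64)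
    fun x hx y hy => by
      rw [Finset.mem_filter] at hx hy
      exact sib x hx.1 y hy.1 (iff_of_true hx.2 hy.2)
  have c2 := card_le_of_close (S := S.filter fun j => ¬ 0 ≤ c j * P.p1 ζ - P.p2 ζ) (L := 64)
    fun x hx y hy => by
      rw [Finset.mem_filter] at hx hy
      exact sib x hx.1 y hy.1 (iff_of_false hx.2 hy.2)
  omega

end Count

section Stopping

open Classical in
/-- Summation along a stopping-time decomposition of a dyadic tree. -/
theorem norm_sum_sq_le_stopping (B : ℕ → ℂ) (n D : ℕ) (M : ℕ → ℕ → Prop)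
    (hM : ∀ θ < 2 ^ n, B θ ≠ 0 → ∃! k, k ≤ n ∧ M k (θ / 2 ^ (n - k)))
    (hD : ∀ k ≤ n, ∀ S : Finset ℕ, (∀ j ∈ S, j < 2 ^ k ∧ M k j ∧
      ∃ i < 2 ^ (n - k), B (j * 2 ^ (n - k) + i) ≠ 0) → S.card ≤ D) :
    ‖∑ θ ∈ Finset.range (2 ^ n), B θ‖ ^ 2 ≤ D * (n + 1) *
      ∑ k ∈ Finset.range (n + 1), ∑ j ∈ Finset.range (2 ^ k),
        if M k j ∧ ∃ i < 2 ^ (n - k), B (j * 2 ^ (n - k) + i) ≠ 0 then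
          ‖∑ i ∈ Finset.range (2 ^ (n - k)), B (j * 2 ^ (n - k) + i)‖ ^ 2 else 0 := by
  set act : ℕ → ℕ → Prop := fun k j =>
    M k j ∧ ∃ i < 2 ^ (n - k), B (j * 2 ^ (n - k) + i) ≠ 0 with hact
  set b : ℕ → ℕ → ℂ := fun k j => ∑ i ∈ Finset.range (2 ^ (n - k)), B (j * 2 ^ (n - k) + i) with hb
  set S : ℕ → Finset ℕ := fun k => (Finset.range (2 ^ k)).filter (act k) with hS
  have e1 : ∑ θ ∈ Finset.range (2 ^ n), B θ
      = ∑ k ∈ Finset.range (n + 1), ∑ j ∈ S k, b k j := by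
    have h1 : ∀ θ ∈ Finset.range (2 ^ n), B θ = ∑ k ∈ Finset.range (n + 1),
        if M k (θ / 2 ^ (n - k)) then B θ else 0 := by
      intro θ hθ
      by_cases h0 : B θ = 0
      · simp [h0]
      · obtain ⟨k, ⟨hk, hMk⟩, huniq⟩ := hM θ (Finset.mem_range.1 hθ) h0
        rw [Finset.sum_eq_single k, if_pos hMk]
        · intro k' hk' hne
          rw [if_neg]
          intro hh
          rw [Finset.mem_range] at hk'
          exact hne (huniq k' ⟨by omega, hh⟩)
        · intro hh; exact absurd (Finset.mem_range.2 (by omega)) hh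
    rw [Finset.sum_congr rfl h1, Finset.sum_comm]
    refine Finset.sum_congr rfl fun k hk => ?_
    rw [Finset.mem_range] at hk
    have hp : 0 < 2 ^ (n - k) := by positivity
    have hn : n = k + (n - k) := by omega
    conv_lhs => rw [hn, sum_range_two_pow]
    rw [← hn, hS, Finset.sum_filter]
    refine Finset.sum_congr rfl fun j hj => ?_
    have h2 : ∀ i ∈ Finset.range (2 ^ (n - k)),
        (if M k ((j * 2 ^ (n - k) + i) / 2 ^ (n - k)) then B (j * 2 ^ (n - k) + i) else 0)
          = if M k j then B (j * 2 ^ (n - k) + i) else 0 := by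
      intro i hi
      rw [Nat.mul_comm j, Nat.mul_add_div hp, Nat.div_eq_of_lt (Finset.mem_range.1 hi), add_zero]
    rw [Finset.sum_congr rfl h2]
    by_cases hMk : M k j
    · simp only [if_pos hMk]
      by_cases ha : act k j
      · rw [if_pos ha]
      · rw [if_neg ha]
        refine Finset.sum_eq_zero fun i hi => ?_
        by_contra hne
        exact ha ⟨hMk, i, Finset.mem_range.1 hi, hne⟩
    · simp only [if_neg hMk, Finset.sum_const_zero]
      rw [if_neg fun ha => hMk ha.1]
  have e2 : ∀ k ∈ Finset.range (n + 1), ‖∑ j ∈ S k, b k j‖ ^ 2 ≤ D * ∑ j ∈ S k, ‖b k j‖ ^ 2 := by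
    intro k hk
    have hcard : (S k).card ≤ D := by
      refine hD k (by rw [Finset.mem_range] at hk; omega) _ fun j hj => ?_
      obtain ⟨h1, h2⟩ := Finset.mem_filter.1 hj
      exact ⟨Finset.mem_range.1 h1, h2⟩
    calc ‖∑ j ∈ S k, b k j‖ ^ 2 ≤ (∑ j ∈ S k, ‖b k j‖) ^ 2 := by
          gcongr; exact norm_sum_le _ _
      _ ≤ (S k).card * ∑ j ∈ S k, ‖b k j‖ ^ 2 := sq_sum_le_card_mul_sum_sq
      _ ≤ _ := by gcongr
  rw [e1]
  calc ‖∑ k ∈ Finset.range (n + 1), ∑ j ∈ S k, b k j‖ ^ 2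
      ≤ (∑ k ∈ Finset.range (n + 1), ‖∑ j ∈ S k, b k j‖) ^ 2 := by
        gcongr; exact norm_sum_le _ _
    _ ≤ (n + 1) * ∑ k ∈ Finset.range (n + 1), ‖∑ j ∈ S k, b k j‖ ^ 2 := by
        have := sq_sum_le_card_mul_sum_sq (s := Finset.range (n + 1))
          (f := fun k => ‖∑ j ∈ S k, b k j‖)
        simpa using this
    _ ≤ (n + 1) * ∑ k ∈ Finset.range (n + 1), (D * ∑ j ∈ S k, ‖b k j‖ ^ 2) := by
        gcongr with k hk
        exact e2 k hk
    _ = _ := by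
        rw [← Finset.mul_sum]
        simp only [hS, Finset.sum_filter]
        ring

end Stopping

section LemA

variable {V : Type*} [NormedAddCommGroup V] [InnerProductSpace ℝ V] [FiniteDimensional ℝ V]
  [MeasurableSpace V] [BorelSpace V]

theorem MaxAdapted.existsUnique {P : Coords V} {n θ : ℕ} {ζ : V} (h : Adapted P n ζ n θ) :
    ∃! k, k ≤ n ∧ MaxAdapted P n ζ k (θ / 2 ^ (n - k)) := by
  classical
  have hex : ∃ k, k ≤ n ∧ Adapted P n ζ k (θ / 2 ^ (n - k)) := ⟨n, le_rfl, by simpa using h⟩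
  have hdiv : ∀ k ≤ n, ∀ k' < k, θ / 2 ^ (n - k) / 2 ^ (k - k') = θ / 2 ^ (n - k') := by
    intro k hk k' hk'
    rw [Nat.div_div_eq_div_mul, ← pow_add]
    congr 2; omega
  refine ⟨Nat.find hex, ⟨(Nat.find_spec hex).1, (Nat.find_spec hex).2, ?_⟩, ?_⟩
  · intro k' hk' hh
    rw [hdiv _ (Nat.find_spec hex).1 _ hk'] at hh
    exact Nat.find_min hex hk' ⟨by have := (Nat.find_spec hex).1; omega, hh⟩
  · rintro k ⟨hk, hA, hmin⟩
    refine le_antisymm ?_ (Nat.find_min' hex ⟨hk, hA⟩)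
    by_contra! hlt
    have := hmin _ hlt
    rw [hdiv _ hk _ hlt] at this
    exact this (Nat.find_spec hex).2

theorem active_bounds {P : Coords V} {κ : ℝ} (hκ : κ ≤ 1) {n : ℕ} {F : ℕ → 𝓢(V, ℂ)}
    (h : Supp P κ n F) {θ : ℕ} (hθ : θ < 2 ^ n) {ζ : V}
    (hne : 𝓕 (mulConj (F θ) (F θ)) ζ ≠ 0) :
    Adapted P n ζ n θ ∧ |dualQ P ζ (θ / 2 ^ n)| ≤ 10 / 4 ^ n := by
  obtain ⟨ξ, h1, h2⟩ := fourier_mulConj_ne_zero hne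
  obtain ⟨b1, b2, b3⟩ := Near.sub_bounds hκ (h _ hθ _ h1) (h _ hθ _ h2)
  rw [sub_sub_cancel] at b1 b2 b3
  refine ⟨⟨?_, ?_⟩, b3⟩
  · rwa [div_self (by positivity)]
  · refine b2.trans (le_of_eq ?_)
    rw [four_pow_eq]; field_simp

theorem lintegral_sqn_le_waveEnv {P : Coords V} {κ : ℝ} (hκ : κ ≤ 1) {n : ℕ}
    {F : ℕ → 𝓢(V, ℂ)} (h : Supp P κ n F) :
    ∫⁻ ζ, ‖𝓕 (sqn F n) ζ‖ₑ ^ 2 ≤ (130 * (n + 1) : ℕ) * waveEnv P n F := by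
  classical
  have hidx : ∀ k ≤ n, ∀ j i : ℕ, i < 2 ^ (n - k) →
      0 ≤ ((j * 2 ^ (n - k) + i : ℕ) : ℝ) / 2 ^ n - j / 2 ^ k ∧
      ((j * 2 ^ (n - k) + i : ℕ) : ℝ) / 2 ^ n - j / 2 ^ k ≤ 1 / 2 ^ k := by
    intro k hk j i hi
    have hn : (2 : ℝ) ^ n = 2 ^ k * 2 ^ (n - k) := by rw [← pow_add]; congr 1; omega
    have e : ((j * 2 ^ (n - k) + i : ℕ) : ℝ) / 2 ^ n - j / 2 ^ k = i / 2 ^ n := by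
      rw [hn]; push_cast; field_simp; ring
    rw [e]
    refine ⟨by positivity, ?_⟩
    rw [hn, div_le_div_iff₀ (by positivity) (by positivity)]
    have : (i : ℝ) ≤ 2 ^ (n - k) := by exact_mod_cast hi.le
    nlinarith [pow_pos (two_pos : (0 : ℝ) < 2) k]
  have key : ∀ ζ, ‖𝓕 (sqn F n) ζ‖ₑ ^ 2 ≤ (130 * (n + 1) : ℕ) *
      ∑ k ∈ Finset.range (n + 1), ∑ j ∈ Finset.range (2 ^ k),
        (Box (P.rescale k j) (n - k)).indicator
          (fun ζ => ‖𝓕 (sqn (fun i => F (j * 2 ^ (n - k) + i)) (n - k)) ζ‖ₑ ^ 2) ζ := by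
    intro ζ
    have main := norm_sum_sq_le_stopping (fun θ => 𝓕 (mulConj (F θ) (F θ)) ζ) n 130
      (MaxAdapted P n ζ) (fun θ hθ hne => MaxAdapted.existsUnique (active_bounds hκ h hθ hne).1) (by
        intro k hk S hS
        choose! i hi hne using fun j hj => (hS j hj).2.2
        refine card_maxAdapted_le P n k ζ (fun j => ((j * 2 ^ (n - k) + i j : ℕ) : ℝ) / 2 ^ n) S
          fun j hj => ?_
        obtain ⟨hj1, hj2, -⟩ := hS j hj
        refine ⟨hj1, hj2, hidx k hk j _ (hi j hj), ?_⟩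
        refine (active_bounds hκ h ?_ (hne j hj)).2
        have := index_lt hj1 (hi j hj)
        rwa [show k + (n - k) = n by omega] at this)
    have hL : ‖𝓕 (sqn F n) ζ‖ₑ ^ 2
        = ENNReal.ofReal (‖∑ θ ∈ Finset.range (2 ^ n), 𝓕 (mulConj (F θ) (F θ)) ζ‖ ^ 2) := by
      rw [ENNReal.ofReal_pow (norm_nonneg _), ofReal_norm, sqn, fourier_sum_apply]
    rw [hL]
    refine (ENNReal.ofReal_le_ofReal main).trans ?_
    have c0 : (0 : ℝ) ≤ (130 : ℕ) * (n + 1) := by positivity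
    rw [ENNReal.ofReal_mul c0]
    refine mul_le_mul' (le_of_eq ?_) ?_
    · rw [← ENNReal.ofReal_natCast]; push_cast; rfl
    · rw [ENNReal.ofReal_sum_of_nonneg fun k _ => Finset.sum_nonneg fun j _ => by
        split_ifs <;> positivity]
      refine Finset.sum_le_sum fun k hk => ?_
      rw [ENNReal.ofReal_sum_of_nonneg fun j _ => by split_ifs <;> positivity]
      refine Finset.sum_le_sum fun j hj => ?_
      rw [Finset.mem_range] at hk hj
      have hk' : k ≤ n := by omega
      split_ifs with hc
      · obtain ⟨hmax, i, hi, hne⟩ := hc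
        have hb := index_lt hj hi
        rw [show k + (n - k) = n by omega] at hb
        have hmem := hmax.1.mem_Box hk' (hidx k hk' j i hi) (active_bounds hκ h hb hne).2
        rw [Set.indicator_of_mem hmem, ENNReal.ofReal_pow (norm_nonneg _), ofReal_norm, sqn,
          fourier_sum_apply]
      · simp
  calc _ ≤ ∫⁻ ζ, (130 * (n + 1) : ℕ) *
      ∑ k ∈ Finset.range (n + 1), ∑ j ∈ Finset.range (2 ^ k),
        (Box (P.rescale k j) (n - k)).indicator
          (fun ζ => ‖𝓕 (sqn (fun i => F (j * 2 ^ (n - k) + i)) (n - k)) ζ‖ₑ ^ 2) ζ :=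
        lintegral_mono key
    _ = _ := by
      have meas : ∀ (k j : ℕ), Measurable ((Box (P.rescale k j) (n - k)).indicator
          (fun ζ => ‖𝓕 (sqn (fun i => F (j * 2 ^ (n - k) + i)) (n - k)) ζ‖ₑ ^ 2)) := by
        intro k j
        refine Measurable.indicator ?_ (measurableSet_Box _ _)
        exact ((SchwartzMap.continuous _).enorm.measurable).pow_const 2
      rw [lintegral_const_mul' _ _ (ENNReal.natCast_ne_top _)]
      congr 1
      rw [lintegral_finsetSum _ fun k _ => Finset.measurable_fun_sum _ fun j _ => meas k j]
      refine Finset.sum_congr rfl fun k _ => ?_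
      rw [lintegral_finsetSum _ fun j _ => meas k j]
      refine Finset.sum_congr rfl fun j _ => ?_
      rw [lintegral_indicator (measurableSet_Box _ _)]
      rfl

end LemA

section Induction

variable {V : Type*} [NormedAddCommGroup V] [InnerProductSpace ℝ V] [FiniteDimensional ℝ V]
  [MeasurableSpace V] [BorelSpace V]

variable (V) in
/-- The wave envelope estimate from scale `m` to scale `m + d` with constant `S`. -/
def Bound (κ : ℝ) (m d S : ℕ) : Prop :=
  ∀ (P : Coords V) (F : ℕ → 𝓢(V, ℂ)), Supp P κ (m + d) F →
    env P m (sqn (coarse F d) m) ≤ S * waveEnv P (m + d) F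

theorem coarse_shift (F : ℕ → 𝓢(V, ℂ)) (j r d : ℕ) :
    (fun i => coarse F d (j * 2 ^ r + i)) = coarse (fun i => F (j * 2 ^ (r + d) + i)) d := by
  ext1 i
  simp only [coarse]
  refine Finset.sum_congr rfl fun u _ => ?_
  congr 1
  rw [pow_add]; ring

/-- The terms of the wave envelope sum at angular scale `2⁻ᵏ`. -/
def waveEnvLevel (P : Coords V) (n : ℕ) (F : ℕ → 𝓢(V, ℂ)) (k : ℕ) : ℝ≥0∞ :=
  ∑ j ∈ Finset.range (2 ^ k),
    env (P.rescale k j) (n - k) (sqn (fun i => F (j * 2 ^ (n - k) + i)) (n - k))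

theorem sum_waveEnv_rescale_le (P : Coords V) (F : ℕ → 𝓢(V, ℂ)) (k r : ℕ) :
    ∑ j ∈ Finset.range (2 ^ k), waveEnv (P.rescale k j) r (fun i => F (j * 2 ^ r + i))
      ≤ waveEnv P (k + r) F := by
  simp only [waveEnv]
  rw [Finset.sum_comm]
  have h1 : ∀ k' ∈ Finset.range (r + 1), ∑ j ∈ Finset.range (2 ^ k),
      ∑ j' ∈ Finset.range (2 ^ k'), env ((P.rescale k j).rescale k' j') (r - k')
        (sqn (fun i => F (j * 2 ^ r + (j' * 2 ^ (r - k') + i))) (r - k'))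
      = waveEnvLevel P (k + r) F (k + k') := by
    intro k' hk'
    rw [Finset.mem_range] at hk'
    rw [waveEnvLevel, sum_range_two_pow]
    refine Finset.sum_congr rfl fun j _ => Finset.sum_congr rfl fun j' _ => ?_
    rw [rescale_rescale, show k + r - (k + k') = r - k' by omega]
    congr 2
    ext1 i
    congr 1
    have : (2 : ℕ) ^ r = 2 ^ k' * 2 ^ (r - k') := by rw [← pow_add]; congr 1; omega
    rw [this]; ring
  rw [Finset.sum_congr rfl h1]
  have h2 : ∑ k' ∈ Finset.range (r + 1), waveEnvLevel P (k + r) F (k + k')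
      ≤ ∑ k' ∈ Finset.range (k + r + 1), waveEnvLevel P (k + r) F k' := by
    rw [add_assoc k r 1, Finset.sum_range_add _ k (r + 1)]
    exact le_add_of_nonneg_left zero_le
  exact h2

theorem Bound.trans {κ : ℝ} {m d₁ d₂ S₁ S₂ : ℕ} (h₁ : Bound V κ m d₁ S₁)
    (h₂ : ∀ k ≤ m + d₁, Bound V κ (m + d₁ - k) d₂ S₂) :
    Bound V κ m (d₁ + d₂) (S₁ * (S₂ * (m + d₁ + 1))) := by
  intro P F hF
  rw [← add_assoc] at hF
  have hG : Supp P κ (m + d₁) (coarse F d₂) := hF.coarse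
  have e1 := h₁ P _ hG
  rw [coarse_coarse] at e1
  refine e1.trans ?_
  push_cast
  rw [mul_assoc]
  gcongr
  have e2 : ∀ k ∈ Finset.range (m + d₁ + 1), (∑ j ∈ Finset.range (2 ^ k),
      env (P.rescale k j) (m + d₁ - k)
        (sqn (fun i => coarse F d₂ (j * 2 ^ (m + d₁ - k) + i)) (m + d₁ - k)))
      ≤ S₂ * waveEnv P (m + d₁ + d₂) F := by
    intro k hk
    rw [Finset.mem_range] at hk
    have hk' : k ≤ m + d₁ := by omega
    set r := m + d₁ - k with hr
    calc _ ≤ ∑ j ∈ Finset.range (2 ^ k), S₂ * waveEnv (P.rescale k j) (r + d₂)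
            (fun i => F (j * 2 ^ (r + d₂) + i)) := by
          refine Finset.sum_le_sum fun j hj => ?_
          rw [coarse_shift]
          refine h₂ k hk' _ _ ?_
          refine Supp.rescale ?_ (Finset.mem_range.1 hj)
          rwa [show k + (r + d₂) = m + d₁ + d₂ by omega]
      _ ≤ S₂ * waveEnv P (k + (r + d₂)) F := by
          rw [← Finset.mul_sum]
          gcongr
          exact sum_waveEnv_rescale_le P F k (r + d₂)
      _ = _ := by rw [show k + (r + d₂) = m + d₁ + d₂ by omega]
  calc waveEnv P (m + d₁) (coarse F d₂)
      ≤ ∑ k ∈ Finset.range (m + d₁ + 1), S₂ * waveEnv P (m + d₁ + d₂) F := Finset.sum_le_sum e2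
    _ = _ := by
      rw [Finset.sum_const, Finset.card_range, nsmul_eq_mul, add_assoc m]
      push_cast
      ring

/-- The constant of a single step of the induction on scales. -/
def stepConst (N : ℕ) : ℕ := 8450 * 265 ^ 2 * (130 * (N + 1))

theorem Bound.base {κ : ℝ} {μ N m d : ℕ} (hκ : κ ≤ 1 / 4 ^ (2 * μ)) (hd : d ≤ μ)
    (hN : m + d ≤ N) : Bound V κ m d (stepConst N) := by
  intro P F hF
  have hκ1 : κ ≤ 1 := hκ.trans (by
    rw [div_le_one (by positivity)]; exact one_le_pow₀ (by norm_num))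
  have hA := lintegral_sqn_le_waveEnv hκ1 hF
  have step : env P m (sqn (coarse F d) m)
      ≤ (8450 * 265 ^ 2 : ℕ) * ∫⁻ ζ, ‖𝓕 (sqn F (m + d)) ζ‖ₑ ^ 2 := by
    rcases le_or_gt μ m with h | h
    · refine (env_sqn_coarse_le hF (by omega)).trans ?_
      gcongr
      norm_num
    · have hκ' : κ ≤ 1 / 4 ^ (m + d) := hκ.trans (by
        gcongr
        · norm_num
        · omega)
      calc env P m (sqn (coarse F d) m) ≤ ∫⁻ ζ, ‖𝓕 (sqn (coarse F d) m) ζ‖ₑ ^ 2 :=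
            setLIntegral_le_lintegral _ _
        _ ≤ 8450 * ∫⁻ x, ‖𝓕 (sqn F (m + d)) x‖ₑ ^ 2 := by
            rw [lintegral_fourier_sq, lintegral_fourier_sq]
            exact lintegral_sqn_coarse_le hκ' hF
        _ ≤ _ := by
            gcongr
            norm_num
  calc _ ≤ (8450 * 265 ^ 2 : ℕ) * ((130 * (m + d + 1) : ℕ) * waveEnv P (m + d) F) :=
        step.trans (by gcongr)
    _ ≤ (8450 * 265 ^ 2 : ℕ) * ((130 * (N + 1) : ℕ) * waveEnv P (m + d) F) := by gcongr
    _ = _ := by rw [stepConst, ← mul_assoc]; push_cast; ring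

theorem Bound.iterate {κ : ℝ} {μ N : ℕ} (hκ : κ ≤ 1 / 4 ^ (2 * μ)) (e : ℕ) :
    ∀ m d, m + d ≤ N → d ≤ (e + 1) * μ →
      Bound V κ m d ((stepConst N * (N + 1)) ^ (e + 1)) := by
  induction e with
  | zero =>
    intro m d hN hd P F hF
    refine (Bound.base hκ (by simpa using hd) hN P F hF).trans ?_
    gcongr
    norm_num
    exact Nat.le_mul_of_pos_right _ (Nat.succ_pos _)
  | succ e ih =>
    intro m d hN hd
    obtain ⟨d₁, d₂, rfl, h1, h2⟩ : ∃ d₁ d₂, d = d₁ + d₂ ∧ d₁ ≤ μ ∧ d₂ ≤ (e + 1) * μ := by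
      have : (e + 1 + 1) * μ = (e + 1) * μ + μ := by ring
      exact ⟨min μ d, d - min μ d, by omega, by omega, by omega⟩
    have := Bound.trans (V := V) (Bound.base hκ h1 (by omega : m + d₁ ≤ N))
      (fun k _ => ih (m + d₁ - k) d₂ (by omega) h2)
    intro P F hF
    refine (this P F hF).trans ?_
    gcongr
    calc stepConst N * ((stepConst N * (N + 1)) ^ (e + 1) * (m + d₁ + 1))
        ≤ stepConst N * ((stepConst N * (N + 1)) ^ (e + 1) * (N + 1)) := by gcongr; omega
      _ = _ := by ring

theorem Near.bounds {P : Coords V} {κ : ℝ} (hκ : κ ≤ 1) {n i : ℕ} (hi : i < 2 ^ n) {ξ : V}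
    (h : Near P κ n i ξ) :
    (1 ≤ P.p1 ξ ∧ P.p1 ξ ≤ 2) ∧ (-6 ≤ P.p2 ξ ∧ P.p2 ξ ≤ 6) ∧ (-1 ≤ P.p3 ξ ∧ P.p3 ξ ≤ 19) := by
  obtain ⟨ω, δ, h1, h2, h3, h4, h5, h6⟩ := h
  have g0 : (1 : ℝ) ≤ 2 ^ n := one_le_pow₀ (by norm_num)
  have g1 : (1 : ℝ) ≤ 4 ^ n := one_le_pow₀ (by norm_num)
  have i0 : (0 : ℝ) ≤ i / 2 ^ n := by positivity
  have i1 : (i : ℝ) / 2 ^ n ≤ 1 := by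
    rw [div_le_one (by positivity)]; exact_mod_cast hi.le
  have k5 : (2 : ℝ) / 2 ^ n ≤ 2 := by rw [div_le_iff₀ (by positivity)]; linarith
  have k6 : (1 : ℝ) / 4 ^ n ≤ 1 := by rw [div_le_iff₀ (by positivity)]; linarith
  have a5 := abs_le.1 (h5.trans k5)
  have a6 := abs_le.1 (h6.trans k6)
  have w1 : -2 ≤ ω := by linarith
  have w2 : ω ≤ 3 := by linarith
  have w3 : ω ^ 2 ≤ 9 := by nlinarith
  have a2 : P.p1 ξ ≤ 2 := by linarith
  refine ⟨⟨h1, a2⟩, ⟨?_, ?_⟩, ?_, ?_⟩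
  · rw [h3]; nlinarith
  · rw [h3]; nlinarith
  · rw [h4]; nlinarith [sq_nonneg ω]
  · rw [h4]; nlinarith [sq_nonneg ω]

/-- The wave envelope estimate for the cone. -/
theorem lintegral_pow_four_le_waveEnv {P : Coords V} {κ : ℝ} {μ N e : ℕ} {F : ℕ → 𝓢(V, ℂ)}
    (hκ : κ ≤ 1 / 4 ^ (2 * μ)) (hN : N ≤ (e + 1) * μ) (h : Supp P κ N F) :
    ∫⁻ x, ‖∑ i ∈ Finset.range (2 ^ N), F i x‖ₑ ^ 4
      ≤ ((stepConst N * (N + 1)) ^ (e + 1) : ℕ) * waveEnv P N F := by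
  have hκ1 : κ ≤ 1 := hκ.trans (by
    rw [div_le_one (by positivity)]; exact one_le_pow₀ (by norm_num))
  have key : env P 0 (sqn (coarse F N) 0)
      ≤ ((stepConst N * (N + 1)) ^ (e + 1) : ℕ) * waveEnv P (0 + N) F :=
    Bound.iterate (V := V) hκ e 0 N (zero_add N).le hN P F (by rwa [zero_add])
  rw [show 0 + N = N from zero_add N] at key
  refine le_trans (le_of_eq ?_) key
  have hbox : ∀ ζ, 𝓕 (sqn (coarse F N) 0) ζ ≠ 0 → ζ ∈ Box P 0 := by
    intro ζ hζ
    have : sqn (coarse F N) 0 = mulConj (coarse F N 0) (coarse F N 0) := by simp [sqn]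
    rw [this] at hζ
    obtain ⟨ξ, a, b⟩ := fourier_mulConj_ne_zero hζ
    simp only [coarse, fourier_sum_apply] at a b
    obtain ⟨i, hi, hi'⟩ := Finset.exists_ne_zero_of_sum_ne_zero a
    obtain ⟨j, hj, hj'⟩ := Finset.exists_ne_zero_of_sum_ne_zero b
    rw [Finset.mem_range] at hi hj
    simp only [zero_mul, zero_add] at hi' hj'
    obtain ⟨⟨a1, a2⟩, ⟨a3, a4⟩, a5, a6⟩ := (h i hi _ hi').bounds hκ1 hi
    obtain ⟨⟨b1, b2⟩, ⟨b3, b4⟩, b5, b6⟩ := (h j hj _ hj').bounds hκ1 hj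
    rw [map_sub] at b1 b2 b3 b4 b5 b6
    refine ⟨?_, ?_, ?_⟩ <;> rw [pow_zero, one_mul, abs_le] <;> constructor <;> linarith
  have hfull : env P 0 (sqn (coarse F N) 0) = ∫⁻ ζ, ‖𝓕 (sqn (coarse F N) 0) ζ‖ₑ ^ 2 := by
    rw [env, ← lintegral_indicator (measurableSet_Box _ _)]
    refine lintegral_congr fun ζ => ?_
    by_cases hz : ζ ∈ Box P 0
    · rw [Set.indicator_of_mem hz]
    · rw [Set.indicator_of_notMem hz]
      have : 𝓕 (sqn (coarse F N) 0) ζ = 0 := by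
        by_contra hne; exact hz (hbox ζ hne)
      simp [this]
  rw [hfull, lintegral_fourier_sq]
  refine lintegral_congr fun x => ?_
  rw [enorm_sqn]
  simp only [pow_zero, Finset.range_one, Finset.sum_singleton]
  rw [ENNReal.ofReal_pow (norm_nonneg _), ofReal_norm, ← pow_mul]
  simp [coarse]

end Induction

open scoped ContDiff

section Multiplier

open scoped LineDeriv

variable {E : Type*} [NormedAddCommGroup E] [InnerProductSpace ℝ E] [FiniteDimensional ℝ E]
  [MeasurableSpace E] [BorelSpace E]

/-- Bounded measurable functions with bounded support. -/
structure BddCpt (f : E → ℂ) : Prop where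
  meas : Measurable f
  bdd : ∃ M : ℝ, ∀ x, ‖f x‖ ≤ M
  supp : ∃ R : ℝ, ∀ x, R < ‖x‖ → f x = 0

/-- Smooth compactly supported Fourier multipliers. -/
structure Sym (m : E → ℂ) : Prop where
  smooth : ContDiff ℝ ∞ m
  cpt : HasCompactSupport m

/-- The Fourier multiplier operator with multiplier `m`. -/
def mulOp (m f : E → ℂ) (x : E) : ℂ := 𝓕⁻ (fun ξ => m ξ * 𝓕 f ξ) x

theorem BddCpt.integrable_of_bdd {f : E → ℂ} (hf : BddCpt f) {g : E → ℝ}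
    (hg : Continuous g) : Integrable (fun x => g x * ‖f x‖) := by
  obtain ⟨M, hM⟩ := hf.bdd
  obtain ⟨R, hR⟩ := hf.supp
  have h0 : (fun x => g x * ‖f x‖)
      = (Metric.closedBall (0 : E) R).indicator (fun x => g x * ‖f x‖) := by
    ext x
    by_cases hx : x ∈ Metric.closedBall (0 : E) R
    · rw [indicator_of_mem hx]
    · rw [indicator_of_notMem hx, hR x (by simpa using hx)]; simp
  rw [h0, integrable_indicator_iff Metric.isClosed_closedBall.measurableSet]
  refine Integrable.mul_bdd (c := M) ?_ hf.meas.norm.aestronglyMeasurable ?_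
  · exact hg.continuousOn.integrableOn_compact (isCompact_closedBall _ _)
  · exact Filter.Eventually.of_forall fun x => by simpa using hM x

theorem BddCpt.integrable {f : E → ℂ} (hf : BddCpt f) : Integrable f := by
  have := hf.integrable_of_bdd (g := fun _ => 1) continuous_const
  simp only [one_mul] at this
  exact (integrable_norm_iff hf.meas.aestronglyMeasurable).1 this

theorem BddCpt.integrable_sq {f : E → ℂ} (hf : BddCpt f) : Integrable (fun x => ‖f x‖ ^ 2) := by
  obtain ⟨M, hM⟩ := hf.bdd
  simp only [sq]
  exact Integrable.bdd_mul (c := M) hf.integrable.norm hf.meas.norm.aestronglyMeasurable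
    (Filter.Eventually.of_forall fun x => by simpa using hM x)

theorem BddCpt.integrable_pow {f : E → ℂ} (hf : BddCpt f) (n : ℕ) :
    Integrable (fun x => ‖x‖ ^ n * ‖f x‖) :=
  hf.integrable_of_bdd (g := fun x => ‖x‖ ^ n) (by fun_prop)

theorem BddCpt.mul {f g : E → ℂ} (hf : BddCpt f) (hg : Measurable g) {M : ℝ}
    (hM : ∀ x, ‖g x‖ ≤ M) : BddCpt (fun x => g x * f x) := by
  obtain ⟨A, hA⟩ := hf.bdd
  obtain ⟨R, hR⟩ := hf.supp
  refine ⟨hg.mul hf.meas, ⟨M * A, fun x => ?_⟩, ⟨R, fun x hx => by simp [hR x hx]⟩⟩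
  rw [norm_mul]
  exact mul_le_mul (hM x) (hA x) (norm_nonneg _) ((norm_nonneg _).trans (hM x))

theorem BddCpt.mul_continuous {f g : E → ℂ} (hf : BddCpt f) (hg : Continuous g) :
    BddCpt (fun x => g x * f x) := by
  obtain ⟨A, hA⟩ := hf.bdd
  obtain ⟨R, hR⟩ := hf.supp
  obtain ⟨M, hM⟩ := (isCompact_closedBall (0 : E) R).exists_bound_of_continuousOn
    hg.continuousOn
  refine ⟨hg.measurable.mul hf.meas, ⟨|M| * |A|, fun x => ?_⟩, ⟨R, fun x hx => by simp [hR x hx]⟩⟩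
  by_cases hx : ‖x‖ ≤ R
  · rw [norm_mul]
    exact mul_le_mul ((hM x (by simpa using hx)).trans (le_abs_self _))
      ((hA x).trans (le_abs_self _)) (norm_nonneg _) (abs_nonneg _)
  · rw [hR x (not_le.1 hx)]; simp; positivity

theorem BddCpt.contDiff_fourier {f : E → ℂ} (hf : BddCpt f) : ContDiff ℝ ∞ (𝓕 f) := by
  have := Real.contDiff_fourier (N := ⊤) (f := f) fun n _ => hf.integrable_pow n
  exact this

theorem Sym.mul_fourier {m f : E → ℂ} (hm : Sym m) (hf : BddCpt f) :
    Sym (fun ξ => m ξ * 𝓕 f ξ) :=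
  ⟨hm.smooth.mul hf.contDiff_fourier, hm.cpt.mul_right⟩

/-- A symbol as a Schwartz function. -/
def Sym.toS {m : E → ℂ} (hm : Sym m) : 𝓢(E, ℂ) := hm.cpt.toSchwartzMap hm.smooth

@[simp] theorem Sym.toS_apply {m : E → ℂ} (hm : Sym m) (x : E) : hm.toS x = m x := rfl

theorem Sym.fderiv {m : E → ℂ} (hm : Sym m) (b : E) : Sym (fun ξ => fderiv ℝ m ξ b) :=
  ⟨(hm.smooth.fderiv_right (m := ∞) (by simp)).clm_apply contDiff_const,
    (hm.cpt.fderiv ℝ).comp_left (g := fun L : E →L[ℝ] ℂ => L b) (by simp)⟩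

theorem mulOp_eq {m f : E → ℂ} (hm : Sym m) (hf : BddCpt f) (x : E) :
    mulOp m f x = 𝓕⁻ (hm.mul_fourier hf).toS x := by
  rw [fourierInv_coe]; rfl

theorem lintegral_fourierInv_sq (h : 𝓢(E, ℂ)) :
    ∫⁻ ξ, ‖𝓕⁻ h ξ‖ₑ ^ 2 = ∫⁻ x, ‖h x‖ₑ ^ 2 := by
  rw [← lintegral_fourier_sq, fourier_fourierInv_eq (F := 𝓢(E, ℂ))]

theorem lintegral_fourier_sq_le {f : E → ℂ} (hf : BddCpt f) :
    ∫⁻ ξ, ‖𝓕 f ξ‖ₑ ^ 2 ≤ ∫⁻ x, ‖f x‖ₑ ^ 2 := by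
  have hI : ∫⁻ x, ‖f x‖ₑ ^ 2 = ENNReal.ofReal (∫ x, ‖f x‖ ^ 2) := by
    rw [ofReal_integral_eq_lintegral_ofReal hf.integrable_sq
      (Filter.Eventually.of_forall fun x => by positivity)]
    exact lintegral_congr fun x => by rw [ENNReal.ofReal_pow (norm_nonneg _), ofReal_norm]
  have key : ∀ n : ℕ, ∫⁻ ξ in Metric.ball 0 n, ‖𝓕 f ξ‖ₑ ^ 2 ≤ ∫⁻ x, ‖f x‖ₑ ^ 2 := by
    intro n
    let ψ : ContDiffBump (0 : E) := ⟨n + 1, n + 2, by positivity, by linarith⟩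
    have hψ : Sym (fun x => ((ψ x : ℝ) : ℂ)) :=
      ⟨Complex.ofRealCLM.contDiff.comp ψ.contDiff,
        ψ.hasCompactSupport.comp_left (g := fun r : ℝ => (r : ℂ)) (by simp)⟩
    let g := (hψ.mul_fourier hf).toS
    let G : 𝓢(E, ℂ) := postcompCLM (Complex.conjCLE : ℂ →L[ℝ] ℂ) g
    have hg : ∀ x, g x = ψ x * 𝓕 f x := fun x => rfl
    have hG : ∀ x, G x = conj (g x) := fun x => rfl
    have h1 : ∫ ξ, 𝓕 f ξ * G ξ = ∫ x, f x * 𝓕 G x := by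
      have := VectorFourier.integral_fourierIntegral_smul_eq_flip (μ := (volume : Measure E))
        (ν := (volume : Measure E)) (e := Real.fourierChar) (L := innerₗ E)
        (f := f) (g := G) Real.continuous_fourierChar (by simpa using continuous_inner)
        hf.integrable G.integrable
      rw [flip_innerₗ] at this
      exact this
    have h2 : ∀ ξ, 𝓕 f ξ * G ξ = ((ψ ξ * ‖𝓕 f ξ‖ ^ 2 : ℝ) : ℂ) := by
      intro ξ
      rw [hG, hg, map_mul, Complex.conj_ofReal, mul_left_comm, Complex.mul_conj,
        Complex.normSq_eq_norm_sq]
      push_cast; ring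
    simp only [h2] at h1
    rw [integral_complex_ofReal] at h1
    have hcont : Continuous (fun ξ => ψ ξ * ‖𝓕 f ξ‖ ^ 2) :=
      ψ.continuous.mul (hf.contDiff_fourier.continuous.norm.pow 2)
    have hfint : Integrable (fun ξ => ψ ξ * ‖𝓕 f ξ‖ ^ 2) :=
      hcont.integrable_of_hasCompactSupport ψ.hasCompactSupport.mul_right
    have hsqi : ∀ h : 𝓢(E, ℂ), Integrable (fun ξ => ‖h ξ‖ ^ 2) := fun h => by
      simpa using (h.memLp 2).integrable_norm_pow (by norm_num)
    have h3 : ∫ ξ, ψ ξ * ‖𝓕 f ξ‖ ^ 2 ≤ ∫ x, ‖f x‖ ^ 2 := by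
      have e1 : ∫ ξ, ψ ξ * ‖𝓕 f ξ‖ ^ 2 ≤ ∫ x, (‖f x‖ ^ 2 + ‖𝓕 G x‖ ^ 2) / 2 := by
        calc ∫ ξ, ψ ξ * ‖𝓕 f ξ‖ ^ 2 ≤ ‖((∫ ξ, ψ ξ * ‖𝓕 f ξ‖ ^ 2 : ℝ) : ℂ)‖ := by
              rw [Complex.norm_real]; exact le_abs_self _
          _ = ‖∫ x, f x * 𝓕 G x‖ := by rw [h1]
          _ ≤ _ := norm_integral_le_of_norm_le
              ((hf.integrable_sq.add (hsqi _)).div_const 2)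
              (Filter.Eventually.of_forall fun x => by
                rw [norm_mul]
                have := two_mul_le_add_sq ‖f x‖ ‖𝓕 G x‖
                simp only [Pi.add_apply]
                linarith)
      rw [integral_div, integral_add hf.integrable_sq (hsqi _), integral_norm_sq_fourier] at e1
      have e2 : ∫ x, ‖G x‖ ^ 2 ≤ ∫ ξ, ψ ξ * ‖𝓕 f ξ‖ ^ 2 := by
        refine integral_mono (hsqi _) hfint fun x => ?_
        simp only [hG, hg, RCLike.norm_conj, norm_mul, Complex.norm_real, mul_pow, norm_eq_abs,
          sq_abs]
        have := ψ.le_one (x := x)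
        have h0 : 0 ≤ ψ x := ψ.nonneg
        gcongr
        nlinarith
      linarith
    rw [hI]
    refine le_trans ?_ (ENNReal.ofReal_le_ofReal h3)
    rw [ofReal_integral_eq_lintegral_ofReal hfint
      (Filter.Eventually.of_forall fun x => mul_nonneg ψ.nonneg (by positivity)),
      ← lintegral_indicator Metric.isOpen_ball.measurableSet]
    refine lintegral_mono fun x => ?_
    by_cases hx : x ∈ Metric.ball (0 : E) n
    · rw [indicator_of_mem hx, ψ.one_of_mem_closedBall, one_mul,
        ENNReal.ofReal_pow (norm_nonneg _), ofReal_norm]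
      have : ‖x‖ < n := by simpa using hx
      simp only [ψ, Metric.mem_closedBall, dist_zero_right]; linarith
    · rw [indicator_of_notMem hx]; exact zero_le
  have hU : ∫⁻ ξ, ‖𝓕 f ξ‖ₑ ^ 2 = ⨆ n : ℕ, ∫⁻ ξ in Metric.ball 0 n, ‖𝓕 f ξ‖ₑ ^ 2 := by
    rw [← setLIntegral_univ, ← Metric.iUnion_ball_nat (0 : E),
      setLIntegral_iUnion_of_directed]
    exact directed_of_isDirected_le fun a b h => Metric.ball_subset_ball (by exact_mod_cast h)
  rw [hU]
  exact iSup_le key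

theorem sum_lintegral_mulOp_sq_le {ι : Type*} (s : Finset ι) {m : ι → E → ℂ} {f : E → ℂ}
    (hm : ∀ i ∈ s, Sym (m i)) (hf : BddCpt f) {A : ℝ≥0∞}
    (hA : ∀ ξ, ∑ i ∈ s, ‖m i ξ‖ₑ ^ 2 ≤ A) :
    ∑ i ∈ s, ∫⁻ x, ‖mulOp (m i) f x‖ₑ ^ 2 ≤ A * ∫⁻ x, ‖f x‖ₑ ^ 2 := by
  have hc := hf.contDiff_fourier.continuous
  calc ∑ i ∈ s, ∫⁻ x, ‖mulOp (m i) f x‖ₑ ^ 2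
      = ∑ i ∈ s, ∫⁻ ξ, ‖m i ξ‖ₑ ^ 2 * ‖𝓕 f ξ‖ₑ ^ 2 := by
        refine Finset.sum_congr rfl fun i hi => ?_
        simp only [mulOp_eq (hm i hi) hf]
        rw [lintegral_fourierInv_sq]
        refine lintegral_congr fun ξ => ?_
        rw [Sym.toS_apply, enorm_mul, mul_pow]
    _ = ∫⁻ ξ, ∑ i ∈ s, ‖m i ξ‖ₑ ^ 2 * ‖𝓕 f ξ‖ₑ ^ 2 := by
        rw [lintegral_finsetSum']
        intro i hi
        have := (hm i hi).smooth.continuous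
        fun_prop
    _ ≤ ∫⁻ ξ, A * ‖𝓕 f ξ‖ₑ ^ 2 := by
        refine lintegral_mono fun ξ => ?_
        simp only
        rw [← Finset.sum_mul]
        gcongr
        exact hA ξ
    _ ≤ _ := by
        rw [lintegral_const_mul _ (by fun_prop)]
        exact mul_le_mul_right (lintegral_fourier_sq_le hf) _

theorem mulOp_eq_of {m f : E → ℂ} {S : 𝓢(E, ℂ)} (h : ∀ ξ, S ξ = m ξ * 𝓕 f ξ) (x : E) :
    mulOp m f x = 𝓕⁻ S x := by
  rw [fourierInv_coe, mulOp]
  exact congrArg (fun u : E → ℂ => 𝓕⁻ u x) (funext fun ξ => (h ξ).symm)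

theorem BddCpt.add {f g : E → ℂ} (hf : BddCpt f) (hg : BddCpt g) :
    BddCpt (fun x => f x + g x) := by
  obtain ⟨A, hA⟩ := hf.bdd
  obtain ⟨R, hR⟩ := hf.supp
  obtain ⟨B, hB⟩ := hg.bdd
  obtain ⟨S, hS⟩ := hg.supp
  refine ⟨hf.meas.add hg.meas, ⟨A + B, fun x => (norm_add_le _ _).trans (add_le_add (hA x) (hB x))⟩,
    ⟨max R S, fun x hx => ?_⟩⟩
  rw [hR x ((le_max_left _ _).trans_lt hx), hS x ((le_max_right _ _).trans_lt hx), add_zero]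

theorem BddCpt.fourier_add {f g : E → ℂ} (hf : BddCpt f) (hg : BddCpt g) (ξ : E) :
    𝓕 (fun x => f x + g x) ξ = 𝓕 f ξ + 𝓕 g ξ := by
  simp only [Real.fourier_eq, smul_add]
  rw [integral_add]
  · exact (Real.fourierIntegral_convergent_iff ξ).2 hf.integrable
  · exact (Real.fourierIntegral_convergent_iff ξ).2 hg.integrable

theorem fourier_const_mul (f : E → ℂ) (c : ℂ) (ξ : E) :
    𝓕 (fun x => c * f x) ξ = c * 𝓕 f ξ := by
  simp only [Real.fourier_eq, ← integral_const_mul, mul_smul_comm]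

theorem mulOp_add {m f g : E → ℂ} (hm : Sym m) (hf : BddCpt f) (hg : BddCpt g) (x : E) :
    mulOp m (fun y => f y + g y) x = mulOp m f x + mulOp m g x := by
  rw [mulOp_eq hm hf, mulOp_eq hm hg,
    mulOp_eq_of (S := (hm.mul_fourier hf).toS + (hm.mul_fourier hg).toS)
      (fun ξ => by simp [hf.fourier_add hg, mul_add]), FourierTransform.fourierInv_add]
  rfl

theorem BddCpt.fourier_inner_mul {h : E → ℂ} (hh : BddCpt h) (b ξ : E) :
    𝓕 (fun y => ((inner ℝ b y : ℝ) : ℂ) * h y) ξ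
      = (Complex.I / (2 * π)) * fderiv ℝ (𝓕 h) ξ b := by
  have h1 := hh.integrable
  have h2 : Integrable (fun v => ‖v‖ * ‖h v‖) := by simpa using hh.integrable_pow 1
  rw [Real.fderiv_fourier h1 h2, Real.fourier_eq (VectorFourier.fourierSMulRight (innerSL ℝ) h),
    ContinuousLinearMap.integral_apply, ← integral_const_mul, Real.fourier_eq]
  · refine integral_congr_ae (Filter.Eventually.of_forall fun y => ?_)
    have hpi : (π : ℂ) ≠ 0 := by exact_mod_cast pi_ne_zero
    have hb : innerSL ℝ y b = inner ℝ b y := by rw [innerSL_apply_apply, real_inner_comm]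
    simp only [VectorFourier.fourierSMulRight_apply, ContinuousLinearMap.smul_apply, Circle.smul_def,
      smul_eq_mul, Complex.real_smul, hb]
    field_simp
    linear_combination (h y * (inner ℝ b y : ℝ)) * Complex.I_sq
  · refine (Real.fourierIntegral_convergent_iff ξ).2 ?_
    refine Integrable.mono' (h2.const_mul (2 * π * ‖innerSL (E := E) ℝ‖))
      h1.aestronglyMeasurable.fourierSMulRight (Filter.Eventually.of_forall fun v => ?_)
    refine (VectorFourier.norm_fourierSMulRight_le _ _ _).trans (le_of_eq ?_)
    ring

theorem mulOp_comm {m h : E → ℂ} (hm : Sym m) (hh : BddCpt h) (b : E) (c : ℝ) (x : E) :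
    mulOp m (fun y => (1 + Complex.I * ((inner ℝ b y + c : ℝ) : ℂ)) * h y) x =
      (1 + Complex.I * ((inner ℝ b x + c : ℝ) : ℂ)) * mulOp m h x
        + (1 / (2 * π)) * mulOp (fun ξ => fderiv ℝ m ξ b) h x := by
  have hpi : (π : ℂ) ≠ 0 := by exact_mod_cast pi_ne_zero
  let G := (hm.mul_fourier hh).toS
  let D := ((hm.fderiv b).mul_fourier hh).toS
  have hlin : ∀ ξ, 𝓕 (fun y => (1 + Complex.I * ((inner ℝ b y + c : ℝ) : ℂ)) * h y) ξ
      = (1 + Complex.I * c) * 𝓕 h ξ - 1 / (2 * π) * fderiv ℝ (𝓕 h) ξ b := by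
    intro ξ
    have e : (fun y => (1 + Complex.I * ((inner ℝ b y + c : ℝ) : ℂ)) * h y) = fun y =>
        (1 + Complex.I * c) * h y + Complex.I * (((inner ℝ b y : ℝ) : ℂ) * h y) := by
      ext y; push_cast; ring
    rw [e, BddCpt.fourier_add (hh.mul_continuous continuous_const)
      ((hh.mul_continuous (by fun_prop)).mul_continuous continuous_const), fourier_const_mul,
      fourier_const_mul, hh.fourier_inner_mul]
    linear_combination (1 / (2 * π) * fderiv ℝ (𝓕 h) ξ b) * Complex.I_sq
  have hd : ∀ ξ, (∂_{b} G) ξ = fderiv ℝ m ξ b * 𝓕 h ξ + m ξ * fderiv ℝ (𝓕 h) ξ b := by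
    intro ξ
    rw [lineDerivOp_apply_eq_fderiv]
    have : (G : E → ℂ) = fun ξ => m ξ * 𝓕 h ξ := rfl
    rw [this, fderiv_fun_mul (hm.smooth.differentiable (by simp) ξ)
      (hh.contDiff_fourier.differentiable (by simp) ξ)]
    simp; ring
  have hI := congrArg (fun S : 𝓢(E, ℂ) => S x) (fourierInv_lineDerivOp_eq G b)
  have htg : (inner ℝ · b : E → ℝ).HasTemperateGrowth := by fun_prop
  simp only [neg_smul, _root_.neg_apply, _root_.smul_apply, smulLeftCLM_apply_apply htg]
    at hI
  rw [mulOp_eq hm hh, mulOp_eq (hm.fderiv b) hh, mulOp_eq_of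
    (S := (1 + Complex.I * c) • G + (-(1 / (2 * π)) : ℂ) • (∂_{b} G) + (1 / (2 * π) : ℂ) • D)]
  · change _ = (1 + Complex.I * ((inner ℝ b x + c : ℝ) : ℂ)) * 𝓕⁻ G x + (1 / (2 * π)) * 𝓕⁻ D x
    rw [FourierTransform.fourierInv_add, FourierTransform.fourierInv_add,
      FourierTransform.fourierInv_smul, FourierTransform.fourierInv_smul,
      FourierTransform.fourierInv_smul]
    simp only [_root_.add_apply, _root_.smul_apply, hI, smul_eq_mul,
      Complex.real_smul, real_inner_comm b x]
    push_cast
    field_simp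
    ring
  · intro ξ
    simp only [_root_.add_apply, _root_.smul_apply, hd, hlin,
      smul_eq_mul, G, D, Sym.toS_apply]
    ring

end Multiplier

section Weighted

variable {E : Type*} [NormedAddCommGroup E] [InnerProductSpace ℝ E] [FiniteDimensional ℝ E]
  [MeasurableSpace E] [BorelSpace E]

/-- The factor `1 + i u`, with `u` affine. -/
def affC (b : E) (c : ℝ) (x : E) : ℂ := 1 + Complex.I * ((inner ℝ b x + c : ℝ) : ℂ)

/-- The weight `1 / (1 + u²)`, with `u` affine. -/
def affW (b : E) (c : ℝ) (x : E) : ℝ := (1 + (inner ℝ b x + c) ^ 2)⁻¹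

theorem norm_affC_sq (b : E) (c : ℝ) (x : E) : ‖affC b c x‖ ^ 2 = 1 + (inner ℝ b x + c) ^ 2 := by
  rw [← Complex.normSq_eq_norm_sq, Complex.normSq_apply, affC]
  simp; ring

theorem one_le_norm_affC (b : E) (c : ℝ) (x : E) : 1 ≤ ‖affC b c x‖ := by
  have := norm_affC_sq b c x
  nlinarith [norm_nonneg (affC b c x), sq_nonneg (inner ℝ b x + c)]

theorem continuous_affC (b : E) (c : ℝ) : Continuous (affC b c) := by
  unfold affC; fun_prop

theorem affC_ne_zero (b : E) (c : ℝ) (x : E) : affC b c x ≠ 0 := by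
  intro h
  have := one_le_norm_affC b c x
  rw [h] at this; simp at this; linarith

theorem affW_eq (b : E) (c : ℝ) (x : E) : affW b c x = (‖affC b c x‖ ^ 2)⁻¹ := by
  rw [norm_affC_sq, affW]

theorem affW_nonneg (b : E) (c : ℝ) (x : E) : 0 ≤ affW b c x := by unfold affW; positivity

theorem continuous_affW (b : E) (c : ℝ) : Continuous (affW b c) := by
  unfold affW
  refine Continuous.inv₀ (by fun_prop) fun x => by positivity

/-- Weighted `L²` estimate for a family of Fourier multipliers. -/
theorem sum_lintegral_mulOp_weighted {ι : Type*} (s : Finset ι) {m : ι → E → ℂ} {f : E → ℂ}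
    (hm : ∀ i ∈ s, Sym (m i)) (hf : BddCpt f) (b₁ b₂ : E) (c₁ c₂ : ℝ) {A : ℝ≥0∞}
    (h0 : ∀ ξ, ∑ i ∈ s, ‖m i ξ‖ₑ ^ 2 ≤ A)
    (h1 : ∀ ξ, ∑ i ∈ s, ‖fderiv ℝ (m i) ξ b₁‖ₑ ^ 2 ≤ A)
    (h2 : ∀ ξ, ∑ i ∈ s, ‖fderiv ℝ (m i) ξ b₂‖ₑ ^ 2 ≤ A)
    (h12 : ∀ ξ, ∑ i ∈ s, ‖fderiv ℝ (fun ξ => fderiv ℝ (m i) ξ b₁) ξ b₂‖ₑ ^ 2 ≤ A) :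
    ∑ i ∈ s, ∫⁻ x, ‖mulOp (m i) f x‖ₑ ^ 2 * ENNReal.ofReal (affW b₁ c₁ x * affW b₂ c₂ x) ≤
      16 * A * ∫⁻ x, ‖f x‖ₑ ^ 2 * ENNReal.ofReal (affW b₁ c₁ x * affW b₂ c₂ x) := by
  set h : E → ℂ := fun y => (affC b₁ c₁ y)⁻¹ * ((affC b₂ c₂ y)⁻¹ * f y) with hh
  have hb2 : BddCpt (fun y => affC b₂ c₂ y * h y) := by
    refine BddCpt.mul_continuous ?_ (continuous_affC _ _)
    exact ((hf.mul_continuous ((continuous_affC _ _).inv₀ (affC_ne_zero _ _))).mul_continuous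
      ((continuous_affC _ _).inv₀ (affC_ne_zero _ _)))
  have hhb : BddCpt h := ((hf.mul_continuous ((continuous_affC _ _).inv₀
    (affC_ne_zero _ _))).mul_continuous ((continuous_affC _ _).inv₀ (affC_ne_zero _ _)))
  have hfh : f = fun y => affC b₁ c₁ y * (affC b₂ c₂ y * h y) := by
    ext y
    have := affC_ne_zero b₁ c₁ y
    have := affC_ne_zero b₂ c₂ y
    simp only [hh]; field_simp
  have hn : ∀ y, ‖f y‖ₑ ^ 2 * ENNReal.ofReal (affW b₁ c₁ y * affW b₂ c₂ y) = ‖h y‖ₑ ^ 2 := by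
    intro y
    rw [← ofReal_norm, ← ofReal_norm, ← ENNReal.ofReal_pow (norm_nonneg _),
      ← ENNReal.ofReal_pow (norm_nonneg _), ← ENNReal.ofReal_mul (by positivity)]
    congr 1
    simp only [hh]
    rw [norm_mul, norm_mul, norm_inv, norm_inv, affW_eq, affW_eq]; ring
  simp only [hn]
  have key : ∀ i ∈ s, ∀ x,
      ‖mulOp (m i) f x‖ₑ ^ 2 * ENNReal.ofReal (affW b₁ c₁ x * affW b₂ c₂ x) ≤
        4 * (‖mulOp (m i) h x‖ₑ ^ 2 + ‖mulOp (fun ξ => fderiv ℝ (m i) ξ b₁) h x‖ₑ ^ 2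
          + ‖mulOp (fun ξ => fderiv ℝ (m i) ξ b₂) h x‖ₑ ^ 2
          + ‖mulOp (fun ξ => fderiv ℝ (fun ξ => fderiv ℝ (m i) ξ b₁) ξ b₂) h x‖ₑ ^ 2) := by
    intro i hi x
    have e1 := mulOp_comm (hm i hi) hb2 b₁ c₁ x
    have e2 := mulOp_comm (hm i hi) hhb b₂ c₂ x
    have e3 := mulOp_comm ((hm i hi).fderiv b₁) hhb b₂ c₂ x
    change mulOp (m i) (fun y => affC b₁ c₁ y * (affC b₂ c₂ y * h y)) x
      = affC b₁ c₁ x * _ + _ at e1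
    change mulOp (m i) (fun y => affC b₂ c₂ y * h y) x = affC b₂ c₂ x * _ + _ at e2
    change mulOp (fun ξ => fderiv ℝ (m i) ξ b₁) (fun y => affC b₂ c₂ y * h y) x
      = affC b₂ c₂ x * _ + _ at e3
    rw [← hfh, e2, e3] at e1
    rw [e1]
    generalize mulOp (m i) h x = a
    generalize mulOp (fun ξ => fderiv ℝ (m i) ξ b₁) h x = b
    generalize mulOp (fun ξ => fderiv ℝ (m i) ξ b₂) h x = c
    generalize mulOp (fun ξ => fderiv ℝ (fun ξ => fderiv ℝ (m i) ξ b₁) ξ b₂) h x = d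
    have g1 := one_le_norm_affC b₁ c₁ x
    have g2 := one_le_norm_affC b₂ c₂ x
    rw [affW_eq, affW_eq]
    generalize affC b₁ c₁ x = z at *
    generalize affC b₂ c₂ x = w at *
    have hκ : ‖(1 / (2 * π) : ℂ)‖ ≤ 1 := by
      rw [norm_div, norm_mul, Complex.norm_real, norm_one, Complex.norm_ofNat,
        norm_of_nonneg pi_pos.le, div_le_one (by positivity)]
      linarith [pi_gt_three]
    generalize (1 / (2 * π) : ℂ) = κ at *
    have hb : ‖z * (w * a + κ * c) + κ * (w * b + κ * d)‖
        ≤ ‖z‖ * ‖w‖ * (‖a‖ + ‖b‖ + ‖c‖ + ‖d‖) := by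
      refine (norm_add_le _ _).trans ?_
      rw [norm_mul, norm_mul]
      have i1 := (norm_add_le (w * a) (κ * c)).trans (by rw [norm_mul, norm_mul])
      have i2 := (norm_add_le (w * b) (κ * d)).trans (by rw [norm_mul, norm_mul])
      have j1 : ‖κ‖ * ‖c‖ ≤ ‖w‖ * ‖c‖ := by gcongr; linarith
      have j2 : ‖κ‖ * ‖d‖ ≤ ‖w‖ * ‖d‖ := by gcongr; linarith
      have k1 : ‖z‖ * ‖w * a + κ * c‖ ≤ ‖z‖ * (‖w‖ * ‖a‖ + ‖w‖ * ‖c‖) := by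
        gcongr; linarith
      have k2 : ‖κ‖ * ‖w * b + κ * d‖ ≤ ‖z‖ * (‖w‖ * ‖b‖ + ‖w‖ * ‖d‖) := by
        gcongr <;> linarith
      linarith
    have hb2 : ‖z * (w * a + κ * c) + κ * (w * b + κ * d)‖ ^ 2 * ((‖z‖ ^ 2)⁻¹ * (‖w‖ ^ 2)⁻¹)
        ≤ 4 * (‖a‖ ^ 2 + ‖b‖ ^ 2 + ‖c‖ ^ 2 + ‖d‖ ^ 2) := by
      have hz : ‖z‖ ≠ 0 := by linarith
      have hw : ‖w‖ ≠ 0 := by linarith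
      calc _ ≤ (‖z‖ * ‖w‖ * (‖a‖ + ‖b‖ + ‖c‖ + ‖d‖)) ^ 2 * ((‖z‖ ^ 2)⁻¹ * (‖w‖ ^ 2)⁻¹) := by
            gcongr
        _ = (‖a‖ + ‖b‖ + ‖c‖ + ‖d‖) ^ 2 := by field_simp
        _ ≤ _ := by
            nlinarith [sq_nonneg (‖a‖ - ‖b‖), sq_nonneg (‖a‖ - ‖c‖), sq_nonneg (‖a‖ - ‖d‖),
              sq_nonneg (‖b‖ - ‖c‖), sq_nonneg (‖b‖ - ‖d‖), sq_nonneg (‖c‖ - ‖d‖)]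
    have hof : ∀ y : ℂ, ‖y‖ₑ ^ 2 = ENNReal.ofReal (‖y‖ ^ 2) := fun y => by
      rw [ENNReal.ofReal_pow (norm_nonneg _), ofReal_norm]
    rw [hof, hof a, hof b, hof c, hof d, ← ENNReal.ofReal_mul (by positivity),
      ← ENNReal.ofReal_add (by positivity) (by positivity),
      ← ENNReal.ofReal_add (by positivity) (by positivity),
      ← ENNReal.ofReal_add (by positivity) (by positivity),
      show (4 : ℝ≥0∞) = ENNReal.ofReal 4 by simp, ← ENNReal.ofReal_mul (by positivity)]
    exact ENNReal.ofReal_le_ofReal hb2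
  have hmeas : ∀ {M : E → ℂ}, Sym M → Measurable (fun x => ‖mulOp M h x‖ₑ ^ 2) := by
    intro M hM
    have : mulOp M h = 𝓕⁻ (hM.mul_fourier hhb).toS := funext fun x => mulOp_eq hM hhb x
    rw [this]
    exact (SchwartzMap.continuous _).measurable.enorm.pow_const 2
  calc _ ≤ ∑ i ∈ s, ∫⁻ x, 4 * (‖mulOp (m i) h x‖ₑ ^ 2
          + ‖mulOp (fun ξ => fderiv ℝ (m i) ξ b₁) h x‖ₑ ^ 2
          + ‖mulOp (fun ξ => fderiv ℝ (m i) ξ b₂) h x‖ₑ ^ 2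
          + ‖mulOp (fun ξ => fderiv ℝ (fun ξ => fderiv ℝ (m i) ξ b₁) ξ b₂) h x‖ₑ ^ 2) :=
        Finset.sum_le_sum fun i hi => lintegral_mono (key i hi)
    _ = 4 * ((∑ i ∈ s, ∫⁻ x, ‖mulOp (m i) h x‖ₑ ^ 2)
          + (∑ i ∈ s, ∫⁻ x, ‖mulOp (fun ξ => fderiv ℝ (m i) ξ b₁) h x‖ₑ ^ 2)
          + (∑ i ∈ s, ∫⁻ x, ‖mulOp (fun ξ => fderiv ℝ (m i) ξ b₂) h x‖ₑ ^ 2)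
          + (∑ i ∈ s, ∫⁻ x,
            ‖mulOp (fun ξ => fderiv ℝ (fun ξ => fderiv ℝ (m i) ξ b₁) ξ b₂) h x‖ₑ ^ 2)) := by
        simp only [← Finset.sum_add_distrib, Finset.mul_sum]
        refine Finset.sum_congr rfl fun i hi => ?_
        have q0 := hmeas (hm i hi)
        have q1 := hmeas ((hm i hi).fderiv b₁)
        have q2 := hmeas ((hm i hi).fderiv b₂)
        have q3 := hmeas (((hm i hi).fderiv b₁).fderiv b₂)
        rw [lintegral_const_mul _ (by fun_prop), lintegral_add_right _ q3,
          lintegral_add_right _ q2, lintegral_add_right _ q1]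
    _ ≤ 4 * (A * (∫⁻ x, ‖h x‖ₑ ^ 2) + A * (∫⁻ x, ‖h x‖ₑ ^ 2) + A * (∫⁻ x, ‖h x‖ₑ ^ 2)
          + A * (∫⁻ x, ‖h x‖ₑ ^ 2)) := by
        gcongr
        · exact sum_lintegral_mulOp_sq_le s hm hhb h0
        · exact sum_lintegral_mulOp_sq_le s (fun i hi => (hm i hi).fderiv b₁) hhb h1
        · exact sum_lintegral_mulOp_sq_le s (fun i hi => (hm i hi).fderiv b₂) hhb h2
        · exact sum_lintegral_mulOp_sq_le s (fun i hi => ((hm i hi).fderiv b₁).fderiv b₂) hhb h12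
    _ = _ := by ring

end Weighted

section Gaussian

variable {V : Type*} [NormedAddCommGroup V] [InnerProductSpace ℝ V] [FiniteDimensional ℝ V]
  [MeasurableSpace V] [BorelSpace V]

/-- The one-dimensional Gaussian. -/
def gam (s : ℝ) : ℝ := Real.exp (-π * s ^ 2)

theorem gam_nonneg (s : ℝ) : 0 ≤ gam s := (Real.exp_pos _).le

theorem gam_le_one (s : ℝ) : gam s ≤ 1 := by
  unfold gam
  rw [Real.exp_le_one_iff]
  nlinarith [Real.pi_pos, sq_nonneg s]

theorem continuous_gam : Continuous gam := by unfold gam; fun_prop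

theorem contDiff_gam : ContDiff ℝ ∞ gam := by unfold gam; fun_prop

theorem integrable_gam : Integrable gam := integrable_exp_neg_mul_sq Real.pi_pos

theorem fourier_gam (w : ℝ) : ∫ s : ℝ, Complex.exp (-(2 * π * Complex.I * s * w)) * (gam s : ℂ) =
    (gam w : ℂ) := by
  have h := congrFun (fourier_gaussian_pi (b := 1) (by simp)) w
  rw [Real.fourier_eq'] at h
  simp only [Complex.one_cpow, one_div, inv_one, one_mul, mul_one, div_one, smul_eq_mul] at h
  unfold gam
  push_cast
  rw [← h]
  refine integral_congr_ae (Filter.Eventually.of_forall fun s => ?_)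
  simp only
  congr 2
  simp
  ring

/-- Averaging in the direction `e` against a Gaussian multiplies the Fourier transform by a
Gaussian. -/
theorem exists_gaussian_average (h : 𝓢(V, ℂ)) (hc : HasCompactSupport (𝓕 h : 𝓢(V, ℂ))) (e : V) :
    ∃ H : 𝓢(V, ℂ), HasCompactSupport (𝓕 H : 𝓢(V, ℂ)) ∧
      (∀ ζ, (𝓕 H : 𝓢(V, ℂ)) ζ = (gam (inner ℝ e ζ) : ℂ) * (𝓕 h : 𝓢(V, ℂ)) ζ) ∧
      ∀ z, H z = ∫ s : ℝ, (gam s : ℂ) * h (z - s • e) := by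
  have hsm : ContDiff ℝ ∞ (fun ζ : V => (gam (inner ℝ e ζ) : ℂ) * (𝓕 h : 𝓢(V, ℂ)) ζ) := by
    refine ContDiff.mul ?_ ((𝓕 h : 𝓢(V, ℂ)).smooth _)
    exact Complex.ofRealCLM.contDiff.comp (contDiff_gam.comp (contDiff_const.inner ℝ contDiff_id))
  have hcs : HasCompactSupport (fun ζ : V => (gam (inner ℝ e ζ) : ℂ) * (𝓕 h : 𝓢(V, ℂ)) ζ) :=
    hc.mul_left
  set S : 𝓢(V, ℂ) := hcs.toSchwartzMap hsm with hS
  have hSa : ∀ ζ, S ζ = (gam (inner ℝ e ζ) : ℂ) * (𝓕 h : 𝓢(V, ℂ)) ζ := fun ζ => rfl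
  have hFS : 𝓕 (𝓕⁻ S) = S := fourier_fourierInv_eq (F := 𝓢(V, ℂ)) S
  refine ⟨𝓕⁻ S, ?_, ?_, ?_⟩
  · rw [hFS]; exact hcs
  · intro ζ
    rw [hFS, hSa]
  · intro z
    rw [SchwartzMap.fourierInv_coe, Real.fourierInv_eq']
    set g : 𝓢(V, ℂ) := 𝓕 h with hg
    have hinv : ∀ y, h y = ∫ v, Complex.exp (↑(2 * π * inner ℝ v y) * Complex.I) • g v := by
      intro y
      have : h = 𝓕⁻ g := (fourierInv_fourier_eq (F := 𝓢(V, ℂ)) h).symm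
      conv_lhs => rw [this]
      rw [SchwartzMap.fourierInv_coe, Real.fourierInv_eq']
    have hfint : Integrable (Function.uncurry fun (v : V) (s : ℝ) =>
        Complex.exp (↑(2 * π * inner ℝ v z) * Complex.I) *
          (Complex.exp (-(2 * π * Complex.I * s * (inner ℝ e v : ℝ))) * (gam s : ℂ)) * g v)
        (volume.prod volume) := by
      have h1 : Integrable (fun p : V × ℝ => g p.1 * (gam p.2 : ℂ)) (volume.prod volume) :=
        g.integrable.mul_prod integrable_gam.ofReal
      refine h1.mono (Continuous.aestronglyMeasurable ?_) (Filter.Eventually.of_forall fun p => ?_)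
      · have := g.continuous
        have := continuous_gam
        simp only [Function.uncurry_def]
        fun_prop
      · have e1 : ‖Complex.exp (↑(2 * π * inner ℝ p.1 z) * Complex.I)‖ = 1 :=
          Complex.norm_exp_ofReal_mul_I _
        have e2 : ‖Complex.exp (-(2 * π * Complex.I * p.2 * (inner ℝ e p.1 : ℝ)))‖ = 1 := by
          rw [← Complex.norm_exp_ofReal_mul_I (-(2 * π * p.2 * inner ℝ e p.1))]
          congr 2
          push_cast
          ring
        simp only [Function.uncurry_def, norm_mul, e1, e2, one_mul]
        rw [mul_comm]
    calc _ = ∫ v, ∫ s : ℝ, Complex.exp (↑(2 * π * inner ℝ v z) * Complex.I) *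
          (Complex.exp (-(2 * π * Complex.I * s * (inner ℝ e v : ℝ))) * (gam s : ℂ)) * g v := by
          refine integral_congr_ae (Filter.Eventually.of_forall fun v => ?_)
          simp only
          rw [integral_mul_const, integral_const_mul, fourier_gam, hSa, smul_eq_mul]
          ring
      _ = ∫ s : ℝ, ∫ v, Complex.exp (↑(2 * π * inner ℝ v z) * Complex.I) *
          (Complex.exp (-(2 * π * Complex.I * s * (inner ℝ e v : ℝ))) * (gam s : ℂ)) * g v :=
          integral_integral_swap hfint
      _ = _ := by
          refine integral_congr_ae (Filter.Eventually.of_forall fun s => ?_)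
          simp only
          rw [hinv, ← integral_const_mul]
          refine integral_congr_ae (Filter.Eventually.of_forall fun v => ?_)
          simp only [smul_eq_mul]
          have : Complex.exp (↑(2 * π * inner ℝ v (z - s • e)) * Complex.I) =
              Complex.exp (↑(2 * π * inner ℝ v z) * Complex.I) *
              Complex.exp (-(2 * π * Complex.I * s * (inner ℝ e v : ℝ))) := by
            rw [← Complex.exp_add]
            congr 1
            rw [inner_sub_right, inner_smul_right, real_inner_comm e v]
            push_cast
            ring
          rw [this]
          ring

theorem lintegral_schwartz_fourier_sq (h : 𝓢(V, ℂ)) :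
    ∫⁻ ζ, ‖(𝓕 h : 𝓢(V, ℂ)) ζ‖ₑ ^ 2 = ∫⁻ z, ‖h z‖ₑ ^ 2 := lintegral_fourier_sq h

theorem exp_le_gam {w : ℝ} (hw : |w| ≤ 1) : Real.exp (-π) ≤ gam w := by
  unfold gam
  rw [Real.exp_le_exp]
  have : w ^ 2 ≤ 1 := by rw [← sq_abs]; nlinarith [abs_nonneg w]
  nlinarith [Real.pi_pos]

/-- An envelope is bounded by the square function of two-fold Gaussian averages. -/
theorem env_le_gaussian (P : Coords V) (r : ℕ) (h : 𝓢(V, ℂ))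
    (hc : HasCompactSupport (𝓕 h : 𝓢(V, ℂ))) (e₁ e₂ : V)
    (h₁ : ∀ ζ ∈ Box P r, |inner ℝ e₁ ζ| ≤ 1) (h₂ : ∀ ζ ∈ Box P r, |inner ℝ e₂ ζ| ≤ 1) :
    env P r h ≤ ENNReal.ofReal (Real.exp (4 * π)) *
      ∫⁻ z, (∫⁻ s₂ : ℝ, ∫⁻ s₁ : ℝ, ENNReal.ofReal (gam s₁ * gam s₂) *
        ‖h (z - (s₁ • e₁ + s₂ • e₂))‖ₑ) ^ 2 := by
  obtain ⟨H₁, hc₁, hf₁, hH₁⟩ := exists_gaussian_average h hc e₁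
  obtain ⟨H₂, hc₂, hf₂, hH₂⟩ := exists_gaussian_average H₁ hc₁ e₂
  calc env P r h ≤ ∫⁻ ζ in Box P r, ENNReal.ofReal (Real.exp (4 * π)) *
        ‖(𝓕 H₂ : 𝓢(V, ℂ)) ζ‖ₑ ^ 2 := by
        refine setLIntegral_mono' (measurableSet_Box P r) fun ζ hζ => ?_
        rw [hf₂, hf₁, enorm_mul, enorm_mul, ← mul_assoc, mul_pow, ← mul_assoc]
        refine le_mul_of_one_le_left zero_le ?_
        have a1 := exp_le_gam (h₁ ζ hζ)
        have a2 := exp_le_gam (h₂ ζ hζ)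
        have e0 : ∀ w, ‖(gam w : ℂ)‖ₑ = ENNReal.ofReal (gam w) := fun w => by
          rw [← ofReal_norm, Complex.norm_real, Real.norm_of_nonneg (gam_nonneg w)]
        rw [e0, e0, ← ENNReal.ofReal_mul (gam_nonneg _),
          ← ENNReal.ofReal_pow (mul_nonneg (gam_nonneg _) (gam_nonneg _)),
          ← ENNReal.ofReal_mul (Real.exp_pos _).le, ENNReal.one_le_ofReal]
        have a3 : Real.exp (-π) * Real.exp (-π) ≤ gam (inner ℝ e₂ ζ) * gam (inner ℝ e₁ ζ) :=
          mul_le_mul a2 a1 (Real.exp_pos _).le (gam_nonneg _)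
        have a4 : (Real.exp (-π) * Real.exp (-π)) ^ 2 ≤
            (gam (inner ℝ e₂ ζ) * gam (inner ℝ e₁ ζ)) ^ 2 :=
          pow_le_pow_left₀ (by positivity) a3 2
        calc (1 : ℝ) = Real.exp (4 * π) * (Real.exp (-π) * Real.exp (-π)) ^ 2 := by
              rw [← Real.exp_add, ← Real.exp_nat_mul, ← Real.exp_add, eq_comm, Real.exp_eq_one_iff]
              push_cast; ring
          _ ≤ _ := by gcongr
    _ ≤ ENNReal.ofReal (Real.exp (4 * π)) * ∫⁻ ζ, ‖(𝓕 H₂ : 𝓢(V, ℂ)) ζ‖ₑ ^ 2 := by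
        rw [lintegral_const_mul' _ _ ENNReal.ofReal_ne_top]
        gcongr
        exact Measure.restrict_le_self
    _ = ENNReal.ofReal (Real.exp (4 * π)) * ∫⁻ z, ‖H₂ z‖ₑ ^ 2 := by
        rw [lintegral_schwartz_fourier_sq]
    _ ≤ _ := by
        refine mul_le_mul_right (lintegral_mono fun z => pow_le_pow_left' ?_ 2) _
        rw [hH₂]
        have e0 : ∀ w, ‖(gam w : ℂ)‖ₑ = ENNReal.ofReal (gam w) := fun w => by
          rw [← ofReal_norm, Complex.norm_real, Real.norm_of_nonneg (gam_nonneg w)]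
        refine (enorm_integral_le_lintegral_enorm _).trans (lintegral_mono fun s₂ => ?_)
        simp only
        rw [enorm_mul, e0, hH₁]
        refine (mul_le_mul_right (enorm_integral_le_lintegral_enorm _) _).trans ?_
        rw [← lintegral_const_mul' _ _ ENNReal.ofReal_ne_top]
        refine lintegral_mono fun s₁ => ?_
        simp only
        rw [enorm_mul, e0, ← mul_assoc, ← ENNReal.ofReal_mul (gam_nonneg _), mul_comm (gam s₂),
          show z - s₂ • e₂ - s₁ • e₁ = z - (s₁ • e₁ + s₂ • e₂) by abel]

end Gaussian

section Interpolation

variable {E : Type*} [NormedAddCommGroup E] [InnerProductSpace ℝ E] [FiniteDimensional ℝ E]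
  [MeasurableSpace E] [BorelSpace E]

theorem hasCompactSupport_fourier_sqn {F : ℕ → 𝓢(E, ℂ)} {R : ℝ}
    (hF : ∀ i ξ, (𝓕 (F i) : 𝓢(E, ℂ)) ξ ≠ 0 → ‖ξ‖ ≤ R) (N : ℕ) :
    HasCompactSupport (𝓕 (sqn F N) : 𝓢(E, ℂ)) := by
  refine HasCompactSupport.of_support_subset_isCompact
    (isCompact_closedBall (0 : E) (R + R)) fun ζ hζ => ?_
  rw [Function.mem_support, sqn, fourier_sum_apply] at hζ
  obtain ⟨i, -, hi⟩ := Finset.exists_ne_zero_of_sum_ne_zero hζ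
  obtain ⟨ξ, h1, h2⟩ := fourier_mulConj_ne_zero hi
  rw [mem_closedBall_zero_iff]
  calc ‖ζ‖ = ‖ξ - (ξ - ζ)‖ := by rw [sub_sub_cancel]
    _ ≤ ‖ξ‖ + ‖ξ - ζ‖ := norm_sub_le _ _
    _ ≤ R + R := add_le_add (hF _ _ h1) (hF _ _ h2)

theorem BddCpt.indicator {f : E → ℂ} (hf : BddCpt f) {s : Set E} (hs : MeasurableSet s) :
    BddCpt (s.indicator f) := by
  have h := hf.mul (g := s.indicator fun _ => (1 : ℂ)) (measurable_const.indicator hs) (M := 1)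
    (fun x => by by_cases hx : x ∈ s <;> simp [hx])
  have e : (fun y => s.indicator (fun _ => (1 : ℂ)) y * f y) = s.indicator f := by
    ext x; by_cases hx : x ∈ s <;> simp [hx]
  rwa [e] at h

/-- Marcinkiewicz interpolation between `L¹` and `L^∞` for a family of quadratic expressions. -/
theorem sum_lintegral_sq_le_of_interpolation {α ι : Type*} [MeasurableSpace α] {μ : Measure α}
    (s : Finset ι) (G : ι → (E → ℂ) → α → ℝ≥0∞) {A : ℝ} {B : ℝ≥0∞} (hA : 0 < A)
    (hmeas : ∀ i ∈ s, ∀ f, BddCpt f → Measurable (G i f))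
    (hsub : ∀ i ∈ s, ∀ f g, BddCpt f → BddCpt g → ∀ x,
      G i (fun y => f y + g y) x ≤ 2 * G i f x + 2 * G i g x)
    (hsup : ∀ i ∈ s, ∀ f, BddCpt f → ∀ M : ℝ, 0 ≤ M → (∀ y, ‖f y‖ ≤ M) → ∀ x,
      G i f x ≤ ENNReal.ofReal (A * M ^ 2))
    (hL1 : ∀ f, BddCpt f → ∑ i ∈ s, ∫⁻ x, G i f x ∂μ ≤ B * ∫⁻ y, ‖f y‖ₑ ^ 2)
    {f : E → ℂ} (hf : BddCpt f) :
    ∑ i ∈ s, ∫⁻ x, G i f x ^ 2 ∂μ ≤ ENNReal.ofReal (32 * A) * B * ∫⁻ y, ‖f y‖ₑ ^ 4 := by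
  have hmf := hf.meas
  obtain ⟨M, hM⟩ := hf.bdd
  have hM0 : 0 ≤ M := (norm_nonneg _).trans (hM 0)
  have hfin : ∀ i ∈ s, ∀ x, G i f x ≠ ⊤ := fun i hi x =>
    ((hsup i hi f hf M hM0 hM x).trans_lt ENNReal.ofReal_lt_top).ne
  have hlayer : ∀ i ∈ s, ∫⁻ x, G i f x ^ 2 ∂μ =
      2 * ∫⁻ τ in Ioi (0 : ℝ), μ {x | τ < (G i f x).toReal} * ENNReal.ofReal τ := by
    intro i hi
    have := lintegral_rpow_eq_lintegral_meas_lt_mul μ (f := fun x => (G i f x).toReal)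
      (Filter.Eventually.of_forall fun x => ENNReal.toReal_nonneg)
      (hmeas i hi f hf).ennreal_toReal.aemeasurable (p := 2) two_pos
    rw [show ENNReal.ofReal 2 = 2 by simp] at this
    calc _ = ∫⁻ x, ENNReal.ofReal ((G i f x).toReal ^ (2 : ℝ)) ∂μ := by
          refine lintegral_congr fun x => ?_
          rw [Real.rpow_two, ENNReal.ofReal_pow ENNReal.toReal_nonneg,
            ENNReal.ofReal_toReal (hfin i hi x)]
      _ = _ := by
          rw [this]
          congr 1
          refine lintegral_congr fun τ => ?_
          norm_num
  have hlevel : ∀ τ : ℝ, 0 < τ → ∑ i ∈ s, μ {x | τ < (G i f x).toReal} * ENNReal.ofReal τ ≤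
      4 * B * ∫⁻ y, ({y : E | τ < 4 * A * ‖f y‖ ^ 2}).indicator (fun y => ‖f y‖ₑ ^ 2) y := by
    intro τ hτ
    set S : Set E := {y : E | τ < 4 * A * ‖f y‖ ^ 2} with hS
    have hSm : MeasurableSet S := measurableSet_lt measurable_const (by fun_prop)
    have hf1 := hf.indicator hSm.compl
    have hf2 := hf.indicator hSm
    have hsplit : (fun y => Sᶜ.indicator f y + S.indicator f y) = f := by
      ext y; exact congrFun (Set.indicator_compl_add_self S f) y
    have hsmall : ∀ i ∈ s, ∀ x, G i (Sᶜ.indicator f) x ≤ ENNReal.ofReal (τ / 4) := by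
      intro i hi x
      refine (hsup i hi _ hf1 (Real.sqrt (τ / (4 * A))) (Real.sqrt_nonneg _) (fun y => ?_) x).trans
        (le_of_eq ?_)
      · by_cases hy : y ∈ S
        · rw [indicator_of_notMem (by simpa using hy), norm_zero]; positivity
        · rw [indicator_of_mem (by simpa using hy)]
          refine Real.le_sqrt_of_sq_le ?_
          have : ¬ (τ < 4 * A * ‖f y‖ ^ 2) := hy
          rw [le_div_iff₀ (by positivity)]
          linarith
      · rw [Real.sq_sqrt (by positivity)]
        congr 1
        field_simp
    have hsubset : ∀ i ∈ s, μ {x | τ < (G i f x).toReal} * ENNReal.ofReal τ ≤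
        4 * ∫⁻ x, G i (S.indicator f) x ∂μ := by
      intro i hi
      have h1 : {x | τ < (G i f x).toReal} ⊆ {x | ENNReal.ofReal τ ≤ 4 * G i (S.indicator f) x} := by
        intro x hx
        simp only [mem_ofPred_eq] at hx ⊢
        have h2 : ENNReal.ofReal τ < G i f x := (ENNReal.ofReal_lt_iff_lt_toReal hτ.le (hfin i hi x)).2 hx
        have h3 := hsub i hi _ _ hf1 hf2 x
        rw [hsplit] at h3
        have h4 : ENNReal.ofReal τ ≤ 2 * ENNReal.ofReal (τ / 4) + 2 * G i (S.indicator f) x :=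
          h2.le.trans (h3.trans (by gcongr; exact hsmall i hi x))
        have hg : G i (S.indicator f) x ≠ ⊤ := by
          refine ((hsup i hi _ hf2 M hM0 (fun y => ?_) x).trans_lt ENNReal.ofReal_lt_top).ne
          exact (norm_indicator_le_norm_self _ _).trans (hM y)
        lift G i (S.indicator f) x to NNReal using hg with g
        rw [show (2 : ℝ≥0∞) * ENNReal.ofReal (τ / 4) = ENNReal.ofReal (τ / 2) by
          rw [← ENNReal.ofReal_ofNat, ← ENNReal.ofReal_mul (by norm_num)]; congr 1; ring] at h4
        rw [← ENNReal.ofReal_coe_nnreal, ← ENNReal.ofReal_ofNat 2,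
          ← ENNReal.ofReal_mul (by norm_num), ← ENNReal.ofReal_add (by positivity) (by positivity),
          ENNReal.ofReal_le_ofReal_iff (by positivity)] at h4
        rw [← ENNReal.ofReal_coe_nnreal, ← ENNReal.ofReal_ofNat 4,
          ← ENNReal.ofReal_mul (by norm_num), ENNReal.ofReal_le_ofReal_iff (by positivity)]
        linarith
      calc _ ≤ μ {x | ENNReal.ofReal τ ≤ 4 * G i (S.indicator f) x} * ENNReal.ofReal τ := by
            gcongr
        _ = ENNReal.ofReal τ * μ {x | ENNReal.ofReal τ ≤ 4 * G i (S.indicator f) x} := mul_comm _ _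
        _ ≤ ∫⁻ x, 4 * G i (S.indicator f) x ∂μ :=
            mul_meas_ge_le_lintegral ((hmeas i hi _ hf2).const_mul _) _
        _ = _ := lintegral_const_mul' _ _ (by simp)
    calc _ ≤ ∑ i ∈ s, 4 * ∫⁻ x, G i (S.indicator f) x ∂μ := Finset.sum_le_sum hsubset
      _ = 4 * ∑ i ∈ s, ∫⁻ x, G i (S.indicator f) x ∂μ := by rw [Finset.mul_sum]
      _ ≤ 4 * (B * ∫⁻ y, ‖S.indicator f y‖ₑ ^ 2) := mul_le_mul_right (hL1 _ hf2) _
      _ = _ := by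
          rw [← mul_assoc]
          congr 1
          refine lintegral_congr fun y => ?_
          by_cases hy : y ∈ S <;> simp [hy]
  have hjm : Measurable (Function.uncurry fun (τ : ℝ) (y : E) =>
      ({y : E | τ < 4 * A * ‖f y‖ ^ 2}).indicator (fun y => ‖f y‖ₑ ^ 2) y) := by
    have e : (Function.uncurry fun (τ : ℝ) (y : E) =>
        ({y : E | τ < 4 * A * ‖f y‖ ^ 2}).indicator (fun y => ‖f y‖ₑ ^ 2) y) =
        ({p : ℝ × E | p.1 < 4 * A * ‖f p.2‖ ^ 2}).indicator (fun p => ‖f p.2‖ₑ ^ 2) := by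
      ext p
      simp only [Function.uncurry_def, indicator_apply, mem_ofPred_eq]
    rw [e]
    refine Measurable.indicator ((hmf.comp measurable_snd).enorm.pow_const 2) ?_
    refine measurableSet_lt measurable_fst ?_
    exact ((hmf.comp measurable_snd).norm.pow_const 2).const_mul _
  calc _ = ∑ i ∈ s, 2 * ∫⁻ τ in Ioi (0 : ℝ), μ {x | τ < (G i f x).toReal} * ENNReal.ofReal τ :=
        Finset.sum_congr rfl hlayer
    _ = 2 * ∫⁻ τ in Ioi (0 : ℝ), ∑ i ∈ s, μ {x | τ < (G i f x).toReal} * ENNReal.ofReal τ := by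
        rw [← Finset.mul_sum, lintegral_finsetSum']
        intro i _
        refine AEMeasurable.mul (Antitone.measurable ?_).aemeasurable (by fun_prop)
        intro a b hab
        exact measure_mono fun x hx => lt_of_le_of_lt hab hx
    _ ≤ 2 * ∫⁻ τ in Ioi (0 : ℝ), 4 * B *
        ∫⁻ y, ({y : E | τ < 4 * A * ‖f y‖ ^ 2}).indicator (fun y => ‖f y‖ₑ ^ 2) y :=
        mul_le_mul_right (setLIntegral_mono' measurableSet_Ioi fun τ hτ => hlevel τ hτ) _
    _ ≤ 2 * (4 * B * ∫⁻ τ in Ioi (0 : ℝ),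
        ∫⁻ y, ({y : E | τ < 4 * A * ‖f y‖ ^ 2}).indicator (fun y => ‖f y‖ₑ ^ 2) y) := by
        rw [lintegral_const_mul _ hjm.lintegral_prod_right]
    _ = 2 * (4 * B * ∫⁻ y, ∫⁻ τ in Ioi (0 : ℝ),
        ({y : E | τ < 4 * A * ‖f y‖ ^ 2}).indicator (fun y => ‖f y‖ₑ ^ 2) y) := by
        rw [lintegral_lintegral_swap hjm.aemeasurable]
    _ = 2 * (4 * B * ∫⁻ y, ENNReal.ofReal (4 * A) * ‖f y‖ₑ ^ 4) := by
        congr 2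
        refine lintegral_congr fun y => ?_
        have e : ∀ τ : ℝ, ({y : E | τ < 4 * A * ‖f y‖ ^ 2}).indicator (fun y => ‖f y‖ₑ ^ 2) y =
            (Iio (4 * A * ‖f y‖ ^ 2)).indicator (fun _ => ‖f y‖ₑ ^ 2) τ := by
          intro τ
          simp only [indicator_apply, mem_ofPred_eq, mem_Iio]
        simp only [e]
        rw [lintegral_indicator measurableSet_Iio, lintegral_const, Measure.restrict_restrict
          measurableSet_Iio, Measure.restrict_apply_univ, Iio_inter_Ioi, Real.volume_Ioo, sub_zero,
          ENNReal.ofReal_mul (by positivity), ENNReal.ofReal_pow (norm_nonneg _), ofReal_norm]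
        ring
    _ = _ := by
        rw [lintegral_const_mul' _ _ ENNReal.ofReal_ne_top, ← mul_assoc, ← mul_assoc, ← mul_assoc]
        congr 1
        rw [show (32 : ℝ) * A = 8 * (4 * A) by ring, ENNReal.ofReal_mul (by norm_num : (0:ℝ) ≤ 8),
          ENNReal.ofReal_ofNat]
        ring

end Interpolation

section Averages

variable {E : Type*} [NormedAddCommGroup E] [InnerProductSpace ℝ E] [FiniteDimensional ℝ E]
  [MeasurableSpace E] [BorelSpace E]

/-- Gaussian average along the plane spanned by `e₁`, `e₂`. -/
def gavg (e₁ e₂ : E) (T : E → ℝ≥0∞) (x : E) : ℝ≥0∞ :=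
  ∫⁻ s₂ : ℝ, ∫⁻ s₁ : ℝ, ENNReal.ofReal (gam s₁ * gam s₂) * T (x - (s₁ • e₁ + s₂ • e₂))

theorem measurable_gavg_integrand (e₁ e₂ : E) {T : E → ℝ≥0∞} (hT : Measurable T) :
    Measurable (fun p : E × ℝ × ℝ =>
      ENNReal.ofReal (gam p.2.2 * gam p.2.1) * T (p.1 - (p.2.2 • e₁ + p.2.1 • e₂))) := by
  have hg := continuous_gam.measurable
  refine Measurable.mul (by fun_prop) (hT.comp ?_)
  exact (by fun_prop : Continuous fun p : E × ℝ × ℝ =>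
    p.1 - (p.2.2 • e₁ + p.2.1 • e₂)).measurable

theorem gavg_eq_prod (e₁ e₂ : E) {T : E → ℝ≥0∞} (hT : Measurable T) (x : E) :
    gavg e₁ e₂ T x = ∫⁻ s : ℝ × ℝ,
      ENNReal.ofReal (gam s.2 * gam s.1) * T (x - (s.2 • e₁ + s.1 • e₂)) := by
  rw [gavg, Measure.volume_eq_prod, lintegral_prod]
  exact ((measurable_gavg_integrand e₁ e₂ hT).comp (measurable_prodMk_left (x := x))).aemeasurable

theorem measurable_gavg (e₁ e₂ : E) {T : E → ℝ≥0∞} (hT : Measurable T) :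
    Measurable (gavg e₁ e₂ T) := by
  have : gavg e₁ e₂ T = fun x => ∫⁻ s : ℝ × ℝ,
      ENNReal.ofReal (gam s.2 * gam s.1) * T (x - (s.2 • e₁ + s.1 • e₂)) :=
    funext (gavg_eq_prod e₁ e₂ hT)
  rw [this]
  exact (measurable_gavg_integrand e₁ e₂ hT).lintegral_prod_right'

theorem gavg_mono {e₁ e₂ : E} {T T' : E → ℝ≥0∞} (h : ∀ x, T x ≤ T' x) (x : E) :
    gavg e₁ e₂ T x ≤ gavg e₁ e₂ T' x :=
  lintegral_mono fun _ => lintegral_mono fun _ => mul_le_mul_right (h _) _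

theorem lintegral_gam : ∫⁻ s : ℝ, ENNReal.ofReal (gam s) = 1 := by
  rw [← ofReal_integral_eq_lintegral_ofReal integrable_gam
    (Filter.Eventually.of_forall gam_nonneg)]
  unfold gam
  rw [integral_gaussian, div_self Real.pi_pos.ne', Real.sqrt_one, ENNReal.ofReal_one]

theorem lintegral_gavg (e₁ e₂ : E) {T : E → ℝ≥0∞} (hT : Measurable T) :
    ∫⁻ x, gavg e₁ e₂ T x = ∫⁻ x, T x := by
  simp only [gavg_eq_prod e₁ e₂ hT]
  rw [lintegral_lintegral_swap (measurable_gavg_integrand e₁ e₂ hT).aemeasurable]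
  have e : ∀ s : ℝ × ℝ, ∫⁻ x : E, ENNReal.ofReal (gam s.2 * gam s.1) *
      T (x - (s.2 • e₁ + s.1 • e₂)) = ENNReal.ofReal (gam s.1) * ENNReal.ofReal (gam s.2) *
        ∫⁻ x, T x := by
    intro s
    rw [lintegral_const_mul' _ _ ENNReal.ofReal_ne_top, lintegral_sub_right_eq_self T,
      mul_comm (gam s.2), ENNReal.ofReal_mul (gam_nonneg _)]
  simp only [e]
  have hg : Measurable fun s => ENNReal.ofReal (gam s) := continuous_gam.measurable.ennreal_ofReal
  rw [lintegral_mul_const _ (f := fun y : ℝ × ℝ => ENNReal.ofReal (gam y.1) * ENNReal.ofReal (gam y.2))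
    ((hg.comp measurable_fst).mul (hg.comp measurable_snd)), Measure.volume_eq_prod,
    lintegral_prod_mul hg.aemeasurable hg.aemeasurable, lintegral_gam]
  simp

theorem gam_le (s : ℝ) : gam s ≤ (1 + s ^ 2)⁻¹ := by
  unfold gam
  rw [neg_mul, Real.exp_neg]
  refine inv_anti₀ (by positivity) ?_
  have := Real.add_one_le_exp (π * s ^ 2)
  nlinarith [Real.pi_gt_three, sq_nonneg s]

theorem lintegral_cauchy : ∫⁻ s : ℝ, ENNReal.ofReal ((1 + s ^ 2)⁻¹) = ENNReal.ofReal π := by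
  rw [← ofReal_integral_eq_lintegral_ofReal integrable_inv_one_add_sq
    (Filter.Eventually.of_forall fun s => by positivity), integral_univ_inv_one_add_sq]

/-- Linear parametrisations of the space change integrals by a constant factor. -/
theorem exists_lintegral_comp_linear (Λ : (ℝ × ℝ) ≃L[ℝ] E) : ∃ c : ℝ≥0∞, ∀ (Θ : E → ℝ≥0∞),
    Measurable Θ → ∀ x, ∫⁻ s, Θ (x - Λ s) = c * ∫⁻ y, Θ y := by
  have hm : Measurable Λ := Λ.continuous.measurable
  have : (Measure.map Λ (volume : Measure (ℝ × ℝ))).IsAddHaarMeasure :=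
    Λ.isAddHaarMeasure_map volume
  refine ⟨(Measure.addHaarScalarFactor (Measure.map Λ (volume : Measure (ℝ × ℝ)))
    (volume : Measure E) : NNReal), fun Θ hΘ x => ?_⟩
  have h1 := lintegral_map (μ := volume) (f := fun y => Θ (x - y)) (by fun_prop) hm
  have h2 := congrArg (fun ν : Measure E => ∫⁻ y, Θ (x - y) ∂ν)
    (Measure.isAddLeftInvariant_eq_smul (Measure.map Λ (volume : Measure (ℝ × ℝ)))
      (volume : Measure E))
  rw [← h1, h2, lintegral_smul_measure, lintegral_sub_left_eq_self Θ x]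
  rfl

/-- The average of the square function of a block is bounded for bounded `f`. -/
theorem gavg_le_of_symbol {κ : Type*} (I : Finset κ) {m : κ → E → ℂ} {f : E → ℂ}
    (hm : ∀ i ∈ I, Sym (m i)) (hf : BddCpt f) {b₁ b₂ e₁ e₂ : E} (Λ : (ℝ × ℝ) ≃L[ℝ] E)
    (hΛ : ∀ s, Λ s = s.2 • e₁ + s.1 • e₂) (hb₁ : ∀ s, inner ℝ b₁ (Λ s) = s.2)
    (hb₂ : ∀ s, inner ℝ b₂ (Λ s) = s.1) {A : ℝ≥0∞}
    (h0 : ∀ ξ, ∑ i ∈ I, ‖m i ξ‖ₑ ^ 2 ≤ A)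
    (h1 : ∀ ξ, ∑ i ∈ I, ‖fderiv ℝ (m i) ξ b₁‖ₑ ^ 2 ≤ A)
    (h2 : ∀ ξ, ∑ i ∈ I, ‖fderiv ℝ (m i) ξ b₂‖ₑ ^ 2 ≤ A)
    (h12 : ∀ ξ, ∑ i ∈ I, ‖fderiv ℝ (fun ξ => fderiv ℝ (m i) ξ b₁) ξ b₂‖ₑ ^ 2 ≤ A)
    {M : ℝ} (hM : ∀ y, ‖f y‖ ≤ M) (x : E) :
    gavg e₁ e₂ (fun y => ∑ i ∈ I, ‖mulOp (m i) f y‖ₑ ^ 2) x ≤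
      16 * A * ENNReal.ofReal (π ^ 2 * M ^ 2) := by
  have hcont : ∀ i ∈ I, Continuous (mulOp (m i) f) := fun i hi => by
    rw [funext (mulOp_eq (hm i hi) hf)]
    exact SchwartzMap.continuous _
  have hmeas : Measurable (fun y => ∑ i ∈ I, ‖mulOp (m i) f y‖ₑ ^ 2) :=
    Finset.measurable_fun_sum _ fun i hi => (hcont i hi).measurable.enorm.pow_const 2
  obtain ⟨c, hc⟩ := exists_lintegral_comp_linear Λ
  have hfm := hf.meas
  set w : E → ℝ≥0∞ := fun y => ENNReal.ofReal
    (affW b₁ (-inner ℝ b₁ x) y * affW b₂ (-inner ℝ b₂ x) y) with hw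
  have hwm : Measurable w :=
    ((continuous_affW _ _).mul (continuous_affW _ _)).measurable.ennreal_ofReal
  have hwx : ∀ s, w (x - Λ s) = ENNReal.ofReal ((1 + s.2 ^ 2)⁻¹ * (1 + s.1 ^ 2)⁻¹) := by
    intro s
    simp only [hw, affW, inner_sub_right, hb₁, hb₂]
    congr 4 <;> ring
  rw [gavg_eq_prod _ _ hmeas]
  calc _ ≤ ∫⁻ s, w (x - Λ s) * ∑ i ∈ I, ‖mulOp (m i) f (x - Λ s)‖ₑ ^ 2 := by
        refine lintegral_mono fun s => ?_
        simp only
        rw [hΛ, ← hΛ s, hwx]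
        gcongr
        · exact gam_nonneg _
        · exact gam_le _
        · exact gam_le _
    _ = c * ∫⁻ y, w y * ∑ i ∈ I, ‖mulOp (m i) f y‖ₑ ^ 2 :=
        hc (fun y => w y * ∑ i ∈ I, ‖mulOp (m i) f y‖ₑ ^ 2) (hwm.mul hmeas) x
    _ = c * ∑ i ∈ I, ∫⁻ y, ‖mulOp (m i) f y‖ₑ ^ 2 * w y := by
        congr 1
        rw [← lintegral_finsetSum]
        · refine lintegral_congr fun y => ?_
          rw [mul_comm, Finset.sum_mul]
        · exact fun i hi => ((hcont i hi).measurable.enorm.pow_const 2).mul hwm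
    _ ≤ c * (16 * A * ∫⁻ y, ‖f y‖ₑ ^ 2 * w y) := by
        gcongr
        exact sum_lintegral_mulOp_weighted I hm hf b₁ b₂ _ _ h0 h1 h2 h12
    _ ≤ c * (16 * A * (ENNReal.ofReal (M ^ 2) * ∫⁻ y, w y)) := by
        refine mul_le_mul_right (mul_le_mul_right ?_ _) _
        rw [← lintegral_const_mul' _ _ ENNReal.ofReal_ne_top]
        refine lintegral_mono fun y => mul_le_mul_left ?_ _
        rw [← ofReal_norm, ← ENNReal.ofReal_pow (norm_nonneg _)]
        exact ENNReal.ofReal_le_ofReal (pow_le_pow_left₀ (norm_nonneg _) (hM y) 2)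
    _ = 16 * A * (ENNReal.ofReal (M ^ 2) * ∫⁻ s, w (x - Λ s)) := by
        rw [hc w hwm x]; ring
    _ = _ := by
        simp only [hwx]
        have e : ∀ s : ℝ × ℝ, ENNReal.ofReal ((1 + s.2 ^ 2)⁻¹ * (1 + s.1 ^ 2)⁻¹) =
            ENNReal.ofReal ((1 + s.1 ^ 2)⁻¹) * ENNReal.ofReal ((1 + s.2 ^ 2)⁻¹) := fun s => by
          rw [mul_comm, ENNReal.ofReal_mul (by positivity)]
        simp only [e]
        have hg : Measurable fun s : ℝ => ENNReal.ofReal ((1 + s ^ 2)⁻¹) := by fun_prop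
        rw [Measure.volume_eq_prod, lintegral_prod_mul hg.aemeasurable hg.aemeasurable,
          lintegral_cauchy, ← ENNReal.ofReal_mul Real.pi_pos.le,
          ← ENNReal.ofReal_mul (sq_nonneg _)]
        congr 2; ring

end Averages

section Blocks

variable {E : Type*} [NormedAddCommGroup E] [InnerProductSpace ℝ E] [FiniteDimensional ℝ E]
  [MeasurableSpace E] [BorelSpace E]

/-- Multiplication of a multiplier by a character. -/
def modu (y : E) (m : E → ℂ) (ξ : E) : ℂ :=
  Complex.exp (↑(2 * π * inner ℝ ξ y) * Complex.I) * m ξ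

theorem contDiff_character (y : E) :
    ContDiff ℝ ∞ (fun ξ : E => Complex.exp (↑(2 * π * inner ℝ ξ y) * Complex.I)) := by
  refine ContDiff.cexp ?_
  refine ContDiff.mul (Complex.ofRealCLM.contDiff.comp ?_) contDiff_const
  exact contDiff_const.mul (contDiff_id.inner ℝ contDiff_const)

theorem Sym.modu {m : E → ℂ} (hm : Sym m) (y : E) : Sym (modu y m) :=
  ⟨(contDiff_character y).mul hm.smooth, hm.cpt.mul_left⟩

theorem mulOp_modu (y : E) (m f : E → ℂ) (x : E) :
    mulOp (modu y m) f x = mulOp m f (x + y) := by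
  unfold mulOp modu
  rw [Real.fourierInv_eq', Real.fourierInv_eq']
  refine integral_congr_ae (Filter.Eventually.of_forall fun ξ => ?_)
  simp only [smul_eq_mul]
  rw [inner_add_right, mul_add, Complex.ofReal_add, add_mul, Complex.exp_add]
  ring

theorem Sym.continuous_mulOp {m f : E → ℂ} (hm : Sym m) (hf : BddCpt f) :
    Continuous (mulOp m f) := by
  rw [funext (mulOp_eq hm hf)]
  exact SchwartzMap.continuous _

theorem gavg_comp_add (e₁ e₂ : E) (T : E → ℝ≥0∞) (y x : E) :
    gavg e₁ e₂ (fun z => T (z + y)) x = gavg e₁ e₂ T (x + y) := by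
  unfold gavg
  simp only [sub_add_eq_add_sub]

theorem gavg_two_add (e₁ e₂ : E) {T T' : E → ℝ≥0∞} (hT : Measurable T) (hT' : Measurable T')
    (x : E) : gavg e₁ e₂ (fun z => 2 * T z + 2 * T' z) x =
      2 * gavg e₁ e₂ T x + 2 * gavg e₁ e₂ T' x := by
  have hs : Measurable fun s : ℝ × ℝ => ENNReal.ofReal (gam s.2 * gam s.1) *
      T (x - (s.2 • e₁ + s.1 • e₂)) := by
    have hg := continuous_gam.measurable
    refine Measurable.mul (by fun_prop) (hT.comp ?_)
    exact (by fun_prop : Continuous fun s : ℝ × ℝ => x - (s.2 • e₁ + s.1 • e₂)).measurable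
  have hTT : Measurable fun z => 2 * T z + 2 * T' z := (hT.const_mul 2).add (hT'.const_mul 2)
  rw [gavg_eq_prod e₁ e₂ hTT, gavg_eq_prod e₁ e₂ hT, gavg_eq_prod e₁ e₂ hT',
    ← lintegral_const_mul' _ _ (by simp),
    ← lintegral_const_mul' _ _ (by simp), ← lintegral_add_left (f := fun s : ℝ × ℝ => 2 * (ENNReal.ofReal (gam s.2 * gam s.1) *
      T (x - (s.2 • e₁ + s.1 • e₂)))) (hs.const_mul 2)]
  refine lintegral_congr fun s => ?_
  ring

/-- `L⁴` bound for averaged square functions over blocks of multipliers. -/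
theorem sum_lintegral_gavg_sq_le {ι κ : Type*} (J : Finset ι) (I : ι → Finset κ) {m : κ → E → ℂ}
    (hm : ∀ j ∈ J, ∀ i ∈ I j, Sym (m i)) (y e₁ e₂ b₁ b₂ : ι → E) (Λ : ι → (ℝ × ℝ) ≃L[ℝ] E)
    (hΛ : ∀ j ∈ J, ∀ s, Λ j s = s.2 • e₁ j + s.1 • e₂ j)
    (hb₁ : ∀ j ∈ J, ∀ s, inner ℝ (b₁ j) (Λ j s) = s.2)
    (hb₂ : ∀ j ∈ J, ∀ s, inner ℝ (b₂ j) (Λ j s) = s.1) {A : ℝ} {B : ℝ≥0∞} (hA : 0 < A)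
    (h0 : ∀ j ∈ J, ∀ ξ, ∑ i ∈ I j, ‖modu (y j) (m i) ξ‖ₑ ^ 2 ≤ ENNReal.ofReal A)
    (h1 : ∀ j ∈ J, ∀ ξ,
      ∑ i ∈ I j, ‖fderiv ℝ (modu (y j) (m i)) ξ (b₁ j)‖ₑ ^ 2 ≤ ENNReal.ofReal A)
    (h2 : ∀ j ∈ J, ∀ ξ,
      ∑ i ∈ I j, ‖fderiv ℝ (modu (y j) (m i)) ξ (b₂ j)‖ₑ ^ 2 ≤ ENNReal.ofReal A)
    (h12 : ∀ j ∈ J, ∀ ξ, ∑ i ∈ I j,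
      ‖fderiv ℝ (fun ξ => fderiv ℝ (modu (y j) (m i)) ξ (b₁ j)) ξ (b₂ j)‖ₑ ^ 2 ≤ ENNReal.ofReal A)
    (hB : ∀ ξ, ∑ j ∈ J, ∑ i ∈ I j, ‖m i ξ‖ₑ ^ 2 ≤ B) {f : E → ℂ} (hf : BddCpt f) :
    ∑ j ∈ J, ∫⁻ x, gavg (e₁ j) (e₂ j) (fun z => ∑ i ∈ I j, ‖mulOp (m i) f z‖ₑ ^ 2) x ^ 2 ≤
      ENNReal.ofReal (32 * (16 * A * π ^ 2)) * B * ∫⁻ x, ‖f x‖ₑ ^ 4 := by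
  have hmeas : ∀ j ∈ J, ∀ f, BddCpt f → Measurable fun z => ∑ i ∈ I j, ‖mulOp (m i) f z‖ₑ ^ 2 :=
    fun j hj f hf => Finset.measurable_fun_sum _ fun i hi =>
      ((hm j hj i hi).continuous_mulOp hf).measurable.enorm.pow_const 2
  refine sum_lintegral_sq_le_of_interpolation (μ := (volume : Measure E)) J
    (fun j f => gavg (e₁ j) (e₂ j) (fun z => ∑ i ∈ I j, ‖mulOp (m i) f z‖ₑ ^ 2))
    (by positivity) (fun j hj f hf => measurable_gavg _ _ (hmeas j hj f hf)) ?_ ?_ ?_ hf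
  · intro j hj f g hf hg x
    have key : ∀ z, ∑ i ∈ I j, ‖mulOp (m i) (fun y => f y + g y) z‖ₑ ^ 2 ≤
        2 * ∑ i ∈ I j, ‖mulOp (m i) f z‖ₑ ^ 2 + 2 * ∑ i ∈ I j, ‖mulOp (m i) g z‖ₑ ^ 2 := by
      intro z
      rw [Finset.mul_sum, Finset.mul_sum, ← Finset.sum_add_distrib]
      refine Finset.sum_le_sum fun i hi => ?_
      rw [mulOp_add (hm j hj i hi) hf hg]
      have h := ENNReal.ofReal_le_ofReal (show ‖mulOp (m i) f z + mulOp (m i) g z‖ ^ 2 ≤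
          2 * ‖mulOp (m i) f z‖ ^ 2 + 2 * ‖mulOp (m i) g z‖ ^ 2 by
        nlinarith [norm_add_le (mulOp (m i) f z) (mulOp (m i) g z),
          norm_nonneg (mulOp (m i) f z + mulOp (m i) g z),
          sq_nonneg (‖mulOp (m i) f z‖ - ‖mulOp (m i) g z‖)])
      rw [ENNReal.ofReal_add (by positivity) (by positivity), ENNReal.ofReal_mul (by norm_num),
        ENNReal.ofReal_mul (by norm_num), ENNReal.ofReal_pow (norm_nonneg _),
        ENNReal.ofReal_pow (norm_nonneg _), ENNReal.ofReal_pow (norm_nonneg _), ofReal_norm,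
        ofReal_norm, ofReal_norm, ENNReal.ofReal_ofNat] at h
      exact h
    refine (gavg_mono key x).trans (le_of_eq ?_)
    have hm1 := hmeas j hj f hf
    have hm2 := hmeas j hj g hg
    exact gavg_two_add _ _ hm1 hm2 x
  · intro j hj f hf M hM hb x
    have e : gavg (e₁ j) (e₂ j) (fun z => ∑ i ∈ I j, ‖mulOp (m i) f z‖ₑ ^ 2) x =
        gavg (e₁ j) (e₂ j) (fun z => ∑ i ∈ I j, ‖mulOp (modu (y j) (m i)) f z‖ₑ ^ 2)
          (x - y j) := by
      simp only [mulOp_modu]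
      rw [gavg_comp_add _ _ (fun z => ∑ i ∈ I j, ‖mulOp (m i) f z‖ₑ ^ 2), sub_add_cancel]
    rw [e]
    have h := gavg_le_of_symbol (I j) (m := fun i => modu (y j) (m i))
      (fun i hi => (hm j hj i hi).modu (y j)) hf (Λ j) (hΛ j hj)
      (hb₁ j hj) (hb₂ j hj) (h0 j hj) (h1 j hj) (h2 j hj) (h12 j hj) hb (x - y j)
    refine h.trans (le_of_eq ?_)
    rw [← ENNReal.ofReal_ofNat, ← ENNReal.ofReal_mul (by norm_num),
      ← ENNReal.ofReal_mul (by positivity)]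
    congr 1
    ring
  · intro f hf
    calc _ = ∑ j ∈ J, ∑ i ∈ I j, ∫⁻ x, ‖mulOp (m i) f x‖ₑ ^ 2 := by
          refine Finset.sum_congr rfl fun j hj => ?_
          rw [lintegral_gavg _ _ (hmeas j hj f hf), lintegral_finsetSum]
          exact fun i hi => ((hm j hj i hi).continuous_mulOp hf).measurable.enorm.pow_const 2
      _ = ∑ p ∈ J.sigma I, ∫⁻ x, ‖mulOp (m p.2) f x‖ₑ ^ 2 := by rw [Finset.sum_sigma]
      _ ≤ _ := by
          refine sum_lintegral_mulOp_sq_le _ (m := fun p : (_ : ι) × κ => m p.2) (fun p hp => ?_)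
            hf fun ξ => ?_
          · rw [Finset.mem_sigma] at hp
            exact hm _ hp.1 _ hp.2
          · rw [Finset.sum_sigma]
            exact hB ξ

end Blocks

section Jets

variable {E : Type*} [NormedAddCommGroup E] [NormedSpace ℝ E]

/-- Bounds for a function and its derivatives in the directions `b₁`, `b₂`, `b₁b₂`. -/
def JetB (U : Set E) (b₁ b₂ : E) (f : E → ℂ) (M : ℝ) : Prop :=
  ∃ f₁ f₂ f₁₂ : E → ℂ, ∀ ξ ∈ U, HasLineDerivAt ℝ f (f₁ ξ) ξ b₁ ∧ HasLineDerivAt ℝ f (f₂ ξ) ξ b₂ ∧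
    HasLineDerivAt ℝ f₁ (f₁₂ ξ) ξ b₂ ∧ ‖f ξ‖ ≤ M ∧ ‖f₁ ξ‖ ≤ M ∧ ‖f₂ ξ‖ ≤ M ∧ ‖f₁₂ ξ‖ ≤ M

/-- Bounds for the derivatives of a real function in the directions `b₁`, `b₂`, `b₁b₂`. -/
def JetR (U : Set E) (b₁ b₂ : E) (g : E → ℝ) (M : ℝ) : Prop :=
  ∃ g₁ g₂ g₁₂ : E → ℝ, ∀ ξ ∈ U, HasLineDerivAt ℝ g (g₁ ξ) ξ b₁ ∧ HasLineDerivAt ℝ g (g₂ ξ) ξ b₂ ∧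
    HasLineDerivAt ℝ g₁ (g₁₂ ξ) ξ b₂ ∧ |g₁ ξ| ≤ M ∧ |g₂ ξ| ≤ M ∧ |g₁₂ ξ| ≤ M

theorem hasLineDerivAt_mul {f g : E → ℂ} {f' g' : ℂ} {ξ b : E} (hf : HasLineDerivAt ℝ f f' ξ b)
    (hg : HasLineDerivAt ℝ g g' ξ b) :
    HasLineDerivAt ℝ (fun ξ => f ξ * g ξ) (f' * g ξ + f ξ * g') ξ b := by
  have := HasDerivAt.mul hf hg
  simp only [zero_smul, add_zero] at this
  exact this

theorem hasLineDerivAt_comp {Φ : ℝ → ℂ} {Φ' : ℂ} {g : E → ℝ} {g' : ℝ} {ξ b : E}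
    (hΦ : HasDerivAt Φ Φ' (g ξ)) (hg : HasLineDerivAt ℝ g g' ξ b) :
    HasLineDerivAt ℝ (fun ξ => Φ (g ξ)) (g' * Φ') ξ b := by
  have h0 : HasDerivAt Φ Φ' (g (ξ + (0 : ℝ) • b)) := by simpa using hΦ
  have := HasDerivAt.scomp (0 : ℝ) h0 hg
  rw [Complex.real_smul] at this
  exact this

theorem hasLineDerivAt_ofReal {g : E → ℝ} {g' : ℝ} {ξ b : E} (hg : HasLineDerivAt ℝ g g' ξ b) :
    HasLineDerivAt ℝ (fun ξ => (g ξ : ℂ)) (g' : ℂ) ξ b :=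
  HasDerivAt.ofReal_comp hg

theorem JetB.mul {U : Set E} {b₁ b₂ : E} {f g : E → ℂ} {M M' : ℝ} (hM : 0 ≤ M)
    (hf : JetB U b₁ b₂ f M) (hg : JetB U b₁ b₂ g M') :
    JetB U b₁ b₂ (fun ξ => f ξ * g ξ) (4 * (M * M')) := by
  obtain ⟨f₁, f₂, f₁₂, hf⟩ := hf
  obtain ⟨g₁, g₂, g₁₂, hg⟩ := hg
  refine ⟨fun ξ => f₁ ξ * g ξ + f ξ * g₁ ξ, fun ξ => f₂ ξ * g ξ + f ξ * g₂ ξ,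
    fun ξ => (f₁₂ ξ * g ξ + f₁ ξ * g₂ ξ) + (f₂ ξ * g₁ ξ + f ξ * g₁₂ ξ), fun ξ hξ => ?_⟩
  obtain ⟨a1, a2, a3, a4, a5, a6, a7⟩ := hf ξ hξ
  obtain ⟨c1, c2, c3, c4, c5, c6, c7⟩ := hg ξ hξ
  have key : ∀ {x y : ℂ}, ‖x‖ ≤ M → ‖y‖ ≤ M' → ‖x * y‖ ≤ M * M' := fun hx hy => by
    rw [norm_mul]; exact mul_le_mul hx hy (norm_nonneg _) hM
  have hMM : 0 ≤ M * M' := (norm_nonneg _).trans (key a4 c4)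
  refine ⟨hasLineDerivAt_mul a1 c1, hasLineDerivAt_mul a2 c2,
    HasDerivAt.add (hasLineDerivAt_mul a3 c2) (hasLineDerivAt_mul a2 c3), ?_, ?_, ?_, ?_⟩
  · linarith [key a4 c4]
  · linarith [norm_add_le (f₁ ξ * g ξ) (f ξ * g₁ ξ), key a5 c4, key a4 c5]
  · linarith [norm_add_le (f₂ ξ * g ξ) (f ξ * g₂ ξ), key a6 c4, key a4 c6]
  · linarith [norm_add_le (f₁₂ ξ * g ξ + f₁ ξ * g₂ ξ) (f₂ ξ * g₁ ξ + f ξ * g₁₂ ξ),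
      norm_add_le (f₁₂ ξ * g ξ) (f₁ ξ * g₂ ξ), norm_add_le (f₂ ξ * g₁ ξ) (f ξ * g₁₂ ξ),
      key a7 c4, key a5 c6, key a6 c5, key a4 c7]

/-- Bounded functions of one variable with two bounded derivatives. -/
def Bdd2 (Φ : ℝ → ℂ) (B : ℝ) : Prop :=
  ContDiff ℝ ∞ Φ ∧ ∀ x, ‖Φ x‖ ≤ B ∧ ‖deriv Φ x‖ ≤ B ∧ ‖deriv (deriv Φ) x‖ ≤ B

theorem JetR.comp {U : Set E} {b₁ b₂ : E} {g : E → ℝ} {M : ℝ} (hM : 1 ≤ M) {Φ : ℝ → ℂ} {B : ℝ}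
    (hΦ : Bdd2 Φ B) (hg : JetR U b₁ b₂ g M) :
    JetB U b₁ b₂ (fun ξ => Φ (g ξ)) (2 * (B * M ^ 2)) := by
  obtain ⟨g₁, g₂, g₁₂, hg⟩ := hg
  have hB : 0 ≤ B := (norm_nonneg _).trans (hΦ.2 0).1
  have hd1 : ∀ x, HasDerivAt Φ (deriv Φ x) x := fun x =>
    ((hΦ.1.differentiable (by simp)) x).hasDerivAt
  have hd2 : ∀ x, HasDerivAt (deriv Φ) (deriv (deriv Φ) x) x := fun x =>
    (((contDiff_infty_iff_deriv.1 hΦ.1).2.differentiable (by simp)) x).hasDerivAt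
  refine ⟨fun ξ => g₁ ξ * deriv Φ (g ξ), fun ξ => g₂ ξ * deriv Φ (g ξ),
    fun ξ => g₁₂ ξ * deriv Φ (g ξ) + g₁ ξ * (g₂ ξ * deriv (deriv Φ) (g ξ)), fun ξ hξ => ?_⟩
  obtain ⟨a1, a2, a3, a4, a5, a6⟩ := hg ξ hξ
  obtain ⟨B0, B1, B2⟩ := hΦ.2 (g ξ)
  have key : ∀ {x : ℝ} {y : ℂ}, |x| ≤ M → ‖y‖ ≤ B → ‖(x : ℂ) * y‖ ≤ B * M := fun hx hy => by
    rw [norm_mul, Complex.norm_real, Real.norm_eq_abs, mul_comm B]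
    exact mul_le_mul hx hy (norm_nonneg _) (by linarith)
  have hM2 : B * M ≤ B * M ^ 2 := by gcongr; nlinarith
  have hM1 : B ≤ B * M := le_mul_of_one_le_right hB hM
  refine ⟨hasLineDerivAt_comp (hd1 _) a1, hasLineDerivAt_comp (hd1 _) a2,
    hasLineDerivAt_mul (hasLineDerivAt_ofReal a3) (hasLineDerivAt_comp (hd2 _) a2), ?_, ?_, ?_, ?_⟩
  · linarith
  · linarith [key a4 B1]
  · linarith [key a5 B1]
  · have h3 : ‖(g₁ ξ : ℂ) * (g₂ ξ * deriv (deriv Φ) (g ξ))‖ ≤ M * (B * M) := by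
      rw [norm_mul, Complex.norm_real, Real.norm_eq_abs]
      exact mul_le_mul a4 (key a5 B2) (norm_nonneg _) (by linarith)
    have := norm_add_le ((g₁₂ ξ : ℂ) * deriv Φ (g ξ)) (g₁ ξ * (g₂ ξ * deriv (deriv Φ) (g ξ)))
    nlinarith [key a6 B1]

theorem JetB.fderiv_le {U : Set E} (hU : IsOpen U) {b₁ b₂ : E} {f : E → ℂ} {M : ℝ}
    (h : JetB U b₁ b₂ f M) (hf : ContDiff ℝ ∞ f) {ξ : E} (hξ : ξ ∈ U) :
    ‖f ξ‖ ≤ M ∧ ‖fderiv ℝ f ξ b₁‖ ≤ M ∧ ‖fderiv ℝ f ξ b₂‖ ≤ M ∧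
      ‖fderiv ℝ (fun ξ => fderiv ℝ f ξ b₁) ξ b₂‖ ≤ M := by
  obtain ⟨f₁, f₂, f₁₂, h⟩ := h
  have hd : Differentiable ℝ f := hf.differentiable (by simp)
  have e1 : ∀ η ∈ U, fderiv ℝ f η b₁ = f₁ η := fun η hη => by
    rw [← (hd η).lineDeriv_eq_fderiv, (h η hη).1.lineDeriv]
  obtain ⟨a1, a2, a3, a4, a5, a6, a7⟩ := h ξ hξ
  refine ⟨a4, by rwa [e1 ξ hξ], by rwa [← (hd ξ).lineDeriv_eq_fderiv, a2.lineDeriv], ?_⟩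
  have hd2 : DifferentiableAt ℝ (fun ξ => fderiv ℝ f ξ b₁) ξ :=
    (((hf.fderiv_right (m := ∞) (by simp)).clm_apply contDiff_const).differentiable (by simp)) ξ
  have hev : (fun ξ => fderiv ℝ f ξ b₁) =ᶠ[nhds ξ] f₁ :=
    Filter.eventually_of_mem (hU.mem_nhds hξ) e1
  rwa [hev.fderiv_eq, ← (hd2.congr_of_eventuallyEq hev.symm).lineDeriv_eq_fderiv, a3.lineDeriv]

end Jets

section Cone

theorem normSq_eq_coords (ξ : ℂ) : ‖ξ‖ ^ 2 = ξ.re ^ 2 + ξ.im ^ 2 := by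
  rw [Complex.sq_norm, Complex.normSq_apply]; ring

theorem hasLineDerivAt_re (ξ b : ℂ) : HasLineDerivAt ℝ (fun ξ : ℂ => ξ.re) b.re ξ b := by
  have : HasDerivAt (fun t : ℝ => ξ.re + t * b.re) (1 * b.re) 0 :=
    ((hasDerivAt_id (0 : ℝ)).mul_const b.re).const_add _
  simpa [HasLineDerivAt] using this

theorem hasLineDerivAt_im (ξ b : ℂ) : HasLineDerivAt ℝ (fun ξ : ℂ => ξ.im) b.im ξ b := by
  have : HasDerivAt (fun t : ℝ => ξ.im + t * b.im) (1 * b.im) 0 :=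
    ((hasDerivAt_id (0 : ℝ)).mul_const b.im).const_add _
  simpa [HasLineDerivAt] using this

theorem hasLineDerivAt_norm {ξ : ℂ} (b : ℂ) (h : ξ ≠ 0) :
    HasLineDerivAt ℝ (fun ξ : ℂ => ‖ξ‖) ((ξ.re * b.re + ξ.im * b.im) / ‖ξ‖) ξ b := by
  have h1 : HasDerivAt (fun t : ℝ => ξ + t • b) b 0 := by
    simpa using ((hasDerivAt_id (0 : ℝ)).smul_const b).const_add ξ
  have h2 := h1.norm_sq
  have h3 := h2.sqrt (by simpa using h)
  simp only [zero_smul, add_zero, Real.sqrt_sq (norm_nonneg _)] at h3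
  refine h3.congr_deriv ?_
  rw [Complex.inner]
  simp
  field_simp

theorem hasLineDerivAt_dot_div_norm {ξ : ℂ} (b b' : ℂ) (h : ξ ≠ 0) :
    HasLineDerivAt ℝ (fun ξ : ℂ => (ξ.re * b.re + ξ.im * b.im) / ‖ξ‖)
      ((b'.re * b.re + b'.im * b.im) / ‖ξ‖ -
        (ξ.re * b.re + ξ.im * b.im) * (ξ.re * b'.re + ξ.im * b'.im) / ‖ξ‖ ^ 3) ξ b' := by
  have h0 : ‖ξ‖ ≠ 0 := by simpa using h
  have := HasDerivAt.div (HasDerivAt.add (HasDerivAt.mul_const (hasLineDerivAt_re ξ b') b.re)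
    (HasDerivAt.mul_const (hasLineDerivAt_im ξ b') b.im)) (hasLineDerivAt_norm b' h)
    (by simpa using h)
  simp only [Pi.add_apply, zero_smul, add_zero] at this
  refine HasDerivAt.congr_deriv this ?_
  field_simp

/-- The projective coordinate on the light cone. -/
def slope (ξ : ℂ) : ℝ := ξ.im / (‖ξ‖ + ξ.re)

theorem hasLineDerivAt_slope {ξ : ℂ} (b : ℂ) (h : ξ ≠ 0) (ha : ‖ξ‖ + ξ.re ≠ 0) :
    HasLineDerivAt ℝ slope ((b.im * ξ.re - b.re * ξ.im) / (‖ξ‖ * (‖ξ‖ + ξ.re))) ξ b := by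
  have h0 : ‖ξ‖ ≠ 0 := by simpa using h
  have := HasDerivAt.div (hasLineDerivAt_im ξ b)
    (HasDerivAt.add (hasLineDerivAt_norm b h) (hasLineDerivAt_re ξ b)) (by simpa using ha)
  simp only [Pi.add_apply, zero_smul, add_zero] at this
  refine HasDerivAt.congr_deriv this ?_
  field_simp
  linear_combination b.im * normSq_eq_coords ξ

theorem hasLineDerivAt_slope_deriv {ξ : ℂ} (b b' : ℂ) (h : ξ ≠ 0) (ha : ‖ξ‖ + ξ.re ≠ 0) :
    HasLineDerivAt ℝ (fun ξ : ℂ => (b.im * ξ.re - b.re * ξ.im) / (‖ξ‖ * (‖ξ‖ + ξ.re)))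
      ((b.im * b'.re - b.re * b'.im) / (‖ξ‖ * (‖ξ‖ + ξ.re)) -
        (b.im * ξ.re - b.re * ξ.im) * ((ξ.re * b'.re + ξ.im * b'.im) / ‖ξ‖ * (2 * ‖ξ‖ + ξ.re) +
          ‖ξ‖ * b'.re) / (‖ξ‖ * (‖ξ‖ + ξ.re)) ^ 2) ξ b' := by
  have h0 : ‖ξ‖ ≠ 0 := by simpa using h
  have hn := hasLineDerivAt_norm b' h
  have := HasDerivAt.div (HasDerivAt.sub (HasDerivAt.const_mul b.im (hasLineDerivAt_re ξ b'))
    (HasDerivAt.const_mul b.re (hasLineDerivAt_im ξ b')))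
    (HasDerivAt.mul hn (HasDerivAt.add hn (hasLineDerivAt_re ξ b')))
    (by simpa using ⟨h, ha⟩)
  simp only [Pi.add_apply, Pi.sub_apply, Pi.mul_apply, zero_smul, add_zero] at this
  refine HasDerivAt.congr_deriv this ?_
  field_simp
  ring

/-- A sector of the annulus around the direction with slope `w`. -/
def sector (w δ : ℝ) : Set ℂ := {ξ | 0.99 < ‖ξ‖ ∧ ‖ξ‖ < 2.01 ∧ -0.26 < ξ.re ∧
  |ξ.im - w * (‖ξ‖ + ξ.re)| < δ * (‖ξ‖ + ξ.re)}

theorem isOpen_sector (w δ : ℝ) : IsOpen (sector w δ) := by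
  have hre : Continuous fun ξ : ℂ => ξ.re := Complex.continuous_re
  have him : Continuous fun ξ : ℂ => ξ.im := Complex.continuous_im
  have h4 : IsOpen {ξ : ℂ | |ξ.im - w * (‖ξ‖ + ξ.re)| < δ * (‖ξ‖ + ξ.re)} :=
    isOpen_lt (by fun_prop) (by fun_prop)
  exact (isOpen_lt continuous_const continuous_norm).inter
    ((isOpen_lt continuous_norm continuous_const).inter ((isOpen_lt continuous_const hre).inter h4))

theorem sector_bounds {w δ c d : ℝ} (hw : (1 + w ^ 2) * c = 1 - w ^ 2)
    (hw' : (1 + w ^ 2) * d = 2 * w) (hδ : 0 ≤ δ) {ξ : ℂ} (hξ : ξ ∈ sector w δ) :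
    ξ ≠ 0 ∧ 0.73 ≤ ‖ξ‖ + ξ.re ∧ ‖ξ‖ + ξ.re ≤ 4.1 ∧ |ξ.re| ≤ 2.01 ∧ |ξ.re * c + ξ.im * d| ≤ 2.01 ∧
    |‖ξ‖ - (ξ.re * c + ξ.im * d)| ≤ 5 * δ ^ 2 ∧ |ξ.im * c - ξ.re * d| ≤ 5 * δ := by
  obtain ⟨h1, h2, h3, h4⟩ := hξ
  have hn := normSq_eq_coords ξ
  have hcd : c ^ 2 + d ^ 2 = 1 := by
    have : (1 + w ^ 2) ^ 2 * (c ^ 2 + d ^ 2) = (1 + w ^ 2) ^ 2 * 1 := by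
      linear_combination ((1 + w ^ 2) * c + (1 - w ^ 2)) * hw + ((1 + w ^ 2) * d + 2 * w) * hw'
    exact mul_left_cancel₀ (by positivity) this
  set ρ := ‖ξ‖
  set x := ξ.re
  set y := ξ.im
  have hre : |x| ≤ ρ := abs_le_of_sq_le_sq (by nlinarith) (by linarith)
  have hX : |x * c + y * d| ≤ ρ := by
    refine abs_le_of_sq_le_sq ?_ (by linarith)
    nlinarith [sq_nonneg (x * d - y * c)]
  have ha : 0.73 ≤ ρ + x := by linarith
  have ha' : ρ + x ≤ 4.1 := by linarith [le_abs_self x]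
  have hX' := abs_le.1 hX
  have key : (ρ + x) * ((1 + w ^ 2) * (ρ - (x * c + y * d))) = (y - w * (ρ + x)) ^ 2 := by
    linear_combination (-(ρ + x) * x) * hw - (ρ + x) * y * hw' + hn
  have h5 : (y - w * (ρ + x)) ^ 2 ≤ (δ * (ρ + x)) ^ 2 := by
    rw [← sq_abs (y - _)]; exact pow_le_pow_left₀ (abs_nonneg _) h4.le 2
  have h6 : ρ - (x * c + y * d) ≤ 5 * δ ^ 2 := by
    have e1 : (ρ + x) * (ρ - (x * c + y * d)) ≤ (ρ + x) * (5 * δ ^ 2) := by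
      have : (ρ + x) * (ρ - (x * c + y * d)) ≤ (ρ + x) * ((1 + w ^ 2) * (ρ - (x * c + y * d))) := by
        refine mul_le_mul_of_nonneg_left ?_ (by linarith)
        nlinarith [sq_nonneg w]
      refine this.trans (key.trans_le (h5.trans ?_))
      have : (ρ + x) * (ρ + x) * δ ^ 2 ≤ (ρ + x) * 5 * δ ^ 2 := by
        gcongr; linarith
      linarith
    exact le_of_mul_le_mul_left e1 (by linarith)
  refine ⟨fun h => ?_, ha, ha', by linarith, by linarith, by rw [abs_of_nonneg (by linarith)]; exact h6, ?_⟩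
  · have : ρ = 0 := by simp [ρ, h]
    linarith
  · refine abs_le_of_sq_le_sq ?_ (by linarith)
    have e2 : (y * c - x * d) ^ 2 = (ρ - (x * c + y * d)) * (ρ + (x * c + y * d)) := by
      linear_combination (x ^ 2 + y ^ 2) * hcd - hn
    rw [e2]
    have : (ρ - (x * c + y * d)) * (ρ + (x * c + y * d)) ≤ 5 * δ ^ 2 * 5 :=
      mul_le_mul h6 (by linarith) (by linarith) (by positivity)
    linarith

end Cone

section Phases

theorem JetR.add {E : Type*} [NormedAddCommGroup E] [NormedSpace ℝ E] {U : Set E} {b₁ b₂ : E}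
    {f g : E → ℝ} {M M' : ℝ} (hf : JetR U b₁ b₂ f M) (hg : JetR U b₁ b₂ g M') :
    JetR U b₁ b₂ (fun ξ => f ξ + g ξ) (M + M') := by
  obtain ⟨f₁, f₂, f₁₂, hf⟩ := hf
  obtain ⟨g₁, g₂, g₁₂, hg⟩ := hg
  refine ⟨fun ξ => f₁ ξ + g₁ ξ, fun ξ => f₂ ξ + g₂ ξ, fun ξ => f₁₂ ξ + g₁₂ ξ, fun ξ hξ => ?_⟩
  obtain ⟨a1, a2, a3, a4, a5, a6⟩ := hf ξ hξ
  obtain ⟨c1, c2, c3, c4, c5, c6⟩ := hg ξ hξ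
  exact ⟨HasDerivAt.add a1 c1, HasDerivAt.add a2 c2, HasDerivAt.add a3 c3,
    (abs_add_le _ _).trans (add_le_add a4 c4), (abs_add_le _ _).trans (add_le_add a5 c5),
    (abs_add_le _ _).trans (add_le_add a6 c6)⟩

theorem JetR.const_mul {E : Type*} [NormedAddCommGroup E] [NormedSpace ℝ E] {U : Set E} {b₁ b₂ : E}
    {f : E → ℝ} {M : ℝ} (k : ℝ) (hf : JetR U b₁ b₂ f M) :
    JetR U b₁ b₂ (fun ξ => k * f ξ) (|k| * M) := by
  obtain ⟨f₁, f₂, f₁₂, hf⟩ := hf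
  refine ⟨fun ξ => k * f₁ ξ, fun ξ => k * f₂ ξ, fun ξ => k * f₁₂ ξ, fun ξ hξ => ?_⟩
  obtain ⟨a1, a2, a3, a4, a5, a6⟩ := hf ξ hξ
  refine ⟨HasDerivAt.const_mul k a1, HasDerivAt.const_mul k a2, HasDerivAt.const_mul k a3, ?_, ?_, ?_⟩
  all_goals rw [abs_mul]; gcongr

theorem JetR.sub_const {E : Type*} [NormedAddCommGroup E] [NormedSpace ℝ E] {U : Set E} {b₁ b₂ : E}
    {f : E → ℝ} {M : ℝ} (k : ℝ) (hf : JetR U b₁ b₂ f M) :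
    JetR U b₁ b₂ (fun ξ => f ξ - k) M := by
  obtain ⟨f₁, f₂, f₁₂, hf⟩ := hf
  refine ⟨f₁, f₂, f₁₂, fun ξ hξ => ?_⟩
  obtain ⟨a1, a2, a3, a4, a5, a6⟩ := hf ξ hξ
  exact ⟨HasDerivAt.sub_const k a1, HasDerivAt.sub_const k a2, a3, a4, a5, a6⟩

theorem JetR.mono {E : Type*} [NormedAddCommGroup E] [NormedSpace ℝ E] {U : Set E} {b₁ b₂ : E}
    {f : E → ℝ} {M M' : ℝ} (hf : JetR U b₁ b₂ f M) (h : M ≤ M') : JetR U b₁ b₂ f M' := by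
  obtain ⟨f₁, f₂, f₁₂, hf⟩ := hf
  refine ⟨f₁, f₂, f₁₂, fun ξ hξ => ?_⟩
  obtain ⟨a1, a2, a3, a4, a5, a6⟩ := hf ξ hξ
  exact ⟨a1, a2, a3, a4.trans h, a5.trans h, a6.trans h⟩

theorem abs_div_le_two_mul {A B q : ℝ} (hA : |A| ≤ B) (hq : 1 / 2 ≤ q) : |A / q| ≤ 2 * B := by
  rw [abs_div, abs_of_pos (by linarith : 0 < q), div_le_iff₀ (by linarith)]
  nlinarith [abs_nonneg A]

/-- Admissible parameters for a dyadic sector at angular scale `δ`. -/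
structure SectorParam (Q δ w c d r₁ r₂ : ℝ) : Prop where
  hw : (1 + w ^ 2) * c = 1 - w ^ 2
  hw' : (1 + w ^ 2) * d = 2 * w
  hQ : 1 ≤ Q
  hδ : 0 < δ
  hδ' : δ ≤ 2
  hr₁ : 0 < r₁
  hr₂ : 0 < r₂
  hr₁' : r₁ ≤ 2000
  hr₂' : r₂ ≤ 2000
  h1 : r₁ * δ ^ 2 ≤ 8000 / Q ^ 2
  h2 : r₂ * δ ≤ 4000 / Q ^ 2
  h3 : r₁ * r₂ * δ ≤ 8000000 / Q ^ 2
  h4 : Q * r₁ * δ ≤ 4000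
  h5 : Q * r₂ ≤ 2000
  h6 : Q * r₁ * r₂ ≤ 4000000

variable {Q δ w c d r₁ r₂ : ℝ}

theorem SectorParam.sq_add_sq (S : SectorParam Q δ w c d r₁ r₂) : c ^ 2 + d ^ 2 = 1 := by
  have : (1 + w ^ 2) ^ 2 * (c ^ 2 + d ^ 2) = (1 + w ^ 2) ^ 2 * 1 := by
    linear_combination ((1 + w ^ 2) * c + (1 - w ^ 2)) * S.hw + ((1 + w ^ 2) * d + 2 * w) * S.hw'
  exact mul_left_cancel₀ (by positivity) this

theorem SectorParam.jet_re (S : SectorParam Q δ w c d r₁ r₂) :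
    JetR (sector w δ) ⟨r₁ * c, r₁ * d⟩ ⟨-(r₂ * d), r₂ * c⟩ (fun ξ => ξ.re) 2000 := by
  refine ⟨fun _ => r₁ * c, fun _ => -(r₂ * d), fun _ => 0, fun ξ hξ =>
    ⟨hasLineDerivAt_re _ _, hasLineDerivAt_re _ _, hasDerivAt_const _ _, ?_, ?_, by norm_num⟩⟩
  · have : |c| ≤ 1 := abs_le_one_iff_mul_self_le_one.2 (by nlinarith [S.sq_add_sq])
    rw [abs_mul, abs_of_pos S.hr₁]; nlinarith [S.hr₁, S.hr₁', abs_nonneg c]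
  · have : |d| ≤ 1 := abs_le_one_iff_mul_self_le_one.2 (by nlinarith [S.sq_add_sq])
    rw [abs_neg, abs_mul, abs_of_pos S.hr₂]; nlinarith [S.hr₂, S.hr₂', abs_nonneg d]

theorem SectorParam.cross_le (S : SectorParam Q δ w c d r₁ r₂) {ξ : ℂ} (hξ : ξ ∈ sector w δ) :
    |r₁ * (ξ.re * c + ξ.im * d) * (r₂ * (ξ.im * c - ξ.re * d))| ≤ 88000000 / Q ^ 2 := by
  obtain ⟨h0, h1, h2, h3, h4, h5, h6⟩ := sector_bounds S.hw S.hw' S.hδ.le hξ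
  have e : |r₁ * (ξ.re * c + ξ.im * d) * (r₂ * (ξ.im * c - ξ.re * d))| =
      r₁ * r₂ * (|ξ.re * c + ξ.im * d| * |ξ.im * c - ξ.re * d|) := by
    rw [abs_mul, abs_mul, abs_mul, abs_of_pos S.hr₁, abs_of_pos S.hr₂]; ring
  have h7 : |ξ.re * c + ξ.im * d| * |ξ.im * c - ξ.re * d| ≤ 2.01 * (5 * δ) := by gcongr
  have hr := mul_pos S.hr₁ S.hr₂
  calc _ ≤ r₁ * r₂ * (2.01 * (5 * δ)) := by rw [e]; gcongr
    _ = 10.05 * (r₁ * r₂ * δ) := by ring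
    _ ≤ 10.05 * (8000000 / Q ^ 2) := by gcongr; exact S.h3
    _ ≤ _ := by
      rw [mul_div_assoc']; gcongr; norm_num

theorem SectorParam.radial_le (S : SectorParam Q δ w c d r₁ r₂) {ξ : ℂ} (hξ : ξ ∈ sector w δ) :
    |r₂ * (ξ.im * c - ξ.re * d)| ≤ 20000 / Q ^ 2 := by
  obtain ⟨h0, h1, h2, h3, h4, h5, h6⟩ := sector_bounds S.hw S.hw' S.hδ.le hξ
  rw [abs_mul, abs_of_pos S.hr₂]
  calc _ ≤ r₂ * (5 * δ) := by gcongr; exact S.hr₂.le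
    _ = 5 * (r₂ * δ) := by ring
    _ ≤ 5 * (4000 / Q ^ 2) := by gcongr; exact S.h2
    _ = _ := by ring

theorem SectorParam.jet_norm (S : SectorParam Q δ w c d r₁ r₂) :
    JetR (sector w δ) ⟨r₁ * c, r₁ * d⟩ ⟨-(r₂ * d), r₂ * c⟩ (fun ξ => ‖ξ‖) 176000000 := by
  refine ⟨fun ξ => (ξ.re * (r₁ * c) + ξ.im * (r₁ * d)) / ‖ξ‖,
    fun ξ => (ξ.re * -(r₂ * d) + ξ.im * (r₂ * c)) / ‖ξ‖,
    fun ξ => (-(r₂ * d) * (r₁ * c) + r₂ * c * (r₁ * d)) / ‖ξ‖ -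
      (ξ.re * (r₁ * c) + ξ.im * (r₁ * d)) * (ξ.re * -(r₂ * d) + ξ.im * (r₂ * c)) / ‖ξ‖ ^ 3,
    fun ξ hξ => ?_⟩
  obtain ⟨h0, h1, h2, h3, h4, h5, h6⟩ := sector_bounds S.hw S.hw' S.hδ.le hξ
  have hρ := hξ.1
  have hQ : 1 ≤ Q ^ 2 := one_le_pow₀ S.hQ
  refine ⟨hasLineDerivAt_norm _ h0, hasLineDerivAt_norm _ h0, hasLineDerivAt_dot_div_norm ⟨r₁ * c, r₁ * d⟩ ⟨-(r₂ * d), r₂ * c⟩ h0,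
    ?_, ?_, ?_⟩ <;> dsimp only
  · rw [show ξ.re * (r₁ * c) + ξ.im * (r₁ * d) = r₁ * (ξ.re * c + ξ.im * d) by ring]
    refine (abs_div_le_two_mul (B := 4020) ?_ (by linarith)).trans (by norm_num)
    rw [abs_mul, abs_of_pos S.hr₁]
    nlinarith [S.hr₁, S.hr₁']
  · rw [show ξ.re * -(r₂ * d) + ξ.im * (r₂ * c) = r₂ * (ξ.im * c - ξ.re * d) by ring]
    refine (abs_div_le_two_mul (S.radial_le hξ) (by linarith)).trans ?_
    have : 20000 / Q ^ 2 ≤ 20000 := div_le_self (by norm_num) hQ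
    linarith
  · rw [show ξ.re * (r₁ * c) + ξ.im * (r₁ * d) = r₁ * (ξ.re * c + ξ.im * d) by ring,
      show ξ.re * -(r₂ * d) + ξ.im * (r₂ * c) = r₂ * (ξ.im * c - ξ.re * d) by ring,
      show -(r₂ * d) * (r₁ * c) + r₂ * c * (r₁ * d) = 0 by ring, zero_div, zero_sub, abs_neg]
    refine (abs_div_le_two_mul (S.cross_le hξ) ?_).trans ?_
    · have := pow_le_pow_left₀ (by norm_num) hρ.le 3
      norm_num at this ⊢; linarith
    · have : 88000000 / Q ^ 2 ≤ 88000000 := div_le_self (by norm_num) hQ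
      linarith

theorem SectorParam.jet_phase (S : SectorParam Q δ w c d r₁ r₂) (t : ℝ) :
    JetR (sector w δ) ⟨r₁ * c, r₁ * d⟩ ⟨-(r₂ * d), r₂ * c⟩
      (fun ξ => t * (‖ξ‖ - (ξ.re * c + ξ.im * d))) (|t| * (176000000 / Q ^ 2)) := by
  refine JetR.const_mul t ⟨fun ξ => (ξ.re * (r₁ * c) + ξ.im * (r₁ * d)) / ‖ξ‖ - (r₁ * c * c + r₁ * d * d),
    fun ξ => (ξ.re * -(r₂ * d) + ξ.im * (r₂ * c)) / ‖ξ‖ - (-(r₂ * d) * c + r₂ * c * d),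
    fun ξ => (-(r₂ * d) * (r₁ * c) + r₂ * c * (r₁ * d)) / ‖ξ‖ -
      (ξ.re * (r₁ * c) + ξ.im * (r₁ * d)) * (ξ.re * -(r₂ * d) + ξ.im * (r₂ * c)) / ‖ξ‖ ^ 3,
    fun ξ hξ => ?_⟩
  obtain ⟨h0, h1, h2, h3, h4, h5, h6⟩ := sector_bounds S.hw S.hw' S.hδ.le hξ
  have hρ := hξ.1
  have hρ0 : ‖ξ‖ ≠ 0 := by simpa using h0
  have hlin : ∀ b : ℂ, HasLineDerivAt ℝ (fun ξ : ℂ => ‖ξ‖ - (ξ.re * c + ξ.im * d))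
      ((ξ.re * b.re + ξ.im * b.im) / ‖ξ‖ - (b.re * c + b.im * d)) ξ b := fun b =>
    HasDerivAt.sub (hasLineDerivAt_norm b h0)
      (HasDerivAt.add (HasDerivAt.mul_const (hasLineDerivAt_re ξ b) c)
        (HasDerivAt.mul_const (hasLineDerivAt_im ξ b) d))
  have hQ2 : 0 < Q ^ 2 := by have := S.hQ; positivity
  refine ⟨hlin _, hlin _, HasDerivAt.sub_const _ (hasLineDerivAt_dot_div_norm ⟨r₁ * c, r₁ * d⟩ ⟨-(r₂ * d), r₂ * c⟩ h0), ?_, ?_, ?_⟩ <;> dsimp only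
  · rw [show (ξ.re * (r₁ * c) + ξ.im * (r₁ * d)) / ‖ξ‖ - (r₁ * c * c + r₁ * d * d) =
      (-(r₁ * (‖ξ‖ - (ξ.re * c + ξ.im * d)))) / ‖ξ‖ by
        rw [show r₁ * c * c + r₁ * d * d = r₁ by linear_combination r₁ * S.sq_add_sq]
        field_simp; ring]
    refine (abs_div_le_two_mul (B := 5 * (8000 / Q ^ 2)) ?_ (by linarith)).trans ?_
    · rw [abs_neg, abs_mul, abs_of_pos S.hr₁]
      calc _ ≤ r₁ * (5 * δ ^ 2) := by gcongr; exact S.hr₁.le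
        _ = 5 * (r₁ * δ ^ 2) := by ring
        _ ≤ _ := by gcongr; exact S.h1
    · rw [mul_div_assoc', mul_div_assoc']; gcongr; norm_num
  · rw [show (ξ.re * -(r₂ * d) + ξ.im * (r₂ * c)) / ‖ξ‖ - (-(r₂ * d) * c + r₂ * c * d) =
      (r₂ * (ξ.im * c - ξ.re * d)) / ‖ξ‖ by ring]
    refine (abs_div_le_two_mul (S.radial_le hξ) (by linarith)).trans ?_
    rw [mul_div_assoc']; gcongr; norm_num
  · rw [show ξ.re * (r₁ * c) + ξ.im * (r₁ * d) = r₁ * (ξ.re * c + ξ.im * d) by ring,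
      show ξ.re * -(r₂ * d) + ξ.im * (r₂ * c) = r₂ * (ξ.im * c - ξ.re * d) by ring,
      show -(r₂ * d) * (r₁ * c) + r₂ * c * (r₁ * d) = 0 by ring, zero_div, zero_sub, abs_neg]
    refine (abs_div_le_two_mul (S.cross_le hξ) ?_).trans ?_
    · have := pow_le_pow_left₀ (by norm_num) hρ.le 3
      norm_num at this ⊢; linarith
    · rw [mul_div_assoc']; gcongr; norm_num

theorem SectorParam.jet_slope (S : SectorParam Q δ w c d r₁ r₂) :
    JetR (sector w δ) ⟨r₁ * c, r₁ * d⟩ ⟨-(r₂ * d), r₂ * c⟩ (fun ξ => Q * slope ξ) 100000000000 := by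
  have hQ := S.hQ
  refine ⟨fun ξ => Q * ((r₁ * d * ξ.re - r₁ * c * ξ.im) / (‖ξ‖ * (‖ξ‖ + ξ.re))),
    fun ξ => Q * ((r₂ * c * ξ.re - -(r₂ * d) * ξ.im) / (‖ξ‖ * (‖ξ‖ + ξ.re))),
    fun ξ => Q * ((r₁ * d * -(r₂ * d) - r₁ * c * (r₂ * c)) / (‖ξ‖ * (‖ξ‖ + ξ.re)) -
      (r₁ * d * ξ.re - r₁ * c * ξ.im) * ((ξ.re * -(r₂ * d) + ξ.im * (r₂ * c)) / ‖ξ‖ *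
        (2 * ‖ξ‖ + ξ.re) + ‖ξ‖ * -(r₂ * d)) / (‖ξ‖ * (‖ξ‖ + ξ.re)) ^ 2), fun ξ hξ => ?_⟩
  obtain ⟨h0, h1, h2, h3, h4, h5, h6⟩ := sector_bounds S.hw S.hw' S.hδ.le hξ
  have hρ := hξ.1
  have hρ2 := hξ.2.1
  have ha0 : ‖ξ‖ + ξ.re ≠ 0 := by linarith
  have hden : 0.72 ≤ ‖ξ‖ * (‖ξ‖ + ξ.re) := by nlinarith
  have hden2 : 1 / 2 ≤ (‖ξ‖ * (‖ξ‖ + ξ.re)) ^ 2 := by nlinarith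
  refine ⟨HasDerivAt.const_mul Q (hasLineDerivAt_slope _ h0 ha0),
    HasDerivAt.const_mul Q (hasLineDerivAt_slope _ h0 ha0),
    HasDerivAt.const_mul Q (hasLineDerivAt_slope_deriv ⟨r₁ * c, r₁ * d⟩ ⟨-(r₂ * d), r₂ * c⟩ h0 ha0), ?_, ?_, ?_⟩ <;> dsimp only
  · rw [mul_div_assoc']
    refine (abs_div_le_two_mul (B := 20000) ?_ (by linarith)).trans (by norm_num)
    rw [show Q * (r₁ * d * ξ.re - r₁ * c * ξ.im) = -(Q * r₁ * (ξ.im * c - ξ.re * d)) by ring,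
      abs_neg, abs_mul, abs_of_pos (mul_pos (by linarith) S.hr₁)]
    have hp : 0 ≤ Q * r₁ := (mul_pos (by linarith) S.hr₁).le
    calc _ ≤ Q * r₁ * (5 * δ) := by gcongr
      _ = 5 * (Q * r₁ * δ) := by ring
      _ ≤ _ := by linarith [S.h4]
  · rw [mul_div_assoc']
    refine (abs_div_le_two_mul (B := 4020) ?_ (by linarith)).trans (by norm_num)
    rw [show Q * (r₂ * c * ξ.re - -(r₂ * d) * ξ.im) = Q * r₂ * (ξ.re * c + ξ.im * d) by ring,
      abs_mul, abs_of_pos (mul_pos (by linarith) S.hr₂)]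
    have hp : 0 ≤ Q * r₂ := (mul_pos (by linarith) S.hr₂).le
    nlinarith [S.h5, abs_nonneg (ξ.re * c + ξ.im * d)]
  · have hp : 0 < Q * r₁ * r₂ := mul_pos (mul_pos (by linarith) S.hr₁) S.hr₂
    have hd1 : |d| ≤ 1 := abs_le_one_iff_mul_self_le_one.2 (by nlinarith [S.sq_add_sq])
    have hv : |ξ.im * c - ξ.re * d| ≤ 10 := by linarith [S.hδ']
    have e1 : Q * ((r₁ * d * -(r₂ * d) - r₁ * c * (r₂ * c)) / (‖ξ‖ * (‖ξ‖ + ξ.re)) -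
      (r₁ * d * ξ.re - r₁ * c * ξ.im) * ((ξ.re * -(r₂ * d) + ξ.im * (r₂ * c)) / ‖ξ‖ *
        (2 * ‖ξ‖ + ξ.re) + ‖ξ‖ * -(r₂ * d)) / (‖ξ‖ * (‖ξ‖ + ξ.re)) ^ 2) =
      (Q * r₁ * r₂) * (-(1 / (‖ξ‖ * (‖ξ‖ + ξ.re))) + (ξ.im * c - ξ.re * d) *
        ((ξ.im * c - ξ.re * d) / ‖ξ‖ * (2 * ‖ξ‖ + ξ.re) - ‖ξ‖ * d) /
          (‖ξ‖ * (‖ξ‖ + ξ.re)) ^ 2) := by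
      have e0 : r₁ * d * -(r₂ * d) - r₁ * c * (r₂ * c) = -(r₁ * r₂) := by
        linear_combination (-(r₁ * r₂)) * S.sq_add_sq
      rw [e0]; ring
    rw [e1, abs_mul, abs_of_pos hp]
    have f1 : |-(1 / (‖ξ‖ * (‖ξ‖ + ξ.re)))| ≤ 2 := by
      rw [abs_neg]
      exact (abs_div_le_two_mul (B := 1) (by norm_num) (by linarith)).trans (by norm_num)
    have f2 : |(ξ.im * c - ξ.re * d) / ‖ξ‖| ≤ 20 :=
      (abs_div_le_two_mul hv (by linarith)).trans (by norm_num)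
    have f3 : |(ξ.im * c - ξ.re * d) / ‖ξ‖ * (2 * ‖ξ‖ + ξ.re)| ≤ 20 * 7 := by
      rw [abs_mul]
      have : |2 * ‖ξ‖ + ξ.re| ≤ 7 := by rw [abs_of_nonneg] <;> linarith
      gcongr
    have f4 : |‖ξ‖ * d| ≤ 3 := by
      rw [abs_mul, abs_of_nonneg (norm_nonneg _)]; nlinarith [abs_nonneg d]
    have f5 := abs_sub ((ξ.im * c - ξ.re * d) / ‖ξ‖ * (2 * ‖ξ‖ + ξ.re)) (‖ξ‖ * d)
    have f6 : |(ξ.im * c - ξ.re * d) * ((ξ.im * c - ξ.re * d) / ‖ξ‖ * (2 * ‖ξ‖ + ξ.re) - ‖ξ‖ * d)|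
        ≤ 10 * 143 := by
      rw [abs_mul]
      have := abs_nonneg ((ξ.im * c - ξ.re * d) / ‖ξ‖ * (2 * ‖ξ‖ + ξ.re) - ‖ξ‖ * d)
      refine mul_le_mul hv ?_ this (by norm_num)
      linarith
    have f7 := abs_div_le_two_mul f6 hden2
    refine (mul_le_mul (d := (2 + 2 * (10 * 143) : ℝ)) S.h6
      ((abs_add_le _ _).trans (add_le_add f1 f7)) (abs_nonneg _) (by norm_num)).trans (by norm_num)

end Phases

section Symbols

theorem exists_bdd2 {g : ℝ → ℝ} (hg : ContDiff ℝ ∞ g) (hc : HasCompactSupport g) :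
    ∃ B, Bdd2 (fun u => (g u : ℂ)) B := by
  have h0 : ContDiff ℝ ∞ (fun u => (g u : ℂ)) := Complex.ofRealCLM.contDiff.comp hg
  have c0 : HasCompactSupport (fun u => (g u : ℂ)) := hc.comp_left (g := fun x : ℝ => (x : ℂ)) (by simp)
  have h1 := (contDiff_infty_iff_deriv.1 h0).2
  have c1 := c0.deriv
  have h2 := (contDiff_infty_iff_deriv.1 h1).2
  have c2 := c1.deriv
  obtain ⟨B0, H0⟩ := h0.continuous.bounded_above_of_compact_support c0
  obtain ⟨B1, H1⟩ := h1.continuous.bounded_above_of_compact_support c1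
  obtain ⟨B2, H2⟩ := h2.continuous.bounded_above_of_compact_support c2
  exact ⟨max B0 (max B1 B2), h0, fun x => ⟨(H0 x).trans (le_max_left _ _),
    (H1 x).trans ((le_max_left _ _).trans (le_max_right _ _)),
    (H2 x).trans ((le_max_right _ _).trans (le_max_right _ _))⟩⟩

theorem Bdd2.mono {Φ : ℝ → ℂ} {B B' : ℝ} (h : Bdd2 Φ B) (hB : B ≤ B') : Bdd2 Φ B' :=
  ⟨h.1, fun x => ⟨(h.2 x).1.trans hB, (h.2 x).2.1.trans hB, (h.2 x).2.2.trans hB⟩⟩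

/-- The character `e^{2πiu}`. -/
def wave (u : ℝ) : ℂ := Complex.exp (↑(2 * π * u) * Complex.I)

theorem hasDerivAt_wave (u : ℝ) : HasDerivAt wave (2 * π * Complex.I * wave u) u := by
  have h1 : HasDerivAt (fun u : ℝ => ((2 * π * u : ℝ) : ℂ) * Complex.I)
      (((2 * π * 1 : ℝ) : ℂ) * Complex.I) u :=
    (((hasDerivAt_id u).const_mul (2 * π)).ofReal_comp).mul_const _
  refine h1.cexp.congr_deriv ?_
  rw [wave]; push_cast; ring

theorem norm_wave (u : ℝ) : ‖wave u‖ = 1 := Complex.norm_exp_ofReal_mul_I _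

theorem wave_add (u v : ℝ) : wave (u + v) = wave u * wave v := by
  rw [wave, wave, wave, ← Complex.exp_add]; congr 1; push_cast; ring

theorem contDiff_wave : ContDiff ℝ ∞ wave := by
  refine ContDiff.cexp (ContDiff.mul (Complex.ofRealCLM.contDiff.comp ?_) contDiff_const)
  exact contDiff_const.mul contDiff_id

theorem bdd2_wave : Bdd2 wave 40 := by
  have hd : deriv wave = fun u => 2 * π * Complex.I * wave u := funext fun u => (hasDerivAt_wave u).deriv
  have hdd : ∀ u, deriv (fun u => 2 * π * Complex.I * wave u) u =
      2 * π * Complex.I * (2 * π * Complex.I * wave u) :=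
    fun u => ((hasDerivAt_wave u).const_mul _).deriv
  have hp := Real.pi_lt_d2
  have hp0 := Real.pi_pos
  have hn : ‖(2 * π * Complex.I : ℂ)‖ = 2 * π := by
    simp [abs_of_pos hp0]
  refine ⟨contDiff_wave, fun x => ⟨by rw [norm_wave]; norm_num, ?_, ?_⟩⟩
  · rw [hd, norm_mul, norm_wave, hn]; linarith
  · rw [hd, hdd, norm_mul, hn, norm_mul, hn, norm_wave]; nlinarith

/-- A smooth cutoff to a half line, localised to `[-4, 4]`. -/
def hemi (u : ℝ) : ℝ := Real.smoothTransition (1 / 2 + 2 * u) *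
  (Real.smoothTransition (4 - u) * Real.smoothTransition (4 + u))

theorem contDiff_hemi : ContDiff ℝ ∞ hemi := by
  have h := Real.smoothTransition.contDiff (n := (⊤ : ℕ∞))
  exact (h.comp (contDiff_const.add (contDiff_const.mul contDiff_id))).mul
    ((h.comp (contDiff_const.sub contDiff_id)).mul (h.comp (contDiff_const.add contDiff_id)))

theorem smoothTransition_add (x : ℝ) : Real.smoothTransition x + Real.smoothTransition (1 - x) = 1 := by
  rw [Real.smoothTransition, Real.smoothTransition, sub_sub_cancel, add_comm (expNegInvGlue (1 - x)),
    ← add_div, div_self]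
  exact (Real.smoothTransition.pos_denom x).ne'

theorem hemi_add_neg {u : ℝ} (hu : |u| ≤ 3) : hemi u + hemi (-u) = 1 := by
  have := abs_le.1 hu
  have h := smoothTransition_add (1 / 2 + 2 * u)
  rw [hemi, hemi, Real.smoothTransition.one_of_one_le (x := 4 - u) (by linarith),
    Real.smoothTransition.one_of_one_le (x := 4 + u) (by linarith),
    Real.smoothTransition.one_of_one_le (x := 4 - -u) (by linarith),
    Real.smoothTransition.one_of_one_le (x := 4 + -u) (by linarith),
    show 1 / 2 + 2 * -u = 1 - (1 / 2 + 2 * u) by ring]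
  linarith

theorem hemi_support {u : ℝ} (hu : hemi u ≠ 0) : -(1 / 4) ≤ u ∧ |u| ≤ 4 := by
  rw [hemi] at hu
  have h1 := left_ne_zero_of_mul hu
  have h2 := left_ne_zero_of_mul (right_ne_zero_of_mul hu)
  have h3 := right_ne_zero_of_mul (right_ne_zero_of_mul hu)
  refine ⟨?_, abs_le.2 ⟨?_, ?_⟩⟩ <;> by_contra! h
  · exact h1 (Real.smoothTransition.zero_of_nonpos (by linarith))
  · exact h3 (Real.smoothTransition.zero_of_nonpos (by linarith))
  · exact h2 (Real.smoothTransition.zero_of_nonpos (by linarith))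

theorem hemi_nonneg (u : ℝ) : 0 ≤ hemi u :=
  mul_nonneg (Real.smoothTransition.nonneg _)
    (mul_nonneg (Real.smoothTransition.nonneg _) (Real.smoothTransition.nonneg _))

theorem hemi_le_one (u : ℝ) : hemi u ≤ 1 :=
  mul_le_one₀ (Real.smoothTransition.le_one _)
    (mul_nonneg (Real.smoothTransition.nonneg _) (Real.smoothTransition.nonneg _))
    (mul_le_one₀ (Real.smoothTransition.le_one _) (Real.smoothTransition.nonneg _)
      (Real.smoothTransition.le_one _))

/-- The bump `φ` in logarithmic coordinates: a smooth partition of unity along `ℤ`. -/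
def chi (φ : ℝ → ℝ) (u : ℝ) : ℝ := φ ((2 : ℝ) ^ u)

variable {φ : ℝ → ℝ}

theorem contDiff_chi (hφ : IsLPBump φ) : ContDiff ℝ ∞ (chi φ) := by
  have h1 := hφ.1
  have : (fun u : ℝ => (2 : ℝ) ^ u) = fun u => Real.exp (Real.log 2 * u) := by
    ext u; rw [Real.rpow_def_of_pos (by norm_num)]
  have h2 : ContDiff ℝ ∞ (fun u : ℝ => (2 : ℝ) ^ u) := by
    rw [this]
    exact Real.contDiff_exp.comp (contDiff_const.mul contDiff_id)
  exact ContDiff.comp h1 h2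

theorem bump_support (hφ : IsLPBump φ) {s : ℝ} (hs : φ s ≠ 0) : 0.999 ≤ s ∧ s ≤ 2.001 := by
  have := hφ.2.2.1 hs
  norm_num at this ⊢
  exact this

theorem bump_le_one (hφ : IsLPBump φ) (s : ℝ) : φ s ≤ 1 := by
  by_cases h : φ s = 0
  · rw [h]; norm_num
  have hs : 0 < s := by have := (bump_support hφ h).1; linarith
  have := le_hasSum (hφ.2.2.2 s hs) 0 (fun j _ => hφ.2.1 _)
  simpa using this

theorem two_rpow_small : (2 : ℝ) ^ (-(1 / 500) : ℝ) ≤ 0.999 := by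
  have h : ((2 : ℝ) ^ (-(1 / 500) : ℝ)) ^ 500 = 1 / 2 := by
    rw [← Real.rpow_natCast, ← Real.rpow_mul (by norm_num)]
    norm_num
  have h2 := one_add_mul_le_pow (a := (-(1 / 1000) : ℝ)) (by norm_num) 500
  refine le_of_pow_le_pow_left₀ (n := 500) (by norm_num) (by norm_num) ?_
  rw [h]
  norm_num at h2 ⊢
  exact h2

theorem chi_support (hφ : IsLPBump φ) {u : ℝ} (hu : chi φ u ≠ 0) : -0.002 ≤ u ∧ u ≤ 1.002 := by
  obtain ⟨h1, h2⟩ := bump_support hφ hu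
  constructor <;> by_contra! h
  · have : (2 : ℝ) ^ u < (2 : ℝ) ^ (-(1 / 500) : ℝ) :=
      Real.rpow_lt_rpow_of_exponent_lt (by norm_num) (by norm_num at h ⊢; linarith)
    linarith [two_rpow_small]
  · have h3 : (2 : ℝ) ^ (1 + 1 / 500 : ℝ) < (2 : ℝ) ^ u :=
      Real.rpow_lt_rpow_of_exponent_lt (by norm_num) (by norm_num at h ⊢; linarith)
    have h4 : (2 : ℝ) ^ (1 / 500 : ℝ) * (2 : ℝ) ^ (-(1 / 500) : ℝ) = 1 := by
      rw [← Real.rpow_add (by norm_num)]; norm_num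
    rw [Real.rpow_add (by norm_num), Real.rpow_one] at h3
    have h5 : 0 < (2 : ℝ) ^ (1 / 500 : ℝ) := by positivity
    nlinarith [two_rpow_small]

theorem chi_nonneg (hφ : IsLPBump φ) (u : ℝ) : 0 ≤ chi φ u := hφ.2.1 _
theorem chi_le_one (hφ : IsLPBump φ) (u : ℝ) : chi φ u ≤ 1 := bump_le_one hφ _

theorem hasCompactSupport_chi (hφ : IsLPBump φ) : HasCompactSupport (chi φ) :=
  HasCompactSupport.of_support_subset_isCompact isCompact_Icc fun _ hu => chi_support hφ hu

theorem hasSum_chi (hφ : IsLPBump φ) (u : ℝ) : HasSum (fun n : ℤ => chi φ (u - n)) 1 := by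
  have h : (fun n : ℤ => chi φ (u - n)) = fun n : ℤ => φ ((2 : ℝ) ^ (-n) * (2 : ℝ) ^ u) := by
    ext n
    rw [chi, sub_eq_neg_add, Real.rpow_add (by norm_num), ← Int.cast_neg, Real.rpow_intCast]
  rw [h]
  exact hφ.2.2.2 ((2 : ℝ) ^ u) (by positivity)

theorem exists_symbol_bound (hφ : IsLPBump φ) : ∃ B : ℝ, 1 ≤ B ∧ Bdd2 wave B ∧
    Bdd2 (fun u => (φ u : ℂ)) B ∧ Bdd2 (fun u => (hemi u : ℂ)) B ∧
    Bdd2 (fun u => (chi φ u : ℂ)) B := by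
  obtain ⟨B1, h1⟩ := exists_bdd2 (g := φ) hφ.1
    (HasCompactSupport.of_support_subset_isCompact isCompact_Icc hφ.2.2.1)
  obtain ⟨B2, h2⟩ := exists_bdd2 contDiff_hemi
    (HasCompactSupport.of_support_subset_isCompact (isCompact_Icc (a := -4) (b := 4))
      fun _ hu => abs_le.1 (hemi_support hu).2)
  obtain ⟨B3, h3⟩ := exists_bdd2 (contDiff_chi hφ) (hasCompactSupport_chi hφ)
  refine ⟨max 40 (max B1 (max B2 B3)), ?_, bdd2_wave.mono (le_max_left _ _), h1.mono ?_,
    h2.mono ?_, h3.mono ?_⟩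
  · exact le_trans (by norm_num) (le_max_left _ _)
  all_goals simp

end Symbols

section Packets

variable {φ : ℝ → ℝ}

theorem contDiff_of_forall_mem_tsupport {E : Type*} [NormedAddCommGroup E] [NormedSpace ℝ E]
    {f : E → ℂ} (h : ∀ x ∈ tsupport f, ContDiffAt ℝ ∞ f x) : ContDiff ℝ ∞ f := by
  refine contDiff_iff_contDiffAt.2 fun x => ?_
  by_cases hx : x ∈ tsupport f
  · exact h x hx
  · exact (contDiffAt_const (c := (0 : ℂ))).congr_of_eventuallyEq
      (notMem_tsupport_iff_eventuallyEq.1 hx)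

/-- The amplitude localised at slope `≈ c / Q` and height `≈ l / K`. -/
def amp (φ : ℝ → ℝ) (K l Q c : ℝ) (ξ : ℂ) : ℝ :=
  φ ‖ξ‖ * hemi ξ.re * chi φ (K * (‖ξ‖ + ξ.re) - l) * chi φ (Q * slope ξ - c)

/-- The half wave symbol localised by `amp`. -/
def packet (φ : ℝ → ℝ) (K l Q c t : ℝ) (ξ : ℂ) : ℂ := wave (t * ‖ξ‖) * (amp φ K l Q c ξ : ℂ)

/-- A closed set containing the support of `amp`. -/
def ampSet (Q c : ℝ) : Set ℂ := {ξ | 0.999 ≤ ‖ξ‖ ∧ ‖ξ‖ ≤ 2.001 ∧ -(1 / 4) ≤ ξ.re ∧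
  (c - 0.002) * (‖ξ‖ + ξ.re) ≤ Q * ξ.im ∧ Q * ξ.im ≤ (c + 1.002) * (‖ξ‖ + ξ.re)}

theorem isClosed_ampSet (Q c : ℝ) : IsClosed (ampSet Q c) := by
  have hre : Continuous fun ξ : ℂ => ξ.re := Complex.continuous_re
  have him : Continuous fun ξ : ℂ => ξ.im := Complex.continuous_im
  have h4 : IsClosed {ξ : ℂ | (c - 0.002) * (‖ξ‖ + ξ.re) ≤ Q * ξ.im} :=
    isClosed_le (by fun_prop) (by fun_prop)
  have h5 : IsClosed {ξ : ℂ | Q * ξ.im ≤ (c + 1.002) * (‖ξ‖ + ξ.re)} :=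
    isClosed_le (by fun_prop) (by fun_prop)
  exact (isClosed_le continuous_const continuous_norm).inter
    ((isClosed_le continuous_norm continuous_const).inter
      ((isClosed_le continuous_const hre).inter (h4.inter h5)))

theorem ampSet_pos {Q c : ℝ} {ξ : ℂ} (h : ξ ∈ ampSet Q c) : ξ ≠ 0 ∧ 0.749 ≤ ‖ξ‖ + ξ.re := by
  obtain ⟨h1, h2, h3, h4, h5⟩ := h
  refine ⟨fun h => ?_, by linarith⟩
  rw [h, norm_zero] at h1; norm_num at h1

theorem amp_support (hφ : IsLPBump φ) {K l Q c : ℝ} {ξ : ℂ} (h : amp φ K l Q c ξ ≠ 0) :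
    ξ ∈ ampSet Q c ∧ -0.002 ≤ K * (‖ξ‖ + ξ.re) - l ∧ K * (‖ξ‖ + ξ.re) - l ≤ 1.002 := by
  rw [amp] at h
  have h4 := chi_support hφ (right_ne_zero_of_mul h)
  have h' := left_ne_zero_of_mul h
  have h3 := chi_support hφ (right_ne_zero_of_mul h')
  have h1 := bump_support hφ (left_ne_zero_of_mul (left_ne_zero_of_mul h'))
  have h2 := hemi_support (right_ne_zero_of_mul (left_ne_zero_of_mul h'))
  have ha : 0 < ‖ξ‖ + ξ.re := by linarith
  have e : Q * ξ.im = (Q * slope ξ) * (‖ξ‖ + ξ.re) := by rw [slope]; field_simp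
  refine ⟨⟨h1.1, h1.2, h2.1, ?_, ?_⟩, h3⟩ <;> rw [e] <;> gcongr <;> linarith

theorem amp_nonneg (hφ : IsLPBump φ) (K l Q c : ℝ) (ξ : ℂ) : 0 ≤ amp φ K l Q c ξ :=
  mul_nonneg (mul_nonneg (mul_nonneg (hφ.2.1 _) (hemi_nonneg _)) (chi_nonneg hφ _)) (chi_nonneg hφ _)

theorem amp_le_one (hφ : IsLPBump φ) (K l Q c : ℝ) (ξ : ℂ) : amp φ K l Q c ξ ≤ 1 :=
  mul_le_one₀ (mul_le_one₀ (mul_le_one₀ (bump_le_one hφ _) (hemi_nonneg _) (hemi_le_one _))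
    (chi_nonneg hφ _) (chi_le_one hφ _)) (chi_nonneg hφ _) (chi_le_one hφ _)

theorem contDiffAt_amp (hφ : IsLPBump φ) {K l Q c : ℝ} {ξ : ℂ} (h : ξ ∈ ampSet Q c) :
    ContDiffAt ℝ ∞ (amp φ K l Q c) ξ := by
  obtain ⟨h0, ha⟩ := ampSet_pos h
  have hn : ContDiffAt ℝ ∞ (fun ξ : ℂ => ‖ξ‖) ξ := contDiffAt_norm ℝ h0
  have hre : ContDiffAt ℝ ∞ (fun ξ : ℂ => ξ.re) ξ := Complex.reCLM.contDiff.contDiffAt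
  have him : ContDiffAt ℝ ∞ (fun ξ : ℂ => ξ.im) ξ := Complex.imCLM.contDiff.contDiffAt
  have hs : ContDiffAt ℝ ∞ slope ξ := him.div (hn.add hre) (by linarith)
  have h1 : ContDiffAt ℝ ∞ (fun ξ : ℂ => φ ‖ξ‖) ξ :=
    ContDiffAt.comp ξ (ContDiff.contDiffAt (n := ∞) hφ.1) hn
  have h2 : ContDiffAt ℝ ∞ (fun ξ : ℂ => hemi ξ.re) ξ :=
    ContDiffAt.comp ξ contDiff_hemi.contDiffAt hre
  have h3 : ContDiffAt ℝ ∞ (fun ξ : ℂ => chi φ (K * (‖ξ‖ + ξ.re) - l)) ξ :=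
    ContDiffAt.comp (g := chi φ) ξ (contDiff_chi hφ).contDiffAt
      ((contDiffAt_const.mul (hn.add hre)).sub contDiffAt_const)
  have h4 : ContDiffAt ℝ ∞ (fun ξ : ℂ => chi φ (Q * slope ξ - c)) ξ :=
    ContDiffAt.comp (g := chi φ) ξ (contDiff_chi hφ).contDiffAt ((contDiffAt_const.mul hs).sub contDiffAt_const)
  exact ((h1.mul h2).mul h3).mul h4

theorem tsupport_packet_subset (hφ : IsLPBump φ) (K l Q c t : ℝ) :
    tsupport (packet φ K l Q c t) ⊆ ampSet Q c :=
  closure_minimal (fun ξ hξ => (amp_support hφ (K := K) (l := l) (fun h => hξ (by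
    rw [packet, h]; simp))).1) (isClosed_ampSet Q c)

theorem sym_packet (hφ : IsLPBump φ) (K l Q c t : ℝ) : Sym (packet φ K l Q c t) := by
  refine ⟨contDiff_of_forall_mem_tsupport fun ξ hξ => ?_, ?_⟩
  · have h := tsupport_packet_subset hφ K l Q c t hξ
    have hn : ContDiffAt ℝ ∞ (fun ξ : ℂ => ‖ξ‖) ξ := contDiffAt_norm ℝ (ampSet_pos h).1
    have h1 : ContDiffAt ℝ ∞ (fun ξ : ℂ => wave (t * ‖ξ‖)) ξ :=
      ContDiffAt.comp (g := wave) ξ contDiff_wave.contDiffAt (contDiffAt_const.mul hn)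
    have h2 : ContDiffAt ℝ ∞ (fun ξ : ℂ => (amp φ K l Q c ξ : ℂ)) ξ :=
      ContDiffAt.comp ξ Complex.ofRealCLM.contDiff.contDiffAt (contDiffAt_amp hφ h)
    exact h1.mul h2
  · refine HasCompactSupport.of_support_subset_isCompact (isCompact_closedBall (0 : ℂ) 2.001)
      fun ξ hξ => ?_
    rw [mem_closedBall_zero_iff]
    exact (tsupport_packet_subset hφ K l Q c t (subset_tsupport _ hξ)).2.1

theorem ampSet_subset_sector {Q c w δ : ℝ} (hQ : 0 < Q) (h1 : Q * (w - δ) < c - 0.002)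
    (h2 : c + 1.002 < Q * (w + δ)) : ampSet Q c ⊆ sector w δ := by
  intro ξ hξ
  obtain ⟨h0, ha⟩ := ampSet_pos hξ
  obtain ⟨a1, a2, a3, a4, a5⟩ := hξ
  have ha0 : 0 < ‖ξ‖ + ξ.re := by linarith
  refine ⟨by linarith, by linarith, by linarith, abs_lt.2 ⟨?_, ?_⟩⟩
  · have : Q * ((w - δ) * (‖ξ‖ + ξ.re)) < Q * ξ.im := by
      rw [← mul_assoc]; exact lt_of_lt_of_le (mul_lt_mul_of_pos_right h1 ha0) a4
    have := lt_of_mul_lt_mul_left this hQ.le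
    linarith
  · have : Q * ξ.im < Q * ((w + δ) * (‖ξ‖ + ξ.re)) := by
      rw [← mul_assoc]; exact lt_of_le_of_lt a5 (mul_lt_mul_of_pos_right h2 ha0)
    have := lt_of_mul_lt_mul_left this hQ.le
    linarith

variable {Q δ w c d r₁ r₂ : ℝ}

theorem modu_packet (K l c' t : ℝ) :
    modu (-(t • (⟨c, d⟩ : ℂ))) (packet φ K l Q c' t) = fun ξ =>
      (((wave (t * (‖ξ‖ - (ξ.re * c + ξ.im * d))) * (φ ‖ξ‖ : ℂ)) * (hemi ξ.re : ℂ)) *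
        (chi φ (K * (‖ξ‖ + ξ.re) - l) : ℂ)) * (chi φ (Q * slope ξ - c') : ℂ) := by
  ext ξ
  have h : t * (‖ξ‖ - (ξ.re * c + ξ.im * d)) = inner ℝ ξ (-(t • (⟨c, d⟩ : ℂ))) + t * ‖ξ‖ := by
    rw [inner_neg_right, inner_smul_right, Complex.inner]; simp; ring
  rw [h, wave_add, modu, packet, amp, show wave (inner ℝ ξ (-(t • (⟨c, d⟩ : ℂ)))) = Complex.exp
    (↑(2 * π * inner ℝ ξ (-(t • (⟨c, d⟩ : ℂ)))) * Complex.I) from rfl]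
  push_cast; ring

theorem SectorParam.jet_packet (S : SectorParam Q δ w c d r₁ r₂) {B K l c' t : ℝ} (hK : 1 ≤ K)
    (hB : 1 ≤ B) (hw : Bdd2 wave B) (hb : Bdd2 (fun u => (φ u : ℂ)) B)
    (hh : Bdd2 (fun u => (hemi u : ℂ)) B) (hc : Bdd2 (fun u => (chi φ u : ℂ)) B) :
    JetB (sector w δ) ⟨r₁ * c, r₁ * d⟩ ⟨-(r₂ * d), r₂ * c⟩
      (modu (-(t • (⟨c, d⟩ : ℂ))) (packet φ K l Q c' t))
      (256 * (2 * (B * (100000000000 * K * (1 + |t| / Q ^ 2)) ^ 2 )) ^ 5) := by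
  obtain ⟨T, hT⟩ : ∃ T, T = 1 + |t| / Q ^ 2 := ⟨_, rfl⟩
  obtain ⟨M, hM⟩ : ∃ M, M = 100000000000 * K * T := ⟨_, rfl⟩
  have hQ2 : 0 < Q ^ 2 := by have := S.hQ; positivity
  have htp : 0 ≤ |t| / Q ^ 2 := by positivity
  have hKT : 1 ≤ K * T := one_le_mul_of_one_le_of_one_le hK (by linarith)
  have hKT' : K ≤ K * T := le_mul_of_one_le_right (by linarith) (by linarith)
  have hKT'' : T ≤ K * T := le_mul_of_one_le_left (by linarith) hK
  have hM1 : 1 ≤ M := by rw [hM]; linarith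
  rw [← hT, ← hM, modu_packet]
  have j1 := ((S.jet_phase t).mono (M' := M) (by
    rw [show |t| * (176000000 / Q ^ 2) = 176000000 * (|t| / Q ^ 2) by ring]; linarith)).comp hM1 hw
  have j2 := (S.jet_norm.mono (M' := M) (by linarith)).comp hM1 hb
  have j3 := (S.jet_re.mono (M' := M) (by linarith)).comp hM1 hh
  have j4 := ((((S.jet_norm.add S.jet_re).const_mul K).sub_const l).mono (M' := M) (by
    rw [abs_of_nonneg (by linarith)]; linarith)).comp hM1 hc
  have j5 := ((S.jet_slope.sub_const c').mono (M' := M) (by linarith)).comp hM1 hc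
  have hX : 0 ≤ 2 * (B * M ^ 2) := by positivity
  have := (((j1.mul hX j2).mul (by positivity) j3).mul (by positivity) j4).mul (by positivity) j5
  convert this using 1
  ring

end Packets

section Families

theorem sum_enorm_sq_le_three (I : Finset ℕ) (u : ℕ → ℂ) {M x : ℝ} (hM : ∀ i ∈ I, ‖u i‖ ≤ M)
    (hx : ∀ i ∈ I, u i ≠ 0 → x ≤ i ∧ (i : ℝ) < x + 2) :
    ∑ i ∈ I, ‖u i‖ₑ ^ 2 ≤ ENNReal.ofReal (3 * M ^ 2) := by
  have h0 : ∑ i ∈ I.filter (fun i => u i ≠ 0), ‖u i‖ₑ ^ 2 = ∑ i ∈ I, ‖u i‖ₑ ^ 2 :=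
    Finset.sum_filter_of_ne fun i _ h h' => h (by simp [h'])
  rw [← h0]
  have hcard : (I.filter (fun i => u i ≠ 0)).card ≤ 3 := by
    rcases (I.filter (fun i => u i ≠ 0)).eq_empty_or_nonempty with he | he
    · rw [he]; simp
    · set S := I.filter (fun i => u i ≠ 0)
      have hsub : S ⊆ Finset.Icc (S.min' he) (S.min' he + 2) := fun i hi => by
        have h1 := Finset.mem_filter.1 hi
        have h2 := Finset.mem_filter.1 (S.min'_mem he)
        refine Finset.mem_Icc.2 ⟨S.min'_le i hi, ?_⟩
        have h3 := (hx i h1.1 h1.2).2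
        have h4 := (hx _ h2.1 h2.2).1
        have : (i : ℝ) < ((S.min' he + 2 : ℕ) : ℝ) := by push_cast; linarith
        exact (Nat.cast_lt.1 this).le
      refine (Finset.card_le_card hsub).trans ?_
      simp; omega
  calc _ ≤ ∑ i ∈ I.filter (fun i => u i ≠ 0), ENNReal.ofReal (M ^ 2) := by
        refine Finset.sum_le_sum fun i hi => ?_
        rw [← ofReal_norm, ← ENNReal.ofReal_pow (norm_nonneg _)]
        exact ENNReal.ofReal_le_ofReal
          (pow_le_pow_left₀ (norm_nonneg _) (hM i (Finset.mem_filter.1 hi).1) 2)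
    _ ≤ _ := by
        rw [Finset.sum_const, nsmul_eq_mul, ENNReal.ofReal_mul (by norm_num)]
        gcongr
        rw [show (3 : ℝ) = ((3 : ℕ) : ℝ) by norm_num, ENNReal.ofReal_natCast]
        exact_mod_cast hcard

theorem four_derivs_eq_zero {E : Type*} [NormedAddCommGroup E] [NormedSpace ℝ E] {S : Set E}
    (hS : IsClosed S) {f : E → ℂ} (hf : ∀ ξ ∉ S, f ξ = 0) (b₁ b₂ : E) {ξ : E} (hξ : ξ ∉ S) :
    f ξ = 0 ∧ fderiv ℝ f ξ b₁ = 0 ∧ fderiv ℝ f ξ b₂ = 0 ∧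
      fderiv ℝ (fun ξ => fderiv ℝ f ξ b₁) ξ b₂ = 0 := by
  have h1 : ∀ η ∉ S, fderiv ℝ f η = 0 := fun η hη => by
    have : f =ᶠ[nhds η] fun _ => 0 :=
      Filter.eventually_of_mem (hS.isOpen_compl.mem_nhds hη) fun x hx => hf x hx
    rw [this.fderiv_eq]; simp
  have h2 : (fun ξ => fderiv ℝ f ξ b₁) =ᶠ[nhds ξ] fun _ => 0 :=
    Filter.eventually_of_mem (hS.isOpen_compl.mem_nhds hξ) fun x hx => by simp [h1 x hx]
  refine ⟨hf ξ hξ, by simp [h1 ξ hξ], by simp [h1 ξ hξ], ?_⟩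
  rw [h2.fderiv_eq]; simp

/-- The plane coordinates with axes `e₁ = r₁⁻¹ n`, `e₂ = r₂⁻¹ n^⊥`. -/
def planeEquiv (c d r₁ r₂ : ℝ) (h : c ^ 2 + d ^ 2 = 1) (h₁ : r₁ ≠ 0) (h₂ : r₂ ≠ 0) :
    (ℝ × ℝ) ≃L[ℝ] ℂ :=
  LinearEquiv.toContinuousLinearEquiv
  { toFun := fun s => s.2 • (r₁⁻¹ • (⟨c, d⟩ : ℂ)) + s.1 • (r₂⁻¹ • (⟨-d, c⟩ : ℂ))
    map_add' := fun s s' => by simp [add_smul]; ring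
    map_smul' := fun a s => by simp [mul_smul]
    invFun := fun ξ => (r₂ * (ξ.im * c - ξ.re * d), r₁ * (ξ.re * c + ξ.im * d))
    left_inv := fun s => by
      ext
      · simp; field_simp; linear_combination (s.1 * r₁) * h
      · simp; field_simp; linear_combination (s.2 * r₂) * h
    right_inv := fun ξ => by
      apply Complex.ext
      · simp; field_simp; linear_combination ξ.re * h
      · simp; field_simp; linear_combination ξ.im * h }

theorem planeEquiv_apply (c d r₁ r₂ : ℝ) (h : c ^ 2 + d ^ 2 = 1) (h₁ : r₁ ≠ 0) (h₂ : r₂ ≠ 0)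
    (s : ℝ × ℝ) : planeEquiv c d r₁ r₂ h h₁ h₂ s =
      s.2 • (r₁⁻¹ • (⟨c, d⟩ : ℂ)) + s.1 • (r₂⁻¹ • (⟨-d, c⟩ : ℂ)) := rfl

/-- First coordinate of the unit normal at slope `w`. -/
def nre (w : ℝ) : ℝ := (1 - w ^ 2) / (1 + w ^ 2)
/-- Second coordinate of the unit normal at slope `w`. -/
def nim (w : ℝ) : ℝ := 2 * w / (1 + w ^ 2)

theorem sectorParam_dyadic (w : ℝ) {N k : ℕ} (hk : k ≤ N) :
    SectorParam (2 ^ N) (2 / 2 ^ k) w (nre w) (nim w) (2000 * 4 ^ k / 4 ^ N) (2000 * 2 ^ k / 4 ^ N) := by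
  have hD : (1 : ℝ) ≤ 2 ^ k := one_le_pow₀ (by norm_num)
  have hQ : (1 : ℝ) ≤ 2 ^ N := one_le_pow₀ (by norm_num)
  have hDQ : (2 : ℝ) ^ k ≤ 2 ^ N := pow_le_pow_right₀ (by norm_num) hk
  rw [four_pow_eq, four_pow_eq]
  set D : ℝ := 2 ^ k
  set Q : ℝ := 2 ^ N
  have hD0 : 0 < D := by linarith
  have hQ0 : 0 < Q := by linarith
  have a1 : D * D ≤ Q * Q := by gcongr
  have a2 : D * D * D ≤ Q * Q * Q := by gcongr
  constructor
  · rw [nre]; field_simp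
  · rw [nim]; field_simp
  · exact hQ
  · positivity
  · exact div_le_self (by norm_num) hD
  · positivity
  · positivity
  · rw [div_le_iff₀ (by positivity)]; linarith
  · rw [div_le_iff₀ (by positivity)]; nlinarith
  · apply le_of_eq; field_simp; norm_num
  · apply le_of_eq; field_simp; norm_num
  · rw [show 2000 * (D * D) / (Q * Q) * (2000 * D / (Q * Q)) * (2 / D) =
      8000000 * (D * D / (Q * Q)) / Q ^ 2 by field_simp; norm_num]
    gcongr
    have : D * D / (Q * Q) ≤ 1 := by rw [div_le_one (by positivity)]; exact a1
    linarith
  · rw [show Q * (2000 * (D * D) / (Q * Q)) * (2 / D) = 4000 * (D / Q) by field_simp; norm_num]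
    have : D / Q ≤ 1 := by rw [div_le_one (by positivity)]; exact hDQ
    linarith
  · rw [show Q * (2000 * D / (Q * Q)) = 2000 * (D / Q) by field_simp]
    have : D / Q ≤ 1 := by rw [div_le_one (by positivity)]; exact hDQ
    linarith
  · rw [show Q * (2000 * (D * D) / (Q * Q)) * (2000 * D / (Q * Q)) =
      4000000 * (D * D * D / (Q * Q * Q)) by field_simp; norm_num]
    have : D * D * D / (Q * Q * Q) ≤ 1 := by rw [div_le_one (by positivity)]; exact a2
    linarith

theorem amp_eq_zero_of_notMem {φ : ℝ → ℝ} (hφ : IsLPBump φ) {K l Q c : ℝ} {ξ : ℂ}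
    (h : ξ ∉ ampSet Q c) : amp φ K l Q c ξ = 0 := by
  by_contra h'
  exact h (amp_support hφ h').1

theorem ampSet_index {Q s : ℝ} {i : ℕ} {ξ : ℂ} (h : ξ ∈ ampSet Q (Q * s + i)) :
    Q * slope ξ - Q * s - 1.002 ≤ i ∧ (i : ℝ) < Q * slope ξ - Q * s - 1.002 + 2 := by
  have ha := (ampSet_pos h).2
  obtain ⟨-, -, -, h4, h5⟩ := h
  have e : Q * ξ.im = (Q * slope ξ) * (‖ξ‖ + ξ.re) := by
    rw [slope]; field_simp
  rw [e] at h4 h5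
  have h4' := le_of_mul_le_mul_right h4 (by linarith)
  have h5' := le_of_mul_le_mul_right h5 (by linarith)
  constructor <;> norm_num at h4' h5' ⊢ <;> linarith

theorem exists_sum_gavg_packet_le {φ : ℝ → ℝ} (hφ : IsLPBump φ) : ∃ C : ℝ, 0 < C ∧
    ∀ (N k : ℕ), k ≤ N → ∀ (s K l t : ℝ), 1 ≤ K → ∀ f : ℂ → ℂ, BddCpt f →
    ∑ j ∈ Finset.range (2 ^ k), ∫⁻ x, gavg
      ((2000 * 4 ^ k / 4 ^ N : ℝ)⁻¹ • (⟨nre (s + j / 2 ^ k), nim (s + j / 2 ^ k)⟩ : ℂ))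
      ((2000 * 2 ^ k / 4 ^ N : ℝ)⁻¹ • (⟨-nim (s + j / 2 ^ k), nre (s + j / 2 ^ k)⟩ : ℂ))
      (fun z => ∑ i ∈ Finset.range (2 ^ (N - k)),
        ‖mulOp (packet φ K l (2 ^ N) (2 ^ N * s + (j * 2 ^ (N - k) + i : ℕ)) t) f z‖ₑ ^ 2) x ^ 2 ≤
      ENNReal.ofReal (C * (K * (1 + |t| / 4 ^ N)) ^ 20) * ∫⁻ x, ‖f x‖ₑ ^ 4 := by
  obtain ⟨B, hB1, hw, hb, hh, hc⟩ := exists_symbol_bound hφ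
  refine ⟨32 * (16 * (3 * (256 * (2 * (B * 100000000000 ^ 2)) ^ 5) ^ 2) * π ^ 2) * 3,
    by positivity, fun N k hk s K l t hK f hf => ?_⟩
  set M : ℝ := 256 * (2 * (B * (100000000000 * K * (1 + |t| / (2 ^ N) ^ 2)) ^ 2)) ^ 5 with hM
  have hT : 0 < 1 + |t| / (2 ^ N : ℝ) ^ 2 := by positivity
  have hM0 : 0 < M := by positivity
  set m : ℕ → ℂ → ℂ := fun i => packet φ K l (2 ^ N) (2 ^ N * s + (i : ℕ)) t with hm
  set w : ℕ → ℝ := fun j => s + j / 2 ^ k with hw'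
  set I : ℕ → Finset ℕ := fun j => (Finset.range (2 ^ (N - k))).map (addLeftEmbedding (j * 2 ^ (N - k)))
    with hI
  have hS : ∀ j, SectorParam (2 ^ N) (2 / 2 ^ k) (w j) (nre (w j)) (nim (w j))
    (2000 * 4 ^ k / 4 ^ N) (2000 * 2 ^ k / 4 ^ N) := fun j => sectorParam_dyadic (w j) hk
  have hpow : (2 : ℝ) ^ (N - k) * 2 ^ k = 2 ^ N := by rw [← pow_add, Nat.sub_add_cancel hk]
  have hD : (1 : ℝ) ≤ 2 ^ (N - k) := one_le_pow₀ (by norm_num)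
  have hsect : ∀ j, ∀ i ∈ I j, ampSet (2 ^ N) (2 ^ N * s + (i : ℕ)) ⊆ sector (w j) (2 / 2 ^ k) := by
    intro j i hi
    obtain ⟨i', hi', rfl⟩ := Finset.mem_map.1 hi
    have h1 : ((i' : ℕ) : ℝ) + 1 ≤ 2 ^ (N - k) := by exact_mod_cast Finset.mem_range.1 hi'
    have h0 : (0 : ℝ) ≤ i' := Nat.cast_nonneg _
    have e1 : (2 : ℝ) ^ N * (j / 2 ^ k) = j * 2 ^ (N - k) := by rw [← hpow]; field_simp
    have e2 : (2 : ℝ) ^ N * (2 / 2 ^ k) = 2 * 2 ^ (N - k) := by rw [← hpow]; field_simp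
    refine ampSet_subset_sector (by positivity) ?_ ?_
    · rw [mul_sub, hw', mul_add, e1, e2]; simp; norm_num; linarith
    · rw [mul_add, hw', mul_add, e1, e2]; simp; norm_num; linarith
  have hder : ∀ j, ∀ i ∈ I j, ∀ ξ ∈ sector (w j) (2 / 2 ^ k), _ := fun j i hi ξ hξ =>
    ((hS j).jet_packet (φ := φ) (l := l) (c' := 2 ^ N * s + (i : ℕ)) (t := t) hK hB1 hw hb hh hc).fderiv_le
      (isOpen_sector _ _) ((sym_packet hφ _ _ _ _ _).modu _).smooth hξ
  have hzero : ∀ j, ∀ i : ℕ, ∀ ξ ∉ ampSet (2 ^ N) (2 ^ N * s + (i : ℕ)), _ := fun j i ξ hξ =>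
    four_derivs_eq_zero (isClosed_ampSet _ _) (f := modu (-(t • (⟨nre (w j), nim (w j)⟩ : ℂ))) (m i))
      (fun ξ hξ => by rw [modu, hm]; simp only [packet]; rw [amp_eq_zero_of_notMem hφ hξ]; simp)
      ⟨2000 * 4 ^ k / 4 ^ N * nre (w j), 2000 * 4 ^ k / 4 ^ N * nim (w j)⟩
      ⟨-(2000 * 2 ^ k / 4 ^ N * nim (w j)), 2000 * 2 ^ k / 4 ^ N * nre (w j)⟩ hξ
  have key := sum_lintegral_gavg_sq_le (Finset.range (2 ^ k)) I (m := m)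
    (fun j _ i _ => sym_packet hφ _ _ _ _ _)
    (fun j => -(t • (⟨nre (w j), nim (w j)⟩ : ℂ)))
    (fun j => (2000 * 4 ^ k / 4 ^ N : ℝ)⁻¹ • (⟨nre (w j), nim (w j)⟩ : ℂ))
    (fun j => (2000 * 2 ^ k / 4 ^ N : ℝ)⁻¹ • (⟨-nim (w j), nre (w j)⟩ : ℂ))
    (fun j => ⟨2000 * 4 ^ k / 4 ^ N * nre (w j), 2000 * 4 ^ k / 4 ^ N * nim (w j)⟩)
    (fun j => ⟨-(2000 * 2 ^ k / 4 ^ N * nim (w j)), 2000 * 2 ^ k / 4 ^ N * nre (w j)⟩)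
    (fun j => planeEquiv (nre (w j)) (nim (w j)) _ _ (hS j).sq_add_sq (hS j).hr₁.ne' (hS j).hr₂.ne')
    (fun j _ s => rfl) (fun j _ s => ?_) (fun j _ s => ?_) (A := 3 * M ^ 2) (B := 3) (by positivity)
    (fun j _ ξ => ?_) (fun j _ ξ => ?_) (fun j _ ξ => ?_) (fun j _ ξ => ?_) (fun ξ => ?_) hf
  · have e1 : ENNReal.ofReal (32 * (16 * (3 * M ^ 2) * π ^ 2)) * 3 = ENNReal.ofReal
        (32 * (16 * (3 * (256 * (2 * (B * 100000000000 ^ 2)) ^ 5) ^ 2) * π ^ 2) * 3 *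
          (K * (1 + |t| / 4 ^ N)) ^ 20) := by
      rw [show (3 : ℝ≥0∞) = ENNReal.ofReal 3 by simp, ← ENNReal.ofReal_mul (by positivity), hM,
        four_pow_eq]
      congr 1; ring
    rw [← e1]
    refine le_trans (le_of_eq ?_) key
    refine Finset.sum_congr rfl fun j _ => ?_
    simp only [hI, Finset.sum_map, addLeftEmbedding_apply]
    rfl
  · have h := (hS j).sq_add_sq
    have hr := (hS j).hr₁.ne'
    rw [planeEquiv_apply]
    generalize (2000 * 4 ^ k / 4 ^ N : ℝ) = r₁ at hr ⊢
    generalize (2000 * 2 ^ k / 4 ^ N : ℝ) = r₂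
    have hr' := mul_inv_cancel₀ hr
    simp [Complex.inner]
    linear_combination s.2 * h + s.2 * (nre (w j) ^ 2 + nim (w j) ^ 2) * hr'
  · have h := (hS j).sq_add_sq
    have hr := (hS j).hr₂.ne'
    rw [planeEquiv_apply]
    generalize (2000 * 4 ^ k / 4 ^ N : ℝ) = r₁
    generalize (2000 * 2 ^ k / 4 ^ N : ℝ) = r₂ at hr ⊢
    have hr' := mul_inv_cancel₀ hr
    simp [Complex.inner]
    linear_combination s.1 * h + s.1 * (nre (w j) ^ 2 + nim (w j) ^ 2) * hr'
  · refine sum_enorm_sq_le_three (x := 2 ^ N * slope ξ - 2 ^ N * s - 1.002) _ _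
      (fun i hi => ?_) (fun i hi h => ?_)
    · by_cases hξ : ξ ∈ ampSet (2 ^ N) (2 ^ N * s + (i : ℕ))
      · exact (hder j i hi ξ (hsect j i hi hξ)).1
      · rw [(hzero j i ξ hξ).1, norm_zero]; exact hM0.le
    · by_contra h'
      exact h ((hzero j i ξ fun hξ => h' (ampSet_index hξ)).1)
  · refine sum_enorm_sq_le_three (x := 2 ^ N * slope ξ - 2 ^ N * s - 1.002) _ _
      (fun i hi => ?_) (fun i hi h => ?_)
    · by_cases hξ : ξ ∈ ampSet (2 ^ N) (2 ^ N * s + (i : ℕ))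
      · exact (hder j i hi ξ (hsect j i hi hξ)).2.1
      · rw [(hzero j i ξ hξ).2.1, norm_zero]; exact hM0.le
    · by_contra h'
      exact h ((hzero j i ξ fun hξ => h' (ampSet_index hξ)).2.1)
  · refine sum_enorm_sq_le_three (x := 2 ^ N * slope ξ - 2 ^ N * s - 1.002) _ _
      (fun i hi => ?_) (fun i hi h => ?_)
    · by_cases hξ : ξ ∈ ampSet (2 ^ N) (2 ^ N * s + (i : ℕ))
      · exact (hder j i hi ξ (hsect j i hi hξ)).2.2.1
      · rw [(hzero j i ξ hξ).2.2.1, norm_zero]; exact hM0.le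
    · by_contra h'
      exact h ((hzero j i ξ fun hξ => h' (ampSet_index hξ)).2.2.1)
  · refine sum_enorm_sq_le_three (x := 2 ^ N * slope ξ - 2 ^ N * s - 1.002) _ _
      (fun i hi => ?_) (fun i hi h => ?_)
    · by_cases hξ : ξ ∈ ampSet (2 ^ N) (2 ^ N * s + (i : ℕ))
      · exact (hder j i hi ξ (hsect j i hi hξ)).2.2.2
      · rw [(hzero j i ξ hξ).2.2.2, norm_zero]; exact hM0.le
    · by_contra h'
      exact h ((hzero j i ξ fun hξ => h' (ampSet_index hξ)).2.2.2)
  · have e : ∑ j ∈ Finset.range (2 ^ k), ∑ i ∈ I j, ‖m i ξ‖ₑ ^ 2 =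
        ∑ i ∈ Finset.range (2 ^ N), ‖m i ξ‖ₑ ^ 2 := by
      have h := sum_range_two_pow (fun i => ‖m i ξ‖ₑ ^ 2) k (N - k)
      rw [Nat.add_sub_cancel' hk] at h
      rw [h]
      refine Finset.sum_congr rfl fun j _ => ?_
      simp only [hI, Finset.sum_map, addLeftEmbedding_apply]
    rw [e]
    refine (sum_enorm_sq_le_three (M := 1) (x := 2 ^ N * slope ξ - 2 ^ N * s - 1.002) _ _
      (fun i _ => ?_) (fun i _ h => ?_)).trans (by simp)
    · rw [hm]
      simp only [packet]
      rw [norm_mul, norm_wave, one_mul, Complex.norm_real, Real.norm_of_nonneg (amp_nonneg hφ _ _ _ _ _)]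
      exact amp_le_one hφ _ _ _ _ _
    · by_contra h'
      refine h ?_
      rw [hm]
      simp only [packet]
      rw [amp_eq_zero_of_notMem hφ fun hξ => h' (ampSet_index hξ)]
      simp

end Families

section Lift

/-- Space-time frequency space. -/
abbrev V3 := WithLp 2 (ℂ × ℝ)

theorem lintegral_V3 {G : V3 → ℝ≥0∞} (hG : Measurable G) :
    ∫⁻ z, G z = ∫⁻ t : ℝ, ∫⁻ x : ℂ, G (WithLp.toLp 2 (x, t)) := by
  have hm : Measurable (fun x : ℂ × ℝ => (WithLp.toLp 2 x : V3)) := (WithLp.prod_continuous_toLp 2 ℂ ℝ).measurable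
  rw [← (WithLp.volume_preserving_toLp ℂ ℝ).lintegral_comp hG, Measure.volume_eq_prod]
  exact lintegral_prod_symm' (fun y : ℂ × ℝ => G (WithLp.toLp 2 y)) (hG.comp hm)

/-- The function `g` spread over the `R⁻¹`-neighbourhood of the cone. -/
def coneLift (b : ℝ → ℝ) (R : ℝ) (g : ℂ → ℂ) (ζ : V3) : ℂ :=
  ((R * b (R * (ζ.snd - ‖ζ.fst‖)) : ℝ) : ℂ) * g ζ.fst

variable {b : ℝ → ℝ} {R : ℝ} {g : ℂ → ℂ}

theorem hasCompactSupport_coneLift (hR : 0 < R) (hb : HasCompactSupport b) (hg : HasCompactSupport g) :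
    HasCompactSupport (coneLift b R g) := by
  let h : V3 ≃ₜ ℂ × ℝ := WithLp.homeomorphProd 2 ℂ ℝ
  let Φ : ℂ × ℝ → V3 := fun y => WithLp.toLp 2 (y.1, ‖y.1‖ + y.2 / R)
  have hΦ : Continuous Φ := (WithLp.prod_continuous_toLp 2 ℂ ℝ).comp (by fun_prop)
  refine HasCompactSupport.of_support_subset_isCompact ((hg.isCompact.prod hb.isCompact).image hΦ)
    fun ζ hζ => ?_
  have h1 : g ζ.fst ≠ 0 := fun h => hζ (by rw [coneLift, h, mul_zero])
  have h2 : b (R * (ζ.snd - ‖ζ.fst‖)) ≠ 0 := fun h => hζ (by rw [coneLift, h]; simp)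
  refine ⟨(ζ.fst, R * (ζ.snd - ‖ζ.fst‖)), ⟨subset_tsupport _ h1, subset_tsupport _ h2⟩, ?_⟩
  have : ‖ζ.fst‖ + R * (ζ.snd - ‖ζ.fst‖) / R = ζ.snd := by field_simp; ring
  simp only [Φ, this]
  rfl

theorem contDiff_coneLift (hb : ContDiff ℝ ∞ b) (hg : Sym g) (h0 : (0 : ℂ) ∉ tsupport g) :
    ContDiff ℝ ∞ (coneLift b R g) := by
  have hfst : ContDiff ℝ ∞ fun ζ : V3 => ζ.fst := (WithLp.fstL 2 ℝ ℂ ℝ).contDiff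
  have hsnd : ContDiff ℝ ∞ fun ζ : V3 => ζ.snd := (WithLp.sndL 2 ℝ ℂ ℝ).contDiff
  refine contDiff_of_forall_mem_tsupport fun ζ hζ => ?_
  have hcl : IsClosed {ζ : V3 | ζ.fst ∈ tsupport g} := (isClosed_tsupport g).preimage hfst.continuous
  have hsub : tsupport (coneLift b R g) ⊆ {ζ : V3 | ζ.fst ∈ tsupport g} :=
    closure_minimal (fun ζ hζ => subset_tsupport _ fun h => hζ (by rw [coneLift, h, mul_zero])) hcl
  have hne : ζ.fst ≠ 0 := fun h => h0 (by rw [← h]; exact hsub hζ)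
  have hn : ContDiffAt ℝ ∞ (fun ζ : V3 => ‖ζ.fst‖) ζ :=
    ContDiffAt.comp (g := fun ξ : ℂ => ‖ξ‖) ζ (contDiffAt_norm ℝ hne) hfst.contDiffAt
  have h1 : ContDiffAt ℝ ∞ (fun ζ : V3 => R * b (R * (ζ.snd - ‖ζ.fst‖))) ζ :=
    contDiffAt_const.mul (ContDiffAt.comp (g := b) ζ hb.contDiffAt
      (contDiffAt_const.mul (hsnd.contDiffAt.sub hn)))
  have h2 : ContDiffAt ℝ ∞ (fun ζ : V3 => ((R * b (R * (ζ.snd - ‖ζ.fst‖)) : ℝ) : ℂ)) ζ :=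
    ContDiffAt.comp (g := fun r : ℝ => (r : ℂ)) ζ Complex.ofRealCLM.contDiff.contDiffAt h1
  exact h2.mul (hg.smooth.comp hfst).contDiffAt

theorem fourierInv_coneLift (hR : 0 < R) (hb : HasCompactSupport b) (hbs : ContDiff ℝ ∞ b) (hg : Sym g)
    (x : ℂ) (t : ℝ) :
    𝓕⁻ (coneLift b R g) (WithLp.toLp 2 (x, t)) =
      (∫ s, wave (t / R * s) * (b s : ℂ)) * 𝓕⁻ (fun ξ => wave (t * ‖ξ‖) * g ξ) x := by
  have hcont : Continuous (coneLift b R g) := by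
    have hfst : Continuous fun ζ : V3 => ζ.fst := (WithLp.fstL 2 ℝ ℂ ℝ).continuous
    have hsnd : Continuous fun ζ : V3 => ζ.snd := (WithLp.sndL 2 ℝ ℂ ℝ).continuous
    have := hbs.continuous
    have := hg.smooth.continuous
    unfold coneLift
    fun_prop
  have hcs := hasCompactSupport_coneLift hR hb hg.cpt
  have hto : Continuous fun y : ℂ × ℝ => (WithLp.toLp 2 y : V3) := WithLp.prod_continuous_toLp 2 ℂ ℝ
  have hfint : Integrable (fun y : ℂ × ℝ =>
      wave (inner ℝ y.1 x + y.2 * t) * coneLift b R g (WithLp.toLp 2 y)) := by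
    have hcs' : HasCompactSupport fun y : ℂ × ℝ => coneLift b R g (WithLp.toLp 2 y) :=
      hcs.comp_homeomorph (WithLp.homeomorphProd 2 ℂ ℝ).symm
    refine Continuous.integrable_of_hasCompactSupport ?_ hcs'.mul_left
    have := contDiff_wave.continuous
    fun_prop
  have key : ∀ ρ : ℝ, ∫ σ : ℝ, wave (σ * t) * ((R * b (R * (σ - ρ)) : ℝ) : ℂ) =
      wave (t * ρ) * ∫ s, wave (t / R * s) * (b s : ℂ) := by
    intro ρ
    have e1 := integral_sub_right_eq_self (μ := volume)
      (fun σ => wave ((σ + ρ) * t) * ((R * b (R * σ) : ℝ) : ℂ)) ρ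
    simp only [sub_add_cancel] at e1
    rw [e1]
    have e2 := Measure.integral_comp_mul_left
      (fun s => wave (t * ρ) * (wave (t / R * s) * ((R * b s : ℝ) : ℂ))) R
    have e3 : (fun σ => wave ((σ + ρ) * t) * ((R * b (R * σ) : ℝ) : ℂ)) = fun σ =>
        wave (t * ρ) * (wave (t / R * (R * σ)) * ((R * b (R * σ) : ℝ) : ℂ)) := by
      ext σ
      rw [show (σ + ρ) * t = t * ρ + t / R * (R * σ) by field_simp; ring, wave_add, mul_assoc]
    rw [e3, e2, integral_const_mul, abs_of_pos (by positivity)]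
    have e4 : ∀ s, wave (t / R * s) * ((R * b s : ℝ) : ℂ) = (R : ℂ) * (wave (t / R * s) * (b s : ℂ)) := by
      intro s; push_cast; ring
    simp_rw [e4]
    rw [integral_const_mul, Complex.real_smul]
    have : (R : ℂ) ≠ 0 := by exact_mod_cast hR.ne'
    push_cast; field_simp
  rw [Real.fourierInv_eq', ← (WithLp.volume_preserving_toLp ℂ ℝ).integral_comp
    (MeasurableEquiv.toLp 2 (ℂ × ℝ)).measurableEmbedding, Measure.volume_eq_prod]
  have e0 : (fun y : ℂ × ℝ => Complex.exp (↑(2 * π * inner ℝ (WithLp.toLp 2 y : V3) (WithLp.toLp 2 (x, t)))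
      * Complex.I) • coneLift b R g (WithLp.toLp 2 y)) = fun y : ℂ × ℝ =>
      wave (inner ℝ y.1 x + y.2 * t) * coneLift b R g (WithLp.toLp 2 y) := by
    ext y
    rw [WithLp.prod_inner_apply, smul_eq_mul, wave]
    simp [mul_comm t]
  rw [e0, integral_prod _ (by rwa [← Measure.volume_eq_prod]), Real.fourierInv_eq', ← integral_const_mul]
  refine integral_congr_ae (Filter.Eventually.of_forall fun ξ => ?_)
  have e5 : (fun σ : ℝ => wave (inner ℝ ξ x + σ * t) * coneLift b R g (WithLp.toLp 2 (ξ, σ))) = fun σ =>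
      (wave (inner ℝ ξ x) * g ξ) * (wave (σ * t) * ((R * b (R * (σ - ‖ξ‖)) : ℝ) : ℂ)) := by
    ext σ; rw [wave_add, coneLift]; simp; ring
  dsimp only
  rw [e5, integral_const_mul, key, smul_eq_mul]
  simp only [wave]
  ring

end Lift

section ConeGeometry

/-- First spatial frequency coordinate. -/
def reL : V3 →L[ℝ] ℝ := Complex.reCLM.comp (WithLp.fstL 2 ℝ ℂ ℝ)
/-- Second spatial frequency coordinate. -/
def imL : V3 →L[ℝ] ℝ := Complex.imCLM.comp (WithLp.fstL 2 ℝ ℂ ℝ)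
/-- The temporal frequency coordinate. -/
def sgL : V3 →L[ℝ] ℝ := WithLp.sndL 2 ℝ ℂ ℝ

/-- Coordinates in which the cone is `p₁ p₃ = p₂²`, centred at slope `s` and height `a`. -/
def coneCoords (s a : ℝ) : Coords V3 where
  p1 := a⁻¹ • (sgL + reL)
  p2 := a⁻¹ • (imL - s • (sgL + reL))
  p3 := a⁻¹ • ((sgL - reL) - (2 * s) • imL + (s ^ 2) • (sgL + reL))

theorem box_coneCoords {s a : ℝ} (ha : a ≠ 0) (ha5 : |a| ≤ 5) {N k j : ℕ} (hk : k ≤ N) {ζ : V3}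
    (hζ : ζ ∈ Box ((coneCoords s a).rescale k j) (N - k)) :
    |ζ.snd + ζ.fst.re| ≤ 160 * (4 ^ k / 4 ^ N) ∧
    |ζ.fst.im - (s + j / 2 ^ k) * (ζ.snd + ζ.fst.re)| ≤ 160 * (2 ^ k / 4 ^ N) ∧
    |(ζ.snd - ζ.fst.re) - 2 * (s + j / 2 ^ k) * ζ.fst.im +
      (s + j / 2 ^ k) ^ 2 * (ζ.snd + ζ.fst.re)| ≤ 160 * (1 / 4 ^ N) := by
  obtain ⟨h1, h2, h3⟩ := hζ
  have e : (4 : ℝ) ^ N = 4 ^ (N - k) * 4 ^ k := by rw [← pow_add, Nat.sub_add_cancel hk]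
  have e1 : ((coneCoords s a).rescale k j).p1 ζ = (ζ.snd + ζ.fst.re) / a := by
    simp [Coords.rescale, coneCoords, reL, imL, sgL]; field_simp
  have e2 : ((coneCoords s a).rescale k j).p2 ζ =
      2 ^ k * ((ζ.fst.im - (s + j / 2 ^ k) * (ζ.snd + ζ.fst.re)) / a) := by
    simp [Coords.rescale, coneCoords, reL, imL, sgL]; field_simp; ring
  have e3 : ((coneCoords s a).rescale k j).p3 ζ =
      4 ^ k * (((ζ.snd - ζ.fst.re) - 2 * (s + j / 2 ^ k) * ζ.fst.im +
      (s + j / 2 ^ k) ^ 2 * (ζ.snd + ζ.fst.re)) / a) := by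
    simp [Coords.rescale, coneCoords, reL, imL, sgL]; field_simp; ring
  have ha0 : 0 < |a| := abs_pos.2 ha
  have gen : ∀ X c : ℝ, 0 < c → 4 ^ (N - k) * (c * (|X| / |a|)) ≤ 32 → |X| ≤ 160 * (1 / (4 ^ (N - k) * c)) := by
    intro X c hc h
    have : 4 ^ (N - k) * (c * (|X| / |a|)) = (|X| * (4 ^ (N - k) * c)) / |a| := by ring
    rw [this, div_le_iff₀ ha0] at h
    rw [mul_one_div, le_div_iff₀ (by positivity)]
    linarith
  rw [e1, abs_div] at h1
  rw [e2, abs_mul, abs_div, abs_of_pos (show (0 : ℝ) < 2 ^ k by positivity)] at h2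
  rw [e3, abs_mul, abs_div, abs_of_pos (show (0 : ℝ) < 4 ^ k by positivity)] at h3
  refine ⟨(gen _ 1 one_pos (by rwa [one_mul])).trans (le_of_eq ?_), (gen _ _ (by positivity) h2).trans (le_of_eq ?_),
    (gen _ _ (by positivity) h3).trans (le_of_eq ?_)⟩
  · rw [e]; field_simp
  · rw [e, four_pow_eq k]; field_simp
  · rw [e]

theorem inner_box_le {s a : ℝ} (ha : a ≠ 0) (ha5 : |a| ≤ 5) {N k j : ℕ} (hk : k ≤ N)
    (hw : |s + j / 2 ^ k| ≤ 2) {ζ : V3}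
    (hζ : ζ ∈ Box ((coneCoords s a).rescale k j) (N - k)) :
    |inner ℝ (WithLp.toLp 2 (((2000 * 4 ^ k / 4 ^ N : ℝ)⁻¹ •
      (⟨nre (s + j / 2 ^ k), nim (s + j / 2 ^ k)⟩ : ℂ)), (0 : ℝ)) : V3) ζ| ≤ 1 ∧
    |inner ℝ (WithLp.toLp 2 (((2000 * 2 ^ k / 4 ^ N : ℝ)⁻¹ •
      (⟨-nim (s + j / 2 ^ k), nre (s + j / 2 ^ k)⟩ : ℂ)), (0 : ℝ)) : V3) ζ| ≤ 1 := by
  obtain ⟨h1, h2, h3⟩ := box_coneCoords ha ha5 hk hζ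
  set w := s + j / 2 ^ k
  obtain ⟨A, hA⟩ : ∃ A, A = ζ.snd + ζ.fst.re := ⟨_, rfl⟩
  obtain ⟨B, hB⟩ : ∃ B, B = ζ.fst.im - w * (ζ.snd + ζ.fst.re) := ⟨_, rfl⟩
  obtain ⟨D, hD⟩ : ∃ D, D = (ζ.snd - ζ.fst.re) - 2 * w * ζ.fst.im + w ^ 2 * (ζ.snd + ζ.fst.re) := ⟨_, rfl⟩
  rw [← hA] at h1
  rw [← hB] at h2
  rw [← hD] at h3
  have hw2 : 0 < 1 + w ^ 2 := by positivity
  have b1 : |nre w| ≤ 1 := by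
    rw [nre, abs_div, abs_of_pos hw2, div_le_one hw2]
    exact abs_le.2 ⟨by nlinarith [sq_nonneg w], by nlinarith [sq_nonneg w]⟩
  have b2 : |nim w| ≤ 1 := by
    rw [nim, abs_div, abs_of_pos hw2, div_le_one hw2]
    exact abs_le.2 ⟨by nlinarith [sq_nonneg (w + 1)], by nlinarith [sq_nonneg (w - 1)]⟩
  have i1 : nre w * ζ.fst.re + nim w * ζ.fst.im = nre w * ((1 - w ^ 2) / 2 * A - w * B - D / 2) +
      nim w * (B + w * A) := by
    rw [hA, hB, hD]; ring
  have i2 : -nim w * ζ.fst.re + nre w * ζ.fst.im = B + nim w / 2 * D := by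
    rw [hB, hD, nim, nre]; field_simp; ring
  have p4 : (2 : ℝ) ^ k / 4 ^ N ≤ 4 ^ k / 4 ^ N := by gcongr; norm_num
  have p5 : 1 / (4 : ℝ) ^ N ≤ 2 ^ k / 4 ^ N := by gcongr; exact one_le_pow₀ (by norm_num)
  have hN : (0 : ℝ) < 4 ^ N := by positivity
  have m1 : ∀ x y : ℝ, ∀ X Y, |x| ≤ X → |y| ≤ Y → |x * y| ≤ X * Y := fun x y X Y hx hy => by
    rw [abs_mul]; exact mul_le_mul hx hy (abs_nonneg _) ((abs_nonneg _).trans hx)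
  constructor
  · have e : inner ℝ (WithLp.toLp 2 (((2000 * 4 ^ k / 4 ^ N : ℝ)⁻¹ •
        (⟨nre w, nim w⟩ : ℂ)), (0 : ℝ)) : V3) ζ = (nre w * ζ.fst.re + nim w * ζ.fst.im) / (2000 * (4 ^ k / 4 ^ N)) := by
      rw [WithLp.prod_inner_apply]
      generalize hr : (2000 * 4 ^ k / 4 ^ N : ℝ) = r
      rw [← mul_div_assoc, hr]
      simp [Complex.inner]; ring
    rw [e, abs_div, abs_of_pos (show (0 : ℝ) < 2000 * (4 ^ k / 4 ^ N) by positivity), div_le_one (by positivity), i1]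
    have hsq : |(1 - w ^ 2) / 2| ≤ 3 / 2 := by
      obtain ⟨a1, a2⟩ := abs_le.1 hw
      exact abs_le.2 ⟨by nlinarith, by nlinarith⟩
    have q1 := m1 _ _ _ _ hsq h1
    have q2 := m1 _ _ _ _ hw h2
    have q3 := m1 _ _ _ _ hw h1
    have r1 : |(1 - w ^ 2) / 2 * A - w * B - D / 2| ≤ 700 * (4 ^ k / 4 ^ N) := by
      rw [abs_le] at *
      constructor <;> linarith [q1.1, q1.2, q2.1, q2.2, h3.1, h3.2]
    have r2 : |B + w * A| ≤ 500 * (4 ^ k / 4 ^ N) := by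
      rw [abs_le] at *
      constructor <;> linarith [q3.1, q3.2, h2.1, h2.2]
    have s1 := m1 _ _ _ _ b1 r1
    have s2 := m1 _ _ _ _ b2 r2
    refine (abs_add_le _ _).trans ?_
    have : (0 : ℝ) < 4 ^ k / 4 ^ N := by positivity
    linarith
  · have e : inner ℝ (WithLp.toLp 2 (((2000 * 2 ^ k / 4 ^ N : ℝ)⁻¹ •
        (⟨-nim w, nre w⟩ : ℂ)), (0 : ℝ)) : V3) ζ = (-nim w * ζ.fst.re + nre w * ζ.fst.im) / (2000 * (2 ^ k / 4 ^ N)) := by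
      rw [WithLp.prod_inner_apply]
      generalize hr : (2000 * 2 ^ k / 4 ^ N : ℝ) = r
      rw [← mul_div_assoc, hr]
      simp [Complex.inner]; ring
    rw [e, abs_div, abs_of_pos (show (0 : ℝ) < 2000 * (2 ^ k / 4 ^ N) by positivity), div_le_one (by positivity), i2]
    have hn2 : |nim w / 2| ≤ 1 := by
      rw [abs_div, abs_two]; linarith
    have s2 := m1 _ _ _ _ hn2 h3
    refine (abs_add_le _ _).trans ?_
    have : (0 : ℝ) < 2 ^ k / 4 ^ N := by positivity
    linarith

set_option maxHeartbeats 1000000 in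
theorem near_coneCoords {s l : ℝ} {μ N i : ℕ} (hμ : 1 ≤ μ) (hN : 2 * μ ≤ N) {ζ : V3}
    (h1 : ζ.fst ∈ ampSet (2 ^ N) (2 ^ N * s + i))
    (h2 : -0.002 ≤ (8 * 4 ^ (2 * μ) : ℝ) * (‖ζ.fst‖ + ζ.fst.re) - l)
    (h3 : (8 * 4 ^ (2 * μ) : ℝ) * (‖ζ.fst‖ + ζ.fst.re) - l ≤ 1.002)
    (h4 : |(4 : ℝ) ^ N * (ζ.snd - ‖ζ.fst‖)| ≤ 1 / 1000) :
    Near (coneCoords s ((l - 1 / 2) / (8 * 4 ^ (2 * μ)))) (1 / 4 ^ (2 * μ)) N i ζ := by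
  have hns := normSq_eq_coords ζ.fst
  have ha := (ampSet_pos h1).2
  obtain ⟨c1, c2, c3, c4, c5⟩ := h1
  obtain ⟨ρ, hρ⟩ : ∃ ρ, ρ = ‖ζ.fst‖ := ⟨_, rfl⟩
  obtain ⟨x, hx⟩ : ∃ x, x = ζ.fst.re := ⟨_, rfl⟩
  obtain ⟨y, hy⟩ : ∃ y, y = ζ.fst.im := ⟨_, rfl⟩
  obtain ⟨τ, hτ⟩ : ∃ τ, τ = ζ.snd - ‖ζ.fst‖ := ⟨_, rfl⟩
  have hsnd : ζ.snd = ρ + τ := by rw [hρ, hτ]; ring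
  have hκ : (16 : ℝ) ≤ 4 ^ (2 * μ) := by
    calc (16 : ℝ) = 4 ^ 2 := by norm_num
      _ ≤ 4 ^ (2 * μ) := pow_le_pow_right₀ (by norm_num) (by omega)
  have hκN : (4 : ℝ) ^ (2 * μ) ≤ 4 ^ N := pow_le_pow_right₀ (by norm_num) hN
  have hQ : (4 : ℝ) ^ N = 2 ^ N * 2 ^ N := four_pow_eq N
  have hQ1 : (1 : ℝ) ≤ 2 ^ N := one_le_pow₀ (by norm_num)
  rw [← hτ] at h4
  rw [← hρ, ← hx, ← hy] at hns c4 c5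
  rw [← hρ, ← hx] at ha h2 h3
  rw [← hρ] at c1 c2
  rw [← hx] at c3
  set q : ℝ := 4 ^ (2 * μ) with hq
  set R : ℝ := 4 ^ N with hR
  set Q : ℝ := 2 ^ N with hQd
  have hR0 : 0 < R := by linarith
  have hQ0 : 0 < Q := by linarith
  have hτR : |τ| ≤ 1 / 1000 / R := by
    rw [le_div_iff₀ hR0, mul_comm]
    rwa [abs_mul, abs_of_pos hR0] at h4
  have hqτ : |q * τ| ≤ 1 / 1000 := by
    rw [abs_mul, abs_of_pos (by linarith : (0 : ℝ) < q)]
    rw [abs_mul, abs_of_pos hR0] at h4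
    exact (mul_le_mul_of_nonneg_right hκN (abs_nonneg _)).trans h4
  have hQτ : |τ| ≤ 1 / 1000 / Q := hτR.trans (by gcongr; nlinarith)
  have hτs : |τ| ≤ 1 / 1000 := hQτ.trans (div_le_self (by norm_num) hQ1)
  obtain ⟨t1, t2⟩ := abs_le.1 hτs
  obtain ⟨t3, t4⟩ := abs_le.1 hqτ
  obtain ⟨A, hA⟩ : ∃ A, A = ρ + x + τ := ⟨_, rfl⟩
  have hA7 : 0.74 ≤ A := by rw [hA]; linarith
  have hA0 : 0 < A := by linarith
  have hL : 5.89 * q ≤ l - 1 / 2 := by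
    have := mul_le_mul_of_nonneg_left ha (by linarith : 0 ≤ 8 * q)
    linarith
  have hL0 : 0 < l - 1 / 2 := by linarith
  set a : ℝ := (l - 1 / 2) / (8 * q) with had
  have ha0 : 0 < a := by positivity
  have ha7 : 0.7 ≤ a := by rw [had, le_div_iff₀ (by linarith)]; linarith
  have haq : a * (8 * q) = l - 1 / 2 := by rw [had]; field_simp
  have p1 : (coneCoords s a).p1 ζ = A / a := by
    simp [coneCoords, reL, sgL, ← hx, hsnd, hA]; field_simp; ring
  have p2 : (coneCoords s a).p2 ζ = (y - s * A) / a := by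
    simp [coneCoords, reL, imL, sgL, ← hx, ← hy, hsnd, hA]; field_simp; ring
  have p3 : (coneCoords s a).p3 ζ = (ρ + τ - x - 2 * s * y + s ^ 2 * A) / a := by
    simp [coneCoords, reL, imL, sgL, ← hx, ← hy, hsnd, hA]; field_simp; ring
  have hy2 : |y| ≤ 2.001 := abs_le_of_sq_le_sq (by nlinarith [sq_nonneg x]) (by norm_num)
  refine ⟨(y - s * A) / A, τ * (2 * ρ + τ) / (a * A), ?_, ?_, ?_, ?_, ?_, ?_⟩
  · rw [p1, le_div_iff₀ ha0, one_mul]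
    have : a * (8 * q) ≤ A * (8 * q) := by rw [haq, hA]; linarith
    exact le_of_mul_le_mul_right this (by linarith)
  · rw [p1, div_le_iff₀ ha0]
    have e : (1 + 1 / q) * a * (8 * q) = l - 1 / 2 + 8 * a := by
      rw [← haq]; field_simp
    have : A * (8 * q) ≤ (1 + 1 / q) * a * (8 * q) := by rw [e, hA]; linarith
    exact le_of_mul_le_mul_right this (by linarith)
  · rw [p1, p2]; field_simp
  · rw [p1, p3]; field_simp; rw [hA]; linear_combination hns
  · have ha' : 0 < ρ + x := by linarith
    have e : (y - s * A) / A - i / Q = (y / (ρ + x) - s - i / Q) - y * τ / ((ρ + x) * A) := by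
      rw [hA] at hA0 ⊢; field_simp; ring
    have d1 : |y / (ρ + x) - s - i / Q| ≤ 1.002 / Q := by
      have e' : y / (ρ + x) - s - i / Q = (Q * y - (Q * s + i) * (ρ + x)) / (ρ + x) / Q := by
        field_simp; ring
      rw [e', abs_div, abs_of_pos hQ0]
      gcongr
      rw [abs_div, abs_of_pos ha', div_le_iff₀ ha']
      exact abs_le.2 ⟨by linarith, by linarith⟩
    have d2 : |y * τ / ((ρ + x) * A)| ≤ 0.9 / Q := by
      rw [abs_div, abs_mul, abs_of_pos (by positivity : 0 < (ρ + x) * A), div_le_iff₀ (by positivity)]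
      have f1 : |y| * |τ| ≤ 2.001 * (1 / 1000 / Q) := mul_le_mul hy2 hQτ (abs_nonneg _) (by norm_num)
      have f2 : 0.5 ≤ (ρ + x) * A := by nlinarith
      have f3 : 2.001 * (1 / 1000 / Q) ≤ 0.9 / Q * 0.5 := by
        rw [← mul_div_assoc, div_mul_eq_mul_div]; exact div_le_div_of_nonneg_right (by norm_num) hQ0.le
      exact f1.trans (f3.trans (by gcongr))
    rw [e]
    refine (abs_sub _ _).trans ((add_le_add d1 d2).trans ?_)
    rw [← add_div]; gcongr; norm_num
  · rw [abs_div, abs_mul, abs_of_pos (by positivity : 0 < a * A), abs_of_pos (by linarith : 0 < 2 * ρ + τ),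
      div_le_iff₀ (by positivity)]
    have f1 : |τ| * (2 * ρ + τ) ≤ 1 / 1000 / R * 5 := mul_le_mul hτR (by linarith) (by linarith) (by positivity)
    have f2 : 0.5 ≤ a * A := by nlinarith
    have f3 : 1 / 1000 / R * 5 ≤ 1 / R * 0.5 := by
      rw [div_right_comm, mul_comm_div, ← sub_nonneg, ← mul_sub]
      exact mul_nonneg (by positivity) (by norm_num)
    exact f1.trans (f3.trans (by gcongr))

end ConeGeometry

section TemporalCutoff

/-- The inverse Fourier transform of a function on the line, written with `wave`. -/
def tcut (b : ℝ → ℝ) (τ : ℝ) : ℂ := ∫ s, wave (τ * s) * (b s : ℂ)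

theorem exists_tcut : ∃ b : ℝ → ℝ, ContDiff ℝ ∞ b ∧ HasCompactSupport b ∧
    (∀ s, b s ≠ 0 → |s| ≤ 1 / 1000) ∧ (∀ τ, |τ| ≤ 2 → 1 / 2 ≤ ‖tcut b τ‖) ∧
    Continuous (tcut b) ∧
    ∫⁻ τ, ‖tcut b τ‖ₑ ^ 4 * ENNReal.ofReal ((1 + |τ|) ^ 20) < ⊤ := by
  let B : ContDiffBump (0 : ℝ) := ⟨1 / 2000, 1 / 1000, by norm_num, by norm_num⟩
  set b : ℝ → ℝ := B.normed volume with hbd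
  have hb : ContDiff ℝ ∞ b := B.contDiff_normed
  have hc : HasCompactSupport b := B.hasCompactSupport_normed
  have hs : ∀ s, b s ≠ 0 → |s| ≤ 1 / 1000 := fun s h => by
    have : s ∈ Function.support b := h
    rw [hbd, B.support_normed_eq, Metric.mem_ball, dist_zero_right, Real.norm_eq_abs] at this
    exact this.le
  have hbC : ContDiff ℝ ∞ (fun s => (b s : ℂ)) := Complex.ofRealCLM.contDiff.comp hb
  have hcC : HasCompactSupport (fun s => (b s : ℂ)) := hc.comp_left (g := ((↑) : ℝ → ℂ)) (by simp)
  let g : 𝓢(ℝ, ℂ) := hcC.toSchwartzMap hbC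
  have hg : ∀ s, g s = b s := fun s => rfl
  have he : ∀ τ, tcut b τ = (𝓕⁻ g : 𝓢(ℝ, ℂ)) τ := fun τ => by
    rw [SchwartzMap.fourierInv_coe, Real.fourierInv_eq']
    exact integral_congr_ae (.of_forall fun s => rfl)
  have hfint : Integrable b := hb.continuous.integrable_of_hasCompactSupport hc
  have hcont : Continuous (tcut b) := by
    rw [show tcut b = (𝓕⁻ g : 𝓢(ℝ, ℂ)) from funext he]; exact (𝓕⁻ g : 𝓢(ℝ, ℂ)).continuous
  refine ⟨b, hb, hc, hs, fun τ hτ => ?_, hcont, ?_⟩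
  · have h1 : ∫ s, (b s : ℂ) = 1 := by rw [integral_complex_ofReal, hbd, B.integral_normed]; simp
    have hw : Continuous fun s => wave (τ * s) := contDiff_wave.continuous.comp (by fun_prop)
    have h2 : tcut b τ - 1 = ∫ s, (wave (τ * s) - 1) * (b s : ℂ) := by
      simp_rw [sub_mul, one_mul]
      rw [integral_sub, h1, tcut]
      · exact hfint.ofReal.bdd_mul (c := 1) hw.aestronglyMeasurable (.of_forall fun s => by rw [norm_wave])
      · exact hfint.ofReal
    have h3 : ‖tcut b τ - 1‖ ≤ ∫ s, (1 / 2) * b s := by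
      rw [h2]
      refine norm_integral_le_of_norm_le (hfint.const_mul _) (.of_forall fun s => ?_)
      have hn : 0 ≤ b s := B.nonneg_normed s
      rw [norm_mul, Complex.norm_real, Real.norm_of_nonneg hn]
      by_cases h0 : b s = 0
      · simp [h0]
      refine mul_le_mul_of_nonneg_right ?_ hn
      have h := Real.norm_exp_I_mul_ofReal_sub_one_le (x := 2 * π * (τ * s))
      rw [mul_comm, ← wave] at h
      refine h.trans ?_
      have hm : |τ| * |s| ≤ 2 * (1 / 1000) := mul_le_mul hτ (hs s h0) (abs_nonneg _) (by norm_num)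
      rw [Real.norm_eq_abs, abs_mul, abs_of_pos Real.two_pi_pos, abs_mul]
      nlinarith [Real.pi_pos, Real.pi_lt_four, abs_nonneg τ, abs_nonneg s]
    rw [integral_const_mul, B.integral_normed] at h3
    have := norm_sub_norm_le (1 : ℂ) (1 - tcut b τ)
    rw [norm_sub_rev 1, sub_sub_cancel, norm_one] at this
    linarith
  · obtain ⟨C, hC⟩ : ∃ C : ℝ, ∀ τ, (1 + |τ|) ^ 6 * ‖tcut b τ‖ ≤ C := by
      refine ⟨2 ^ 6 * ((Finset.Iic (6, 0)).sup fun m => SchwartzMap.seminorm ℝ m.1 m.2) (𝓕⁻ g : 𝓢(ℝ, ℂ)), fun τ => ?_⟩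
      have := SchwartzMap.one_add_le_sup_seminorm_apply (𝕜 := ℝ) (m := (6, 0)) (k := 6) (n := 0) le_rfl le_rfl (𝓕⁻ g : 𝓢(ℝ, ℂ)) τ
      rw [norm_iteratedFDeriv_zero, ← he] at this
      exact this
    have hC0 : 0 ≤ C := le_trans (by positivity) (hC 0)
    refine lt_of_le_of_lt (lintegral_mono (g := fun τ => ENNReal.ofReal (C ^ 4 * (1 + τ ^ 2)⁻¹)) fun τ => ?_)
      (integrable_inv_one_add_sq.const_mul _).lintegral_lt_top
    dsimp only
    rw [← ofReal_norm, ← ENNReal.ofReal_pow (norm_nonneg _), ← ENNReal.ofReal_mul (by positivity)]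
    refine ENNReal.ofReal_le_ofReal ?_
    rw [← div_eq_mul_inv, le_div_iff₀ (by positivity)]
    have h1 : 1 + τ ^ 2 ≤ (1 + |τ|) ^ 4 := by
      rw [← sq_abs]
      nlinarith [abs_nonneg τ, sq_nonneg |τ|, pow_nonneg (abs_nonneg τ) 3, pow_nonneg (abs_nonneg τ) 4]
    calc ‖tcut b τ‖ ^ 4 * (1 + |τ|) ^ 20 * (1 + τ ^ 2)
        ≤ ‖tcut b τ‖ ^ 4 * (1 + |τ|) ^ 20 * (1 + |τ|) ^ 4 := by gcongr
      _ = ((1 + |τ|) ^ 6 * ‖tcut b τ‖) ^ 4 := by ring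
      _ ≤ C ^ 4 := by gcongr; exact hC τ

end TemporalCutoff

section SpacetimePackets

variable {φ : ℝ → ℝ}

theorem packet_eq_wave_mul (φ : ℝ → ℝ) (K l Q c t : ℝ) (ξ : ℂ) :
    packet φ K l Q c t ξ = wave (t * ‖ξ‖) * packet φ K l Q c 0 ξ := by
  simp [packet, wave]

theorem exists_spacetime_packets (hφ : IsLPBump φ) {b : ℝ → ℝ} (hb : ContDiff ℝ ∞ b)
    (hc : HasCompactSupport b) (hs : ∀ s, b s ≠ 0 → |s| ≤ 1 / 1000) {f : ℂ → ℂ} (hf : BddCpt f)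
    (s l : ℝ) {μ N : ℕ} (hμ : 1 ≤ μ) (hN : 2 * μ ≤ N) :
    ∃ F : ℕ → 𝓢(V3, ℂ),
      Supp (coneCoords s ((l - 1 / 2) / (8 * 4 ^ (2 * μ)))) (1 / 4 ^ (2 * μ)) N F ∧
      (∀ i ξ, (𝓕 (F i) : 𝓢(V3, ℂ)) ξ ≠ 0 → ‖ξ‖ ≤ 10) ∧
      ∀ (i : ℕ) (x : ℂ) (t : ℝ), F i (WithLp.toLp 2 (x, t)) = tcut b (t / 4 ^ N) *
        mulOp (packet φ (8 * 4 ^ (2 * μ)) l (2 ^ N) (2 ^ N * s + i) t) f x := by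
  set K : ℝ := 8 * 4 ^ (2 * μ) with hK
  have hR : (0 : ℝ) < 4 ^ N := by positivity
  let g : ℕ → ℂ → ℂ := fun i ξ => packet φ K l (2 ^ N) (2 ^ N * s + i) 0 ξ * 𝓕 f ξ
  have hg : ∀ i, Sym (g i) := fun i => (sym_packet hφ K l (2 ^ N) (2 ^ N * s + i) 0).mul_fourier hf
  have hsub : ∀ i, tsupport (g i) ⊆ ampSet (2 ^ N) (2 ^ N * s + i) := fun i =>
    (tsupport_mul_subset_left (f := packet φ K l (2 ^ N) (2 ^ N * s + i) 0) (g := 𝓕 f)).trans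
      (tsupport_packet_subset hφ K l (2 ^ N) (2 ^ N * s + i) 0)
  have h0 : ∀ i, (0 : ℂ) ∉ tsupport (g i) := fun i h => (ampSet_pos (hsub i h)).1 rfl
  have hS : ∀ i, Sym (coneLift b (4 ^ N) (g i)) := fun i =>
    ⟨contDiff_coneLift hb (hg i) (h0 i), hasCompactSupport_coneLift hR hc (hg i).cpt⟩
  have hF : ∀ i ξ, (𝓕 (𝓕⁻ (hS i).toS : 𝓢(V3, ℂ)) : 𝓢(V3, ℂ)) ξ = coneLift b (4 ^ N) (g i) ξ := fun i ξ => by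
    rw [fourier_fourierInv_eq (F := 𝓢(V3, ℂ))]; rfl
  have hsupp : ∀ i (ξ : V3), coneLift b (4 ^ N) (g i) ξ ≠ 0 →
      |(4 : ℝ) ^ N * (ξ.snd - ‖ξ.fst‖)| ≤ 1 / 1000 ∧
        amp φ K l (2 ^ N) (2 ^ N * s + i) ξ.fst ≠ 0 := fun i ξ h => by
    rw [coneLift] at h
    have h1 := left_ne_zero_of_mul h
    have h2 := left_ne_zero_of_mul (right_ne_zero_of_mul h)
    refine ⟨hs _ fun h => h1 (by rw [h]; simp), fun h => h2 (by rw [packet, h]; simp)⟩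
  refine ⟨fun i => 𝓕⁻ (hS i).toS, fun i _ ξ h => ?_, fun i ξ h => ?_, fun i x t => ?_⟩
  · have h' : (𝓕 (𝓕⁻ (hS i).toS : 𝓢(V3, ℂ)) : 𝓢(V3, ℂ)) ξ ≠ 0 := h
    rw [hF] at h'
    obtain ⟨h1, h2⟩ := hsupp i ξ h'
    obtain ⟨h3, h4, h5⟩ := amp_support hφ h2
    exact near_coneCoords hμ hN h3 h4 h5 h1
  · have h' : (𝓕 (𝓕⁻ (hS i).toS : 𝓢(V3, ℂ)) : 𝓢(V3, ℂ)) ξ ≠ 0 := h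
    rw [hF] at h'
    obtain ⟨h1, h2⟩ := hsupp i ξ h'
    have h3 := (amp_support hφ h2).1.2.1
    have h4 : (1 : ℝ) ≤ 4 ^ N := one_le_pow₀ (by norm_num)
    have h5 : |ξ.snd - ‖ξ.fst‖| ≤ 1 / 1000 := by
      rw [abs_mul, abs_of_pos hR] at h1
      nlinarith [abs_nonneg (ξ.snd - ‖ξ.fst‖)]
    have h6 := abs_le.1 h5
    have h7 := norm_nonneg ξ.fst
    refine abs_le_of_sq_le_sq' (a := ‖ξ‖) ?_ (by norm_num) |>.2
    rw [WithLp.prod_norm_sq_eq_of_L2, Real.norm_eq_abs, sq_abs]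
    nlinarith
  · have e : (𝓕⁻ (hS i).toS : 𝓢(V3, ℂ)) (WithLp.toLp 2 (x, t)) =
        𝓕⁻ (coneLift b (4 ^ N) (g i)) (WithLp.toLp 2 (x, t)) := by rw [fourierInv_coe]; rfl
    refine e.trans ?_
    rw [fourierInv_coneLift hR hc hb (hg i), mulOp, tcut]
    simp only [packet_eq_wave_mul (t := t), mul_assoc, g]

end SpacetimePackets

section BlockEstimate

theorem gavg_const_mul (e₁ e₂ : ℂ) (T : ℂ → ℝ≥0∞) {c : ℝ≥0∞} (hc : c ≠ ⊤) (x : ℂ) :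
    gavg e₁ e₂ (fun y => c * T y) x = c * gavg e₁ e₂ T x := by
  simp only [gavg, mul_left_comm _ c, lintegral_const_mul' c _ hc]

theorem gavg_toLp (v₁ v₂ : ℂ) (T : V3 → ℝ≥0∞) (x : ℂ) (t : ℝ) :
    gavg (WithLp.toLp 2 (v₁, (0 : ℝ)) : V3) (WithLp.toLp 2 (v₂, (0 : ℝ))) T (WithLp.toLp 2 (x, t)) =
      gavg v₁ v₂ (fun y => T (WithLp.toLp 2 (y, t))) x := by
  unfold gavg
  refine lintegral_congr fun s₂ => lintegral_congr fun s₁ => ?_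
  congr 2
  simp [← WithLp.toLp_smul, ← WithLp.toLp_add, ← WithLp.toLp_sub]

theorem lintegral_comp_div_pos {R : ℝ} (hR : 0 < R) {g : ℝ → ℝ≥0∞} :
    ∫⁻ t, g (t / R) = ENNReal.ofReal R * ∫⁻ t, g t := by
  have h := Measure.map_addHaar_smul (volume : Measure ℝ) (inv_ne_zero hR.ne')
  simp only [Module.finrank_self, pow_one, inv_inv, abs_of_pos hR] at h
  have e : MeasurableEmbedding (fun t : ℝ => R⁻¹ • t) :=
    (Homeomorph.smulOfNeZero R⁻¹ (inv_ne_zero hR.ne')).measurableEmbedding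
  rw [← smul_eq_mul, ← lintegral_smul_measure, ← h, e.lintegral_map]
  simp [div_eq_inv_mul]

theorem exists_lintegral_block_le {φ : ℝ → ℝ} (hφ : IsLPBump φ) {b : ℝ → ℝ} (hb : ContDiff ℝ ∞ b)
    (hc : HasCompactSupport b) (hs : ∀ s, b s ≠ 0 → |s| ≤ 1 / 1000) (hcont : Continuous (tcut b)) :
    ∃ C : ℝ, 0 < C ∧ ∀ (μ e N : ℕ), 1 ≤ μ → 2 * μ ≤ N → N ≤ (e + 1) * μ → ∀ (s l : ℝ), -2 ≤ s → s ≤ 1 →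
      l ≠ 1 / 2 → |(l - 1 / 2) / (8 * 4 ^ (2 * μ))| ≤ 5 → ∀ f : ℂ → ℂ, BddCpt f →
      ∫⁻ t : ℝ, ∫⁻ x, ‖tcut b (t / 4 ^ N) * ∑ i ∈ Finset.range (2 ^ N),
          mulOp (packet φ (8 * 4 ^ (2 * μ)) l (2 ^ N) (2 ^ N * s + i) t) f x‖ₑ ^ 4 ≤
        ((stepConst N * (N + 1)) ^ (e + 1) : ℕ) * ((N + 1 : ℕ) *
          (ENNReal.ofReal (C * (8 * 4 ^ (2 * μ)) ^ 20) * ENNReal.ofReal (4 ^ N) *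
          ((∫⁻ τ, ‖tcut b τ‖ₑ ^ 4 * ENNReal.ofReal ((1 + |τ|) ^ 20)) * ∫⁻ x, ‖f x‖ₑ ^ 4))) := by
  obtain ⟨C, hC, hG⟩ := exists_sum_gavg_packet_le hφ
  refine ⟨Real.exp (4 * π) * C, by positivity, fun μ e N hμ hN hNe s l hs2 hs1 hl hl5 f hf => ?_⟩
  obtain ⟨F, hF, hFb, hFe⟩ := exists_spacetime_packets hφ hb hc hs hf s l hμ hN
  set K : ℝ := 8 * 4 ^ (2 * μ) with hK
  have hK1 : 1 ≤ K := by
    have : (1 : ℝ) ≤ 4 ^ (2 * μ) := one_le_pow₀ (by norm_num)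
    linarith
  set a : ℝ := (l - 1 / 2) / K with ha
  have ha0 : a ≠ 0 := div_ne_zero (sub_ne_zero.2 hl) (by positivity)
  have h1 := lintegral_pow_four_le_waveEnv le_rfl hNe hF
  have hm : Measurable fun z => ‖∑ i ∈ Finset.range (2 ^ N), F i z‖ₑ ^ 4 := by
    have : Continuous fun z => ∑ i ∈ Finset.range (2 ^ N), F i z :=
      continuous_finset_sum _ fun i _ => (F i).continuous
    exact this.measurable.enorm.pow_const 4
  rw [lintegral_V3 hm] at h1
  simp only [hFe, ← Finset.mul_sum] at h1
  refine h1.trans (mul_le_mul_right ?_ _)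
  set A := ∫⁻ τ, ‖tcut b τ‖ₑ ^ 4 * ENNReal.ofReal ((1 + |τ|) ^ 20) with hA
  set Z := ∫⁻ x, ‖f x‖ₑ ^ 4 with hZ
  rw [waveEnv, show ((N + 1 : ℕ) : ℝ≥0∞) = ((Finset.range (N + 1)).card : ℝ≥0∞) by simp, ← nsmul_eq_mul]
  refine Finset.sum_le_card_nsmul _ _ _ fun k hk => ?_
  have hk : k ≤ N := Nat.lt_succ_iff.1 (Finset.mem_range.1 hk)
  set v₁ : ℕ → ℂ := fun j => (2000 * 4 ^ k / 4 ^ N : ℝ)⁻¹ •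
    (⟨nre (s + j / 2 ^ k), nim (s + j / 2 ^ k)⟩ : ℂ) with hv₁
  set v₂ : ℕ → ℂ := fun j => (2000 * 2 ^ k / 4 ^ N : ℝ)⁻¹ •
    (⟨-nim (s + j / 2 ^ k), nre (s + j / 2 ^ k)⟩ : ℂ) with hv₂
  set h : ℕ → 𝓢(V3, ℂ) := fun j => sqn (fun i => F (j * 2 ^ (N - k) + i)) (N - k) with hh
  set T : ℕ → ℝ → ℂ → ℝ≥0∞ := fun j t z => ∑ i ∈ Finset.range (2 ^ (N - k)),
    ‖mulOp (packet φ K l (2 ^ N) (2 ^ N * s + (j * 2 ^ (N - k) + i : ℕ)) t) f z‖ₑ ^ 2 with hT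
  have hhT : ∀ j x t, ‖h j (WithLp.toLp 2 (x, t))‖ₑ = ‖tcut b (t / 4 ^ N)‖ₑ ^ 2 * T j t x := by
    intro j x t
    rw [hh]; dsimp only
    rw [enorm_sqn, ENNReal.ofReal_sum_of_nonneg (fun _ _ => by positivity), hT]
    dsimp only
    rw [Finset.mul_sum]
    refine Finset.sum_congr rfl fun i _ => ?_
    rw [hFe, ENNReal.ofReal_pow (norm_nonneg _), ofReal_norm, enorm_mul, mul_pow]
  have hTm : ∀ j t, Measurable (T j t) := fun j t => Finset.measurable_fun_sum _ fun i _ =>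
    ((sym_packet hφ K l (2 ^ N) (2 ^ N * s + (j * 2 ^ (N - k) + i : ℕ)) t).continuous_mulOp hf).measurable.enorm.pow_const 2
  set G : ℕ → V3 → ℝ≥0∞ := fun j z => gavg (WithLp.toLp 2 (v₁ j, (0 : ℝ)) : V3)
    (WithLp.toLp 2 (v₂ j, (0 : ℝ))) (fun z => ‖h j z‖ₑ) z ^ 2 with hGdef
  have hGm : ∀ j, Measurable (G j) := fun j =>
    (measurable_gavg _ _ (h j).continuous.measurable.enorm).pow_const 2
  have hGe : ∀ j x t, G j (WithLp.toLp 2 (x, t)) =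
      ‖tcut b (t / 4 ^ N)‖ₑ ^ 4 * gavg (v₁ j) (v₂ j) (T j t) x ^ 2 := by
    intro j x t
    rw [hGdef]; dsimp only
    rw [gavg_toLp]
    simp only [hhT]
    rw [gavg_const_mul _ _ _ (by finiteness), mul_pow, ← pow_mul]
  have henv : ∀ j ∈ Finset.range (2 ^ k), env ((coneCoords s a).rescale k j) (N - k) (h j) ≤
      ENNReal.ofReal (Real.exp (4 * π)) * ∫⁻ z, G j z := by
    intro j hj
    have hw : |s + j / 2 ^ k| ≤ 2 := by
      have : (j : ℝ) / 2 ^ k ≤ 1 := by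
        rw [div_le_one (by positivity)]; exact_mod_cast (Finset.mem_range.1 hj).le
      have : (0 : ℝ) ≤ j / 2 ^ k := by positivity
      exact abs_le.2 ⟨by linarith, by linarith⟩
    exact env_le_gaussian _ _ _ (hasCompactSupport_fourier_sqn (fun i ξ => hFb _ ξ) _) _ _
      (fun ζ hζ => (inner_box_le ha0 hl5 hk hw hζ).1) (fun ζ hζ => (inner_box_le ha0 hl5 hk hw hζ).2)
  refine (Finset.sum_le_sum henv).trans ?_
  rw [← Finset.mul_sum, ← lintegral_finsetSum _ fun j _ => hGm j,
    lintegral_V3 (Finset.measurable_fun_sum _ fun j _ => hGm j)]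
  have hin : ∀ t, ∫⁻ x, ∑ j ∈ Finset.range (2 ^ k), G j (WithLp.toLp 2 (x, t)) ≤
      (ENNReal.ofReal (C * K ^ 20) * Z) *
        (‖tcut b (t / 4 ^ N)‖ₑ ^ 4 * ENNReal.ofReal ((1 + |t / 4 ^ N|) ^ 20)) := by
    intro t
    simp only [hGe, ← Finset.mul_sum]
    have hmm : ∀ j, Measurable fun x => gavg (v₁ j) (v₂ j) (T j t) x ^ 2 := fun j =>
      (measurable_gavg _ _ (hTm j t)).pow_const 2
    rw [lintegral_const_mul _ (Finset.measurable_fun_sum _ fun j _ => hmm j),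
      lintegral_finsetSum _ fun j _ => hmm j]
    refine (mul_le_mul_right (hG N k hk s K l t hK1 f hf) _).trans_eq ?_
    rw [abs_div, abs_of_pos (by positivity : (0 : ℝ) < 4 ^ N), mul_pow, ← mul_assoc C,
      ENNReal.ofReal_mul (by positivity)]
    ring
  refine (mul_le_mul_right (lintegral_mono hin) _).trans_eq ?_
  have hm2 : Measurable fun τ => ‖tcut b τ‖ₑ ^ 4 * ENNReal.ofReal ((1 + |τ|) ^ 20) := by
    have := hcont.measurable.enorm.pow_const 4
    refine this.mul (Measurable.ennreal_ofReal ?_)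
    exact (by fun_prop : Continuous fun τ : ℝ => (1 + |τ|) ^ 20).measurable
  rw [lintegral_const_mul _ (f := fun t => ‖tcut b (t / 4 ^ N)‖ₑ ^ 4 * ENNReal.ofReal ((1 + |t / 4 ^ N|) ^ 20))
      (hm2.comp (measurable_id.div_const _)),
    lintegral_comp_div_pos (by positivity) (g := fun τ => ‖tcut b τ‖ₑ ^ 4 * ENNReal.ofReal ((1 + |τ|) ^ 20)),
    ← hA, mul_assoc (Real.exp _), ENNReal.ofReal_mul (Real.exp_pos _).le]
  ring

end BlockEstimate

section HalfWave

variable {φ : ℝ → ℝ}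

theorem BddCpt.comp_neg {f : ℂ → ℂ} (hf : BddCpt f) : BddCpt (fun x => f (-x)) := by
  obtain ⟨M, hM⟩ := hf.bdd
  obtain ⟨R, hR⟩ := hf.supp
  exact ⟨hf.meas.comp measurable_neg, ⟨M, fun x => hM _⟩, ⟨R, fun x hx => hR _ (by rwa [norm_neg])⟩⟩

theorem mulOp_comp_neg (m f : ℂ → ℂ) (x : ℂ) :
    mulOp (fun ξ => m (-ξ)) f x = mulOp m (fun y => f (-y)) (-x) := by
  have h1 : ∀ ξ, 𝓕 f ξ = 𝓕 (fun y => f (-y)) (-ξ) := fun ξ => by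
    have := Real.fourier_comp_linearIsometry (LinearIsometryEquiv.neg ℝ (E := ℂ)) f (-ξ)
    simp only [LinearIsometryEquiv.coe_neg, neg_neg, Function.comp_def] at this
    exact this.symm
  have h2 : ∀ (g : ℂ → ℂ), 𝓕⁻ (fun ξ => g (-ξ)) x = 𝓕⁻ g (-x) := fun g => by
    have := Real.fourier_comp_linearIsometry (LinearIsometryEquiv.neg ℝ (E := ℂ)) g (-x)
    rw [Real.fourierInv_eq_fourier_neg, Real.fourierInv_eq_fourier_neg]
    simpa [Function.comp_def] using this
  unfold mulOp
  simp only [h1]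
  exact h2 fun ξ => m ξ * 𝓕 (fun y => f (-y)) ξ

theorem mulOp_add_left {m m' f : ℂ → ℂ} (hm : Sym m) (hm' : Sym m') (hf : BddCpt f) (x : ℂ) :
    mulOp (fun ξ => m ξ + m' ξ) f x = mulOp m f x + mulOp m' f x := by
  rw [mulOp_eq hm hf, mulOp_eq hm' hf,
    mulOp_eq_of (S := (hm.mul_fourier hf).toS + (hm'.mul_fourier hf).toS)
      (fun ξ => by simp [add_mul]), FourierTransform.fourierInv_add]
  rfl

theorem mulOp_sum {ι : Type*} (s : Finset ι) {m : ι → ℂ → ℂ} (hm : ∀ i, Sym (m i)) {f : ℂ → ℂ}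
    (hf : BddCpt f) (x : ℂ) :
    mulOp (fun ξ => ∑ i ∈ s, m i ξ) f x = ∑ i ∈ s, mulOp (m i) f x := by
  rw [mulOp_eq_of (S := ∑ i ∈ s, ((hm i).mul_fourier hf).toS)
      (fun ξ => by simp [sum_schwartz_apply, Finset.sum_mul]), FourierTransform.fourierInv_sum,
      sum_schwartz_apply]
  exact Finset.sum_congr rfl fun i _ => (mulOp_eq (hm i) hf x).symm

theorem Sym.integrable_mul_fourier {m f : ℂ → ℂ} (hm : Sym m) (hf : BddCpt f) :
    Integrable (fun ξ => m ξ * 𝓕 f ξ) :=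
  (hm.mul_fourier hf).smooth.continuous.integrable_of_hasCompactSupport (hm.mul_fourier hf).cpt

theorem continuous_mulOp_wave {m f : ℂ → ℂ} (hm : Sym m) (hf : BddCpt f) :
    Continuous (fun p : ℂ × ℝ => mulOp (fun ξ => wave (p.2 * ‖ξ‖) * m ξ) f p.1) := by
  unfold mulOp
  simp only [Real.fourierInv_eq']
  have hw := contDiff_wave.continuous
  have hc := (hm.mul_fourier hf).smooth.continuous
  have hms := hm.smooth.continuous
  have hfc := hf.contDiff_fourier.continuous
  refine continuous_of_dominated (bound := fun ξ => ‖m ξ * 𝓕 f ξ‖) (fun p => ?_) (fun p => ?_)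
    (hm.integrable_mul_fourier hf).norm (.of_forall fun ξ => by fun_prop)
  · exact (by fun_prop : Continuous _).aestronglyMeasurable
  · refine .of_forall fun ξ => le_of_eq ?_
    rw [norm_smul, Complex.norm_exp_ofReal_mul_I, one_mul, mul_assoc, norm_mul, norm_wave, one_mul]

theorem Sym.wave_mul {m : ℂ → ℂ} (hm : Sym m) (h0 : (0 : ℂ) ∉ tsupport m) (t : ℝ) :
    Sym (fun ξ => wave (t * ‖ξ‖) * m ξ) := by
  refine ⟨contDiff_of_forall_mem_tsupport fun ξ hξ => ?_, hm.cpt.mul_left⟩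
  have hξ' : ξ ∈ tsupport m := tsupport_mul_subset_right (f := fun ξ : ℂ => wave (t * ‖ξ‖)) hξ
  have hn : ContDiffAt ℝ ∞ (fun ξ : ℂ => ‖ξ‖) ξ := contDiffAt_norm ℝ fun h => h0 (h ▸ hξ')
  exact (ContDiffAt.comp (g := wave) ξ contDiff_wave.contDiffAt (contDiffAt_const.mul hn)).mul
    hm.smooth.contDiffAt

theorem tsupport_bump_subset (hφ : IsLPBump φ) :
    tsupport (fun ξ : ℂ => (φ ‖ξ‖ : ℂ)) ⊆ {ξ | 0.999 ≤ ‖ξ‖ ∧ ‖ξ‖ ≤ 2.001} :=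
  closure_minimal (fun ξ hξ => bump_support hφ fun h => hξ (by simp [h]))
    ((isClosed_le continuous_const continuous_norm).inter (isClosed_le continuous_norm continuous_const))

theorem zero_notMem_tsupport_bump (hφ : IsLPBump φ) : (0 : ℂ) ∉ tsupport (fun ξ : ℂ => (φ ‖ξ‖ : ℂ)) :=
  fun h => by have := (tsupport_bump_subset hφ h).1; norm_num at this

theorem sym_bump (hφ : IsLPBump φ) : Sym (fun ξ : ℂ => (φ ‖ξ‖ : ℂ)) := by
  refine ⟨contDiff_of_forall_mem_tsupport fun ξ hξ => ?_, ?_⟩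
  · have hn : ContDiffAt ℝ ∞ (fun ξ : ℂ => ‖ξ‖) ξ :=
      contDiffAt_norm ℝ fun h => zero_notMem_tsupport_bump hφ (h ▸ hξ)
    exact ContDiffAt.comp ξ Complex.ofRealCLM.contDiff.contDiffAt
      (ContDiffAt.comp ξ (ContDiff.contDiffAt (n := ∞) hφ.1) hn)
  · exact HasCompactSupport.of_support_subset_isCompact (isCompact_closedBall (0 : ℂ) 2.001)
      fun ξ hξ => mem_closedBall_zero_iff.2 (tsupport_bump_subset hφ (subset_tsupport _ hξ)).2

/-- The part of the annulus multiplier in the right half plane. -/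
def halfBump (φ : ℝ → ℝ) (ξ : ℂ) : ℂ := (φ ‖ξ‖ : ℂ) * (hemi ξ.re : ℂ)

theorem sym_halfBump (hφ : IsLPBump φ) : Sym (halfBump φ) :=
  ⟨(sym_bump hφ).smooth.mul (Complex.ofRealCLM.contDiff.comp (contDiff_hemi.comp Complex.reCLM.contDiff)),
    (sym_bump hφ).cpt.mul_right⟩

theorem zero_notMem_tsupport_halfBump (hφ : IsLPBump φ) : (0 : ℂ) ∉ tsupport (halfBump φ) := fun h =>
  zero_notMem_tsupport_bump hφ (tsupport_mul_subset_left (g := fun ξ : ℂ => (hemi ξ.re : ℂ)) h)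

theorem halfBump_add_neg (hφ : IsLPBump φ) (ξ : ℂ) :
    (φ ‖ξ‖ : ℂ) = halfBump φ ξ + halfBump φ (-ξ) := by
  rw [halfBump, halfBump, norm_neg, ← mul_add, Complex.neg_re]
  by_cases h : φ ‖ξ‖ = 0
  · simp [h]
  have h1 : |ξ.re| ≤ 3 := (Complex.abs_re_le_norm ξ).trans (by linarith [(bump_support hφ h).2])
  rw [← Complex.ofReal_add, hemi_add_neg h1]; simp

theorem sum_chi_range (hφ : IsLPBump φ) {u : ℝ} {M : ℕ} (h0 : 0.002 < u) (h1 : u + 0.002 < M) :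
    ∑ n ∈ Finset.range M, chi φ (u - n) = 1 := by
  have h : HasSum (fun n : ℤ => chi φ (u - n))
      (∑ n ∈ (Finset.range M).map Nat.castEmbedding, chi φ (u - (n : ℤ))) :=
    hasSum_sum_of_ne_finset_zero fun n hn => by
      by_contra hc
      obtain ⟨h2, h3⟩ := chi_support hφ hc
      have h4 : (-1 : ℝ) < n := by linarith
      have h5 : (n : ℝ) < M := by linarith
      have h4' : -1 < n := by exact_mod_cast h4
      have h5' : n < M := by exact_mod_cast h5
      lift n to ℕ using by omega
      exact hn (by simpa using h5')
  have := h.unique (hasSum_chi hφ u)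
  simpa using this

theorem abs_slope_le {ξ : ℂ} (h1 : 0.999 ≤ ‖ξ‖) (h2 : -(1 / 4) ≤ ξ.re) : |slope ξ| ≤ 1.3 := by
  have h3 : ξ.re ^ 2 + ξ.im ^ 2 = ‖ξ‖ ^ 2 := by
    rw [Complex.sq_norm, Complex.normSq_apply]; ring
  have h4 : 0 < ‖ξ‖ + ξ.re := by linarith
  rw [slope, abs_div, abs_of_pos h4, div_le_iff₀ h4]
  refine abs_le_of_sq_le_sq ?_ (by positivity)
  have : ξ.im ^ 2 = (‖ξ‖ + ξ.re) * (‖ξ‖ - ξ.re) := by linarith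
  rw [this]
  nlinarith

theorem sum_amp (hφ : IsLPBump φ) {N K : ℕ} (hK : 2 ≤ K) (ξ : ℂ) :
    ∑ s ∈ Finset.range 4, ∑ l ∈ Finset.range (5 * K), ∑ i ∈ Finset.range (2 ^ N),
      (amp φ K l (2 ^ N) (2 ^ N * ((s : ℝ) - 2) + i) ξ : ℂ) = halfBump φ ξ := by
  have e : ∀ l c : ℝ, amp φ K l (2 ^ N) c ξ = φ ‖ξ‖ * hemi ξ.re * (chi φ (K * (‖ξ‖ + ξ.re) - l) *
      chi φ (2 ^ N * slope ξ - c)) := fun l c => by rw [amp]; ring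
  rw [halfBump, ← Complex.ofReal_mul]
  simp only [← Complex.ofReal_sum, e, ← Finset.mul_sum]
  congr 1
  by_cases h : φ ‖ξ‖ * hemi ξ.re = 0
  · rw [h, zero_mul]
  obtain ⟨h1, h2⟩ := bump_support hφ (left_ne_zero_of_mul h)
  obtain ⟨h3, -⟩ := hemi_support (right_ne_zero_of_mul h)
  have hK' : (2 : ℝ) ≤ K := by exact_mod_cast hK
  have hre : ξ.re ≤ 2.001 := (Complex.re_le_norm ξ).trans h2
  have hl : ∑ l ∈ Finset.range (5 * K), chi φ (K * (‖ξ‖ + ξ.re) - l) = 1 :=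
    sum_chi_range hφ (by nlinarith) (by push_cast; nlinarith)
  simp only [← Finset.sum_mul, hl, one_mul]
  have hsl := abs_le.1 (abs_slope_le h1 h3)
  have hQ : (1 : ℝ) ≤ 2 ^ N := one_le_pow₀ (by norm_num)
  have hc := sum_chi_range hφ (u := 2 ^ N * slope ξ + 2 * 2 ^ N) (M := 4 * 2 ^ N) (by nlinarith)
    (by push_cast; nlinarith)
  rw [sum_range_mul] at hc
  refine Eq.trans ?_ (mul_one _)
  rw [← hc]
  congr 1
  refine Finset.sum_congr rfl fun s _ => Finset.sum_congr rfl fun i _ => ?_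
  congr 1
  push_cast; ring

end HalfWave

section GlobalWave

variable {φ : ℝ → ℝ}

theorem enorm_sum_pow_four_le {ι : Type*} (s : Finset ι) (z : ι → ℂ) :
    ‖∑ i ∈ s, z i‖ₑ ^ 4 ≤ (s.card : ℝ≥0∞) ^ 3 * ∑ i ∈ s, ‖z i‖ₑ ^ 4 := by
  have h : ‖∑ i ∈ s, z i‖ ^ 4 ≤ (s.card : ℝ) ^ 3 * ∑ i ∈ s, ‖z i‖ ^ 4 := by
    have h1 := sq_sum_le_card_mul_sum_sq (s := s) (f := fun i => ‖z i‖)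
    have h2 := sq_sum_le_card_mul_sum_sq (s := s) (f := fun i => ‖z i‖ ^ 2)
    calc ‖∑ i ∈ s, z i‖ ^ 4 ≤ ((∑ i ∈ s, ‖z i‖) ^ 2) ^ 2 := by
          rw [← pow_mul]; gcongr; exact norm_sum_le _ _
      _ ≤ (s.card * ∑ i ∈ s, ‖z i‖ ^ 2) ^ 2 := by gcongr
      _ = s.card ^ 2 * (∑ i ∈ s, ‖z i‖ ^ 2) ^ 2 := by ring
      _ ≤ s.card ^ 2 * (s.card * ∑ i ∈ s, (‖z i‖ ^ 2) ^ 2) := by gcongr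
      _ = _ := by simp only [← pow_mul]; ring
  have := ENNReal.ofReal_le_ofReal h
  rw [ENNReal.ofReal_mul (by positivity), ENNReal.ofReal_sum_of_nonneg (fun _ _ => by positivity)] at this
  simpa only [ENNReal.ofReal_pow (norm_nonneg _), ofReal_norm, ENNReal.ofReal_pow (Nat.cast_nonneg _),
    ENNReal.ofReal_natCast] using this

theorem mulOp_halfBump_eq (hφ : IsLPBump φ) {N K : ℕ} (hK : 2 ≤ K) {f : ℂ → ℂ} (hf : BddCpt f)
    (t : ℝ) (x : ℂ) :
    mulOp (fun ξ => wave (t * ‖ξ‖) * halfBump φ ξ) f x =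
      ∑ p ∈ Finset.range 4 ×ˢ Finset.range (5 * K), ∑ i ∈ Finset.range (2 ^ N),
        mulOp (packet φ K p.2 (2 ^ N) (2 ^ N * ((p.1 : ℝ) - 2) + i) t) f x := by
  have e : (fun ξ => wave (t * ‖ξ‖) * halfBump φ ξ) = fun ξ =>
      ∑ q ∈ (Finset.range 4 ×ˢ Finset.range (5 * K)) ×ˢ Finset.range (2 ^ N),
        packet φ K q.1.2 (2 ^ N) (2 ^ N * ((q.1.1 : ℝ) - 2) + q.2) t ξ := by
    ext1 ξ
    rw [← sum_amp hφ (N := N) hK ξ, Finset.sum_product, Finset.sum_product]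
    simp only [Finset.mul_sum, packet]
  rw [e, mulOp_sum _ (fun q => sym_packet hφ _ _ _ _ _) hf, Finset.sum_product]

theorem exists_lintegral_halfWave_le (hφ : IsLPBump φ) : ∃ C : ℝ, 0 < C ∧
    ∀ μ e N : ℕ, 1 ≤ μ → 2 * μ ≤ N → N ≤ (e + 1) * μ → ∀ f : ℂ → ℂ, BddCpt f →
      ∫⁻ t in Icc (-(2 * 4 ^ N)) (2 * 4 ^ N : ℝ), ∫⁻ x,
          ‖mulOp (fun ξ => wave (t * ‖ξ‖) * halfBump φ ξ) f x‖ₑ ^ 4 ≤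
        ((stepConst N * (N + 1)) ^ (e + 1) : ℕ) * ((N + 1 : ℕ) *
          (ENNReal.ofReal (C * (8 * 4 ^ (2 * μ)) ^ 24 * 4 ^ N) * ∫⁻ x, ‖f x‖ₑ ^ 4)) := by
  obtain ⟨b, hb, hc, hs, hlow, hcont, hfin⟩ := exists_tcut
  obtain ⟨C, hC, hB⟩ := exists_lintegral_block_le hφ hb hc hs hcont
  set A := ∫⁻ τ, ‖tcut b τ‖ₑ ^ 4 * ENNReal.ofReal ((1 + |τ|) ^ 20) with hA
  refine ⟨16 * 20 ^ 4 * C * (A.toReal + 1), by positivity, fun μ e N hμ hN hNe f hf => ?_⟩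
  have hB := hB μ e N hμ hN hNe
  revert hB
  generalize (((stepConst N * (N + 1)) ^ (e + 1) : ℕ) : ℝ≥0∞) = S
  intro hB
  set Z := ∫⁻ x, ‖f x‖ₑ ^ 4 with hZ
  set K : ℕ := 8 * 4 ^ (2 * μ) with hK
  have hKc : (8 * 4 ^ (2 * μ) : ℝ) = (K : ℝ) := by rw [hK]; push_cast; rfl
  have hK2 : 2 ≤ K := by
    have : 1 ≤ 4 ^ (2 * μ) := Nat.one_le_pow _ _ (by norm_num)
    omega
  have hK0 : (0 : ℝ) < K := by exact_mod_cast (by omega : 0 < K)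
  set J := Finset.range 4 ×ˢ Finset.range (5 * K) with hJ
  have hJc : J.card = 20 * K := by rw [hJ, Finset.card_product, Finset.card_range, Finset.card_range]; ring
  set g : ℕ × ℕ → ℝ → ℂ → ℂ := fun p t x => tcut b (t / 4 ^ N) * ∑ i ∈ Finset.range (2 ^ N),
        mulOp (packet φ K p.2 (2 ^ N) (2 ^ N * ((p.1 : ℝ) - 2) + i) t) f x with hg
  have hgc : ∀ p, Continuous fun z : ℝ × ℂ => g p z.1 z.2 := by
    intro p
    refine Continuous.mul (hcont.comp (by fun_prop)) (continuous_finset_sum _ fun i _ => ?_)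
    have h := (continuous_mulOp_wave (sym_packet hφ K p.2 (2 ^ N) (2 ^ N * ((p.1 : ℝ) - 2) + i) 0) hf).comp
      (continuous_swap (X := ℝ) (Y := ℂ))
    refine h.congr fun z => ?_
    exact congrArg (fun m => mulOp m f z.2) (funext fun ξ => (packet_eq_wave_mul _ _ _ _ _ _ _).symm)
  have hgm : ∀ p, Measurable fun z : ℝ × ℂ => ‖g p z.1 z.2‖ₑ ^ 4 := fun p =>
    (hgc p).measurable.enorm.pow_const 4
  have hblock : ∀ p ∈ J, ∫⁻ t : ℝ, ∫⁻ x, ‖g p t x‖ₑ ^ 4 ≤ S * ((N + 1 : ℕ) *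
      (ENNReal.ofReal (C * K ^ 20) * ENNReal.ofReal (4 ^ N) * (A * Z))) := by
    intro p hp
    rw [hJ, Finset.mem_product, Finset.mem_range, Finset.mem_range] at hp
    have h4 : (p.1 : ℝ) ≤ 3 := by exact_mod_cast (by omega : p.1 ≤ 3)
    have h0 : (0 : ℝ) ≤ p.1 := Nat.cast_nonneg _
    have h5 : (p.2 : ℝ) ≤ 5 * K := by exact_mod_cast hp.2.le
    have h6 : (0 : ℝ) ≤ p.2 := Nat.cast_nonneg _
    have hK2' : (2 : ℝ) ≤ K := by exact_mod_cast hK2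
    have := hB ((p.1 : ℝ) - 2) p.2 (by linarith) (by linarith) ?_ ?_ f hf
    · rw [hKc] at this; exact this
    · intro h
      have : ((2 * p.2 : ℕ) : ℝ) = (1 : ℕ) := by push_cast; linarith
      have := Nat.cast_injective this
      omega
    · rw [hKc, abs_div, abs_of_pos hK0, div_le_iff₀ hK0]
      exact abs_le.2 ⟨by linarith, by linarith⟩
  have hpt : ∀ t ∈ Icc (-(2 * 4 ^ N)) (2 * 4 ^ N : ℝ), ∫⁻ x,
      ‖mulOp (fun ξ => wave (t * ‖ξ‖) * halfBump φ ξ) f x‖ₑ ^ 4 ≤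
      ∫⁻ x, 16 * ((J.card : ℝ≥0∞) ^ 3 * ∑ p ∈ J, ‖g p t x‖ₑ ^ 4) := by
    intro t ht
    refine lintegral_mono fun x => ?_
    dsimp only
    have hη : 1 / 2 ≤ ‖tcut b (t / 4 ^ N)‖ := by
      refine hlow _ ?_
      rw [abs_div, abs_of_pos (by positivity : (0 : ℝ) < 4 ^ N), div_le_iff₀ (by positivity)]
      exact abs_le.2 ht
    have h1 : ‖mulOp (fun ξ => wave (t * ‖ξ‖) * halfBump φ ξ) f x‖ₑ ^ 4 ≤
        16 * ‖∑ p ∈ J, g p t x‖ₑ ^ 4 := by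
      rw [hg]; dsimp only
      rw [← Finset.mul_sum, ← mulOp_halfBump_eq hφ hK2 hf, enorm_mul, mul_pow, ← mul_assoc]
      refine le_mul_of_one_le_left zero_le ?_
      rw [← ofReal_norm, ← ENNReal.ofReal_pow (norm_nonneg _),
        show (16 : ℝ≥0∞) = ENNReal.ofReal 16 by simp, ← ENNReal.ofReal_mul (by norm_num),
        ENNReal.one_le_ofReal]
      have : (1 / 2 : ℝ) ^ 4 ≤ ‖tcut b (t / 4 ^ N)‖ ^ 4 := by gcongr
      norm_num at this
      linarith
    exact h1.trans (mul_le_mul_right (enorm_sum_pow_four_le J _) _)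
  refine (setLIntegral_mono' measurableSet_Icc hpt).trans ((setLIntegral_le_lintegral _ _).trans ?_)
  have hswap : ∫⁻ t, ∫⁻ x, 16 * ((J.card : ℝ≥0∞) ^ 3 * ∑ p ∈ J, ‖g p t x‖ₑ ^ 4) =
      16 * ((J.card : ℝ≥0∞) ^ 3 * ∑ p ∈ J, ∫⁻ t, ∫⁻ x, ‖g p t x‖ₑ ^ 4) := by
    have hgm' : ∀ p t, Measurable fun x => ‖g p t x‖ₑ ^ 4 := fun p t =>
      Measurable.of_uncurry_left (f := fun t x => ‖g p t x‖ₑ ^ 4) (hgm p)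
    have e1 : ∀ t, ∫⁻ x, 16 * ((J.card : ℝ≥0∞) ^ 3 * ∑ p ∈ J, ‖g p t x‖ₑ ^ 4) =
        16 * ((J.card : ℝ≥0∞) ^ 3 * ∑ p ∈ J, ∫⁻ x, ‖g p t x‖ₑ ^ 4) := fun t => by
      rw [lintegral_const_mul' _ _ (by simp), lintegral_const_mul' _ _ (by finiteness),
        lintegral_finsetSum _ fun p _ => hgm' p t]
    simp only [e1]
    rw [lintegral_const_mul' _ _ (by simp), lintegral_const_mul' _ _ (by finiteness),
      lintegral_finsetSum _ fun p _ => (hgm p).lintegral_prod_right']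
  rw [hswap]
  have hsum := Finset.sum_le_card_nsmul J _ _ hblock
  refine (mul_le_mul_right (mul_le_mul_right hsum _) _).trans ?_
  rw [nsmul_eq_mul, hJc]
  have hAr : A = ENNReal.ofReal A.toReal := (ENNReal.ofReal_toReal hfin.ne).symm
  have hle : 16 * ((20 * K : ℕ) : ℝ≥0∞) ^ 4 * (ENNReal.ofReal (C * K ^ 20) * ENNReal.ofReal (4 ^ N) * A) ≤
      ENNReal.ofReal (16 * 20 ^ 4 * C * (A.toReal + 1) * (8 * 4 ^ (2 * μ)) ^ 24 * 4 ^ N) := by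
    rw [hKc, hAr, ENNReal.toReal_ofReal ENNReal.toReal_nonneg, ← ENNReal.ofReal_natCast,
      ← ENNReal.ofReal_pow (Nat.cast_nonneg _),
      show (16 : ℝ≥0∞) = ENNReal.ofReal 16 by simp, ← ENNReal.ofReal_mul (by positivity),
      ← ENNReal.ofReal_mul (by positivity), ← ENNReal.ofReal_mul (by positivity),
      ← ENNReal.ofReal_mul (by positivity)]
    refine ENNReal.ofReal_le_ofReal ?_
    have : 16 * ((20 * K : ℕ) : ℝ) ^ 4 * (C * K ^ 20 * 4 ^ N * A.toReal) =
        16 * 20 ^ 4 * C * A.toReal * K ^ 24 * 4 ^ N := by push_cast; ring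
    rw [this]
    gcongr
    linarith
  calc 16 * (((20 * K : ℕ) : ℝ≥0∞) ^ 3 * (((20 * K : ℕ) : ℝ≥0∞) * (S * ((N + 1 : ℕ) *
        (ENNReal.ofReal (C * K ^ 20) * ENNReal.ofReal (4 ^ N) * (A * Z))))))
      = S * ((N + 1 : ℕ) * ((16 * ((20 * K : ℕ) : ℝ≥0∞) ^ 4 *
          (ENNReal.ofReal (C * K ^ 20) * ENNReal.ofReal (4 ^ N) * A)) * Z)) := by ring
    _ ≤ _ := mul_le_mul_right (mul_le_mul_right (mul_le_mul_left hle _) _) _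

theorem exists_lintegral_wave_le (hφ : IsLPBump φ) : ∃ C : ℝ, 0 < C ∧
    ∀ μ e N : ℕ, 1 ≤ μ → 2 * μ ≤ N → N ≤ (e + 1) * μ → ∀ f : ℂ → ℂ, BddCpt f →
      ∫⁻ t in Icc (-(2 * 4 ^ N)) (2 * 4 ^ N : ℝ), ∫⁻ x,
          ‖mulOp (fun ξ => wave (t * ‖ξ‖) * (φ ‖ξ‖ : ℂ)) f x‖ₑ ^ 4 ≤
        ((stepConst N * (N + 1)) ^ (e + 1) : ℕ) * ((N + 1 : ℕ) *
          (ENNReal.ofReal (C * (8 * 4 ^ (2 * μ)) ^ 24 * 4 ^ N) * ∫⁻ x, ‖f x‖ₑ ^ 4)) := by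
  obtain ⟨C, hC, hB⟩ := exists_lintegral_halfWave_le hφ
  refine ⟨16 * C, by positivity, fun μ e N hμ hN hNe f hf => ?_⟩
  have h1 := hB μ e N hμ hN hNe f hf
  have h2 := hB μ e N hμ hN hNe _ hf.comp_neg
  revert h1 h2
  generalize (((stepConst N * (N + 1)) ^ (e + 1) : ℕ) : ℝ≥0∞) = S
  intro h1 h2
  rw [lintegral_neg_eq_self (μ := volume) fun x : ℂ => ‖f x‖ₑ ^ 4] at h2
  set Z := ∫⁻ x, ‖f x‖ₑ ^ 4 with hZ
  set u : (ℂ → ℂ) → ℝ → ℂ → ℂ := fun f t x => mulOp (fun ξ => wave (t * ‖ξ‖) * halfBump φ ξ) f x with hu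
  have hum : ∀ f, BddCpt f → Measurable fun z : ℝ × ℂ => ‖u f z.1 z.2‖ₑ ^ 4 := fun f hf =>
    (((continuous_mulOp_wave (sym_halfBump hφ) hf).comp continuous_swap).measurable.enorm).pow_const 4
  have hpt : ∀ t x, ‖mulOp (fun ξ => wave (t * ‖ξ‖) * (φ ‖ξ‖ : ℂ)) f x‖ₑ ^ 4 ≤
      8 * (‖u f t x‖ₑ ^ 4 + ‖u (fun y => f (-y)) t (-x)‖ₑ ^ 4) := by
    intro t x
    have hS1 := (sym_halfBump hφ).wave_mul (zero_notMem_tsupport_halfBump hφ) t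
    have hS2 : Sym fun ξ => (fun ξ => wave (t * ‖ξ‖) * halfBump φ ξ) (-ξ) :=
      ⟨hS1.smooth.comp contDiff_neg, hS1.cpt.comp_homeomorph (Homeomorph.neg ℂ)⟩
    have e : mulOp (fun ξ => wave (t * ‖ξ‖) * (φ ‖ξ‖ : ℂ)) f x =
        u f t x + u (fun y => f (-y)) t (-x) := by
      rw [hu]; dsimp only
      rw [← mulOp_comp_neg, ← mulOp_add_left hS1 hS2 hf]
      congr 1; ext1 ξ
      dsimp only
      rw [norm_neg, ← mul_add, halfBump_add_neg hφ ξ]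
    have h := enorm_sum_pow_four_le (Finset.univ : Finset (Fin 2)) ![u f t x, u (fun y => f (-y)) t (-x)]
    simp only [Fin.sum_univ_two, Finset.card_univ, Fintype.card_fin] at h
    rw [e]
    refine h.trans_eq ?_
    norm_num
  have hm' : ∀ f, BddCpt f → ∀ t, Measurable fun x => ‖u f t x‖ₑ ^ 4 := fun f hf t =>
    Measurable.of_uncurry_left (f := fun t x => ‖u f t x‖ₑ ^ 4) (hum f hf)
  have hin : ∀ t, ∫⁻ x, ‖mulOp (fun ξ => wave (t * ‖ξ‖) * (φ ‖ξ‖ : ℂ)) f x‖ₑ ^ 4 ≤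
      8 * ((∫⁻ x, ‖u f t x‖ₑ ^ 4) + ∫⁻ x, ‖u (fun y => f (-y)) t x‖ₑ ^ 4) := by
    intro t
    refine (lintegral_mono (hpt t)).trans_eq ?_
    rw [lintegral_const_mul' _ _ (by simp), lintegral_add_left (hm' f hf t),
      lintegral_neg_eq_self (μ := volume) fun x : ℂ => ‖u (fun y => f (-y)) t x‖ₑ ^ 4]
  refine (lintegral_mono hin).trans ?_
  rw [lintegral_const_mul' _ _ (by simp), lintegral_add_left (f := fun t => ∫⁻ x, ‖u f t x‖ₑ ^ 4) (hum f hf).lintegral_prod_right']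
  refine (mul_le_mul_right (add_le_add h1 h2) _).trans_eq ?_
  rw [show 16 * C * (8 * 4 ^ (2 * μ)) ^ 24 * 4 ^ N = 16 * (C * (8 * 4 ^ (2 * μ)) ^ 24 * 4 ^ N) by ring,
    ENNReal.ofReal_mul (by norm_num : (0 : ℝ) ≤ 16), show ENNReal.ofReal 16 = 16 by simp]
  ring

end GlobalWave

section Interpolation

variable {Y : Type*} [MeasurableSpace Y] {ν : Measure Y}

theorem lintegral_Ioc_rpow {s L : ℝ} (hs : 0 < s) (hL : 0 ≤ L) :
    ∫⁻ t in Ioc 0 L, ENNReal.ofReal (t ^ (s - 1)) = ENNReal.ofReal (L ^ s / s) := by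
  have hi := (intervalIntegral.intervalIntegrable_rpow' (a := 0) (b := L) (by linarith : -1 < s - 1)).1
  rw [← ofReal_integral_eq_lintegral_ofReal hi, ← intervalIntegral.integral_of_le hL,
    integral_rpow (Or.inl (by linarith)), sub_add_cancel, zero_rpow hs.ne', sub_zero]
  exact (ae_restrict_iff' measurableSet_Ioc).2 (.of_forall fun t ht => rpow_nonneg ht.1.le _)

theorem lintegral_Ioi_rpow {s c : ℝ} (hs : 0 < s) (hc : 0 < c) :
    ∫⁻ t in Ioi c, ENNReal.ofReal (t ^ (-s - 1)) = ENNReal.ofReal (c ^ (-s) / s) := by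
  rw [← ofReal_integral_eq_lintegral_ofReal (integrableOn_Ioi_rpow_of_lt (by linarith) hc),
    integral_Ioi_rpow_of_lt (by linarith) hc, sub_add_cancel, neg_div_neg_eq]
  exact (ae_restrict_iff' measurableSet_Ioi).2 (.of_forall fun t ht => rpow_nonneg (hc.trans ht).le _)

theorem lintegral_rpow_le_of_meas_lt {g : Y → ℝ} (hg : Measurable g) (h0 : ∀ y, 0 ≤ g y) {r : ℝ}
    (hr : 0 < r) {B c : ℝ≥0∞} (hB : B ≠ ⊤) (hc : c ≠ ⊤) {w : ℝ → ℂ → ℝ≥0∞}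
    (hw : Measurable (Function.uncurry w)) {W : ℂ → ℝ≥0∞}
    (h : ∀ t : ℝ, 0 < t → ν {y | t < g y} ≤ B * ∫⁻ x, w t x)
    (hW : ∀ x, ∫⁻ t in Ioi (0 : ℝ), w t x * ENNReal.ofReal (t ^ (r - 1)) ≤ c * W x) :
    ∫⁻ y, ENNReal.ofReal (g y ^ r) ∂ν ≤ ENNReal.ofReal r * (B * (c * ∫⁻ x, W x)) := by
  rw [lintegral_rpow_eq_lintegral_meas_lt_mul ν (.of_forall h0) hg.aemeasurable hr]
  refine mul_le_mul_right ?_ _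
  have hm : Measurable (Function.uncurry fun (t : ℝ) x => w t x * ENNReal.ofReal (t ^ (r - 1))) :=
    hw.mul (by fun_prop)
  calc ∫⁻ t in Ioi (0 : ℝ), ν {y | t < g y} * ENNReal.ofReal (t ^ (r - 1))
      ≤ ∫⁻ t in Ioi (0 : ℝ), B * ∫⁻ x, w t x * ENNReal.ofReal (t ^ (r - 1)) := by
        refine setLIntegral_mono' measurableSet_Ioi fun t ht => ?_
        rw [lintegral_mul_const' _ _ ENNReal.ofReal_ne_top, ← mul_assoc]
        exact mul_le_mul_left (h t ht) _
    _ = B * ∫⁻ x, ∫⁻ t in Ioi (0 : ℝ), w t x * ENNReal.ofReal (t ^ (r - 1)) := by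
        rw [lintegral_const_mul' _ _ hB, lintegral_lintegral_swap hm.aemeasurable]
    _ ≤ B * ∫⁻ x, c * W x := mul_le_mul_right (lintegral_mono hW) _
    _ = _ := by rw [lintegral_const_mul' _ _ hc]

/-- `T` is bounded from `L^r` to `L^r(ν)` with constant `A^{1/r}` on bounded functions of compact
support. -/
def StrongType (ν : Measure Y) (T : (ℂ → ℂ) → Y → ℂ) (A r : ℝ) : Prop :=
  ∀ f, BddCpt f →
    ∫⁻ y, ENNReal.ofReal (‖T f y‖ ^ r) ∂ν ≤ ENNReal.ofReal A * ∫⁻ x, ENNReal.ofReal (‖f x‖ ^ r)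

/-- Additive operators on bounded functions of compact support, with measurable values. -/
structure AddOp (T : (ℂ → ℂ) → Y → ℂ) : Prop where
  meas : ∀ f, BddCpt f → Measurable (T f)
  add : ∀ f g, BddCpt f → BddCpt g → ∀ y, T (fun x => f x + g x) y = T f y + T g y

theorem AddOp.indicator {T : (ℂ → ℂ) → Y → ℂ} (hT : AddOp T) {f : ℂ → ℂ} (hf : BddCpt f) {S : Set ℂ}
    (hS : MeasurableSet S) (y : Y) : T f y = T (S.indicator f) y + T (Sᶜ.indicator f) y := by
  rw [← hT.add _ _ (hf.indicator hS) (hf.indicator hS.compl)]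
  congr 1
  exact (indicator_self_add_compl S f).symm

theorem StrongType.meas_lt_le {T : (ℂ → ℂ) → Y → ℂ} (hT : AddOp T) {A r : ℝ} (hr : 0 < r)
    (h : StrongType ν T A r) {f : ℂ → ℂ} (hf : BddCpt f) {S : Set ℂ} (hS : MeasurableSet S) {t : ℝ}
    (ht : 0 < t) :
    ν {y | t < ‖T (S.indicator f) y‖} ≤ ENNReal.ofReal A *
      ∫⁻ x, S.indicator (fun x => ENNReal.ofReal (t ^ (-r) * ‖f x‖ ^ r)) x := by
  have hm : Measurable fun y => ENNReal.ofReal (‖T (S.indicator f) y‖ ^ r) := by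
    have := hT.meas _ (hf.indicator hS)
    fun_prop
  have ht' : 0 < t ^ r := rpow_pos_of_pos ht _
  have h1 := meas_ge_le_lintegral_div hm.aemeasurable (μ := ν) (ENNReal.ofReal_pos.2 ht').ne'
    ENNReal.ofReal_ne_top
  have hsub : {y | t < ‖T (S.indicator f) y‖} ⊆
      {y | ENNReal.ofReal (t ^ r) ≤ ENNReal.ofReal (‖T (S.indicator f) y‖ ^ r)} := fun y hy =>
    ENNReal.ofReal_le_ofReal (rpow_le_rpow ht.le (le_of_lt hy) hr.le)
  refine (measure_mono hsub).trans (h1.trans ?_)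
  rw [ENNReal.div_eq_inv_mul, ← ENNReal.ofReal_inv_of_pos ht', ← rpow_neg ht.le]
  refine (mul_le_mul_right (h _ (hf.indicator hS)) _).trans_eq ?_
  rw [mul_left_comm, ← lintegral_const_mul' _ _ ENNReal.ofReal_ne_top]
  congr 2
  ext1 x
  rw [← ENNReal.ofReal_mul (by positivity)]
  by_cases hx : x ∈ S
  · simp [hx]
  · simp [hx, hr.ne']

/-- Marcinkiewicz interpolation between two diagonal estimates. -/
theorem StrongType.interpolate {T : (ℂ → ℂ) → Y → ℂ} (hT : AddOp T) {A a r b : ℝ} (ha : 0 < a)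
    (har : a < r) (hrb : r < b) (hTa : StrongType ν T A a) (hTb : StrongType ν T A b) :
    ∃ c : ℝ, 0 < c ∧ c = r * (2 ^ a / (r - a) + 2 ^ b / (b - r)) ∧ StrongType ν T (c * A) r := by
  have hra : 0 < r - a := sub_pos.2 har
  have hbr : 0 < b - r := sub_pos.2 hrb
  have hr : 0 < r := ha.trans har
  refine ⟨_, by positivity, rfl, fun f hf => ?_⟩
  set w : ℝ → ℂ → ℝ≥0∞ := fun t x => if t < ‖f x‖ then ENNReal.ofReal ((t / 2) ^ (-a) * ‖f x‖ ^ a)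
    else ENNReal.ofReal ((t / 2) ^ (-b) * ‖f x‖ ^ b) with hw
  have hfm := hf.meas
  have hwm : Measurable (Function.uncurry w) := by
    refine Measurable.ite (measurableSet_lt measurable_fst (hfm.comp measurable_snd).norm) ?_ ?_ <;>
    fun_prop
  have key := lintegral_rpow_le_of_meas_lt (ν := ν) (hT.meas f hf).norm (fun _ => norm_nonneg _) hr
    (B := ENNReal.ofReal A) ENNReal.ofReal_ne_top
    (c := ENNReal.ofReal (2 ^ a / (r - a) + 2 ^ b / (b - r))) ENNReal.ofReal_ne_top hwm
    (W := fun x => ENNReal.ofReal (‖f x‖ ^ r)) ?_ ?_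
  · refine key.trans_eq ?_
    rw [ENNReal.ofReal_mul (by positivity), ENNReal.ofReal_mul hr.le]
    ring
  · intro t ht
    have hS : MeasurableSet {x | t < ‖f x‖} := measurableSet_lt measurable_const hfm.norm
    have hsub : {y | t < ‖T f y‖} ⊆ {y | t / 2 < ‖T ({x | t < ‖f x‖}.indicator f) y‖} ∪
        {y | t / 2 < ‖T ({x | t < ‖f x‖}ᶜ.indicator f) y‖} := by
      intro y hy
      by_contra! hcon
      simp only [mem_union, Set.mem_ofPred_eq, not_or, not_lt] at hcon hy
      have := norm_add_le (T ({x | t < ‖f x‖}.indicator f) y) (T ({x | t < ‖f x‖}ᶜ.indicator f) y)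
      rw [← hT.indicator hf hS] at this
      linarith [hcon.1, hcon.2]
    refine (measure_mono hsub).trans ((measure_union_le _ _).trans ((add_le_add
      (hTa.meas_lt_le hT ha hf hS (half_pos ht))
      (hTb.meas_lt_le hT (hr.trans hrb) hf hS.compl (half_pos ht))).trans_eq ?_))
    rw [← mul_add, ← lintegral_add_left (Measurable.indicator (by fun_prop) hS)]
    congr 2
    ext1 x
    by_cases hx : t < ‖f x‖ <;> simp [hw, indicator, hx]
  · intro x
    rcases (norm_nonneg (f x)).eq_or_lt with h0 | h0
    · have : ∀ t : ℝ, t ∈ Ioi (0 : ℝ) → w t x * ENNReal.ofReal (t ^ (r - 1)) = 0 := fun t ht => by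
        rw [hw]; dsimp only
        rw [if_neg (by rw [← h0]; exact not_lt.2 (le_of_lt ht)), ← h0, zero_rpow (hr.trans hrb).ne']
        simp
      rw [setLIntegral_congr_fun measurableSet_Ioi this]
      simp
    set y := ‖f x‖ with hy
    have e : Ioi (0 : ℝ) = Ioc 0 y ∪ Ioi y := (Ioc_union_Ioi_eq_Ioi h0.le).symm
    rw [e]
    refine (lintegral_union_le _ _ _).trans ?_
    have h1 : ∫⁻ t in Ioc 0 y, w t x * ENNReal.ofReal (t ^ (r - 1)) =
        ENNReal.ofReal (2 ^ a / (r - a) * y ^ r) := by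
      have : ∫⁻ t in Ioc 0 y, w t x * ENNReal.ofReal (t ^ (r - 1)) =
          ∫⁻ t in Ioo 0 y, ENNReal.ofReal (2 ^ a * y ^ a) * ENNReal.ofReal (t ^ ((r - a) - 1)) := by
        rw [← restrict_Ioo_eq_restrict_Ioc]
        refine setLIntegral_congr_fun measurableSet_Ioo fun t ht => ?_
        rw [hw]; dsimp only
        rw [if_pos ht.2, ← ENNReal.ofReal_mul (by positivity [ht.1]), ← ENNReal.ofReal_mul (by positivity),
          show r - a - 1 = -a + (r - 1) by ring, rpow_add ht.1, div_rpow ht.1.le (by norm_num),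
          rpow_neg (by norm_num : (0 : ℝ) ≤ 2), div_inv_eq_mul]
        congr 1; ring
      rw [this, restrict_Ioo_eq_restrict_Ioc, lintegral_const_mul' _ _ ENNReal.ofReal_ne_top,
        lintegral_Ioc_rpow hra h0.le, ← ENNReal.ofReal_mul (by positivity)]
      congr 1
      rw [show r = a + (r - a) by ring, rpow_add h0]
      ring_nf
    have h2 : ∫⁻ t in Ioi y, w t x * ENNReal.ofReal (t ^ (r - 1)) =
        ENNReal.ofReal (2 ^ b / (b - r) * y ^ r) := by
      have : ∫⁻ t in Ioi y, w t x * ENNReal.ofReal (t ^ (r - 1)) =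
          ∫⁻ t in Ioi y, ENNReal.ofReal (2 ^ b * y ^ b) * ENNReal.ofReal (t ^ (-(b - r) - 1)) := by
        refine setLIntegral_congr_fun measurableSet_Ioi fun t ht => ?_
        have ht0 : 0 < t := h0.trans ht
        rw [hw]; dsimp only
        rw [if_neg (not_lt.2 (le_of_lt ht)), ← ENNReal.ofReal_mul (by positivity),
          ← ENNReal.ofReal_mul (by positivity),
          show -(b - r) - 1 = -b + (r - 1) by ring, rpow_add ht0, div_rpow ht0.le (by norm_num),
          rpow_neg (by norm_num : (0 : ℝ) ≤ 2), div_inv_eq_mul]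
        congr 1; ring
      rw [this, lintegral_const_mul' _ _ ENNReal.ofReal_ne_top,
        lintegral_Ioi_rpow hbr h0, ← ENNReal.ofReal_mul (by positivity)]
      congr 1
      rw [show y ^ r = y ^ (b + -(b - r)) by congr 1; ring, rpow_add h0]
      ring
    rw [h1, h2, ← ENNReal.ofReal_add (by positivity) (by positivity),
      ← ENNReal.ofReal_mul (by positivity), add_mul]

end Interpolation

section OffDiagonal

variable {Y : Type*} [MeasurableSpace Y] {ν : Measure Y}

theorem BddCpt.lintegral_rpow_ne_top {f : ℂ → ℂ} (hf : BddCpt f) {p : ℝ} (hp : 0 < p) :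
    ∫⁻ x, ENNReal.ofReal (‖f x‖ ^ p) ≠ ⊤ := by
  obtain ⟨M, hM⟩ := hf.bdd
  obtain ⟨R, hR⟩ := hf.supp
  have hb : BddCpt fun x => ((‖f x‖ ^ p : ℝ) : ℂ) := by
    have := hf.meas
    refine ⟨by fun_prop, ⟨M ^ p, fun x => ?_⟩, ⟨R, fun x hx => by simp [hR x hx, hp.ne']⟩⟩
    rw [Complex.norm_real, norm_of_nonneg (by positivity)]
    exact rpow_le_rpow (norm_nonneg _) (hM x) hp.le
  have h := hb.integrable.hasFiniteIntegral.ne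
  refine ne_of_eq_of_ne (lintegral_congr fun x => ?_) h
  rw [← ofReal_norm, Complex.norm_real, norm_of_nonneg (by positivity)]

/-- Marcinkiewicz interpolation between an `L^1`–`L^∞` and a diagonal estimate. -/
theorem StrongType.interpolate_one_top {T : (ℂ → ℂ) → Y → ℂ} (hT : AddOp T) {A A₀ r p q : ℝ}
    (hA₀ : 0 < A₀) (h1 : ∀ f, BddCpt f → ∀ᵐ y ∂ν, ‖T f y‖ ≤ A₀ * ∫ x, ‖f x‖) (hr : 0 < r)
    (hTr : StrongType ν T A r) (hp : 1 < p) (hrq : r < q) (hrel : r + (1 - p) * (q - r) = p)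
    {f : ℂ → ℂ} (hf : BddCpt f) :
    ∫⁻ y, ENNReal.ofReal (‖T f y‖ ^ q) ∂ν ≤ ENNReal.ofReal (q * 2 ^ q / (q - r) * A₀ ^ (q - r)) *
      (ENNReal.ofReal A * (∫⁻ x, ENNReal.ofReal (‖f x‖ ^ p)) ^ (q - r + 1)) := by
  have hqr : 0 < q - r := sub_pos.2 hrq
  have hq : 0 < q := hr.trans hrq
  have hp0 : 0 < p := zero_lt_one.trans hp
  have hfm := hf.meas
  have hfin := hf.lintegral_rpow_ne_top hp0
  set I := ∫⁻ x, ENNReal.ofReal (‖f x‖ ^ p) with hI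
  by_cases hI0 : I = 0
  · have hae : ∀ᵐ x, f x = 0 := by
      rw [hI, lintegral_eq_zero_iff (by fun_prop)] at hI0
      filter_upwards [hI0] with x hx
      have h := ENNReal.ofReal_eq_zero.1 hx
      by_contra hne
      exact absurd h (not_le.2 (rpow_pos_of_pos (norm_pos_iff.2 hne) _))
    have hz : ∫ x, ‖f x‖ = 0 := by
      rw [integral_eq_zero_of_ae]
      filter_upwards [hae] with x hx
      simp [hx]
    have : ∫⁻ y, ENNReal.ofReal (‖T f y‖ ^ q) ∂ν = 0 := by
      refine (lintegral_eq_zero_iff (by have := hT.meas f hf; fun_prop)).2 ?_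
      filter_upwards [h1 f hf] with y hy
      rw [hz, mul_zero] at hy
      rw [le_antisymm hy (norm_nonneg _), zero_rpow hq.ne']
      simp
    rw [this]; exact zero_le
  set M := I.toReal with hM
  have hM0 : 0 < M := ENNReal.toReal_pos hI0 hfin
  have hIM : I = ENNReal.ofReal M := (ENNReal.ofReal_toReal hfin).symm
  set D := 2 * A₀ * M with hD
  have hD0 : 0 < D := by positivity
  set S : ℝ → Set ℂ := fun t => {x | t * ‖f x‖ ^ (p - 1) ≤ D} with hSdef
  have hSm : ∀ t, MeasurableSet (S t) := fun t => measurableSet_le (by fun_prop) measurable_const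
  set w : ℝ → ℂ → ℝ≥0∞ := fun t x =>
    if t * ‖f x‖ ^ (p - 1) ≤ D then ENNReal.ofReal ((t / 2) ^ (-r) * ‖f x‖ ^ r) else 0 with hw
  have hwm : Measurable (Function.uncurry w) := by
    refine Measurable.ite (measurableSet_le ?_ measurable_const) ?_ measurable_const <;>
    fun_prop
  have hpm : AEStronglyMeasurable (fun x => ‖f x‖ ^ p) := (hfm.norm.pow_const p).aestronglyMeasurable
  have hpow : Integrable fun x => ‖f x‖ ^ p :=
    ⟨hpm, by
      rw [hasFiniteIntegral_iff_ofReal (.of_forall fun x => by positivity)]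
      exact hfin.lt_top⟩
  have hMi : ∫ x, ‖f x‖ ^ p = M := by
    rw [hM, hI, integral_eq_lintegral_of_nonneg_ae (.of_forall fun x => by positivity) hpm]
  have key := lintegral_rpow_le_of_meas_lt (ν := ν) (hT.meas f hf).norm (fun _ => norm_nonneg _) hq
    (B := ENNReal.ofReal A) ENNReal.ofReal_ne_top
    (c := ENNReal.ofReal (2 ^ r / (q - r) * D ^ (q - r))) ENNReal.ofReal_ne_top hwm
    (W := fun x => ENNReal.ofReal (‖f x‖ ^ p)) ?_ ?_
  · refine key.trans_eq ?_
    rw [← hI, ENNReal.rpow_add _ _ hI0 hfin, ENNReal.rpow_one, hIM, ENNReal.ofReal_rpow_of_pos hM0]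
    have e : q * (2 ^ r / (q - r) * D ^ (q - r)) =
        q * 2 ^ q / (q - r) * A₀ ^ (q - r) * M ^ (q - r) := by
      rw [hD, mul_rpow (by positivity) hM0.le, mul_rpow (by norm_num) hA₀.le,
        show (2 : ℝ) ^ q = 2 ^ (r + (q - r)) by congr 1; ring, rpow_add (by norm_num : (0 : ℝ) < 2)]
      ring
    calc _ = ENNReal.ofReal (q * (2 ^ r / (q - r) * D ^ (q - r))) *
          (ENNReal.ofReal A * ENNReal.ofReal M) := by rw [ENNReal.ofReal_mul hq.le]; ring
      _ = _ := by rw [e, ENNReal.ofReal_mul (by positivity)]; ring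
  · intro t ht
    have hcomp : ∫ x, ‖(S t)ᶜ.indicator f x‖ ≤ t / D * M := by
      rw [← hMi, ← integral_const_mul]
      refine integral_mono (hf.indicator (hSm t).compl).integrable.norm (hpow.const_mul _) fun x => ?_
      dsimp only
      by_cases hx : x ∈ S t
      · simp only [indicator, mem_compl_iff, hx, not_true_eq_false, if_false, norm_zero]
        positivity
      · simp only [indicator, mem_compl_iff, hx, not_false_eq_true, if_true]
        have hx' : D < t * ‖f x‖ ^ (p - 1) := not_le.1 hx
        have hf0 : 0 < ‖f x‖ := by
          refine (norm_nonneg _).lt_of_ne fun h => ?_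
          rw [← h, zero_rpow (by linarith), mul_zero] at hx'
          linarith
        have : ‖f x‖ ^ p = ‖f x‖ ^ (p - 1) * ‖f x‖ := by
          rw [← rpow_add_one hf0.ne', sub_add_cancel]
        rw [this, div_mul_eq_mul_div, le_div_iff₀ hD0]
        nlinarith
    have hsub : ∀ᵐ y ∂ν, y ∈ {y | t < ‖T f y‖} → y ∈ {y | t / 2 < ‖T ((S t).indicator f) y‖} := by
      filter_upwards [h1 _ (hf.indicator (hSm t).compl)] with y hy hty
      have h2 := norm_add_le (T ((S t).indicator f) y) (T ((S t)ᶜ.indicator f) y)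
      rw [← hT.indicator hf (hSm t)] at h2
      have h3 : A₀ * (t / D * M) = t / 2 := by rw [hD]; field_simp
      have h4 := mul_le_mul_of_nonneg_left hcomp hA₀.le
      linarith
    refine (measure_mono_ae hsub).trans ((hTr.meas_lt_le hT hr hf (hSm t) (half_pos ht)).trans_eq ?_)
    rfl
  · intro x
    rcases (norm_nonneg (f x)).eq_or_lt with h0 | h0
    · have : ∀ t : ℝ, w t x * ENNReal.ofReal (t ^ (q - 1)) = 0 := fun t => by
        rw [hw]; dsimp only
        rw [← h0, zero_rpow hr.ne']
        simp
      simp [this]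
    set y := ‖f x‖ with hy
    have hyp : 0 < y ^ (p - 1) := rpow_pos_of_pos h0 _
    have e : ∫⁻ t in Ioi (0 : ℝ), w t x * ENNReal.ofReal (t ^ (q - 1)) =
        ∫⁻ t in Ioc 0 (D / y ^ (p - 1)), ENNReal.ofReal (2 ^ r * y ^ r) *
          ENNReal.ofReal (t ^ ((q - r) - 1)) := by
      rw [← lintegral_indicator measurableSet_Ioi, ← lintegral_indicator measurableSet_Ioc]
      congr 1; ext1 t
      by_cases ht : 0 < t
      · rw [indicator_of_mem (mem_Ioi.2 ht), hw]
        dsimp only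
        by_cases h : t * y ^ (p - 1) ≤ D
        · rw [if_pos h, indicator_of_mem (mem_Ioc.2 ⟨ht, (le_div_iff₀ hyp).2 h⟩), ← ENNReal.ofReal_mul (by positivity),
            ← ENNReal.ofReal_mul (by positivity), show q - r - 1 = -r + (q - 1) by ring, rpow_add ht,
            div_rpow ht.le (by norm_num), rpow_neg (by norm_num : (0 : ℝ) ≤ 2), div_inv_eq_mul]
          congr 1; ring
        · rw [if_neg h, indicator_of_notMem fun h' => h ((le_div_iff₀ hyp).1 h'.2), zero_mul]
      · rw [indicator_of_notMem (by simpa using ht), indicator_of_notMem fun h => ht h.1]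
    rw [e, lintegral_const_mul' _ _ ENNReal.ofReal_ne_top, lintegral_Ioc_rpow hqr (by positivity),
      ← ENNReal.ofReal_mul (by positivity), ← ENNReal.ofReal_mul (by positivity)]
    refine le_of_eq (congrArg _ ?_)
    rw [div_rpow hD0.le hyp.le, ← rpow_mul h0.le,
      show y ^ p = y ^ (r + -((p - 1) * (q - r))) by congr 1; linarith, rpow_add h0, rpow_neg h0.le]
    ring

end OffDiagonal

section Kernel

variable {φ : ℝ → ℝ}

theorem sq_le_abs_cos_sub_cos {x y : ℝ} (hx : x ∈ Icc 0 π) (hy : y ∈ Icc 0 π) :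
    2 / π ^ 2 * (x - y) ^ 2 ≤ |cos x - cos y| := by
  wlog h : y ≤ x generalizing x y
  · rw [← neg_sub, neg_sq, abs_sub_comm]; exact this hy hx (le_of_not_ge h)
  set d := (x - y) / 2 with hd
  have hd0 : 0 ≤ d := by rw [hd]; linarith
  have hdp : d ≤ π / 2 := by rw [hd]; linarith [hx.2, hy.1]
  have h1 : 2 / π * d ≤ sin d := mul_le_sin hd0 hdp
  have h0 : 0 ≤ 2 / π * d := by positivity
  have h2 : sin d ≤ sin ((x + y) / 2) := by
    rcases le_total ((x + y) / 2) (π / 2) with h' | h'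
    · exact sin_le_sin_of_le_of_le_pi_div_two (by linarith) h' (by rw [hd]; linarith [hy.1])
    · rw [← sin_pi_sub ((x + y) / 2)]
      exact sin_le_sin_of_le_of_le_pi_div_two (by linarith) (by linarith) (by rw [hd]; linarith [hx.2])
  have h3 : (2 / π * d) * (2 / π * d) ≤ sin ((x + y) / 2) * sin d :=
    mul_le_mul (h1.trans h2) h1 h0 ((h0.trans h1).trans h2)
  have hpi := pi_pos
  rw [cos_sub_cos, ← hd, mul_assoc, abs_mul, abs_of_nonneg ((mul_nonneg h0 h0).trans h3)]
  norm_num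
  have : 2 / π ^ 2 * (x - y) ^ 2 = 2 * (2 / π * d * (2 / π * d)) := by
    rw [hd]; field_simp
  linarith

theorem exists_abs_cos_sub_le {a : ℝ} (ha : 0 ≤ a) :
    ∃ y ∈ Icc 0 π, ∀ θ, |cos θ - cos y| ≤ |a + cos θ| := by
  by_cases h : a ≤ 1
  · refine ⟨arccos (-a), ⟨arccos_nonneg _, arccos_le_pi _⟩, fun θ => ?_⟩
    rw [cos_arccos (by linarith) (by linarith), sub_neg_eq_add, add_comm]
  · refine ⟨π, ⟨pi_pos.le, le_rfl⟩, fun θ => ?_⟩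
    have := neg_one_le_cos θ
    rw [cos_pi, sub_neg_eq_add, abs_of_nonneg (by linarith), abs_of_nonneg (by linarith)]
    linarith

theorem lintegral_inv_one_add_mul_sq {c : ℝ} (hc : 0 < c) (y : ℝ) :
    ∫⁻ θ : ℝ, ENNReal.ofReal (1 + c ^ 2 * (θ - y) ^ 2)⁻¹ = ENNReal.ofReal (π / c) := by
  have h1 := lintegral_sub_right_eq_self (μ := volume)
    (fun θ : ℝ => ENNReal.ofReal (1 + c ^ 2 * θ ^ 2)⁻¹) y
  rw [h1]
  have h2 := lintegral_comp_div_pos (R := c⁻¹) (by positivity)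
    (g := fun v : ℝ => ENNReal.ofReal (1 + v ^ 2)⁻¹)
  rw [← ofReal_integral_eq_lintegral_ofReal integrable_inv_one_add_sq (.of_forall fun v => by positivity),
    integral_univ_inv_one_add_sq, ← ENNReal.ofReal_mul (by positivity)] at h2
  rw [show π / c = c⁻¹ * π by ring, ← h2]
  refine lintegral_congr fun θ => ?_
  rw [div_inv_eq_mul, mul_pow, mul_comm (c ^ 2)]

theorem lintegral_angle_le {s r : ℝ} (hs : 0 < s) (hr : 0 ≤ r) :
    ∫⁻ θ in Ioo (-π) π, ENNReal.ofReal (1 + (s + r * cos θ) ^ 2)⁻¹ ≤ ENNReal.ofReal (60 * (√s)⁻¹) := by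
  have hsq : 0 < √s := sqrt_pos.2 hs
  have hss : √s * √s = s := mul_self_sqrt hs.le
  have hpi := pi_pos
  have hpi4 := pi_lt_four
  by_cases h : r ≤ s / 2
  · have hb : ∀ θ : ℝ, ENNReal.ofReal (1 + (s + r * cos θ) ^ 2)⁻¹ ≤ ENNReal.ofReal (√s)⁻¹ := by
      intro θ
      refine ENNReal.ofReal_le_ofReal (inv_anti₀ hsq ?_)
      have h1 : s / 2 ≤ s + r * cos θ := by nlinarith [neg_one_le_cos θ]
      have h2 : (s / 2) ^ 2 ≤ (s + r * cos θ) ^ 2 := by gcongr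
      nlinarith [sq_nonneg (√s - 1), sq_nonneg (s - 1)]
    refine (lintegral_mono hb).trans ?_
    rw [lintegral_const, Measure.restrict_apply_univ, volume_Ioo, ← ENNReal.ofReal_mul (by positivity)]
    refine ENNReal.ofReal_le_ofReal ?_
    rw [mul_comm]
    gcongr
    linarith
  · have hr0 : 0 < r := by linarith
    obtain ⟨y, hy, hcos⟩ := exists_abs_cos_sub_le (a := s / r) (by positivity)
    set c := √(2 / π ^ 2 * r) with hcdef
    have hc0 : 0 < c := sqrt_pos.2 (by positivity)
    have hc2 : c ^ 2 = 2 / π ^ 2 * r := sq_sqrt (by positivity)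
    have hb : ∀ θ ∈ Ioo (-π) π, ENNReal.ofReal (1 + (s + r * cos θ) ^ 2)⁻¹ ≤
        2 * (ENNReal.ofReal (1 + c ^ 2 * (θ - y) ^ 2)⁻¹ + ENNReal.ofReal (1 + c ^ 2 * (θ - -y) ^ 2)⁻¹) := by
      intro θ hθ
      have hθ' : |θ| ∈ Icc 0 π := ⟨abs_nonneg _, (abs_lt.2 hθ).le⟩
      have h1 := sq_le_abs_cos_sub_cos hθ' hy
      rw [cos_abs] at h1
      replace h1 := h1.trans (hcos θ)
      have h2 : c ^ 2 * (|θ| - y) ^ 2 ≤ |s + r * cos θ| := by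
        rw [hc2, show s + r * cos θ = r * (s / r + cos θ) by field_simp, abs_mul, abs_of_pos hr0]
        nlinarith
      have h3 : (1 + (s + r * cos θ) ^ 2)⁻¹ ≤ 2 * (1 + c ^ 2 * (|θ| - y) ^ 2)⁻¹ := by
        rw [← div_eq_mul_inv, inv_le_comm₀ (by positivity) (by positivity), inv_div]
        rw [← sq_abs (s + r * cos θ)]
        set A := c ^ 2 * (|θ| - y) ^ 2
        nlinarith [sq_nonneg (|s + r * cos θ| - 1), abs_nonneg (s + r * cos θ)]
      refine (ENNReal.ofReal_le_ofReal h3).trans ?_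
      rw [ENNReal.ofReal_mul (by norm_num), show ENNReal.ofReal 2 = 2 by simp]
      refine mul_le_mul_right ?_ _
      rcases abs_choice θ with h' | h'
      · rw [h']; exact le_self_add
      · rw [h', show (-θ - y) ^ 2 = (θ - -y) ^ 2 by ring]; exact le_add_self
    refine (setLIntegral_mono' measurableSet_Ioo hb).trans ((setLIntegral_le_lintegral _ _).trans ?_)
    rw [lintegral_const_mul' _ _ (by simp), lintegral_add_left (by fun_prop),
      lintegral_inv_one_add_mul_sq hc0, lintegral_inv_one_add_mul_sq hc0,
      ← ENNReal.ofReal_add (by positivity) (by positivity), show (2 : ℝ≥0∞) = ENNReal.ofReal 2 by simp,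
      ← ENNReal.ofReal_mul (by norm_num)]
    refine ENNReal.ofReal_le_ofReal ?_
    have h4 : √s / π ≤ c := by
      refine le_sqrt_of_sq_le ?_
      rw [div_pow, sq_sqrt hs.le, div_mul_eq_mul_div]
      gcongr
      linarith
    have h5 : π / c ≤ π / (√s / π) := by gcongr
    have h6 : π / (√s / π) = π * π * (√s)⁻¹ := by field_simp
    have h7 : π * π ≤ 15 := by nlinarith [pi_lt_d2]
    have h8 : π * π * (√s)⁻¹ ≤ 15 * (√s)⁻¹ := by gcongr
    linarith

theorem exists_norm_bump_fourierInv_le (hφ : IsLPBump φ) :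
    ∃ C : ℝ, 0 < C ∧ ∀ u, ‖∫ ρ : ℝ, wave (u * ρ) * ((φ ρ * ρ : ℝ) : ℂ)‖ ≤ C * (1 + u ^ 2)⁻¹ := by
  have hcR : HasCompactSupport φ :=
    HasCompactSupport.of_support_subset_isCompact isCompact_Icc hφ.2.2.1
  have hb : ContDiff ℝ ∞ fun ρ => ((φ ρ * ρ : ℝ) : ℂ) :=
    Complex.ofRealCLM.contDiff.comp (ContDiff.mul hφ.1 contDiff_id)
  have hc : HasCompactSupport fun ρ => ((φ ρ * ρ : ℝ) : ℂ) :=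
    (hcR.mul_right (f' := fun ρ => ρ)).comp_left (g := ((↑) : ℝ → ℂ)) (by simp)
  let g : 𝓢(ℝ, ℂ) := hc.toSchwartzMap hb
  have he : ∀ u, ∫ ρ : ℝ, wave (u * ρ) * ((φ ρ * ρ : ℝ) : ℂ) = (𝓕⁻ g : 𝓢(ℝ, ℂ)) u := fun u => by
    rw [SchwartzMap.fourierInv_coe, Real.fourierInv_eq']
    exact integral_congr_ae (.of_forall fun s => rfl)
  set C := 2 ^ 2 * ((Finset.Iic (2, 0)).sup fun m => SchwartzMap.seminorm ℝ m.1 m.2) (𝓕⁻ g : 𝓢(ℝ, ℂ))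
    with hCdef
  have hC : ∀ u : ℝ, (1 + |u|) ^ 2 * ‖(𝓕⁻ g : 𝓢(ℝ, ℂ)) u‖ ≤ C := fun u => by
    have := SchwartzMap.one_add_le_sup_seminorm_apply (𝕜 := ℝ) (m := (2, 0)) (k := 2) (n := 0)
      le_rfl le_rfl (𝓕⁻ g : 𝓢(ℝ, ℂ)) u
    rw [norm_iteratedFDeriv_zero] at this
    exact this
  have hC0 : 0 ≤ C := le_trans (by positivity) (hC 0)
  refine ⟨C + 1, by positivity, fun u => ?_⟩
  rw [he, ← div_eq_mul_inv, le_div_iff₀ (by positivity)]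
  have h1 := hC u
  have h2 : 1 + u ^ 2 ≤ (1 + |u|) ^ 2 := by
    rw [← sq_abs u]; nlinarith [abs_nonneg u]
  nlinarith [norm_nonneg ((𝓕⁻ g : 𝓢(ℝ, ℂ)) u)]

end Kernel

section KernelBound

variable {φ : ℝ → ℝ}

theorem exists_rotation_eq_norm (x : ℂ) : ∃ A : ℂ ≃ₗᵢ[ℝ] ℂ, A x = (‖x‖ : ℂ) := by
  refine ⟨rotation (Circle.exp (-x.arg)), ?_⟩
  rw [rotation_apply, Circle.coe_exp]
  conv_lhs => rw [← Complex.norm_mul_exp_arg_mul_I x]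
  rw [mul_left_comm, ← Complex.exp_add]
  simp

theorem exists_norm_waveKernel_le (hφ : IsLPBump φ) : ∃ C : ℝ, 0 < C ∧ ∀ s : ℝ, 0 < s → ∀ x : ℂ,
    ‖𝓕⁻ (fun ξ : ℂ => wave (s * ‖ξ‖) * (φ ‖ξ‖ : ℂ)) x‖ ≤ C * (√s)⁻¹ := by
  obtain ⟨C, hC, hB⟩ := exists_norm_bump_fourierInv_le hφ
  refine ⟨C * 60, by positivity, fun s hs x => ?_⟩
  obtain ⟨A, hA⟩ := exists_rotation_eq_norm x
  have e1 : 𝓕⁻ (fun ξ : ℂ => wave (s * ‖ξ‖) * (φ ‖ξ‖ : ℂ)) x =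
      𝓕⁻ (fun ξ : ℂ => wave (s * ‖ξ‖) * (φ ‖ξ‖ : ℂ)) (‖x‖ : ℂ) := by
    rw [← hA, ← Real.fourierInv_comp_linearIsometry]
    exact congrArg (fun m : ℂ → ℂ => 𝓕⁻ m x) (funext fun ξ => by simp only [Function.comp, A.norm_map])
  set r := ‖x‖ with hr
  set G : ℝ × ℝ → ℂ := fun p => wave ((s + r * cos p.2) * p.1) * ((φ p.1 * p.1 : ℝ) : ℂ) with hG
  have e2 : 𝓕⁻ (fun ξ : ℂ => wave (s * ‖ξ‖) * (φ ‖ξ‖ : ℂ)) (r : ℂ) =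
      ∫ p in Ioi (0 : ℝ) ×ˢ Ioo (-π) π, G p := by
    rw [Real.fourierInv_eq', ← Complex.integral_comp_polarCoord_symm, polarCoord_target]
    refine setIntegral_congr_fun (measurableSet_Ioi.prod measurableSet_Ioo) fun p hp => ?_
    have hp1 : 0 < p.1 := hp.1
    rw [Complex.norm_polarCoord_symm, abs_of_pos hp1, Complex.polarCoord_symm_apply, hG]
    dsimp only
    rw [show (s + r * cos p.2) * p.1 = r * cos p.2 * p.1 + s * p.1 by ring, wave_add]
    have : inner ℝ ((p.1 : ℂ) * (↑(cos p.2) + ↑(sin p.2) * Complex.I)) (r : ℂ) = r * cos p.2 * p.1 := by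
      rw [Complex.inner]
      simp [-Complex.ofReal_cos, -Complex.ofReal_sin]
      ring
    rw [this, Complex.real_smul, smul_eq_mul]
    simp only [wave]
    push_cast
    ring
  have hbi : Integrable fun ρ => ((φ ρ * ρ : ℝ) : ℂ) := by
    have hcR : HasCompactSupport φ :=
      HasCompactSupport.of_support_subset_isCompact isCompact_Icc hφ.2.2.1
    exact ((hφ.1.continuous.mul continuous_id).integrable_of_hasCompactSupport
      (hcR.mul_right (f' := fun ρ => ρ))).ofReal
  have hGi : Integrable G ((volume.restrict (Ioi (0 : ℝ))).prod (volume.restrict (Ioo (-π) π))) := by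
    have h := (hbi.restrict (s := Ioi 0)).mul_prod
      (integrable_const (1 : ℂ) (μ := volume.restrict (Ioo (-π) π)))
    simp only [mul_one] at h
    refine h.bdd_mul (c := 1) ?_ (.of_forall fun p => by rw [norm_wave])
    exact (contDiff_wave.continuous.comp (by fun_prop)).aestronglyMeasurable
  have e3 : ∫ p in Ioi (0 : ℝ) ×ˢ Ioo (-π) π, G p =
      ∫ θ in Ioo (-π) π, ∫ ρ : ℝ, wave ((s + r * cos θ) * ρ) * ((φ ρ * ρ : ℝ) : ℂ) := by
    rw [Measure.volume_eq_prod, ← Measure.prod_restrict, integral_prod_symm _ hGi]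
    refine integral_congr_ae (.of_forall fun θ => ?_)
    refine setIntegral_eq_integral_of_forall_compl_eq_zero fun ρ hρ => ?_
    have : φ ρ = 0 := by
      by_contra h
      have := (bump_support hφ h).1
      exact hρ (mem_Ioi.2 (by linarith))
    simp [hG, this]
  rw [e1, e2, e3, ← toReal_enorm]
  refine ENNReal.toReal_le_of_le_ofReal (by positivity) ((enorm_integral_le_lintegral_enorm _).trans ?_)
  calc _ ≤ ∫⁻ θ in Ioo (-π) π, ENNReal.ofReal C * ENNReal.ofReal (1 + (s + r * cos θ) ^ 2)⁻¹ := by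
        refine lintegral_mono fun θ => ?_
        rw [← ofReal_norm, ← ENNReal.ofReal_mul hC.le]
        exact ENNReal.ofReal_le_ofReal (hB _)
    _ ≤ ENNReal.ofReal C * ENNReal.ofReal (60 * (√s)⁻¹) := by
        rw [lintegral_const_mul' _ _ ENNReal.ofReal_ne_top]
        exact mul_le_mul_right (lintegral_angle_le hs (norm_nonneg x)) _
    _ = _ := by rw [← ENNReal.ofReal_mul hC.le, mul_assoc]

theorem mulOp_eq_integral {m f : ℂ → ℂ} (hm : Integrable m) (hf : Integrable f) (x : ℂ) :
    mulOp m f x = ∫ y, f y * 𝓕⁻ m (x - y) := by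
  have hg : Integrable fun ξ => wave (inner ℝ ξ x) * m ξ :=
    hm.bdd_mul (c := 1) (contDiff_wave.continuous.comp (by fun_prop)).aestronglyMeasurable
      (.of_forall fun ξ => by rw [norm_wave])
  have h := VectorFourier.integral_fourierIntegral_smul_eq_flip (L := innerₗ ℂ) (μ := volume)
    (ν := volume) Real.continuous_fourierChar continuous_inner hf hg
  have e1 : mulOp m f x = ∫ ξ, VectorFourier.fourierIntegral Real.fourierChar volume (innerₗ ℂ) f ξ •
      (wave (inner ℝ ξ x) * m ξ) := by
    rw [mulOp, Real.fourierInv_eq']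
    refine integral_congr_ae (.of_forall fun ξ => ?_)
    change Complex.exp _ • (m ξ * 𝓕 f ξ) = 𝓕 f ξ • (wave (inner ℝ ξ x) * m ξ)
    rw [smul_eq_mul, smul_eq_mul, wave]
    ring
  rw [e1, h]
  refine integral_congr_ae (.of_forall fun y => ?_)
  dsimp only
  rw [smul_eq_mul]
  congr 1
  have e2 : VectorFourier.fourierIntegral Real.fourierChar volume (innerₗ ℂ).flip
      (fun ξ => wave (inner ℝ ξ x) * m ξ) y = 𝓕 (fun ξ => wave (inner ℝ ξ x) * m ξ) y := by
    rw [flip_innerₗ]; rfl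
  rw [e2, Real.fourier_eq', Real.fourierInv_eq']
  refine integral_congr_ae (.of_forall fun ξ => ?_)
  dsimp only
  rw [smul_eq_mul, smul_eq_mul, wave, ← mul_assoc, ← Complex.exp_add, inner_sub_right]
  congr 2
  push_cast
  ring

theorem exists_norm_waveOp_le (hφ : IsLPBump φ) : ∃ C : ℝ, 0 < C ∧ ∀ s : ℝ, 0 < s → ∀ f : ℂ → ℂ,
    Integrable f → ∀ x : ℂ,
    ‖mulOp (fun ξ : ℂ => wave (s * ‖ξ‖) * (φ ‖ξ‖ : ℂ)) f x‖ ≤ C * (√s)⁻¹ * ∫ x, ‖f x‖ := by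
  obtain ⟨C, hC, hB⟩ := exists_norm_waveKernel_le hφ
  refine ⟨C, hC, fun s hs f hf x => ?_⟩
  have hm := (sym_bump hφ).wave_mul (zero_notMem_tsupport_bump hφ) s
  rw [mulOp_eq_integral (hm.smooth.continuous.integrable_of_hasCompactSupport hm.cpt) hf,
    ← integral_const_mul]
  refine norm_integral_le_of_norm_le (hf.norm.const_mul _) (.of_forall fun y => ?_)
  rw [norm_mul, mul_comm]
  exact mul_le_mul_of_nonneg_right (hB s hs _) (norm_nonneg _)

end KernelBound

section LocalSmoothing

variable {φ : ℝ → ℝ}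

theorem exists_pow_le_rpow (k : ℕ) {δ : ℝ} (hδ : 0 < δ) :
    ∃ C : ℝ, 0 < C ∧ ∀ j : ℕ, ((j : ℝ) + 1) ^ k ≤ C * 2 ^ (δ * j) := by
  have hr : (1 : ℝ) < 2 ^ δ := one_lt_rpow (by norm_num) hδ
  obtain ⟨B, hB⟩ := (tendsto_pow_const_div_const_pow_of_one_lt k hr).bddAbove_range
  have h1 : ∀ n : ℕ, (n : ℝ) ^ k ≤ B * (2 ^ δ) ^ n := fun n => by
    have := hB (mem_range_self n)
    rwa [div_le_iff₀ (by positivity)] at this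
  have hB0 : 0 < B := by
    have := h1 1
    by_contra hcon
    have h2 : B * (2 ^ δ) ^ 1 ≤ 0 := mul_nonpos_of_nonpos_of_nonneg (not_lt.1 hcon) (by positivity)
    norm_num at this
    norm_num at h2
    linarith
  refine ⟨B * 2 ^ δ, by positivity, fun j => ?_⟩
  have := h1 (j + 1)
  rw [rpow_mul (by norm_num), rpow_natCast]
  push_cast at this
  rw [pow_succ (2 ^ δ : ℝ)] at this
  linarith

theorem exists_stepConst_eq : ∃ K : ℕ, ∀ N : ℕ, stepConst N = K * (N + 1) :=
  ⟨8450 * 265 ^ 2 * 130, fun N => by rw [stepConst]; ring⟩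

/-- The `L⁴` local smoothing estimate at frequency scale `2 ^ j`, with an `ε`-loss. -/
theorem exists_lintegral_waveOp_pow_four_le (hφ : IsLPBump φ) {ε : ℝ} (hε : 0 < ε) :
    ∃ C : ℝ, 0 < C ∧ ∀ j : ℕ, ∀ f : ℂ → ℂ, BddCpt f →
      ∫⁻ s in Icc (2 ^ j / (2 * π)) (2 * (2 ^ j / (2 * π))), ∫⁻ x,
        ‖mulOp (fun ξ => wave (s * ‖ξ‖) * (φ ‖ξ‖ : ℂ)) f x‖ₑ ^ 4 ≤
        ENNReal.ofReal (C * 2 ^ ((1 + ε) * j)) * ∫⁻ x, ‖f x‖ₑ ^ 4 := by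
  obtain ⟨C₀, hC₀, hB⟩ := exists_lintegral_wave_le hφ
  obtain ⟨K, hK⟩ := exists_stepConst_eq
  obtain ⟨e, he⟩ := exists_nat_gt (96 / ε)
  set M : ℕ := e + 1 + 1 with hM
  have hM0 : (0 : ℝ) < M := by positivity
  have hMε : 48 / (M : ℝ) ≤ ε / 2 := by
    rw [div_lt_iff₀ hε] at he
    rw [div_le_iff₀ hM0, hM]
    push_cast
    nlinarith
  obtain ⟨D, hD, hDj⟩ := exists_pow_le_rpow (2 * M + 1) (half_pos hε)
  refine ⟨(K + 1) ^ M * ((M + 1) ^ (2 * M + 1) * D) * (C₀ * (8 ^ 24 * 4 ^ 48) * 4 ^ M),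
    by positivity, fun j f hf => ?_⟩
  set μ : ℕ := j / (2 * M) + 1 with hμ
  set N : ℕ := M * μ with hN
  have hd : j < 2 * M * μ := by
    rw [hμ]; exact Nat.lt_mul_div_succ j (by positivity)
  have hd2 : 2 * M * μ ≤ j + 2 * M := by
    rw [hμ, mul_add, mul_one]
    exact Nat.add_le_add_right (Nat.mul_div_le _ _) _
  have hjN : (2 : ℝ) ^ j ≤ 4 ^ N := by
    rw [show (4 : ℝ) = 2 ^ 2 by norm_num, ← pow_mul]
    exact pow_le_pow_right₀ (by norm_num) (by rw [hN]; linarith)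
  have hNj : (4 : ℝ) ^ N ≤ 4 ^ M * 2 ^ j := by
    rw [show (4 : ℝ) = 2 ^ 2 by norm_num, ← pow_mul, ← pow_mul, ← pow_add]
    exact pow_le_pow_right₀ (by norm_num) (by rw [hN]; linarith)
  have hμj : (4 : ℝ) ^ (48 * μ) ≤ 4 ^ 48 * 2 ^ (ε / 2 * j) := by
    have h4 : (4 : ℝ) = 2 ^ (2 : ℝ) := by norm_num
    rw [← rpow_natCast, ← rpow_natCast 4 48, h4, ← rpow_mul (by norm_num), ← rpow_mul (by norm_num),
      ← rpow_add (by norm_num)]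
    refine rpow_le_rpow_of_exponent_le (by norm_num) ?_
    have h5 : (2 * M * μ : ℝ) ≤ j + 2 * M := by exact_mod_cast hd2
    have h6 : 48 / (M : ℝ) * j ≤ ε / 2 * j := mul_le_mul_of_nonneg_right hMε (Nat.cast_nonneg _)
    have h7 : 48 / (M : ℝ) * (2 * M * μ) ≤ 48 / (M : ℝ) * (j + 2 * M) :=
      mul_le_mul_of_nonneg_left h5 (by positivity)
    have h8 : 48 / (M : ℝ) * (2 * M * μ) = 96 * μ := by field_simp; ring
    have h9 : 48 / (M : ℝ) * (j + 2 * M) = 48 / (M : ℝ) * j + 96 := by field_simp; ring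
    push_cast
    linarith
  have hN1 : (N : ℝ) + 1 ≤ (M + 1) * (j + 1) := by
    have h5 : (2 * N : ℝ) ≤ j + 2 * M := by exact_mod_cast (by rw [hN]; linarith : 2 * N ≤ j + 2 * M)
    have : (0 : ℝ) ≤ M * j := by positivity
    nlinarith [(Nat.cast_nonneg j : (0 : ℝ) ≤ j)]
  have hsub : Icc (2 ^ j / (2 * π)) (2 * (2 ^ j / (2 * π))) ⊆ Icc (-(2 * 4 ^ N)) (2 * 4 ^ N : ℝ) := by
    have h1 : (2 : ℝ) ^ j / (2 * π) ≤ 2 ^ j :=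
      div_le_self (by positivity) (by linarith [pi_gt_three])
    have h2 : (0 : ℝ) < 2 ^ j / (2 * π) := by positivity
    refine Icc_subset_Icc ?_ (by linarith)
    have : (0 : ℝ) < 4 ^ N := by positivity
    linarith
  refine (lintegral_mono_set hsub).trans ((hB μ (e + 1) N (Nat.le_add_left 1 _) ?_ le_rfl f hf).trans ?_)
  · rw [hN]; exact Nat.mul_le_mul_right _ (by omega)
  have hSS : ((stepConst N * (N + 1)) ^ M * (N + 1 : ℕ) : ℝ) ≤
      (K + 1) ^ M * ((M + 1) ^ (2 * M + 1) * (D * 2 ^ (ε / 2 * j))) := by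
    rw [hK]
    push_cast
    calc ((K : ℝ) * (N + 1) * (N + 1)) ^ M * (N + 1) = K ^ M * (N + 1) ^ (2 * M + 1) := by
          rw [mul_assoc (K : ℝ), mul_pow, ← sq, ← pow_mul, mul_assoc, ← pow_succ]
      _ ≤ (K + 1) ^ M * ((M + 1) * (j + 1)) ^ (2 * M + 1) := by gcongr; linarith
      _ ≤ _ := by rw [mul_pow]; gcongr; exact hDj j
  rw [← ENNReal.ofReal_natCast, ← ENNReal.ofReal_natCast, ← mul_assoc, ← mul_assoc,
    ← ENNReal.ofReal_mul (by positivity), ← ENNReal.ofReal_mul (by positivity)]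
  refine mul_le_mul_left (ENNReal.ofReal_le_ofReal ?_) _
  push_cast at hSS ⊢
  calc _ ≤ (K + 1) ^ M * ((M + 1) ^ (2 * M + 1) * (D * 2 ^ (ε / 2 * j))) *
        (C₀ * (8 ^ 24 * (4 ^ 48 * 2 ^ (ε / 2 * j))) * (4 ^ M * 2 ^ j)) := by
        refine mul_le_mul hSS ?_ (by positivity) (by positivity)
        refine mul_le_mul ?_ hNj (by positivity) (by positivity)
        rw [mul_pow, ← pow_mul, show 2 * μ * 24 = 48 * μ by ring]
        gcongr
    _ = _ := by
        have : (2 : ℝ) ^ ((1 + ε) * j) = 2 ^ (ε / 2 * j) * 2 ^ (ε / 2 * j) * 2 ^ j := by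
          rw [← rpow_natCast, ← rpow_add (by norm_num), ← rpow_add (by norm_num)]
          congr 1; ring
        rw [this]
        generalize (2 : ℝ) ^ (ε / 2 * j) = a
        ring

end LocalSmoothing

section WaveOp

variable {φ : ℝ → ℝ}

/-- The frequency localised half-wave operator, as a function of time and space. -/
def waveOp (φ : ℝ → ℝ) (f : ℂ → ℂ) (y : ℝ × ℂ) : ℂ :=
  mulOp (fun ξ => wave (y.1 * ‖ξ‖) * (φ ‖ξ‖ : ℂ)) f y.2

/-- Lebesgue measure on the slab of times in `[R, 2R]`. -/
def slab (R : ℝ) : Measure (ℝ × ℂ) := (volume.restrict (Icc R (2 * R))).prod volume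

theorem BddCpt.continuous_waveOp (hφ : IsLPBump φ) {f : ℂ → ℂ} (hf : BddCpt f) :
    Continuous (waveOp φ f) := by
  have h := (continuous_mulOp_wave (sym_bump hφ) hf).comp
    (continuous_snd.prodMk continuous_fst : Continuous fun y : ℝ × ℂ => (y.2, y.1))
  exact h.congr fun y => rfl

theorem addOp_waveOp (hφ : IsLPBump φ) : AddOp (waveOp φ) where
  meas _ hf := (hf.continuous_waveOp hφ).measurable
  add _ _ hf hg y :=
    mulOp_add ((sym_bump hφ).wave_mul (zero_notMem_tsupport_bump hφ) y.1) hf hg y.2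

theorem ofReal_norm_rpow_natCast (z : ℂ) (n : ℕ) :
    ENNReal.ofReal (‖z‖ ^ (n : ℝ)) = ‖z‖ₑ ^ n := by
  rw [rpow_natCast, ENNReal.ofReal_pow (norm_nonneg _), ofReal_norm]

theorem lintegral_slab {R : ℝ} {F : ℝ × ℂ → ℝ≥0∞} (hF : Measurable F) :
    ∫⁻ y, F y ∂slab R = ∫⁻ s in Icc R (2 * R), ∫⁻ x, F (s, x) ∂volume :=
  lintegral_prod _ hF.aemeasurable

theorem StrongType.mono {Y : Type*} [MeasurableSpace Y] {ν : Measure Y} {T : (ℂ → ℂ) → Y → ℂ}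
    {A B r : ℝ} (h : StrongType ν T A r) (hAB : A ≤ B) : StrongType ν T B r := fun f hf =>
  (h f hf).trans (mul_le_mul_left (ENNReal.ofReal_le_ofReal hAB) _)

theorem strongType_waveOp_of_natCast (hφ : IsLPBump φ) {R A : ℝ} (n : ℕ)
    (h : ∀ f, BddCpt f → ∫⁻ s in Icc R (2 * R), ∫⁻ x,
      ‖mulOp (fun ξ : ℂ => wave (s * ‖ξ‖) * (φ ‖ξ‖ : ℂ)) f x‖ₑ ^ n ≤
      ENNReal.ofReal A * ∫⁻ x, ‖f x‖ₑ ^ n) : StrongType (slab R) (waveOp φ) A n := by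
  intro f hf
  have hm : Measurable fun y => ‖waveOp φ f y‖ₑ ^ n :=
    ((hf.continuous_waveOp hφ).measurable.enorm).pow_const n
  simp only [ofReal_norm_rpow_natCast]
  rw [lintegral_slab hm]
  exact h f hf

theorem strongType_waveOp_two (hφ : IsLPBump φ) {R : ℝ} (hR : 0 ≤ R) :
    StrongType (slab R) (waveOp φ) R 2 := by
  refine strongType_waveOp_of_natCast hφ 2 fun f hf => ?_
  have h1 : ∀ s : ℝ, ∫⁻ x, ‖mulOp (fun ξ => wave (s * ‖ξ‖) * (φ ‖ξ‖ : ℂ)) f x‖ₑ ^ 2 ≤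
      ∫⁻ x, ‖f x‖ₑ ^ 2 := fun s => by
    have := sum_lintegral_mulOp_sq_le ({0} : Finset ℕ)
      (m := fun _ => fun ξ : ℂ => wave (s * ‖ξ‖) * (φ ‖ξ‖ : ℂ))
      (fun _ _ => (sym_bump hφ).wave_mul (zero_notMem_tsupport_bump hφ) s) hf (A := 1) fun ξ => by
        rw [Finset.sum_singleton]
        refine pow_le_one₀ (zero_le) ?_
        rw [← ofReal_norm, norm_mul, norm_wave, one_mul, Complex.norm_real, Real.norm_eq_abs,
          abs_of_nonneg (hφ.2.1 _)]
        exact ENNReal.ofReal_le_one.2 (bump_le_one hφ _)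
    simpa using this
  refine (lintegral_mono h1).trans_eq ?_
  rw [lintegral_const, Measure.restrict_apply_univ, Real.volume_Icc, mul_comm]
  congr 2; ring

theorem exists_strongType_waveOp (hφ : IsLPBump φ) {ε r : ℝ} (hε : 0 < ε) (h2 : 2 ≤ r) (h4 : r ≤ 4) :
    ∃ C : ℝ, 0 < C ∧ ∀ j : ℕ,
      StrongType (slab (2 ^ j / (2 * π))) (waveOp φ) (C * 2 ^ ((1 + ε) * j)) r := by
  obtain ⟨C, hC, hB⟩ := exists_lintegral_waveOp_pow_four_le hφ hε
  have H4 : ∀ j : ℕ, StrongType (slab (2 ^ j / (2 * π))) (waveOp φ)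
      ((C + 1) * 2 ^ ((1 + ε) * j)) (4 : ℕ) := fun j =>
    (strongType_waveOp_of_natCast hφ 4 (hB j)).mono (by gcongr; linarith)
  have H2 : ∀ j : ℕ, StrongType (slab (2 ^ j / (2 * π))) (waveOp φ)
      ((C + 1) * 2 ^ ((1 + ε) * j)) 2 := fun j => by
    refine (strongType_waveOp_two hφ (by positivity)).mono ?_
    calc (2 : ℝ) ^ j / (2 * π) ≤ 2 ^ j := div_le_self (by positivity) (by linarith [pi_gt_three])
      _ ≤ 2 ^ ((1 + ε) * j) := by
        rw [← rpow_natCast]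
        refine rpow_le_rpow_of_exponent_le (by norm_num) ?_
        have : 0 ≤ ε * j := by positivity
        linarith
      _ ≤ _ := le_mul_of_one_le_left (by positivity) (by linarith)
  rcases h2.eq_or_lt with rfl | h2
  · exact ⟨C + 1, by positivity, H2⟩
  rcases h4.eq_or_lt with rfl | h4
  · exact ⟨C + 1, by positivity, fun j => by exact_mod_cast H4 j⟩
  refine ⟨r * (2 ^ (2 : ℝ) / (r - 2) + 2 ^ (4 : ℝ) / (4 - r)) * (C + 1), ?_, fun j => ?_⟩
  · have := sub_pos.2 h2
    have := sub_pos.2 h4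
    positivity
  · have H4' : StrongType (slab (2 ^ j / (2 * π))) (waveOp φ)
      ((C + 1) * 2 ^ ((1 + ε) * j)) 4 := by exact_mod_cast H4 j
    obtain ⟨c, -, rfl, h⟩ := (H2 j).interpolate (addOp_waveOp hφ) (by norm_num) h2 h4 H4'
    rwa [← mul_assoc] at h

/-- The local smoothing estimate for bounded functions of compact support. -/
theorem exists_lintegral_waveOp_rpow_le (hφ : IsLPBump φ) {ε p q : ℝ} (hε : 0 < ε) (hp : 1 < p)
    (hpq : p ≤ q) (h1 : 1 / p + 1 / q ≤ 1) (h2 : 1 ≤ 1 / p + 3 / q) :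
    ∃ C : ℝ, 0 < C ∧ ∀ j : ℕ, ∀ f, BddCpt f →
      ∫⁻ y, ENNReal.ofReal (‖waveOp φ f y‖ ^ q) ∂slab (2 ^ j / (2 * π)) ≤
        ENNReal.ofReal (C * 2 ^ ((3 / 2 - q / p / 2 + ε) * j)) *
          (∫⁻ x, ENNReal.ofReal (‖f x‖ ^ p)) ^ (q / p) := by
  have hp0 : 0 < p := by linarith
  have hq0 : 0 < q := by linarith
  have hqp : 1 ≤ q / p := (one_le_div hp0).2 hpq
  have e1 : q * (1 / p + 1 / q) = q / p + 1 := by field_simp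
  have e2 : q * (1 / p + 3 / q) = q / p + 3 := by field_simp
  have hr2 : 2 ≤ q - q / p + 1 := by nlinarith [mul_le_mul_of_nonneg_left h1 hq0.le]
  have hr4 : q - q / p + 1 ≤ 4 := by nlinarith [mul_le_mul_of_nonneg_left h2 hq0.le]
  obtain ⟨C, hC, hB⟩ := exists_strongType_waveOp hφ hε hr2 hr4
  rcases hpq.eq_or_lt with rfl | hlt
  · refine ⟨C, hC, fun j f hf => ?_⟩
    have := hB j f hf
    rw [div_self hp0.ne'] at this ⊢
    rw [ENNReal.rpow_one, show 3 / 2 - 1 / 2 + ε = 1 + ε by ring]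
    rwa [sub_add_cancel] at this
  have hqp' : 1 < q / p := (one_lt_div hp0).2 hlt
  obtain ⟨C₀, hC₀, hK⟩ := exists_norm_waveOp_le hφ
  refine ⟨q * 2 ^ q / (q / p - 1) * (C₀ * √(2 * π)) ^ (q / p - 1) * C, ?_, fun j f hf => ?_⟩
  · have := sub_pos.2 hqp'
    positivity
  have hR : (0 : ℝ) < 2 ^ j / (2 * π) := by positivity
  have key := (hB j).interpolate_one_top (addOp_waveOp hφ)
    (A₀ := C₀ * (√(2 ^ j / (2 * π)))⁻¹) (q := q) (p := p) (by positivity) ?_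
    (by linarith) hp (by linarith) (by field_simp; ring) hf
  · rw [show q - (q - q / p + 1) = q / p - 1 by ring, sub_add_cancel, ← mul_assoc,
      ← ENNReal.ofReal_mul (by have := sub_pos.2 hqp'; positivity)] at key
    refine key.trans_eq ?_
    congr 2
    have e3 : C₀ * (√(2 ^ j / (2 * π)))⁻¹ = C₀ * √(2 * π) * 2 ^ (-(1 / 2) * j : ℝ) := by
      rw [sqrt_div (by positivity), inv_div, mul_div_assoc', div_eq_mul_inv]
      congr 1
      rw [sqrt_eq_rpow, ← rpow_natCast, ← rpow_mul (by norm_num), ← rpow_neg (by norm_num)]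
      congr 1; ring
    have e4 : ((2 : ℝ) ^ (-(1 / 2) * j : ℝ)) ^ (q / p - 1) * 2 ^ ((1 + ε) * j) =
        2 ^ ((3 / 2 - q / p / 2 + ε) * j) := by
      rw [← rpow_mul (by norm_num), ← rpow_add (by norm_num)]
      congr 1; ring
    rw [e3, mul_rpow (by positivity) (by positivity), ← e4]
    ring
  · intro g hg
    have hae : ∀ᵐ y ∂slab (2 ^ j / (2 * π)), y.1 ∈ Icc (2 ^ j / (2 * π)) (2 * (2 ^ j / (2 * π))) :=
      Measure.quasiMeasurePreserving_fst.ae (ae_restrict_mem measurableSet_Icc)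
    filter_upwards [hae] with y hy
    have hy0 : 0 < y.1 := hR.trans_le hy.1
    refine (hK y.1 hy0 g hg.integrable y.2).trans ?_
    have : (√y.1)⁻¹ ≤ (√(2 ^ j / (2 * π)))⁻¹ := inv_anti₀ (sqrt_pos.2 hR) (sqrt_le_sqrt hy.1)
    have h0 : 0 ≤ ∫ x, ‖g x‖ := integral_nonneg fun _ => norm_nonneg _
    gcongr

end WaveOp

section Integrable

variable {φ : ℝ → ℝ}

/-- Truncation of a function in height and in space. -/
def truncate (f : ℂ → ℂ) (n : ℕ) : ℂ → ℂ := {x | ‖f x‖ ≤ n ∧ ‖x‖ ≤ n}.indicator f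

theorem bddCpt_truncate {f : ℂ → ℂ} (hf : Measurable f) (n : ℕ) : BddCpt (truncate f n) where
  meas := hf.indicator ((measurableSet_le hf.norm measurable_const).inter
    (measurableSet_le measurable_norm measurable_const))
  bdd := ⟨n, fun x => by
    by_cases h : x ∈ {x | ‖f x‖ ≤ n ∧ ‖x‖ ≤ n}
    · rw [truncate, indicator_of_mem h]; exact h.1
    · rw [truncate, indicator_of_notMem h, norm_zero]; positivity⟩
  supp := ⟨n, fun x hx => indicator_of_notMem (fun h => not_lt.2 h.2 hx) _⟩

theorem norm_truncate_le (f : ℂ → ℂ) (n : ℕ) (x : ℂ) : ‖truncate f n x‖ ≤ ‖f x‖ :=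
  norm_indicator_le_norm_self f x

theorem tendsto_truncate (f : ℂ → ℂ) (x : ℂ) :
    Filter.Tendsto (fun n => truncate f n x) Filter.atTop (nhds (f x)) := by
  obtain ⟨N, hN⟩ := exists_nat_ge (max ‖f x‖ ‖x‖)
  refine tendsto_const_nhds.congr' ?_
  filter_upwards [Filter.eventually_ge_atTop N] with n hn
  have hn' : max ‖f x‖ ‖x‖ ≤ n := hN.trans (by exact_mod_cast hn)
  exact (indicator_of_mem (show x ∈ {x | ‖f x‖ ≤ n ∧ ‖x‖ ≤ n} from
    ⟨(le_max_left _ _).trans hn', (le_max_right _ _).trans hn'⟩) f).symm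

theorem tendsto_mulOp_truncate {m f : ℂ → ℂ} (hm : Sym m) (hf : Integrable f) (hfm : Measurable f)
    (x : ℂ) : Filter.Tendsto (fun n => mulOp m (truncate f n) x) Filter.atTop
      (nhds (mulOp m f x)) := by
  have hmi : Integrable m := hm.smooth.continuous.integrable_of_hasCompactSupport hm.cpt
  rw [mulOp_eq_integral hmi hf]
  simp only [mulOp_eq_integral hmi (bddCpt_truncate hfm _).integrable]
  have hK : ∀ y, ‖𝓕⁻ m y‖ ≤ ∫ ξ, ‖m ξ‖ := fun y => by
    rw [Real.fourierInv_eq']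
    refine (norm_integral_le_integral_norm _).trans_eq (integral_congr_ae (.of_forall fun ξ => ?_))
    dsimp only
    rw [smul_eq_mul, norm_mul, Complex.norm_exp_ofReal_mul_I, one_mul]
  have hKc : Continuous (𝓕⁻ m) := by
    have h : Continuous (𝓕 m) := VectorFourier.fourierIntegral_continuous
      Real.continuous_fourierChar continuous_inner hmi
    rw [show 𝓕⁻ m = fun y => 𝓕 m (-y) from funext fun y => Real.fourierInv_eq_fourier_neg m y]
    exact h.comp continuous_neg
  refine tendsto_integral_of_dominated_convergence (fun y => ‖f y‖ * ∫ ξ, ‖m ξ‖) (fun n => ?_)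
    (hf.norm.mul_const _) (fun n => .of_forall fun y => ?_) (.of_forall fun y => ?_)
  · exact ((bddCpt_truncate hfm n).meas.mul
      (hKc.comp (continuous_const.sub continuous_id)).measurable).aestronglyMeasurable
  · rw [norm_mul]
    exact mul_le_mul (norm_truncate_le f n y) (hK _) (norm_nonneg _) (norm_nonneg _)
  · exact (tendsto_truncate f y).mul_const _

theorem mulOp_congr_ae {m f g : ℂ → ℂ} (h : f =ᵐ[volume] g) : mulOp m f = mulOp m g := by
  have : 𝓕 f = 𝓕 g := by
    funext ξ
    rw [Real.fourier_eq', Real.fourier_eq']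
    refine integral_congr_ae ?_
    filter_upwards [h] with x hx
    rw [hx]
  funext x
  rw [mulOp, mulOp, this]

theorem exists_tendsto_waveOp (hφ : IsLPBump φ) {f : ℂ → ℂ} (hf : Integrable f) :
    ∃ F : ℕ → ℂ → ℂ, (∀ n, BddCpt (F n)) ∧ (∀ n, ∀ᵐ x, ‖F n x‖ ≤ ‖f x‖) ∧
      ∀ y, Filter.Tendsto (fun n => waveOp φ (F n) y) Filter.atTop (nhds (waveOp φ f y)) := by
  have hm : Measurable (hf.1.mk f) := hf.1.stronglyMeasurable_mk.measurable
  have he := hf.1.ae_eq_mk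
  refine ⟨truncate (hf.1.mk f), bddCpt_truncate hm, fun n => ?_, fun y => ?_⟩
  · filter_upwards [he] with x hx
    rw [hx]
    exact norm_truncate_le _ n x
  · have := tendsto_mulOp_truncate ((sym_bump hφ).wave_mul (zero_notMem_tsupport_bump hφ) y.1)
      (hf.congr he) hm y.2
    rwa [← mulOp_congr_ae he] at this

theorem measurable_waveOp (hφ : IsLPBump φ) {f : ℂ → ℂ} (hf : Integrable f) :
    Measurable (waveOp φ f) := by
  obtain ⟨F, hF, -, hlim⟩ := exists_tendsto_waveOp hφ hf
  exact measurable_of_tendsto_metrizable (fun n => ((hF n).continuous_waveOp hφ).measurable)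
    (tendsto_pi_nhds.2 hlim)

theorem lintegral_waveOp_le_of_bddCpt (hφ : IsLPBump φ) {ν : Measure (ℝ × ℂ)} {p q : ℝ} {K : ℝ≥0∞}
    (hp : 0 < p) (hq : 0 < q)
    (h : ∀ f, BddCpt f → ∫⁻ y, ENNReal.ofReal (‖waveOp φ f y‖ ^ q) ∂ν ≤
      K * (∫⁻ x, ENNReal.ofReal (‖f x‖ ^ p)) ^ (q / p)) {f : ℂ → ℂ} (hf : Integrable f) :
    ∫⁻ y, ENNReal.ofReal (‖waveOp φ f y‖ ^ q) ∂ν ≤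
      K * (∫⁻ x, ENNReal.ofReal (‖f x‖ ^ p)) ^ (q / p) := by
  obtain ⟨F, hF, hle, hlim⟩ := exists_tendsto_waveOp hφ hf
  have hlim' : ∀ y, Filter.liminf (fun n => ENNReal.ofReal (‖waveOp φ (F n) y‖ ^ q)) Filter.atTop =
      ENNReal.ofReal (‖waveOp φ f y‖ ^ q) := fun y =>
    ((ENNReal.continuous_ofReal.tendsto _).comp
      ((hlim y).norm.rpow_const (Or.inr hq.le))).liminf_eq
  simp only [← hlim']
  refine (lintegral_liminf_le fun n => ?_).trans ?_
  · have := ((hF n).continuous_waveOp hφ).measurable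
    fun_prop
  refine Filter.liminf_le_of_le (by isBoundedDefault) fun b hb => ?_
  obtain ⟨n, hn⟩ := hb.exists
  refine hn.trans ((h _ (hF n)).trans (mul_le_mul_right (ENNReal.rpow_le_rpow
    (lintegral_mono_ae ?_) (by positivity)) _))
  filter_upwards [hle n] with x hx
  exact ENNReal.ofReal_le_ofReal (rpow_le_rpow (norm_nonneg _) hx hp.le)

end Integrable

section Rescaling

variable {φ : ℝ → ℝ}

/-- The function `f` on the plane `ℝ × ℝ`, dilated and viewed as a function on `ℂ`. -/
def rescale {α : Type*} (L : ℝ) (f : ℝ × ℝ → α) (z : ℂ) : α := f (L * z.re, L * z.im)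

theorem rescale_eq {α : Type*} (L : ℝ) (f : ℝ × ℝ → α) :
    rescale L f = fun z => f (L • Complex.measurableEquivRealProd z) := rfl

theorem integral_rescale {L : ℝ} (hL : 0 < L) (f : ℝ × ℝ → ℂ) :
    ∫ x, f x = (L ^ 2 : ℝ) * ∫ z, rescale L f z := by
  rw [rescale_eq, Complex.volume_preserving_equiv_real_prod.integral_comp
    Complex.measurableEquivRealProd.measurableEmbedding (fun x => f (L • x)),
    Measure.integral_comp_smul]
  simp only [Module.finrank_prod, Module.finrank_self]
  rw [abs_of_pos (by positivity), Complex.real_smul, ← mul_assoc, ← Complex.ofReal_mul,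
    mul_inv_cancel₀ (by positivity)]
  simp

theorem integrable_rescale_iff {L : ℝ} (hL : 0 < L) (f : ℝ × ℝ → ℂ) :
    Integrable (rescale L f) ↔ Integrable f := by
  rw [← integrable_comp_smul_iff volume f hL.ne']
  exact Complex.volume_preserving_equiv_real_prod.integrable_comp_emb
    Complex.measurableEquivRealProd.measurableEmbedding (g := fun x => f (L • x))

theorem lintegral_rescale {L : ℝ} (hL : 0 < L) (f : ℝ × ℝ → ℝ≥0∞) :
    ∫⁻ x, f x = ENNReal.ofReal (L ^ 2) * ∫⁻ z, rescale L f z := by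
  have h := Measure.map_addHaar_smul (volume : Measure (ℝ × ℝ)) hL.ne'
  have e : MeasurableEmbedding (fun t : ℝ × ℝ => L • t) :=
    (Homeomorph.smulOfNeZero L hL.ne').measurableEmbedding
  simp only [Module.finrank_prod, Module.finrank_self] at h
  rw [rescale_eq, Complex.volume_preserving_equiv_real_prod.lintegral_comp_emb
    Complex.measurableEquivRealProd.measurableEmbedding (fun x => f (L • x)), ← e.lintegral_map, h,
    lintegral_smul_measure, smul_eq_mul, ← mul_assoc, ← ENNReal.ofReal_mul (by positivity),
    abs_of_pos (by positivity), mul_inv_cancel₀ (by positivity), ENNReal.ofReal_one, one_mul]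

theorem ft2_rescale {L : ℝ} (hL : 0 < L) (f : ℝ × ℝ → ℂ) (η : ℂ) :
    rescale (2 * π / L) (ft2 f) η = (L ^ 2 : ℝ) * 𝓕 (rescale L f) η := by
  rw [rescale, ft2, integral_rescale hL, Real.fourier_eq']
  congr 1
  refine integral_congr_ae (.of_forall fun z => ?_)
  dsimp only [rescale]
  rw [smul_eq_mul]
  congr 2
  have hLc : (L : ℂ) ≠ 0 := by exact_mod_cast hL.ne'
  rw [Complex.inner]
  simp
  field_simp

theorem enorm2_rescale {L : ℝ} (hL : 0 < L) (η : ℂ) : rescale L enorm2 η = L * ‖η‖ := by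
  rw [rescale, enorm2, Complex.norm_eq_sqrt_sq_add_sq]
  dsimp only
  rw [mul_pow, mul_pow, ← mul_add, sqrt_mul (by positivity), sqrt_sq hL.le]

theorem multiplier_integral_eq {κ : ℝ} (hκ : 0 < κ) (f : ℝ × ℝ → ℂ) (t : ℝ) (x : ℝ × ℝ) :
    (((2 * π) ^ (-2 : ℤ) : ℝ) : ℂ) * ∫ ξ : ℝ × ℝ,
      Complex.exp (Complex.I * ((x.1 * ξ.1 + x.2 * ξ.2 + t * enorm2 ξ : ℝ) : ℂ)) *
        ((φ (κ * enorm2 ξ) : ℝ) : ℂ) * ft2 f ξ =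
      waveOp φ (rescale (2 * π * κ) f) (t / (2 * π * κ), ⟨x.1 / (2 * π * κ), x.2 / (2 * π * κ)⟩) := by
  have hL : 0 < 2 * π * κ := by positivity
  rw [integral_rescale (inv_pos.2 hκ), waveOp, mulOp, Real.fourierInv_eq', ← mul_assoc,
    ← integral_const_mul]
  refine integral_congr_ae (.of_forall fun η => ?_)
  have h1 := ft2_rescale hL f η
  have h2 := enorm2_rescale (inv_pos.2 hκ) η
  rw [show 2 * π / (2 * π * κ) = κ⁻¹ by field_simp] at h1
  simp only [rescale] at h1 h2 ⊢
  rw [h1, h2, mul_inv_cancel_left₀ hκ.ne', smul_eq_mul, wave, Complex.inner]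
  generalize 𝓕 (rescale (2 * π * κ) f) η = G
  have e1 : Complex.exp (Complex.I * ((x.1 * (κ⁻¹ * η.re) + x.2 * (κ⁻¹ * η.im) +
      t * (κ⁻¹ * ‖η‖) : ℝ) : ℂ)) =
      Complex.exp (↑(2 * π * ((⟨x.1 / (2 * π * κ), x.2 / (2 * π * κ)⟩ : ℂ) *
        (starRingEnd ℂ) η).re) * Complex.I) *
      Complex.exp (↑(2 * π * (t / (2 * π * κ) * ‖η‖)) * Complex.I) := by
    rw [← Complex.exp_add, ← add_mul, ← Complex.ofReal_add, mul_comm Complex.I]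
    congr 3
    simp
    field_simp
  have e2 : ((((2 * π) ^ (-2 : ℤ) : ℝ) : ℂ) * (((κ⁻¹) ^ 2 : ℝ) : ℂ)) * (((2 * π * κ) ^ 2 : ℝ) : ℂ) = 1 := by
    rw [← Complex.ofReal_mul, ← Complex.ofReal_mul, ← Complex.ofReal_one]
    congr 1
    rw [zpow_neg]
    field_simp
  rw [e1]
  linear_combination (Complex.exp (↑(2 * π * ((⟨x.1 / (2 * π * κ), x.2 / (2 * π * κ)⟩ : ℂ) *
        (starRingEnd ℂ) η).re) * Complex.I) *
      Complex.exp (↑(2 * π * (t / (2 * π * κ) * ‖η‖)) * Complex.I) * (φ ‖η‖ : ℂ) * G) * e2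

theorem fourier_eq_zero_of_not_integrable {f : ℂ → ℂ} (hf : ¬ Integrable f) : 𝓕 f = 0 := by
  funext ξ
  rw [Real.fourier_eq]
  exact integral_undef fun h => hf ((Real.fourierIntegral_convergent_iff ξ).1 h)

theorem ft2_eq_zero_of_not_integrable {f : ℝ × ℝ → ℂ} (hf : ¬ Integrable f) : ft2 f = 0 := by
  funext ξ
  have h := ft2_rescale one_pos f ⟨(2 * π)⁻¹ * ξ.1, (2 * π)⁻¹ * ξ.2⟩
  rw [fourier_eq_zero_of_not_integrable ((integrable_rescale_iff one_pos f).not.2 hf), rescale] at h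
  have h2 : 2 * π ≠ 0 := by positivity
  dsimp only at h
  rw [div_one, mul_inv_cancel_left₀ h2, mul_inv_cancel_left₀ h2] at h
  simpa using h

theorem waveProp_eq_zero_of_ft2 {f : ℝ × ℝ → ℂ} (hf : ft2 f = 0) (t : ℝ) (x : ℝ × ℝ) :
    waveProp f t x = 0 := by
  simp [waveProp, hf]

theorem proj_eq_waveOp (φ : ℝ → ℝ) (j : ℤ) (f : ℝ × ℝ → ℂ) (x : ℝ × ℝ) :
    proj φ j f x = waveOp φ (rescale (2 * π * 2 ^ (-j)) f)
      (0, ⟨x.1 / (2 * π * 2 ^ (-j)), x.2 / (2 * π * 2 ^ (-j))⟩) := by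
  have := multiplier_integral_eq (φ := φ) (zpow_pos (two_pos : (0 : ℝ) < 2) (-j)) f 0 x
  simp only [zero_mul, add_zero, zero_div] at this
  rw [← this, proj]

theorem rescale_proj (φ : ℝ → ℝ) (j : ℤ) (f : ℝ × ℝ → ℂ) :
    rescale (2 * π * 2 ^ (-j)) (proj φ j f) =
      𝓕⁻ fun ξ => (φ ‖ξ‖ : ℂ) * 𝓕 (rescale (2 * π * 2 ^ (-j)) f) ξ := by
  funext z
  have hL : (2 * π * 2 ^ (-j) : ℝ) ≠ 0 := by positivity
  rw [rescale, proj_eq_waveOp, waveOp, mulOp]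
  dsimp only
  rw [mul_div_cancel_left₀ _ hL, mul_div_cancel_left₀ _ hL]
  simp [wave]

theorem ft2_proj (hφ : IsLPBump φ) (j : ℤ) {f : ℝ × ℝ → ℂ} (hf : Integrable f)
    (hP : Integrable (proj φ j f)) (ξ : ℝ × ℝ) :
    ft2 (proj φ j f) ξ = (φ (2 ^ (-j) * enorm2 ξ) : ℂ) * ft2 f ξ := by
  have hκ : (0 : ℝ) < 2 ^ (-j) := by positivity
  set κ : ℝ := 2 ^ (-j) with hκd
  have hL : 0 < 2 * π * κ := by positivity
  have hg := (integrable_rescale_iff hL f).2 hf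
  have hPg := (integrable_rescale_iff hL _).2 hP
  have hF : Continuous (𝓕 (rescale (2 * π * κ) f)) := VectorFourier.fourierIntegral_continuous
      Real.continuous_fourierChar continuous_inner hg
  have hM : Continuous fun ξ : ℂ => (φ ‖ξ‖ : ℂ) * 𝓕 (rescale (2 * π * κ) f) ξ :=
    (sym_bump hφ).smooth.continuous.mul hF
  have hMi : Integrable fun ξ : ℂ => (φ ‖ξ‖ : ℂ) * 𝓕 (rescale (2 * π * κ) f) ξ :=
    hM.integrable_of_hasCompactSupport (sym_bump hφ).cpt.mul_right
  have e := rescale_proj φ j f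
  have h1 := ft2_rescale hL (proj φ j f) ⟨κ * ξ.1, κ * ξ.2⟩
  have h2 := ft2_rescale hL f ⟨κ * ξ.1, κ * ξ.2⟩
  have h3 := enorm2_rescale (inv_pos.2 hκ) ⟨κ * ξ.1, κ * ξ.2⟩
  have hPg' : Integrable (𝓕 fun ξ : ℂ => (φ ‖ξ‖ : ℂ) * 𝓕 (rescale (2 * π * κ) f) ξ) := by
    rw [e] at hPg
    refine hPg.comp_neg.congr (.of_forall fun x => ?_)
    dsimp only
    rw [Real.fourierInv_eq_fourier_neg, neg_neg]
  rw [e, hM.fourier_fourierInv_eq hMi hPg'] at h1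
  rw [show 2 * π / (2 * π * κ) = κ⁻¹ by field_simp] at h1 h2
  simp only [rescale, inv_mul_cancel_left₀ hκ.ne'] at h1 h2 h3
  change ft2 (proj φ j f) ξ = _ at h1
  change ft2 f ξ = _ at h2
  change enorm2 ξ = _ at h3
  rw [h1, h2, h3, mul_inv_cancel_left₀ hκ.ne']
  ring

theorem waveProp_proj (hφ : IsLPBump φ) (j : ℤ) {f : ℝ × ℝ → ℂ} (hf : Integrable f)
    (hP : Integrable (proj φ j f)) (t : ℝ) (x : ℝ × ℝ) :
    waveProp (proj φ j f) t x = waveOp φ (rescale (2 * π * 2 ^ (-j)) f)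
      (t / (2 * π * 2 ^ (-j)), ⟨x.1 / (2 * π * 2 ^ (-j)), x.2 / (2 * π * 2 ^ (-j))⟩) := by
  rw [← multiplier_integral_eq (zpow_pos (two_pos : (0 : ℝ) < 2) (-j)) f t x, waveProp]
  simp only [ft2_proj hφ j hf hP, mul_assoc]

end Rescaling

section Main

variable {φ : ℝ → ℝ}

theorem setLIntegral_comp_div {L : ℝ} (hL : 0 < L) {F : ℝ × ℂ → ℝ≥0∞} (hF : Measurable F) :
    ∫⁻ z : (ℝ × ℝ) × ℝ in univ ×ˢ Icc (1 : ℝ) 2, F (z.2 / L, ⟨z.1.1 / L, z.1.2 / L⟩) =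
      ENNReal.ofReal (L ^ 3) * ∫⁻ y, F y ∂slab L⁻¹ := by
  have hc : Measurable fun z : (ℝ × ℝ) × ℝ => F (z.2 / L, ⟨z.1.1 / L, z.1.2 / L⟩) := by
    have : Measurable fun x : ℝ × ℝ => (⟨x.1 / L, x.2 / L⟩ : ℂ) :=
      Complex.measurableEquivRealProd.symm.measurable.comp
        (g := fun x => Complex.measurableEquivRealProd.symm x)
        (f := fun x : ℝ × ℝ => (x.1 / L, x.2 / L)) (by fun_prop)
    exact hF.comp ((by fun_prop : Measurable fun z : (ℝ × ℝ) × ℝ => z.2 / L).prodMk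
      (this.comp measurable_fst))
  have h1 : ∀ t : ℝ, ∫⁻ x : ℝ × ℝ, F (t / L, ⟨x.1 / L, x.2 / L⟩) =
      ENNReal.ofReal (L ^ 2) * ∫⁻ z : ℂ, F (t / L, z) := fun t => by
    rw [lintegral_rescale hL]
    congr 2
    funext z
    simp only [rescale, mul_div_cancel_left₀ _ hL.ne']
  rw [Measure.volume_eq_prod, ← Measure.prod_restrict, Measure.restrict_univ,
    lintegral_prod_symm _ hc.aemeasurable]
  simp only [h1]
  rw [lintegral_const_mul' _ _ ENNReal.ofReal_ne_top, lintegral_slab hF,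
    ← lintegral_indicator measurableSet_Icc, ← lintegral_indicator measurableSet_Icc]
  have h2 : (fun t : ℝ => (Icc (1 : ℝ) 2).indicator (fun t => ∫⁻ z : ℂ, F (t / L, z)) t) =
      fun t => (Icc L⁻¹ (2 * L⁻¹)).indicator (fun s => ∫⁻ z : ℂ, F (s, z)) (t / L) := by
    funext t
    have : t ∈ Icc (1 : ℝ) 2 ↔ t / L ∈ Icc L⁻¹ (2 * L⁻¹) := by
      rw [mem_Icc, mem_Icc, div_eq_mul_inv, mul_le_mul_iff_of_pos_right (inv_pos.2 hL),
        le_mul_iff_one_le_left (inv_pos.2 hL)]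
    by_cases ht : t ∈ Icc (1 : ℝ) 2
    · rw [indicator_of_mem ht, indicator_of_mem (this.1 ht)]
    · rw [indicator_of_notMem ht, indicator_of_notMem (this.not.1 ht)]
  rw [h2, lintegral_comp_div_pos hL, ← mul_assoc, ← ENNReal.ofReal_mul (by positivity)]
  congr 2

theorem waveProp_proj_eq_zero (φ : ℝ → ℝ) (j : ℤ) {f : ℝ × ℝ → ℂ}
    (h : ¬ (Integrable f ∧ Integrable (proj φ j f))) (t : ℝ) (x : ℝ × ℝ) :
    waveProp (proj φ j f) t x = 0 := by
  refine waveProp_eq_zero_of_ft2 ?_ t x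
  by_cases hf : Integrable f
  · exact ft2_eq_zero_of_not_integrable fun hP => h ⟨hf, hP⟩
  · have hP : proj φ j f = 0 := by
      funext y
      simp [proj, ft2_eq_zero_of_not_integrable hf]
    rw [hP]
    funext ξ
    simp [ft2]

theorem exists_eLpNorm_waveProp_le_top (hφ : IsLPBump φ) : ∃ C : ℝ, 0 < C ∧ ∀ j : ℕ,
    ∀ f : ℝ × ℝ → ℂ, Integrable f → Integrable (proj φ j f) →
      eLpNorm (fun z : (ℝ × ℝ) × ℝ => waveProp (proj φ j f) z.2 z.1) ⊤
        (volume.restrict (univ ×ˢ Icc (1 : ℝ) 2)) ≤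
      ENNReal.ofReal (C * 2 ^ (3 / 2 * j : ℝ)) * eLpNorm f 1 volume := by
  obtain ⟨C, hC, hK⟩ := exists_norm_waveOp_le hφ
  refine ⟨C, hC, fun j f hf hP => ?_⟩
  set L : ℝ := 2 * π * 2 ^ (-(j : ℤ)) with hLd
  have hL : 0 < L := by positivity
  have hL1 : L⁻¹ ≤ 2 ^ (j : ℝ) := by
    rw [hLd, zpow_neg, zpow_natCast, rpow_natCast, mul_inv, inv_inv]
    refine mul_le_of_le_one_left (by positivity) (inv_le_one_of_one_le₀ ?_)
    linarith [pi_gt_three]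
  have hg := (integrable_rescale_iff hL f).2 hf
  have hgn : ENNReal.ofReal (∫ z, ‖rescale L f z‖) =
      ENNReal.ofReal (L⁻¹ ^ 2) * eLpNorm f 1 volume := by
    rw [ofReal_integral_norm_eq_lintegral_enorm hg, eLpNorm_one_eq_lintegral_enorm,
      lintegral_rescale hL, ← mul_assoc, ← ENNReal.ofReal_mul (by positivity), ← mul_pow,
      inv_mul_cancel₀ hL.ne', one_pow, ENNReal.ofReal_one, one_mul]
    rfl
  rw [eLpNorm_exponent_top]
  refine eLpNormEssSup_le_of_ae_enorm_bound ?_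
  filter_upwards [ae_restrict_mem (MeasurableSet.univ.prod measurableSet_Icc)] with z hz
  have ht : 1 ≤ z.2 := hz.2.1
  rw [waveProp_proj hφ j hf hP, ← ofReal_norm, waveOp]
  have hs : 0 < z.2 / L := by positivity
  refine (ENNReal.ofReal_le_ofReal (hK _ hs _ hg _)).trans ?_
  rw [ENNReal.ofReal_mul (by positivity), hgn, ← mul_assoc, ← ENNReal.ofReal_mul (by positivity)]
  refine mul_le_mul_left (ENNReal.ofReal_le_ofReal ?_) _
  rw [mul_assoc]
  refine mul_le_mul_of_nonneg_left ?_ hC.le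
  calc (√(z.2 / L))⁻¹ * L⁻¹ ^ 2 ≤ (√(L⁻¹))⁻¹ * L⁻¹ ^ 2 := by
        refine mul_le_mul_of_nonneg_right (inv_anti₀ (sqrt_pos.2 (inv_pos.2 hL)) (sqrt_le_sqrt ?_))
          (by positivity)
        rw [div_eq_mul_inv]
        exact le_mul_of_one_le_left (inv_pos.2 hL).le ht
    _ = L⁻¹ ^ (3 / 2 : ℝ) := by
        rw [sqrt_eq_rpow, ← rpow_neg (inv_pos.2 hL).le, ← rpow_natCast, ← rpow_add (inv_pos.2 hL)]
        norm_num
    _ ≤ (2 ^ (j : ℝ)) ^ (3 / 2 : ℝ) := rpow_le_rpow (inv_pos.2 hL).le hL1 (by norm_num)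
    _ = _ := by rw [← rpow_mul (by norm_num), mul_comm (j : ℝ)]

theorem exists_eLpNorm_waveProp_le (hφ : IsLPBump φ) {ε p q : ℝ} (hε : 0 < ε) (hp : 1 < p)
    (hpq : p ≤ q) (h1 : 1 / p + 1 / q ≤ 1) (h2 : 1 ≤ 1 / p + 3 / q) : ∃ C : ℝ, 0 < C ∧ ∀ j : ℕ,
    ∀ f : ℝ × ℝ → ℂ, Integrable f → Integrable (proj φ j f) →
      eLpNorm (fun z : (ℝ × ℝ) × ℝ => waveProp (proj φ j f) z.2 z.1) (ENNReal.ofReal q)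
        (volume.restrict (univ ×ˢ Icc (1 : ℝ) 2)) ≤
      ENNReal.ofReal (C * 2 ^ (3 / 2 * (1 / p - 1 / q) * j + ε * j : ℝ)) *
        eLpNorm f (ENNReal.ofReal p) volume := by
  have hp0 : 0 < p := by linarith
  have hq0 : 0 < q := by linarith
  obtain ⟨C, hC, hB⟩ := exists_lintegral_waveOp_rpow_le hφ hε hp hpq h1 h2
  refine ⟨C ^ q⁻¹ * (2 * π) ^ (3 / q - 2 / p), by positivity, fun j f hf hP => ?_⟩
  set L : ℝ := 2 * π * 2 ^ (-(j : ℤ)) with hLd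
  have hL : 0 < L := by positivity
  have hLi : L⁻¹ = 2 ^ j / (2 * π) := by
    rw [hLd, zpow_neg, zpow_natCast, mul_inv, inv_inv]
    field_simp
  have hLr : L = 2 * π * 2 ^ (-j : ℝ) := by
    rw [hLd, rpow_neg (by norm_num), zpow_neg, zpow_natCast, rpow_natCast]
  have hg := (integrable_rescale_iff hL f).2 hf
  have hm : Measurable fun y => ENNReal.ofReal (‖waveOp φ (rescale L f) y‖ ^ q) := by
    have := measurable_waveOp hφ hg
    fun_prop
  have key := lintegral_waveOp_le_of_bddCpt hφ hp0 hq0 (hB j) hg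
  have hofp : ENNReal.ofReal p ≠ 0 := (ENNReal.ofReal_pos.2 hp0).ne'
  have hofq : ENNReal.ofReal q ≠ 0 := (ENNReal.ofReal_pos.2 hq0).ne'
  have henorm : ∀ (r : ℝ), 0 < r → ∀ z : ℂ, ‖z‖ₑ ^ r = ENNReal.ofReal (‖z‖ ^ r) := fun r hr z => by
    rw [← ofReal_norm, ENNReal.ofReal_rpow_of_nonneg (norm_nonneg _) hr.le]
  rw [eLpNorm_eq_lintegral_rpow_enorm_toReal hofp ENNReal.ofReal_ne_top,
    eLpNorm_eq_lintegral_rpow_enorm_toReal hofq ENNReal.ofReal_ne_top,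
    ENNReal.toReal_ofReal hp0.le, ENNReal.toReal_ofReal hq0.le]
  simp only [henorm p hp0, henorm q hq0, waveProp_proj hφ j hf hP, ← hLd]
  rw [setLIntegral_comp_div hL hm, hLi, lintegral_rescale hL]
  change _ ≤ _ * (_ * ∫⁻ z, ENNReal.ofReal (‖rescale L f z‖ ^ p)) ^ (1 / p)
  generalize (∫⁻ z, ENNReal.ofReal (‖rescale L f z‖ ^ p)) = I at key ⊢
  have hq1 : 0 ≤ 1 / q := by positivity
  have hp1 : 0 ≤ 1 / p := by positivity
  refine (ENNReal.rpow_le_rpow (mul_le_mul_right key _) hq1).trans ?_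
  rw [← mul_assoc, ← ENNReal.ofReal_mul (by positivity), ENNReal.mul_rpow_of_nonneg _ _ hq1,
    ENNReal.mul_rpow_of_nonneg _ _ hp1, ← ENNReal.rpow_mul, show q / p * (1 / q) = 1 / p by field_simp,
    ENNReal.ofReal_rpow_of_nonneg (by positivity) hq1,
    ENNReal.ofReal_rpow_of_nonneg (by positivity) hp1, ← mul_assoc (ENNReal.ofReal _) (ENNReal.ofReal _),
    ← ENNReal.ofReal_mul (by positivity)]
  refine mul_le_mul_left (ENNReal.ofReal_le_ofReal ?_) _
  have hsp : (L ^ 2) ^ (1 / p) = L ^ (2 / p) := by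
    rw [← rpow_natCast, ← rpow_mul hL.le]; congr 1; push_cast; ring
  have hsq : (L ^ 3) ^ (1 / q) = L ^ (3 / q) := by
    rw [← rpow_natCast, ← rpow_mul hL.le]; congr 1; push_cast; ring
  have hsplit : L ^ (3 / q) = L ^ (3 / q - 2 / p) * L ^ (2 / p) := by
    rw [← rpow_add hL, sub_add_cancel]
  rw [mul_rpow (by positivity) (by positivity), mul_rpow (by positivity) (by positivity), hsp, hsq,
    hsplit, mul_right_comm]
  refine mul_le_mul_of_nonneg_right ?_ (by positivity)
  rw [hLr, mul_rpow (by positivity) (by positivity), one_div q, ← rpow_mul (by norm_num),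
    ← rpow_mul (by norm_num)]
  calc _ = C ^ q⁻¹ * (2 * π) ^ (3 / q - 2 / p) *
        (2 ^ (-j * (3 / q - 2 / p)) * 2 ^ ((3 / 2 - q / p / 2 + ε) * j * q⁻¹)) := by ring
    _ ≤ _ := by
      refine mul_le_mul_of_nonneg_left ?_ (by positivity)
      rw [← rpow_add (by norm_num)]
      refine rpow_le_rpow_of_exponent_le (by norm_num) ?_
      have h3 : ε * j * q⁻¹ ≤ ε * j :=
        mul_le_of_le_one_right (by positivity) (inv_le_one_of_one_le₀ (by linarith))
      have h4 : -j * (3 / q - 2 / p) + (3 / 2 - q / p / 2 + ε) * j * q⁻¹ =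
          3 / 2 * (1 / p - 1 / q) * j + ε * j * q⁻¹ := by
        field_simp
        ring
      rw [h4, one_div q]
      exact add_le_add_right h3 _

end Main

end WaveEnv

/-- `L^p`–`L^q` local smoothing for the wave equation in `ℝ²` (Theorem 3.1): for `j ≥ 0`,
`p ≤ q`, `1/p+1/q ≤ 1`, `1/p+3/q ≥ 1` and every `ε > 0`,
`‖e^{it√(−Δ)} 𝒫_j f‖_{L^q(ℝ²×[1,2])} ≲ 2^{(3/2)(1/p−1/q)j+εj} ‖f‖_{L^p(ℝ²)}`. -/
theorem local_smoothing_wave_2d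
    (φ : ℝ → ℝ) (hφ : IsLPBump φ) (p q : ℝ≥0∞)
    (hpq : p ≤ q) (hpq1 : 1/p + 1/q ≤ 1) (hpq2 : 1 ≤ 1/p + 3/q)
    (ε : ℝ) (hε : 0 < ε) :
    ∃ C : ℝ, 0 < C ∧ ∀ j : ℤ, 0 ≤ j → ∀ f : ℝ × ℝ → ℂ,
      eLpNorm (fun z : (ℝ × ℝ) × ℝ => waveProp (proj φ j f) z.2 z.1) q
          (volume.restrict (Set.univ ×ˢ Set.Icc (1:ℝ) 2)) ≤
        ENNReal.ofReal (C * (2:ℝ) ^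
            (3/2 * ((1/p).toReal - (1/q).toReal) * (j:ℝ) + ε * (j:ℝ))) *
          eLpNorm f p volume := by
  suffices H : ∃ C : ℝ, 0 < C ∧ ∀ j : ℕ, ∀ f : ℝ × ℝ → ℂ, Integrable f → Integrable (proj φ j f) →
      eLpNorm (fun z : (ℝ × ℝ) × ℝ => waveProp (proj φ j f) z.2 z.1) q
          (volume.restrict (Set.univ ×ˢ Set.Icc (1:ℝ) 2)) ≤
        ENNReal.ofReal (C * (2:ℝ) ^
            (3/2 * ((1/p).toReal - (1/q).toReal) * (j:ℝ) + ε * (j:ℝ))) *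
          eLpNorm f p volume by
    obtain ⟨C, hC, hB⟩ := H
    refine ⟨C, hC, fun j hj f => ?_⟩
    lift j to ℕ using hj
    by_cases hf : Integrable f ∧ Integrable (proj φ j f)
    · exact_mod_cast hB j f hf.1 hf.2
    · simp [WaveEnv.waveProp_proj_eq_zero φ j hf]
  have hp1 : 1 ≤ p := by
    have h : 1 / p ≤ 1 := le_self_add.trans hpq1
    rwa [one_div, ENNReal.inv_le_one] at h
  by_cases hq : q = ⊤
  · subst hq
    have hp : p = 1 := by
      refine le_antisymm ?_ hp1
      simpa using hpq2
    subst hp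
    obtain ⟨C, hC, hB⟩ := WaveEnv.exists_eLpNorm_waveProp_le_top hφ
    refine ⟨C, hC, fun j f hf hP => (hB j f hf hP).trans
      (mul_le_mul_left (ENNReal.ofReal_le_ofReal ?_) _)⟩
    refine mul_le_mul_of_nonneg_left (rpow_le_rpow_of_exponent_le (by norm_num) ?_) hC.le
    have : 0 ≤ ε * (j : ℝ) := by positivity
    simp
    linarith
  have hp : p ≠ ⊤ := ne_top_of_le_ne_top hq hpq
  have hp0 : p ≠ 0 := (zero_lt_one.trans_le hp1).ne'
  have hq0 : q ≠ 0 := (zero_lt_one.trans_le (hp1.trans hpq)).ne'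
  have hlt : 1 < p := by
    refine hp1.lt_of_ne fun h => ?_
    rw [← h, div_one] at hpq1
    have h1 : 1 / q = 0 := by
      by_contra hne
      exact not_lt.2 hpq1 (ENNReal.lt_add_right ENNReal.one_ne_top hne)
    simp [hq] at h1
  have t1 : 1 / p ≠ ⊤ := ENNReal.div_ne_top ENNReal.one_ne_top hp0
  have t2 : 1 / q ≠ ⊤ := ENNReal.div_ne_top ENNReal.one_ne_top hq0
  have t3 : 3 / q ≠ ⊤ := ENNReal.div_ne_top (by norm_num) hq0
  have h1 : 1 / p.toReal + 1 / q.toReal ≤ 1 := by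
    have := ENNReal.toReal_mono ENNReal.one_ne_top hpq1
    rw [ENNReal.toReal_add t1 t2] at this
    simpa using this
  have h2 : 1 ≤ 1 / p.toReal + 3 / q.toReal := by
    have := ENNReal.toReal_mono (ENNReal.add_ne_top.2 ⟨t1, t3⟩) hpq2
    rw [ENNReal.toReal_add t1 t3, ENNReal.toReal_div, ENNReal.toReal_div] at this
    simpa using this
  have hlt' : 1 < p.toReal := by
    rw [← ENNReal.toReal_one]
    exact (ENNReal.toReal_lt_toReal ENNReal.one_ne_top hp).2 hlt
  have H := WaveEnv.exists_eLpNorm_waveProp_le hφ hε hlt' (ENNReal.toReal_mono hq hpq) h1 h2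
  rw [ENNReal.ofReal_toReal hp, ENNReal.ofReal_toReal hq] at H
  simpa only [ENNReal.toReal_div, ENNReal.toReal_one] using H

end
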